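/- There exists a constant c_0 > 0 such that for every constant c ≥ c_0 the following holds for all sufficiently large odd integers N: with D = \sqrt{N} L^{-c}, r_1(m) = \sum_{d | m, d \le D} χ(d) and r_3(m) = \sum_{d | m, d \ge N/D} χ(d), one has \sum_{p_1+p_2+p_3=N} r_1(p_1-1) r_3(p_2-1) (\log p_1)(\log p_2)(\log p_3) \ll N^2 L^{-1}, the sum being over ordered triples of primes and the implied constant depending only on c. -/

import Mathlib

open Finset

noncomputable section

/-- The non-principal Dirichlet character modulo 4. -/
def chi4 (n : ℕ) : ℝ := if n % 4 = 1 then 1 else if n % 4 = 3 then -1 else 0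

/-- θ₀ = 1/2 - (1/4) e log 2. -/
def theta0 : ℝ := 1 / 2 - (1 / 4) * Real.exp 1 * Real.log 2

/-- Weighted sum over ordered triples of primes with p₁ + p₂ + p₃ = N. -/
def tripleSum (N : ℕ) (w1 w2 : ℕ → ℝ) : ℝ :=
  ∑ p1 ∈ Finset.range (N + 1), ∑ p2 ∈ Finset.range (N + 1), ∑ p3 ∈ Finset.range (N + 1),
    if p1.Prime ∧ p2.Prime ∧ p3.Prime ∧ p1 + p2 + p3 = N then
      w1 p1 * w2 p2 * Real.log p1 * Real.log p2 * Real.log p3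
    else 0

/-- r₁(m) = ∑_{d ∣ m, d ≤ D} χ(d). -/
def r1 (D : ℝ) (m : ℕ) : ℝ := ∑ d ∈ m.divisors, if (d : ℝ) ≤ D then chi4 d else 0

/-- r₂(m) = ∑_{d ∣ m, D < d < N/D} χ(d). -/
def r2 (D NR : ℝ) (m : ℕ) : ℝ :=
  ∑ d ∈ m.divisors, if D < (d : ℝ) ∧ (d : ℝ) < NR / D then chi4 d else 0

/-- r₃(m) = ∑_{d ∣ m, d ≥ N/D} χ(d). -/
def r3 (D NR : ℝ) (m : ℕ) : ℝ :=
  ∑ d ∈ m.divisors, if NR / D ≤ (d : ℝ) then chi4 d else 0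

/-- Powers of the logarithm are dominated by any positive power. -/
lemma exists_log_pow_le (j : ℕ) {ε : ℝ} (hε : 0 < ε) :
    ∃ C : ℝ, 1 ≤ C ∧ ∀ u : ℝ, 1 ≤ u → Real.log u ^ j ≤ C * u ^ ε := by
  have hj : (0 : ℝ) < j + 1 := by positivity
  have hd : 0 < ε / (j + 1) := by positivity
  refine ⟨max 1 ((1 / (ε / (j + 1))) ^ j), le_max_left _ _, fun u hu => ?_⟩
  have h1 := Real.log_le_rpow_div (by linarith : (0 : ℝ) ≤ u) hd
  have h0 := Real.log_nonneg hu
  calc Real.log u ^ j ≤ (u ^ (ε / (j + 1)) / (ε / (j + 1))) ^ j := by gcongr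
    _ = (1 / (ε / (j + 1))) ^ j * u ^ (ε / (j + 1) * j) := by
        rw [Real.rpow_mul (by linarith), Real.rpow_natCast, ← mul_pow]; ring_nf
    _ ≤ max 1 ((1 / (ε / (j + 1))) ^ j) * u ^ ε := by
        apply mul_le_mul (le_max_right _ _) _ (by positivity) (by positivity)
        apply Real.rpow_le_rpow_of_exponent_le hu
        rw [div_mul_eq_mul_div, div_le_iff₀ hj]
        nlinarith

/-- Abel summation for series: bounded partial sums against a sequence of bounded variation. -/
lemma norm_tsum_mul_le_of_partial_sums {a h : ℕ → ℂ} {B V : ℝ} (hB : 0 ≤ B)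
    (ha : ∀ n, ‖∑ i ∈ range n, a i‖ ≤ B) (hsum : Summable fun n => a n * h n)
    (h0 : Filter.Tendsto h Filter.atTop (nhds 0))
    (hV : ∀ n, ∑ i ∈ range n, ‖h i - h (i + 1)‖ ≤ V) :
    ‖∑' n, a n * h n‖ ≤ B * V := by
  have key : ∀ n, ‖∑ i ∈ range n, a i * h i‖ ≤ B * ‖h (n - 1)‖ + B * V := by
    intro n
    have e : ∑ i ∈ range n, a i * h i = h (n - 1) * ∑ i ∈ range n, a i
        - ∑ i ∈ range (n - 1), (h (i + 1) - h i) * ∑ k ∈ range (i + 1), a k := by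
      have := Finset.sum_range_by_parts h a n
      simp only [smul_eq_mul] at this
      rw [← this]
      exact sum_congr rfl fun i _ => mul_comm _ _
    rw [e]
    refine (norm_sub_le _ _).trans (add_le_add ?_ ?_)
    · rw [norm_mul, mul_comm]
      gcongr
      exact ha n
    · refine (norm_sum_le _ _).trans ?_
      calc ∑ i ∈ range (n - 1), ‖(h (i + 1) - h i) * ∑ k ∈ range (i + 1), a k‖
          ≤ ∑ i ∈ range (n - 1), B * ‖h i - h (i + 1)‖ := by
            refine sum_le_sum fun i _ => ?_
            rw [norm_mul, mul_comm, norm_sub_rev]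
            gcongr
            exact ha _
        _ ≤ B * V := by
            rw [← mul_sum]
            gcongr
            exact hV _
  have h1 : Filter.Tendsto (fun n => ‖∑ i ∈ range n, a i * h i‖) Filter.atTop
      (nhds ‖∑' n, a n * h n‖) := (hsum.hasSum.tendsto_sum_nat).norm
  have h2 : Filter.Tendsto (fun n => B * ‖h (n - 1)‖ + B * V) Filter.atTop
      (nhds (B * 0 + B * V)) := by
    refine (Filter.Tendsto.const_mul B ?_).add_const _
    have := (h0.comp (Filter.tendsto_sub_atTop_nat 1)).norm
    simpa using this
  have := le_of_tendsto_of_tendsto' h1 h2 key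
  simpa using this

/-- Discrete Abel summation against a nonnegative antitone weight. -/
lemma norm_sum_mul_le_of_antitone {a : ℕ → ℂ} {w : ℕ → ℝ} {B : ℝ} {m n : ℕ}
    (hw : ∀ i ∈ Ioc m n, 0 ≤ w i) (hanti : ∀ i ∈ Ioc m n, i + 1 ∈ Ioc m n → w (i + 1) ≤ w i)
    (hB : ∀ k, m ≤ k → k ≤ n → ‖∑ i ∈ Ioc m k, a i‖ ≤ B) :
    ‖∑ i ∈ Ioc m n, (w i : ℂ) * a i‖ ≤ w (m + 1) * B ∨ n ≤ m := by
  rcases Nat.lt_or_ge m n with hmn | hmn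
  swap
  · exact Or.inr hmn
  left
  have hB0 : 0 ≤ B := (norm_nonneg _).trans (hB m le_rfl hmn.le)
  have key : ∀ k, m + 1 ≤ k → k ≤ n →
      ∃ r : ℂ, ∑ i ∈ Ioc m k, (w i : ℂ) * a i = (w k : ℂ) * ∑ i ∈ Ioc m k, a i + r ∧
        ‖r‖ ≤ (w (m + 1) - w k) * B := by
    intro k hk
    induction k, hk using Nat.le_induction with
    | base =>
      intro _
      refine ⟨0, by simp, by simp⟩
    | succ k hk ih =>
      intro hkn
      obtain ⟨r, hr, hr'⟩ := ih (by omega)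
      refine ⟨((w k - w (k + 1) : ℝ) : ℂ) * ∑ i ∈ Ioc m k, a i + r, ?_, ?_⟩
      · rw [sum_Ioc_succ_top (by omega), sum_Ioc_succ_top (by omega), hr]
        push_cast
        ring
      · have hle : w (k + 1) ≤ w k := hanti k (by simp; omega) (by simp; omega)
        have h1 := hB k (by omega) (by omega)
        refine (norm_add_le _ _).trans ?_
        rw [norm_mul, Complex.norm_real, Real.norm_eq_abs, abs_of_nonneg (by linarith)]
        have : (w k - w (k + 1)) * ‖∑ i ∈ Ioc m k, a i‖ ≤ (w k - w (k + 1)) * B := by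
          gcongr
        linarith
  obtain ⟨r, hr, hr'⟩ := key n hmn le_rfl
  rw [hr]
  refine (norm_add_le _ _).trans ?_
  have hwn : 0 ≤ w n := hw n (by simp; omega)
  rw [norm_mul, Complex.norm_real, Real.norm_eq_abs, abs_of_nonneg hwn]
  have := mul_le_mul_of_nonneg_left (hB n hmn.le le_rfl) hwn
  linarith

/-- The partial sums of a nonprincipal character are bounded by the modulus. -/
lemma norm_sum_range_char_le {q : ℕ} [NeZero q] {χ : DirichletCharacter ℂ q} (hχ : χ ≠ 1) (n : ℕ) :
    ‖∑ i ∈ range n, χ (i : ZMod q)‖ ≤ q := by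
  have hper : ∀ k : ℕ, ∑ i ∈ range (k * q), χ (i : ZMod q) = 0 := by
    intro k
    induction k with
    | zero => simp
    | succ k ih =>
      rw [Nat.succ_mul, sum_range_add, ih, zero_add]
      have : ∀ i : ℕ, ((k * q + i : ℕ) : ZMod q) = (i : ZMod q) := by intro i; simp
      simp only [this]
      rw [← MulChar.sum_eq_zero_of_ne_one hχ]
      exact (Finset.sum_bij (fun (i : ℕ) _ => (i : ZMod q)) (by simp)
        (by
          intro a ha b hb h
          rw [ZMod.natCast_eq_natCast_iff'] at h
          rwa [Nat.mod_eq_of_lt (by simpa using ha), Nat.mod_eq_of_lt (by simpa using hb)] at h)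
        (by
          intro b _
          exact ⟨b.val, by simpa using ZMod.val_lt b, by simp⟩) (by simp))
  have e : n = (n / q) * q + n % q := by rw [mul_comm]; exact (Nat.div_add_mod n q).symm
  rw [e, sum_range_add, hper, zero_add]
  refine (norm_sum_le _ _).trans ?_
  calc ∑ i ∈ range (n % q), ‖χ (((n / q) * q + i : ℕ) : ZMod q)‖ ≤ ∑ i ∈ range (n % q), (1 : ℝ) :=
        sum_le_sum fun i _ => χ.norm_le_one _
    _ ≤ q := by
      simp only [sum_const, card_range, nsmul_eq_mul, mul_one]
      exact_mod_cast (Nat.mod_lt n (Nat.pos_of_neZero q)).le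

/-- Consecutive differences of `(log n)^j n^{-s}`. -/
lemma exists_norm_log_pow_cpow_sub_le (j : ℕ) {ε : ℝ} (hε : 0 < ε) (hε2 : ε ≤ 2) :
    ∃ C : ℝ, 1 ≤ C ∧ ∀ s : ℂ, 1 ≤ s.re → ∀ n : ℕ, 1 ≤ n →
      ‖((Real.log n ^ j : ℝ) : ℂ) * (n : ℂ) ^ (-s)
        - ((Real.log (n + 1 : ℕ) ^ j : ℝ) : ℂ) * ((n + 1 : ℕ) : ℂ) ^ (-s)‖
        ≤ C * ‖s‖ * (n : ℝ) ^ (ε - 2) := by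
  obtain ⟨C0, hC0, h0⟩ := exists_log_pow_le j hε
  obtain ⟨C1, hC1, h1⟩ := exists_log_pow_le (j - 1) hε
  refine ⟨j * C1 + C0, by nlinarith [Nat.cast_nonneg (α := ℝ) j], fun s hs n hn => ?_⟩
  have hs1 : 1 ≤ ‖s‖ := hs.trans (Complex.re_le_norm s)
  have hn1 : (1 : ℝ) ≤ n := by exact_mod_cast hn
  set f : ℝ → ℂ := fun u => ((Real.log u ^ j : ℝ) : ℂ) * (u : ℂ) ^ (-s) with hf
  set f' : ℝ → ℂ := fun u => ((j * Real.log u ^ (j - 1) * u⁻¹ : ℝ) : ℂ) * (u : ℂ) ^ (-s)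
    + ((Real.log u ^ j : ℝ) : ℂ) * (-s * (u : ℂ) ^ (-s - 1)) with hf'
  have hder : ∀ u : ℝ, 1 ≤ u → HasDerivAt f (f' u) u := by
    intro u hu
    have hu0 : u ≠ 0 := by linarith
    have d1 : HasDerivAt (fun u : ℝ => ((Real.log u ^ j : ℝ) : ℂ))
        ((j * Real.log u ^ (j - 1) * u⁻¹ : ℝ) : ℂ) u :=
      ((Real.hasDerivAt_log hu0).pow j).ofReal_comp
    have d2 : HasDerivAt (fun u : ℝ => (u : ℂ) ^ (-s)) (-s * (u : ℂ) ^ (-s - 1)) u := by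
      have hslit : (u : ℂ) ∈ Complex.slitPlane := by
        rw [Complex.ofReal_mem_slitPlane]; linarith
      have := ((hasDerivAt_id (u : ℂ)).cpow_const (c := -s) (by simpa using hslit)).comp_ofReal
      simpa using this
    exact (d1.mul d2 :)
  have hbd : ∀ u : ℝ, n ≤ u → ‖f' u‖ ≤ (j * C1 + C0) * ‖s‖ * (n : ℝ) ^ (ε - 2) := by
    intro u hu
    have hu1 : 1 ≤ u := hn1.trans hu
    have hupos : 0 < u := by linarith
    have hl := Real.log_nonneg hu1
    have e1 : ‖(u : ℂ) ^ (-s)‖ ≤ u⁻¹ := by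
      rw [Complex.norm_cpow_eq_rpow_re_of_pos hupos, ← Real.rpow_neg_one]
      exact Real.rpow_le_rpow_of_exponent_le hu1 (by simpa using hs)
    have e2 : ‖(u : ℂ) ^ (-s - 1)‖ ≤ u⁻¹ * u⁻¹ := by
      rw [Complex.norm_cpow_eq_rpow_re_of_pos hupos, ← Real.rpow_neg_one, ← Real.rpow_add hupos]
      exact Real.rpow_le_rpow_of_exponent_le hu1 (by simp; linarith)
    have e3 : u ^ ε * (u⁻¹ * u⁻¹) ≤ (n : ℝ) ^ (ε - 2) := by
      rw [← Real.rpow_neg_one, ← Real.rpow_add hupos, ← Real.rpow_add hupos]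
      have : ε + (-1 + -1) = ε - 2 := by ring
      rw [this]
      exact Real.rpow_le_rpow_of_nonpos (by linarith) hu (by linarith)
    have hpos : 0 ≤ u⁻¹ * u⁻¹ := by positivity
    calc ‖f' u‖ ≤ (j * (C1 * u ^ ε) * u⁻¹) * u⁻¹ + (C0 * u ^ ε) * (‖s‖ * (u⁻¹ * u⁻¹)) := by
          refine (norm_add_le _ _).trans (add_le_add ?_ ?_)
          · rw [norm_mul, Complex.norm_real, Real.norm_eq_abs, abs_of_nonneg (by positivity)]
            gcongr
            exact h1 u hu1
          · rw [norm_mul, norm_mul, norm_neg, Complex.norm_real, Real.norm_eq_abs,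
              abs_of_nonneg (by positivity)]
            gcongr
            exact h0 u hu1
      _ = (j * C1 + C0 * ‖s‖) * (u ^ ε * (u⁻¹ * u⁻¹)) := by ring
      _ ≤ ((j * C1 + C0) * ‖s‖) * (n : ℝ) ^ (ε - 2) := by
          gcongr
          have : 0 ≤ (j : ℝ) * C1 := by positivity
          nlinarith
  have := Convex.norm_image_sub_le_of_norm_hasDerivWithin_le (f := f) (f' := f')
    (s := Set.Icc (n : ℝ) (n + 1)) (C := (j * C1 + C0) * ‖s‖ * (n : ℝ) ^ (ε - 2))
    (x := n + 1) (y := n)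
    (fun u hu => (hder u (hn1.trans hu.1)).hasDerivWithinAt) (fun u hu => hbd u hu.1)
    (convex_Icc _ _) (by simp) (by simp)
  simpa [hf] using this

lemma LSeriesSummable_mul_log_pow {a : ℕ → ℂ} (ha : ∀ n, ‖a n‖ ≤ 1) (j : ℕ) {s : ℂ}
    (hs : 1 < s.re) : LSeriesSummable (fun n => a n * ((Real.log n ^ j : ℝ) : ℂ)) s := by
  set ε : ℝ := (s.re - 1) / 2 with hε
  have hε0 : 0 < ε := by rw [hε]; linarith
  obtain ⟨C, hC, hl⟩ := exists_log_pow_le j hε0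
  refine LSeriesSummable_of_le_const_mul_rpow (x := ε + 1) (by rw [hε]; linarith)
    ⟨C, fun n hn => ?_⟩
  have hn1 : (1 : ℝ) ≤ n := by exact_mod_cast Nat.one_le_iff_ne_zero.mpr hn
  rw [norm_mul, Complex.norm_real, Real.norm_eq_abs,
    abs_of_nonneg (pow_nonneg (Real.log_nonneg hn1) _), add_sub_cancel_right]
  calc ‖a n‖ * Real.log n ^ j ≤ 1 * (C * (n : ℝ) ^ ε) := by
        exact mul_le_mul (ha n) (hl n hn1) (pow_nonneg (Real.log_nonneg hn1) _) zero_le_one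
    _ = _ := one_mul _

/-- Uniform upper bounds for (derivatives of) Dirichlet series whose coefficients have bounded
partial sums. -/
lemma exists_norm_LSeries_log_pow_le (j : ℕ) {ε : ℝ} (hε : 0 < ε) :
    ∃ C : ℝ, 1 ≤ C ∧ ∀ (a : ℕ → ℂ) (B : ℝ) (s : ℂ), (∀ n, ‖a n‖ ≤ 1) → 1 ≤ B →
      (∀ n, ‖∑ i ∈ range n, a i‖ ≤ B) → 1 < s.re →
      ‖LSeries (fun n => a n * ((Real.log n ^ j : ℝ) : ℂ)) s‖ ≤ C * (B * ‖s‖) ^ ε := by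
  set δ : ℝ := min (ε / 2) (1 / 2) with hδ
  have hδ0 : 0 < δ := by rw [hδ]; positivity
  have hδ1 : 2 * δ ≤ ε := by have := min_le_left (ε / 2) (1 / 2 : ℝ); linarith
  have hδ2 : 2 * δ ≤ 1 := by have := min_le_right (ε / 2) (1 / 2 : ℝ); linarith
  obtain ⟨C0, hC0, h0⟩ := exists_log_pow_le j hδ0
  obtain ⟨C1, hC1, h1⟩ := exists_norm_log_pow_cpow_sub_le j hδ0 (by linarith)
  have hZs : Summable fun n : ℕ => (n : ℝ) ^ (-1 - δ) := Real.summable_nat_rpow.mpr (by linarith)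
  set Z : ℝ := ∑' n : ℕ, (n : ℝ) ^ (-1 - δ) with hZ
  have hZ0 : 0 ≤ Z := tsum_nonneg fun n => by positivity
  refine ⟨max 1 ((C0 + 2 * C1) * Z * 2), le_max_left _ _, fun a B s ha hB hpart hs => ?_⟩
  have hs1 : 1 ≤ ‖s‖ := hs.le.trans (Complex.re_le_norm s)
  set X := B * ‖s‖ with hX
  have hX1 : 1 ≤ X := by nlinarith
  set z := ⌈X⌉₊ with hz
  have hzX : X ≤ z := Nat.le_ceil X
  have hz2 : (z : ℝ) ≤ 2 * X := by have := Nat.ceil_lt_add_one (by linarith : 0 ≤ X); linarith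
  have hz1 : (1 : ℝ) ≤ z := by linarith
  have hsum := LSeriesSummable_mul_log_pow ha j hs
  set h : ℕ → ℂ := fun n => ((Real.log n ^ j : ℝ) : ℂ) * (n : ℂ) ^ (-s) with hh
  have hs0 : s ≠ 0 := by rintro rfl; simp at hs; linarith
  have hterm : ∀ n, LSeries.term (fun n => a n * ((Real.log n ^ j : ℝ) : ℂ)) s n = a n * h n := by
    intro n
    rw [LSeries.term_def]
    split_ifs with hn
    · subst hn; simp [hh, Complex.zero_cpow (neg_ne_zero.mpr hs0)]
    · simp only [hh]; rw [Complex.cpow_neg, div_eq_mul_inv, mul_assoc]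
  have hsum' : Summable fun n => a n * h n := by
    have := hsum
    unfold LSeriesSummable at this
    refine this.congr ?_
    intro n
    exact hterm n
  have hL : LSeries (fun n => a n * ((Real.log n ^ j : ℝ) : ℂ)) s = ∑' n, a n * h n := by
    unfold LSeries
    exact tsum_congr hterm
  rw [hL, ← hsum'.sum_add_tsum_nat_add z]
  -- the initial segment
  have hnorm : ∀ n, ‖h n‖ ≤ C0 * (n : ℝ) ^ (δ - 1) := by
    intro n
    rcases Nat.eq_zero_or_pos n with rfl | hn
    · simp [hh, Complex.zero_cpow (neg_ne_zero.mpr hs0)]; positivity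
    have hn1 : (1 : ℝ) ≤ n := by exact_mod_cast hn
    simp only [hh]
    rw [norm_mul, Complex.norm_real, Real.norm_eq_abs,
      abs_of_nonneg (pow_nonneg (Real.log_nonneg hn1) _), Complex.norm_natCast_cpow_of_pos hn]
    calc Real.log n ^ j * (n : ℝ) ^ (-s).re ≤ (C0 * (n : ℝ) ^ δ) * (n : ℝ) ^ (-1 : ℝ) := by
          gcongr
          · exact h0 n hn1
          · simpa using hs.le
      _ = C0 * (n : ℝ) ^ (δ - 1) := by
          rw [mul_assoc, ← Real.rpow_add (by linarith)]; ring_nf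
  have hhead : ‖∑ i ∈ range z, a i * h i‖ ≤ C0 * Z * (z : ℝ) ^ (2 * δ) := by
    refine (norm_sum_le _ _).trans ?_
    calc ∑ i ∈ range z, ‖a i * h i‖ ≤ ∑ i ∈ range z, C0 * (z : ℝ) ^ (2 * δ) * (i : ℝ) ^ (-1 - δ) := by
          refine sum_le_sum fun i hi => ?_
          rw [norm_mul]
          have hiz : (i : ℝ) ≤ z := by exact_mod_cast (by simpa using hi : i < z).le
          calc ‖a i‖ * ‖h i‖ ≤ 1 * (C0 * (i : ℝ) ^ (δ - 1)) := by
                gcongr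
                · exact ha i
                · exact hnorm i
            _ ≤ C0 * (z : ℝ) ^ (2 * δ) * (i : ℝ) ^ (-1 - δ) := by
                rcases Nat.eq_zero_or_pos i with rfl | hi0
                · simp only [Nat.cast_zero]
                  rw [Real.zero_rpow (by linarith), Real.zero_rpow (by linarith)]; simp
                have hi1 : (0 : ℝ) < i := by exact_mod_cast hi0
                have : (i : ℝ) ^ (δ - 1) = (i : ℝ) ^ (2 * δ) * (i : ℝ) ^ (-1 - δ) := by
                  rw [← Real.rpow_add hi1]; ring_nf
                rw [one_mul, this, ← mul_assoc]
                gcongr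
      _ ≤ C0 * (z : ℝ) ^ (2 * δ) * Z := by
          rw [← mul_sum]
          gcongr
          exact hZs.sum_le_tsum _ fun i _ => by positivity
      _ = _ := by ring
  -- the tail
  have htail : ‖∑' n, a (n + z) * h (n + z)‖ ≤ (2 * B) * (C1 * ‖s‖ * (z : ℝ) ^ (2 * δ - 1) * Z) := by
    apply norm_tsum_mul_le_of_partial_sums (a := fun n => a (n + z)) (h := fun n => h (n + z))
      (by linarith)
    · intro n
      have : ∑ i ∈ range n, a (i + z) = ∑ i ∈ range (z + n), a i - ∑ i ∈ range z, a i := by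
        rw [sum_range_add]; simp [add_comm]
      rw [this]
      refine (norm_sub_le _ _).trans ?_
      linarith [hpart (z + n), hpart z]
    · have hh3 := (summable_nat_add_iff z).mpr hsum'
      exact (hh3 :)
    · have : Filter.Tendsto h Filter.atTop (nhds 0) := by
        rw [tendsto_zero_iff_norm_tendsto_zero]
        refine squeeze_zero (fun _ => norm_nonneg _) hnorm ?_
        have h3 : Filter.Tendsto (fun n : ℕ => (n : ℝ) ^ (-(1 - δ))) Filter.atTop (nhds 0) :=
          (tendsto_rpow_neg_atTop (by linarith)).comp tendsto_natCast_atTop_atTop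
        have := h3.const_mul C0
        simpa using this
      exact this.comp (Filter.tendsto_add_atTop_nat z)
    · intro n
      calc ∑ i ∈ range n, ‖h (i + z) - h (i + 1 + z)‖
          ≤ ∑ i ∈ range n, C1 * ‖s‖ * (z : ℝ) ^ (2 * δ - 1) * ((i + z : ℕ) : ℝ) ^ (-1 - δ) := by
            refine sum_le_sum fun i _ => ?_
            have hz' : 1 ≤ z := by exact_mod_cast hz1
            have h4 := h1 s hs.le (i + z) (by omega)
            have e : i + 1 + z = i + z + 1 := by ring
            rw [e]
            refine h4.trans ?_
            have hpos : (0 : ℝ) < ((i + z : ℕ) : ℝ) := by exact_mod_cast (by omega : 0 < i + z)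
            have : ((i + z : ℕ) : ℝ) ^ (δ - 2)
                = ((i + z : ℕ) : ℝ) ^ (2 * δ - 1) * ((i + z : ℕ) : ℝ) ^ (-1 - δ) := by
              rw [← Real.rpow_add hpos]; ring_nf
            rw [this, ← mul_assoc]
            gcongr ?_ * _
            gcongr ?_ * ?_
            refine Real.rpow_le_rpow_of_nonpos (by linarith) ?_ (by linarith)
            push_cast
            linarith [Nat.cast_nonneg (α := ℝ) i]
        _ ≤ C1 * ‖s‖ * (z : ℝ) ^ (2 * δ - 1) * Z := by
            rw [← mul_sum]
            gcongr
            have := ((summable_nat_add_iff z).mpr hZs).sum_le_tsum (range n)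
              (fun i _ => by positivity)
            refine this.trans ?_
            rw [hZ, ← hZs.sum_add_tsum_nat_add z]
            have : 0 ≤ ∑ i ∈ range z, (i : ℝ) ^ (-1 - δ) := sum_nonneg fun i _ => by positivity
            linarith
  have hzX' : (z : ℝ) ^ (2 * δ) ≤ 2 * X ^ ε := by
    calc (z : ℝ) ^ (2 * δ) ≤ (2 * X) ^ (2 * δ) := by gcongr
      _ = 2 ^ (2 * δ) * X ^ (2 * δ) := Real.mul_rpow (by norm_num) (by linarith)
      _ ≤ 2 ^ (1 : ℝ) * X ^ ε := by
          gcongr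
          · norm_num
      _ = _ := by simp
  have hz3 : B * ‖s‖ * (z : ℝ) ^ (2 * δ - 1) ≤ (z : ℝ) ^ (2 * δ) := by
    rw [Real.rpow_sub (by linarith), Real.rpow_one, mul_div_assoc', div_le_iff₀ (by linarith), mul_comm]
    gcongr
  calc ‖∑ i ∈ range z, a i * h i + ∑' n, a (n + z) * h (n + z)‖
      ≤ C0 * Z * (z : ℝ) ^ (2 * δ) + (2 * B) * (C1 * ‖s‖ * (z : ℝ) ^ (2 * δ - 1) * Z) :=
        (norm_add_le _ _).trans (add_le_add hhead htail)
    _ = C0 * Z * (z : ℝ) ^ (2 * δ) + 2 * C1 * Z * (B * ‖s‖ * (z : ℝ) ^ (2 * δ - 1)) := by ring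
    _ ≤ C0 * Z * (z : ℝ) ^ (2 * δ) + 2 * C1 * Z * (z : ℝ) ^ (2 * δ) := by gcongr
    _ = (C0 + 2 * C1) * Z * (z : ℝ) ^ (2 * δ) := by ring
    _ ≤ (C0 + 2 * C1) * Z * (2 * X ^ ε) := by gcongr
    _ = (C0 + 2 * C1) * Z * 2 * X ^ ε := by ring
    _ ≤ max 1 ((C0 + 2 * C1) * Z * 2) * X ^ ε := by
        gcongr
        exact le_max_right _ _

/-- A uniform upper bound for the Riemann zeta function to the right of the line `Re s = 1`. -/
lemma exists_norm_riemannZeta_le {ε : ℝ} (hε : 0 < ε) (hε1 : ε ≤ 1) :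
    ∃ C : ℝ, 1 ≤ C ∧ ∀ s : ℂ, 1 < s.re → ‖riemannZeta s‖ ≤ 1 / ‖s - 1‖ + C * ‖s‖ ^ ε := by
  have hZs : Summable fun n : ℕ => (n : ℝ) ^ (-1 - ε) := Real.summable_nat_rpow.mpr (by linarith)
  set Z : ℝ := ∑' n : ℕ, (n : ℝ) ^ (-1 - ε) with hZ
  refine ⟨max 1 (2 * Z), le_max_left _ _, fun s hs => ?_⟩
  have hs1 : 1 ≤ ‖s‖ := hs.le.trans (Complex.re_le_norm s)
  have hsne : s - 1 ≠ 0 := by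
    intro h
    have := congrArg Complex.re h
    simp at this
    linarith
  set g : ℕ → ℂ := fun n => ((n + 1 : ℕ) : ℂ) ^ (1 - s) with hg
  set d : ℕ → ℂ := fun n => ((n + 1 : ℕ) : ℂ) ^ (-s) - (g n - g (n + 1)) / (s - 1) with hd
  have hcpow : ∀ (c : ℂ) (u : ℝ), 0 < u →
      HasDerivAt (fun u : ℝ => (u : ℂ) ^ c) (c * (u : ℂ) ^ (c - 1)) u := by
    intro c u hu
    have hslit : (u : ℂ) ∈ Complex.slitPlane := by
      rw [Complex.ofReal_mem_slitPlane]; exact hu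
    have := ((hasDerivAt_id (u : ℂ)).cpow_const (c := c) (by simpa using hslit)).comp_ofReal
    simpa using this
  have hdb : ∀ n, ‖d n‖ ≤ 2 * ‖s‖ ^ ε * ((n + 1 : ℕ) : ℝ) ^ (-1 - ε) := by
    intro n
    set m : ℝ := ((n + 1 : ℕ) : ℝ) with hm
    have hm1 : 1 ≤ m := by rw [hm]; push_cast; linarith [Nat.cast_nonneg (α := ℝ) n]
    have hm0 : 0 < m := by linarith
    have b1 : ∀ u : ℝ, m ≤ u → ‖(u : ℂ) ^ (-s)‖ ≤ m⁻¹ := by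
      intro u hu
      have hu0 : 0 < u := by linarith
      rw [Complex.norm_cpow_eq_rpow_re_of_pos hu0]
      calc u ^ (-s).re ≤ u ^ (-1 : ℝ) :=
            Real.rpow_le_rpow_of_exponent_le (by linarith) (by simpa using hs.le)
        _ ≤ m⁻¹ := by rw [Real.rpow_neg_one]; gcongr
    have b2 : ∀ u : ℝ, m ≤ u → u ≤ m + 1 →
        ‖(u : ℂ) ^ (-s) - (m : ℂ) ^ (-s)‖ ≤ ‖s‖ * (m⁻¹ * m⁻¹) := by
      intro u hu hu1
      have := Convex.norm_image_sub_le_of_norm_hasDerivWithin_le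
        (f := fun u : ℝ => (u : ℂ) ^ (-s)) (f' := fun u : ℝ => -s * (u : ℂ) ^ (-s - 1))
        (s := Set.Icc m (m + 1)) (C := ‖s‖ * (m⁻¹ * m⁻¹)) (x := m) (y := u)
        (fun v hv => (hcpow (-s) v (by linarith [hv.1])).hasDerivWithinAt)
        (fun v hv => by
          have hv0 : 0 < v := by linarith [hv.1]
          rw [norm_mul, norm_neg, Complex.norm_cpow_eq_rpow_re_of_pos hv0]
          gcongr
          calc v ^ (-s - 1).re ≤ v ^ (-1 + -1 : ℝ) :=
                Real.rpow_le_rpow_of_exponent_le (by linarith [hv.1]) (by simp; linarith)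
            _ ≤ m⁻¹ * m⁻¹ := by
                have h1 := hv.1
                rw [Real.rpow_add hv0, Real.rpow_neg_one]; gcongr)
        (convex_Icc _ _) (by simp) ⟨hu, hu1⟩
      refine this.trans ?_
      rw [Real.norm_eq_abs, abs_of_nonneg (by linarith)]
      exact mul_le_of_le_one_right (by positivity) (by linarith)
    have b3 : ∀ u : ℝ, m ≤ u → u ≤ m + 1 →
        ‖(m : ℂ) ^ (-s) - (u : ℂ) ^ (-s)‖ ≤ 2 * ‖s‖ ^ ε * m ^ (-1 - ε) := by
      intro u hu hu1
      have e : m ^ (-1 - ε) = m⁻¹ * (m ^ ε)⁻¹ := by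
        rw [Real.rpow_sub hm0, Real.rpow_neg_one, div_eq_mul_inv]
      rw [e]
      by_cases hsm : ‖s‖ ≤ m
      · rw [norm_sub_rev]
        refine (b2 u hu hu1).trans ?_
        have : ‖s‖ / m ≤ (‖s‖ / m) ^ ε := by
          conv_lhs => rw [← Real.rpow_one (‖s‖ / m)]
          exact Real.rpow_le_rpow_of_exponent_ge (by positivity) ((div_le_one hm0).mpr hsm) hε1
        rw [Real.div_rpow (by positivity) hm0.le] at this
        calc ‖s‖ * (m⁻¹ * m⁻¹) = (‖s‖ / m) * m⁻¹ := by ring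
          _ ≤ (‖s‖ ^ ε / m ^ ε) * m⁻¹ := by gcongr
          _ ≤ 2 * ‖s‖ ^ ε * (m⁻¹ * (m ^ ε)⁻¹) := by
              have : 0 ≤ ‖s‖ ^ ε * (m⁻¹ * (m ^ ε)⁻¹) := by positivity
              calc (‖s‖ ^ ε / m ^ ε) * m⁻¹ = ‖s‖ ^ ε * (m⁻¹ * (m ^ ε)⁻¹) := by ring
                _ ≤ _ := by linarith
      · have h2 : 1 ≤ ‖s‖ ^ ε * (m ^ ε)⁻¹ := by
          rw [← div_eq_mul_inv, one_le_div (by positivity)]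
          exact Real.rpow_le_rpow hm0.le (by linarith) hε.le
        calc ‖(m : ℂ) ^ (-s) - (u : ℂ) ^ (-s)‖ ≤ m⁻¹ + m⁻¹ :=
              (norm_sub_le _ _).trans (add_le_add (b1 m le_rfl) (b1 u hu))
          _ = 2 * m⁻¹ * 1 := by ring
          _ ≤ 2 * m⁻¹ * (‖s‖ ^ ε * (m ^ ε)⁻¹) := by gcongr
          _ = _ := by ring
    have := Convex.norm_image_sub_le_of_norm_hasDerivWithin_le
      (f := fun u : ℝ => (m : ℂ) ^ (-s) * (u : ℂ) + (u : ℂ) ^ (1 - s) / (s - 1))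
      (f' := fun u : ℝ => (m : ℂ) ^ (-s) - (u : ℂ) ^ (-s))
      (s := Set.Icc m (m + 1)) (C := 2 * ‖s‖ ^ ε * m ^ (-1 - ε)) (x := m) (y := m + 1)
      (fun v hv => by
        have h1 := ((hasDerivAt_id (v : ℂ)).comp_ofReal.const_mul ((m : ℂ) ^ (-s))).add
          ((hcpow (1 - s) v (by linarith [hv.1])).div_const (s - 1))
        refine (h1.congr_deriv ?_).hasDerivWithinAt
        have : 1 - s - 1 = -s := by ring
        rw [this]
        field_simp
        ring)
      (fun v hv => b3 v hv.1 hv.2)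
      (convex_Icc _ _) (by simp) (by simp)
    simp only [add_sub_cancel_left, norm_one, mul_one] at this
    have e : d n = (m : ℂ) ^ (-s) * ((m + 1 : ℝ) : ℂ) + ((m + 1 : ℝ) : ℂ) ^ (1 - s) / (s - 1)
        - ((m : ℂ) ^ (-s) * (m : ℂ) + (m : ℂ) ^ (1 - s) / (s - 1)) := by
      simp only [hd, hg, hm]
      push_cast
      field_simp
      ring
    calc ‖d n‖ = _ := by rw [e]
      _ ≤ _ := this
  have hds : Summable fun n => 2 * ‖s‖ ^ ε * ((n + 1 : ℕ) : ℝ) ^ (-1 - ε) :=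
    ((summable_nat_add_iff 1).mpr hZs).mul_left _
  have hsumd : Summable d := Summable.of_norm_bounded hds hdb
  have hdt : ‖∑' n, d n‖ ≤ 2 * Z * ‖s‖ ^ ε := by
    refine (tsum_of_norm_bounded hds.hasSum hdb).trans ?_
    rw [tsum_mul_left]
    have : ∑' n : ℕ, ((n + 1 : ℕ) : ℝ) ^ (-1 - ε) ≤ Z := by
      rw [hZ, hZs.tsum_eq_zero_add]
      have : 0 ≤ ((0 : ℕ) : ℝ) ^ (-1 - ε) := by positivity
      linarith
    have h0 : 0 ≤ ‖s‖ ^ ε := by positivity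
    nlinarith
  have hg0 : Filter.Tendsto g Filter.atTop (nhds 0) := by
    rw [tendsto_zero_iff_norm_tendsto_zero]
    have h3 : Filter.Tendsto (fun n : ℕ => ((n + 1 : ℕ) : ℝ) ^ (-(s.re - 1))) Filter.atTop (nhds 0) :=
      (tendsto_rpow_neg_atTop (by linarith)).comp
        (tendsto_natCast_atTop_atTop.comp (Filter.tendsto_add_atTop_nat 1))
    refine h3.congr fun n => ?_
    change _ = ‖((n + 1 : ℕ) : ℂ) ^ (1 - s)‖
    rw [Complex.norm_natCast_cpow_of_pos (by omega)]
    simp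
  have hzs : HasSum (fun n : ℕ => d n + (g n - g (n + 1)) / (s - 1))
      (∑' n, d n + (1 - 0) / (s - 1)) := by
    have hs2 : Summable fun n : ℕ => ((n + 1 : ℕ) : ℂ) ^ (-s) := by
      have := (summable_nat_add_iff 1).mpr (Complex.summable_one_div_nat_cpow.mpr hs)
      refine this.congr fun n => ?_
      rw [Complex.cpow_neg, one_div]
    have hs3 : Summable fun n : ℕ => (g n - g (n + 1)) / (s - 1) := by
      refine (hs2.sub hsumd).congr fun n => ?_
      change ((n + 1 : ℕ) : ℂ) ^ (-s) - (((n + 1 : ℕ) : ℂ) ^ (-s) - (g n - g (n + 1)) / (s - 1)) = _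
      ring
    refine hsumd.hasSum.add ?_
    refine (hs3.hasSum_iff_tendsto_nat).mpr ?_
    have : ∀ n, ∑ i ∈ range n, (g i - g (i + 1)) / (s - 1) = (1 - g n) / (s - 1) := by
      intro n
      rw [← sum_div, sum_range_sub']
      simp [hg]
    simp only [this]
    exact (tendsto_const_nhds.sub hg0).div_const _
  have hzeta : riemannZeta s = ∑' n, d n + 1 / (s - 1) := by
    rw [zeta_eq_tsum_one_div_nat_add_one_cpow hs]
    rw [sub_zero] at hzs
    rw [← hzs.tsum_eq]
    refine tsum_congr fun n => ?_
    change 1 / ((n : ℂ) + 1) ^ s =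
      ((n + 1 : ℕ) : ℂ) ^ (-s) - (g n - g (n + 1)) / (s - 1) + (g n - g (n + 1)) / (s - 1)
    rw [Complex.cpow_neg]
    push_cast
    ring
  rw [hzeta]
  refine (norm_add_le _ _).trans ?_
  rw [norm_div, norm_one, add_comm]
  gcongr
  refine hdt.trans ?_
  gcongr
  exact le_max_right _ _

lemma norm_natCast_cpow_neg_sub_le {s : ℂ} (hs : 0 ≤ s.re) {n : ℕ} (hn : 1 ≤ n) :
    ‖(n : ℂ) ^ (-s) - ((n + 1 : ℕ) : ℂ) ^ (-s)‖ ≤ ‖s‖ * (n : ℝ) ^ (-s.re - 1) := by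
  have hn1 : (1 : ℝ) ≤ n := by exact_mod_cast hn
  have := Convex.norm_image_sub_le_of_norm_hasDerivWithin_le
    (f := fun u : ℝ => (u : ℂ) ^ (-s)) (f' := fun u : ℝ => -s * (u : ℂ) ^ (-s - 1))
    (s := Set.Icc (n : ℝ) (n + 1)) (C := ‖s‖ * (n : ℝ) ^ (-s.re - 1)) (x := n) (y := n + 1)
    (fun v hv => by
      have hslit : (v : ℂ) ∈ Complex.slitPlane := by
        rw [Complex.ofReal_mem_slitPlane]; linarith [hv.1]
      have := ((hasDerivAt_id (v : ℂ)).cpow_const (c := -s) (by simpa using hslit)).comp_ofReal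
      exact HasDerivAt.hasDerivWithinAt (by simpa using this))
    (fun v hv => by
      have hv0 : 0 < v := by linarith [hv.1]
      rw [norm_mul, norm_neg, Complex.norm_cpow_eq_rpow_re_of_pos hv0]
      gcongr
      have : (-s - 1).re = -s.re - 1 := by simp
      rw [this]
      exact Real.rpow_le_rpow_of_nonpos (by linarith) hv.1 (by linarith))
    (convex_Icc _ _) (by simp) (by simp)
  rw [norm_sub_rev]
  simpa using this

lemma hasSum_of_tendsto_sub {a : ℕ → ℂ} {h : ℕ → ℂ} (hs : Summable fun n => a n * h n)
    (hs' : Summable fun n => (∑ i ∈ range (n + 1), a i) * (h n - h (n + 1)))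
    (hlim : Filter.Tendsto (fun n => (∑ i ∈ range n, a i) * h n) Filter.atTop (nhds 0)) :
    ∑' n, a n * h n = ∑' n, (∑ i ∈ range (n + 1), a i) * (h n - h (n + 1)) := by
  have e : ∀ N, ∑ n ∈ range N, (∑ i ∈ range (n + 1), a i) * (h n - h (n + 1)) =
      ∑ n ∈ range N, a n * h n - (∑ i ∈ range N, a i) * h N := by
    intro N
    induction N with
    | zero => simp
    | succ N ih => rw [sum_range_succ, ih, sum_range_succ _ N, sum_range_succ _ N]; ring
  have h1 := hs'.hasSum.tendsto_sum_nat
  simp only [e] at h1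
  have h2 := hs.hasSum.tendsto_sum_nat.sub hlim
  rw [sub_zero] at h2
  exact tendsto_nhds_unique h2 h1

section
variable {q : ℕ} [NeZero q]

/-- Abel summation representation of a Dirichlet `L`-function on `0 < re s`. -/
def abelSeries (χ : DirichletCharacter ℂ q) (s : ℂ) : ℂ :=
  ∑' n : ℕ, (∑ i ∈ range (n + 2), χ (i : ZMod q)) *
    (((n + 1 : ℕ) : ℂ) ^ (-s) - ((n + 2 : ℕ) : ℂ) ^ (-s))

lemma norm_abelSeries_term_le {χ : DirichletCharacter ℂ q} (hχ : χ ≠ 1) {s : ℂ} (hs : 0 ≤ s.re)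
    (n : ℕ) : ‖(∑ i ∈ range (n + 2), χ (i : ZMod q)) *
    (((n + 1 : ℕ) : ℂ) ^ (-s) - ((n + 2 : ℕ) : ℂ) ^ (-s))‖ ≤
      q * (‖s‖ * ((n + 1 : ℕ) : ℝ) ^ (-s.re - 1)) := by
  rw [norm_mul]
  exact mul_le_mul (norm_sum_range_char_le hχ _)
    (norm_natCast_cpow_neg_sub_le hs (by omega : 1 ≤ n + 1)) (norm_nonneg _) (by positivity)

lemma summable_natCast_add_one_rpow {δ : ℝ} (hδ : 0 < δ) :
    Summable fun n : ℕ => ((n + 1 : ℕ) : ℝ) ^ (-δ - 1) :=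
  (summable_nat_add_iff 1).mpr (Real.summable_nat_rpow.mpr (by linarith : -δ - 1 < -1))

lemma summable_abelSeries {χ : DirichletCharacter ℂ q} (hχ : χ ≠ 1) {s : ℂ} (hs : 0 < s.re) :
    Summable fun n : ℕ => (∑ i ∈ range (n + 2), χ (i : ZMod q)) *
    (((n + 1 : ℕ) : ℂ) ^ (-s) - ((n + 2 : ℕ) : ℂ) ^ (-s)) :=
  Summable.of_norm_bounded (((summable_natCast_add_one_rpow hs).mul_left _).mul_left _)
    (norm_abelSeries_term_le hχ hs.le)

lemma LFunction_eq_abelSeries_of_one_lt {χ : DirichletCharacter ℂ q} (hχ : χ ≠ 1) {s : ℂ}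
    (hs : 1 < s.re) : χ.LFunction s = abelSeries χ s := by
  have hs0 : s ≠ 0 := by rintro rfl; simp at hs; linarith
  have hq : q ≠ 1 := by
    rintro rfl
    exact hχ (Subsingleton.elim _ _)
  have hχ0 : χ ((0 : ℕ) : ZMod q) = 0 := by
    have : Nontrivial (ZMod q) := ZMod.nontrivial_iff.mpr hq
    exact χ.map_nonunit (by simp)
  rw [DirichletCharacter.LFunction_eq_LSeries χ hs]
  have hsm := ZMod.LSeriesSummable_of_one_lt_re χ hs
  have hterm : ∀ n, LSeries.term (fun n => χ n) s n = χ (n : ZMod q) * (n : ℂ) ^ (-s) := by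
    intro n
    rw [LSeries.term_def]
    split_ifs with hn
    · subst hn; rw [hχ0, zero_mul]
    · rw [Complex.cpow_neg, div_eq_mul_inv]
  have h1 : Summable fun n : ℕ => χ (n : ZMod q) * (n : ℂ) ^ (-s) := by
    have h2 : Summable (LSeries.term (fun n => χ n) s) := hsm
    exact h2.congr fun n => hterm n
  have h2 : Summable fun n : ℕ => (∑ i ∈ range (n + 1), χ (i : ZMod q)) *
      ((n : ℂ) ^ (-s) - ((n + 1 : ℕ) : ℂ) ^ (-s)) :=
    (summable_nat_add_iff 1).mp (summable_abelSeries hχ (by linarith))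
  have h3 : Filter.Tendsto (fun n : ℕ => (∑ i ∈ range n, χ (i : ZMod q)) * (n : ℂ) ^ (-s))
      Filter.atTop (nhds 0) := by
    rw [tendsto_zero_iff_norm_tendsto_zero]
    have h4 : Filter.Tendsto (fun n : ℕ => (q : ℝ) * (n : ℝ) ^ (-s.re)) Filter.atTop (nhds (q * 0)) :=
      ((tendsto_rpow_neg_atTop (by linarith)).comp tendsto_natCast_atTop_atTop).const_mul _
    rw [mul_zero] at h4
    refine squeeze_zero' (Filter.Eventually.of_forall fun _ => norm_nonneg _) ?_ h4
    filter_upwards [Filter.eventually_ge_atTop 1] with n hn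
    rw [norm_mul, Complex.norm_natCast_cpow_of_pos hn]
    exact mul_le_mul (norm_sum_range_char_le hχ n) (by simp) (by positivity) (by positivity)
  calc LSeries (fun n => χ n) s = ∑' n : ℕ, χ (n : ZMod q) * (n : ℂ) ^ (-s) := tsum_congr hterm
    _ = _ := hasSum_of_tendsto_sub h1 h2 h3
    _ = _ := by
      rw [h2.tsum_eq_zero_add]
      simp only [zero_add, sum_range_one, hχ0, zero_mul]
      rfl

lemma differentiableOn_abelSeries {χ : DirichletCharacter ℂ q} (hχ : χ ≠ 1) :
    DifferentiableOn ℂ (abelSeries χ) {s | 0 < s.re} := by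
  intro s hs
  have hs' : 0 < s.re := hs
  set U : Set ℂ := {w | s.re / 2 < w.re} ∩ Metric.ball 0 (‖s‖ + 1) with hU
  have hUo : IsOpen U := (isOpen_lt continuous_const Complex.continuous_re).inter Metric.isOpen_ball
  have hsU : s ∈ U := ⟨by show s.re / 2 < s.re; linarith, by simp⟩
  have hd : DifferentiableOn ℂ (abelSeries χ) U := by
    refine Complex.differentiableOn_tsum_of_summable_norm
      (u := fun n : ℕ => q * ((‖s‖ + 1) * ((n + 1 : ℕ) : ℝ) ^ (-(s.re / 2) - 1)))
      (((summable_natCast_add_one_rpow (by linarith)).mul_left _).mul_left _) ?_ hUo ?_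
    · intro n
      refine Differentiable.differentiableOn ?_
      refine Differentiable.const_mul (Differentiable.sub ?_ ?_) _
      · exact differentiable_neg.const_cpow (Or.inl (by exact_mod_cast (by omega : n + 1 ≠ 0)))
      · exact differentiable_neg.const_cpow (Or.inl (by exact_mod_cast (by omega : n + 2 ≠ 0)))
    · intro n w hw
      have h1 : s.re / 2 < w.re := hw.1
      have h2 : ‖w‖ < ‖s‖ + 1 := by simpa using hw.2
      refine (norm_abelSeries_term_le hχ (by linarith) n).trans ?_
      gcongr
      · push_cast; linarith [Nat.cast_nonneg (α := ℝ) n]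
  exact ((hd s hsU).differentiableAt (hUo.mem_nhds hsU)).differentiableWithinAt

lemma LFunction_eq_abelSeries {χ : DirichletCharacter ℂ q} (hχ : χ ≠ 1) {s : ℂ}
    (hs : 0 < s.re) : χ.LFunction s = abelSeries χ s := by
  have hUo : IsOpen {s : ℂ | 0 < s.re} := isOpen_lt continuous_const Complex.continuous_re
  have h1 : AnalyticOnNhd ℂ (χ.LFunction) {s : ℂ | 0 < s.re} :=
    (DirichletCharacter.differentiable_LFunction hχ).differentiableOn.analyticOnNhd hUo
  have h2 : AnalyticOnNhd ℂ (abelSeries χ) {s : ℂ | 0 < s.re} :=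
    (differentiableOn_abelSeries hχ).analyticOnNhd hUo
  refine h1.eqOn_of_preconnected_of_eventuallyEq h2 (convex_halfSpace_re_gt 0).isPreconnected
    (z₀ := 2) (by simp) ?_ hs
  have h3 : IsOpen {s : ℂ | 1 < s.re} := isOpen_lt continuous_const Complex.continuous_re
  filter_upwards [h3.mem_nhds (by simp : (2 : ℂ) ∈ {s : ℂ | 1 < s.re})] with w hw
  exact LFunction_eq_abelSeries_of_one_lt hχ hw

lemma exists_norm_LFunction_le : ∃ Z : ℝ, 1 ≤ Z ∧ ∀ (q : ℕ) [NeZero q]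
    (χ : DirichletCharacter ℂ q), χ ≠ 1 → ∀ s : ℂ, 1 / 2 ≤ s.re →
      ‖χ.LFunction s‖ ≤ Z * q * ‖s‖ := by
  refine ⟨max 1 (∑' n : ℕ, ((n + 1 : ℕ) : ℝ) ^ (-(1 / 2 : ℝ) - 1)), le_max_left _ _,
    fun q _ χ hχ s hs => ?_⟩
  rw [LFunction_eq_abelSeries hχ (by linarith)]
  have h1 := (summable_natCast_add_one_rpow (by norm_num : (0 : ℝ) < 1 / 2)).mul_left (q * ‖s‖)
  refine (tsum_of_norm_bounded h1.hasSum fun n => ?_).trans ?_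
  · refine (norm_abelSeries_term_le hχ (by linarith) n).trans ?_
    rw [← mul_assoc]
    gcongr
    · push_cast; linarith [Nat.cast_nonneg (α := ℝ) n]
  · rw [tsum_mul_left]
    have := le_max_right 1 (∑' n : ℕ, ((n + 1 : ℕ) : ℝ) ^ (-(1 / 2 : ℝ) - 1))
    calc _ ≤ q * ‖s‖ * max 1 (∑' n : ℕ, ((n + 1 : ℕ) : ℝ) ^ (-(1 / 2 : ℝ) - 1)) := by gcongr
      _ = _ := by ring

lemma char_im_eq_zero {χ : DirichletCharacter ℂ q} (hχ : χ ^ 2 = 1) (a : ZMod q) :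
    (χ a).im = 0 := by
  by_cases ha : IsUnit a
  · have h1 : χ a ^ 2 = 1 := by
      rw [← MulChar.pow_apply' χ two_ne_zero, hχ, MulChar.one_apply ha]
    rcases mul_self_eq_one_iff.mp ((sq (χ a)).symm.trans h1) with h | h <;> simp [h]
  · simp [χ.map_nonunit ha]

lemma LFunction_im_eq_zero {χ : DirichletCharacter ℂ q} (hχ : χ ≠ 1) (hχ2 : χ ^ 2 = 1) {x : ℝ}
    (hx : 0 < x) : (χ.LFunction x).im = 0 := by
  rw [LFunction_eq_abelSeries hχ (by simpa using hx), abelSeries,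
    Complex.im_tsum (summable_abelSeries hχ (by simpa using hx))]
  convert tsum_zero with n
  have h1 : (∑ i ∈ range (n + 2), χ (i : ZMod q)).im = 0 := by
    rw [Complex.im_sum]
    exact sum_eq_zero fun i _ => char_im_eq_zero hχ2 _
  have h2 : ∀ m : ℕ, ((m : ℂ) ^ (-(x : ℂ))).im = 0 := by
    intro m
    have : ((m : ℂ) ^ (-(x : ℂ))) = (((m : ℝ) ^ (-x) : ℝ) : ℂ) := by
      rw [Complex.ofReal_cpow (by positivity)]; simp
    rw [this, Complex.ofReal_im]
  rw [Complex.mul_im, h1, Complex.sub_im, h2, h2]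
  simp

lemma LFunction_two_re_pos (χ : DirichletCharacter ℂ q) :
    0 < (χ.LFunction (2 : ℝ)).re := by
  have h2 : (1 : ℝ) < ((2 : ℝ) : ℂ).re := by norm_num
  rw [DirichletCharacter.LFunction_eq_LSeries χ h2]
  have hsm := ZMod.LSeriesSummable_of_one_lt_re χ h2
  have hb : ∀ n : ℕ, ‖LSeries.term (fun n => χ n) ((2 : ℝ) : ℂ) (n + 2)‖ ≤
      1 / (((n + 2 : ℕ) : ℝ)) ^ 2 := by
    intro n
    refine (LSeries.norm_term_le (g := 1) _ (by simpa using χ.norm_le_one _)).trans ?_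
    rw [LSeries.term_of_ne_zero (by omega), norm_div, Complex.norm_natCast_cpow_of_pos (by omega)]
    simp
  have hz := hasSum_zeta_two
  have hz2 := (hasSum_nat_add_iff' 2).mpr hz
  have ht := tsum_of_norm_bounded hz2 hb
  have e : LSeries (fun n => χ n) ((2 : ℝ) : ℂ) =
      1 + ∑' n, LSeries.term (fun n => χ n) ((2 : ℝ) : ℂ) (n + 2) := by
    rw [LSeries, ← Summable.sum_add_tsum_nat_add 2 hsm]
    simp [sum_range_succ, LSeries.term_def]
  rw [e, Complex.add_re, Complex.one_re]
  have h3 := (abs_le.mp (Complex.abs_re_le_norm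
    (∑' n, LSeries.term (fun n => χ n) ((2 : ℝ) : ℂ) (n + 2)))).1
  have h4 : Real.pi ^ 2 / 6 - ∑ i ∈ range 2, 1 / ((i : ℝ)) ^ 2 < 1 := by
    simp [sum_range_succ]
    nlinarith [Real.pi_lt_d2, Real.pi_pos]
  linarith
end

lemma estermann_lower_bound {H : ℂ → ℂ} (hH : Differentiable ℂ H) {b : ℕ → ℝ} (hb : ∀ m, 0 ≤ b m)
    (hb0 : 1 ≤ b 0) {lam : ℂ} {M : ℝ} (hM : ∀ s, ‖s - 2‖ = 3 / 2 → ‖H s‖ ≤ M)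
    (hHb : ∀ m, iteratedDeriv m H 2 = (-1) ^ m * m.factorial * (b m - lam)) {x : ℝ}
    (hx : 7 / 8 ≤ x) (hx1 : x < 1) {K : ℕ} (hK : 0 < K) :
    1 - 4 * M * (3 / 4) ^ K - ‖lam‖ * (2 - x) ^ K / (1 - x) ≤ (H x + lam / (x - 1)).re := by
  have hM0 : 0 ≤ M := (norm_nonneg _).trans (hM (2 + (3 / 2 : ℝ)) (by simp))
  have hf : ∀ m : ℕ, (m.factorial : ℂ) ≠ 0 := fun m => by exact_mod_cast m.factorial_ne_zero
  have hT : HasSum (fun n : ℕ => ((2 - x : ℝ) : ℂ) ^ n * (b n - lam)) (H x) := by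
    have := Complex.hasSum_taylorSeries_of_entire hH 2 x
    refine this.congr_fun ?_
    intro n
    rw [hHb, smul_eq_mul, smul_eq_mul]
    have e : ((x : ℂ) - 2) = (-1) * ((2 - x : ℝ) : ℂ) := by push_cast; ring
    rw [e, mul_pow]
    field_simp [hf n]
    rw [← pow_mul, mul_comm n 2, pow_mul]
    norm_num
  have hc : ∀ n : ℕ, ‖((2 - x : ℝ) : ℂ) ^ n * (b n - lam)‖ ≤ M * (3 / 4) ^ n := by
    intro n
    have h1 := Complex.norm_iteratedDeriv_le_of_forall_mem_sphere_norm_le n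
      (by norm_num : (0 : ℝ) < 3 / 2) hH.diffContOnCl (c := 2) (C := M)
      (fun z hz => hM z (by simpa [dist_eq_norm] using hz))
    rw [hHb, norm_mul, norm_mul, norm_pow, norm_neg, norm_one, one_pow, one_mul,
      Complex.norm_natCast, mul_div_assoc] at h1
    have h2 := le_of_mul_le_mul_left h1 (by exact_mod_cast n.factorial_pos)
    rw [norm_mul, norm_pow, Complex.norm_real, Real.norm_eq_abs, abs_of_nonneg (by linarith)]
    calc (2 - x) ^ n * ‖(b n : ℂ) - lam‖ ≤ (9 / 8) ^ n * (M / (3 / 2) ^ n) := by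
          gcongr
          · linarith
          · linarith
      _ = M * ((9 / 8) ^ n / (3 / 2) ^ n) := by ring
      _ = M * (3 / 4) ^ n := by rw [← div_pow]; norm_num
  have hgeo : HasSum (fun n : ℕ => M * (3 / 4 : ℝ) ^ (n + K)) (4 * M * (3 / 4) ^ K) := by
    have := (hasSum_geometric_of_lt_one (by norm_num : (0 : ℝ) ≤ 3 / 4) (by norm_num)).mul_left
      (M * (3 / 4) ^ K)
    have e : M * (3 / 4) ^ K * (1 - 3 / 4)⁻¹ = 4 * M * (3 / 4) ^ K := by norm_num; ring
    rw [e] at this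
    refine this.congr_fun fun n => ?_
    rw [pow_add]; ring
  have htail := tsum_of_norm_bounded hgeo fun n => hc (n + K)
  rw [← hT.tsum_eq, ← hT.summable.sum_add_tsum_nat_add K, Complex.add_re, Complex.add_re]
  have h1 := (abs_le.mp ((Complex.abs_re_le_norm _).trans htail)).1
  have h2 : -(‖lam‖ / (1 - x)) ≤ (lam / (x - 1)).re := by
    have : ‖lam / (x - 1)‖ = ‖lam‖ / (1 - x) := by
      rw [norm_div]
      congr 1
      rw [show ((x : ℂ) - 1) = ((x - 1 : ℝ) : ℂ) by push_cast; ring, Complex.norm_real,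
        Real.norm_eq_abs, abs_of_neg (by linarith)]
      ring
    rw [← this]
    exact (abs_le.mp (Complex.abs_re_le_norm _)).1
  have h3 : 1 - ‖lam‖ * (((2 - x) ^ K - 1) / (1 - x)) ≤
      (∑ n ∈ range K, ((2 - x : ℝ) : ℂ) ^ n * (b n - lam)).re := by
    have hterm : ∀ n, (2 - x) ^ n * b n - ‖lam‖ * (2 - x) ^ n ≤
        (((2 - x : ℝ) : ℂ) ^ n * (b n - lam)).re := by
      intro n
      rw [← Complex.ofReal_pow, Complex.re_ofReal_mul, Complex.sub_re, Complex.ofReal_re]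
      have := Complex.re_le_norm lam
      have h0 : 0 ≤ (2 - x) ^ n := by apply pow_nonneg; linarith
      nlinarith
    rw [Complex.re_sum]
    refine le_trans ?_ (sum_le_sum fun n _ => hterm n)
    rw [sum_sub_distrib, ← mul_sum, geom_sum_eq (by linarith)]
    have : (2 - x) - 1 = 1 - x := by ring
    rw [this]
    have : 1 ≤ ∑ n ∈ range K, (2 - x) ^ n * b n := by
      refine le_trans ?_ (single_le_sum (fun n _ => mul_nonneg (pow_nonneg (by linarith) _) (hb n))
        (mem_range.mpr hK))
      simpa using hb0
    linarith
  have hx0 : 0 < 1 - x := by linarith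
  have e : ‖lam‖ * (2 - x) ^ K / (1 - x) = ‖lam‖ * (((2 - x) ^ K - 1) / (1 - x)) +
      ‖lam‖ / (1 - x) := by field_simp; ring
  rw [e]
  linarith

lemma alternating_sums (m : ℕ) :
    (∑ i ∈ range (2 * m + 1), (-1 : ℝ) ^ i * (i + 1) = m + 1) ∧
    (∑ i ∈ range (2 * m + 1), (-1 : ℝ) ^ i * (i + 1) * (2 * m - i + 1) = m + 1) := by
  induction m with
  | zero => simp
  | succ m ih =>
    obtain ⟨h1, h2⟩ := ih
    have e : 2 * (m + 1) + 1 = 2 * m + 1 + 1 + 1 := by ring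
    have p1 : (-1 : ℝ) ^ (2 * m + 1) = -1 := Odd.neg_one_pow ⟨m, rfl⟩
    have p2 : (-1 : ℝ) ^ (2 * m + 1 + 1) = 1 := Even.neg_one_pow ⟨m + 1, by ring⟩
    have h3 : ∑ i ∈ range (2 * m + 1), (-1 : ℝ) ^ i * (i + 1) * (2 * (m + 1 : ℕ) - i + 1) =
        (m + 1) + 2 * (m + 1) := by
      refine Eq.trans ?_ (congrArg₂ (fun u v => u + 2 * v) h2 h1)
      rw [mul_sum, ← sum_add_distrib]
      refine sum_congr rfl fun i _ => ?_
      push_cast; ring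
    rw [e, sum_range_succ _ (2 * m + 1 + 1), sum_range_succ _ (2 * m + 1 + 1),
      sum_range_succ _ (2 * m + 1), sum_range_succ _ (2 * m + 1), h1, h3, p1, p2]
    push_cast
    constructor <;> ring

lemma alternating_sum_nonneg (k : ℕ) :
    0 ≤ ∑ i ∈ range (k + 1), (-1 : ℝ) ^ i * (i + 1) * (k - i + 1) := by
  rcases Nat.even_or_odd' k with ⟨m, rfl | rfl⟩
  · have := (alternating_sums m).2
    push_cast
    rw [this]; positivity
  · have h1 := (alternating_sums m).1
    have h2 := (alternating_sums m).2
    have p1 : (-1 : ℝ) ^ (2 * m + 1) = -1 := Odd.neg_one_pow ⟨m, rfl⟩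
    rw [sum_range_succ, p1]
    have h3 : ∑ i ∈ range (2 * m + 1), (-1 : ℝ) ^ i * (i + 1) * ((2 * m + 1 : ℕ) - i + 1) =
        (m + 1) + (m + 1) := by
      refine Eq.trans ?_ (congrArg₂ (fun u v => u + v) h2 h1)
      rw [← sum_add_distrib]
      refine sum_congr rfl fun i _ => ?_
      push_cast; ring
    rw [h3]
    push_cast
    apply le_of_eq; ring

open scoped ComplexOrder in
lemma quadratic_convolution_nonneg {x y : ℂ} (hx : x = 0 ∨ x = 1 ∨ x = -1)
    (hy : y = 0 ∨ y = 1 ∨ y = -1) (k : ℕ) :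
    0 ≤ ∑ i ∈ range (k + 1), (∑ l ∈ range (k - i + 1), x ^ l) *
      (y ^ i * ∑ l ∈ range (i + 1), x ^ l) := by
  have hz : ∀ i, 0 ≤ ∑ l ∈ range (i + 1), x ^ l := by
    intro i
    rcases hx with rfl | rfl | rfl
    · exact sum_nonneg fun l _ => pow_nonneg le_rfl _
    · exact sum_nonneg fun l _ => pow_nonneg zero_le_one _
    · rw [neg_one_geom_sum]; split_ifs <;> simp
  have hpos : 0 ≤ y → 0 ≤ ∑ i ∈ range (k + 1), (∑ l ∈ range (k - i + 1), x ^ l) *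
      (y ^ i * ∑ l ∈ range (i + 1), x ^ l) := fun hy0 =>
    sum_nonneg fun i _ => mul_nonneg (hz _) (mul_nonneg (pow_nonneg hy0 _) (hz _))
  rcases hy with rfl | rfl | rfl
  · exact hpos le_rfl
  · exact hpos zero_le_one
  · rcases hx with rfl | rfl | rfl
    · have : ∀ i : ℕ, ∑ l ∈ range (i + 1), (0 : ℂ) ^ l = 1 := fun i => by
        rw [sum_range_succ']; simp
      simp only [this, one_mul, mul_one]
      rw [neg_one_geom_sum]; split_ifs <;> simp
    · have := alternating_sum_nonneg k
      have e : ∑ i ∈ range (k + 1), (∑ l ∈ range (k - i + 1), (1 : ℂ) ^ l) *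
          ((-1) ^ i * ∑ l ∈ range (i + 1), (1 : ℂ) ^ l) =
          ((∑ i ∈ range (k + 1), (-1 : ℝ) ^ i * (i + 1) * (k - i + 1) : ℝ) : ℂ) := by
        push_cast
        refine sum_congr rfl fun i hi => ?_
        have : i ≤ k := by simp at hi; omega
        simp [this]
        ring
      rw [e]
      exact_mod_cast this
    · refine sum_nonneg fun i _ => mul_nonneg (hz _) ?_
      rw [neg_one_geom_sum]
      split_ifs with h
      · simp
      · rw [Nat.even_add_one, not_not] at h
        simp [h.neg_one_pow]

section
open scoped ComplexOrder
open ArithmeticFunction LSeries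

/-- The coefficients of `ζ(s) L(s, χ₁) L(s, χ₂) L(s, χ₃)`. -/
def quadCoeff {a b c : ℕ} (χ₁ : DirichletCharacter ℂ a) (χ₂ : DirichletCharacter ℂ b)
    (χ₃ : DirichletCharacter ℂ c) : ArithmeticFunction ℂ :=
  ((ArithmeticFunction.zeta : ArithmeticFunction ℕ) * toArithmeticFunction (χ₁ ·)) * (toArithmeticFunction (χ₂ ·) * toArithmeticFunction (χ₃ ·))

variable {a b c : ℕ} {χ₁ : DirichletCharacter ℂ a} {χ₂ : DirichletCharacter ℂ b}
  {χ₃ : DirichletCharacter ℂ c}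

lemma isMultiplicative_quadCoeff : (quadCoeff χ₁ χ₂ χ₃).IsMultiplicative :=
  (isMultiplicative_zeta.natCast.mul
    (DirichletCharacter.isMultiplicative_toArithmeticFunction χ₁)).mul
  ((DirichletCharacter.isMultiplicative_toArithmeticFunction χ₂).mul
    (DirichletCharacter.isMultiplicative_toArithmeticFunction χ₃))

lemma mul_apply_prime_pow (f g : ArithmeticFunction ℂ) {p : ℕ} (hp : p.Prime) (k : ℕ) :
    (f * g) (p ^ k) = ∑ i ∈ range (k + 1), f (p ^ (k - i)) * g (p ^ i) := by
  rw [ArithmeticFunction.mul_apply, Nat.sum_divisorsAntidiagonal' fun x y => f x * g y,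
    Nat.sum_divisors_prime_pow hp]
  refine sum_congr rfl fun i hi => ?_
  rw [Nat.pow_div (by simp at hi; omega) hp.pos]

lemma quadCoeff_nonneg (h1 : χ₁ ^ 2 = 1) (h2 : χ₂ ^ 2 = 1)
    (h3 : ∀ n : ℕ, χ₃ n = χ₁ n * χ₂ n) (n : ℕ) : 0 ≤ quadCoeff χ₁ χ₂ χ₃ n := by
  rcases eq_or_ne n 0 with rfl | hn
  · simp
  rw [isMultiplicative_quadCoeff.multiplicative_factorization _ hn]
  refine prod_nonneg fun p hp => ?_
  have hp := Nat.prime_of_mem_primeFactors hp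
  generalize n.factorization p = k
  have key := quadratic_convolution_nonneg (MulChar.isQuadratic_iff_sq_eq_one.mpr h1 p)
    (MulChar.isQuadratic_iff_sq_eq_one.mpr h2 p) k
  have hA : ∀ {d : ℕ} (χ : DirichletCharacter ℂ d) (i : ℕ),
      toArithmeticFunction (χ ·) (p ^ i) = χ p ^ i := by
    intro d χ i
    simp [toArithmeticFunction, hp.ne_zero]
  change 0 ≤ quadCoeff χ₁ χ₂ χ₃ (p ^ k)
  rw [quadCoeff, mul_apply_prime_pow _ _ hp]
  convert key using 4 with i hi j
  · rw [mul_apply_prime_pow _ _ hp]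
    refine sum_congr rfl fun l _ => ?_
    rw [hA, ArithmeticFunction.natCoe_apply, zeta_apply_ne (pow_ne_zero _ hp.ne_zero)]
    simp
  · rw [mul_apply_prime_pow _ _ hp, mul_sum]
    refine sum_congr rfl fun l hl => ?_
    have hl' : l ≤ i := by simp at hl; omega
    rw [hA, hA, h3, mul_pow, mul_comm (χ₁ p ^ l), ← mul_assoc, ← pow_add, Nat.sub_add_cancel hl']

lemma quadCoeff_one : quadCoeff χ₁ χ₂ χ₃ 1 = 1 := isMultiplicative_quadCoeff.1

lemma LSeriesSummable_toArithmeticFunction {d : ℕ} (χ : DirichletCharacter ℂ d) {s : ℂ}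
    (hs : 1 < s.re) : LSeriesSummable (toArithmeticFunction (χ ·)) s :=
  LSeriesSummable_of_bounded_of_one_lt_re (m := 1) (fun n hn => by
    simpa only [toArithmeticFunction, coe_mk, hn, ↓reduceIte] using χ.norm_le_one _) hs

lemma LSeries_toArithmeticFunction {d : ℕ} [NeZero d] (χ : DirichletCharacter ℂ d) {s : ℂ}
    (hs : 1 < s.re) : LSeries (toArithmeticFunction (χ ·)) s = χ.LFunction s := by
  rw [DirichletCharacter.LFunction_eq_LSeries χ hs]
  refine LSeries_congr (fun {n} hn => ?_) s
  simp [toArithmeticFunction, hn]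

lemma LSeries_quadCoeff_aux {f g h k : ArithmeticFunction ℂ} {s : ℂ} (hf : LSeriesSummable f s)
    (hg : LSeriesSummable g s) (hh : LSeriesSummable h s) (hk : LSeriesSummable k s) :
    LSeriesSummable ((f * g) * (h * k) : ArithmeticFunction ℂ) s ∧
    LSeries ((f * g) * (h * k) : ArithmeticFunction ℂ) s =
      LSeries f s * LSeries g s * (LSeries h s * LSeries k s) :=
  ⟨LSeriesSummable_mul (LSeriesSummable_mul hf hg) (LSeriesSummable_mul hh hk), by
    rw [LSeries_mul' (LSeriesSummable_mul hf hg) (LSeriesSummable_mul hh hk),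
      LSeries_mul' hf hg, LSeries_mul' hh hk]⟩

lemma LSeries_quadCoeff [NeZero a] [NeZero b] [NeZero c] {s : ℂ} (hs : 1 < s.re) :
    LSeriesSummable (quadCoeff χ₁ χ₂ χ₃) s ∧ LSeries (quadCoeff χ₁ χ₂ χ₃) s =
      riemannZeta s * χ₁.LFunction s * (χ₂.LFunction s * χ₃.LFunction s) := by
  have h0 : LSeriesSummable ((ArithmeticFunction.zeta : ArithmeticFunction ℕ) :
    ArithmeticFunction ℂ) s := LSeriesSummable_zeta_iff.mpr hs
  have h0' : LSeries ((ArithmeticFunction.zeta : ArithmeticFunction ℕ) :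
    ArithmeticFunction ℂ) s = riemannZeta s := LSeries_zeta_eq_riemannZeta hs
  have := LSeries_quadCoeff_aux h0 (LSeriesSummable_toArithmeticFunction χ₁ hs)
    (LSeriesSummable_toArithmeticFunction χ₂ hs) (LSeriesSummable_toArithmeticFunction χ₃ hs)
  rwa [LSeries_toArithmeticFunction _ hs, LSeries_toArithmeticFunction _ hs,
    LSeries_toArithmeticFunction _ hs, h0'] at this
end

section
open scoped ComplexOrder
open ArithmeticFunction LSeries Filter Topology

/-- The entire function `(s - 1) ζ(s)`. -/
def zetaPoleRemoved : ℂ → ℂ := Function.update (fun s => (s - 1) * riemannZeta s) 1 1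

lemma zetaPoleRemoved_one : zetaPoleRemoved 1 = 1 := Function.update_self ..

lemma zetaPoleRemoved_of_ne {s : ℂ} (hs : s ≠ 1) : zetaPoleRemoved s = (s - 1) * riemannZeta s :=
  Function.update_of_ne hs ..

lemma differentiable_zetaPoleRemoved : Differentiable ℂ zetaPoleRemoved := by
  rw [← differentiableOn_univ,
    ← Complex.differentiableOn_compl_singleton_and_continuousAt_iff (c := 1) Filter.univ_mem]
  refine ⟨DifferentiableOn.congr (f := fun s ↦ (s - 1) * riemannZeta s)
    (fun s hs ↦ ?_) fun s hs ↦ zetaPoleRemoved_of_ne (Set.mem_sdiff_singleton.mp hs).2, ?_⟩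
  · have := differentiableAt_riemannZeta (Set.mem_sdiff_singleton.mp hs).2
    exact DifferentiableAt.differentiableWithinAt (by fun_prop)
  · rw [← continuousWithinAt_compl_self, ContinuousWithinAt, zetaPoleRemoved_one]
    refine riemannZeta_residue_one.congr' ?_
    filter_upwards [self_mem_nhdsWithin] with s hs
    exact (zetaPoleRemoved_of_ne hs).symm

lemma iteratedDeriv_sub_one_inv (m : ℕ) :
    iteratedDeriv m (fun s : ℂ => (s - 1)⁻¹) 2 = (-1) ^ m * m.factorial := by
  rw [show (fun s : ℂ => (s - 1)⁻¹) = fun s => Inv.inv (s - 1) from rfl,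
    iteratedDeriv_comp_sub_const, iteratedDeriv_eq_iterate]
  change deriv^[m] Inv.inv ((2 : ℂ) - 1) = _
  rw [iter_deriv_inv]
  norm_num

lemma exists_le_quadratic_product : ∃ C : ℝ, 1 ≤ C ∧ ∀ (a b c : ℕ) [NeZero a] [NeZero b] [NeZero c]
    (χ₁ : DirichletCharacter ℂ a) (χ₂ : DirichletCharacter ℂ b) (χ₃ : DirichletCharacter ℂ c),
    χ₁ ≠ 1 → χ₂ ≠ 1 → χ₃ ≠ 1 → χ₁ ^ 2 = 1 → χ₂ ^ 2 = 1 → (∀ n : ℕ, χ₃ n = χ₁ n * χ₂ n) →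
    ∀ (x : ℝ) (K : ℕ), 7 / 8 ≤ x → x < 1 → 0 < K →
    1 - 4 * (C * (a * b * c)) * (3 / 4) ^ K -
      ‖χ₁.LFunction 1 * (χ₂.LFunction 1 * χ₃.LFunction 1)‖ * (2 - x) ^ K / (1 - x) ≤
      (riemannZeta x * χ₁.LFunction x * (χ₂.LFunction x * χ₃.LFunction x)).re := by
  obtain ⟨Z, hZ1, hZ⟩ := exists_norm_LFunction_le
  obtain ⟨Y, hY⟩ := (isCompact_closedBall (2 : ℂ) (3 / 2)).exists_bound_of_continuousOn
    differentiable_zetaPoleRemoved.continuous.continuousOn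
  have hY1 : 1 ≤ Y := by
    have := hY 1 (by simp [dist_eq_norm]; norm_num)
    rwa [zetaPoleRemoved_one, norm_one] at this
  refine ⟨2 * (Y * (Z * (7 / 2)) ^ 3 + Z ^ 3), ?_, ?_⟩
  · have := one_le_pow₀ hZ1 (n := 3)
    have : 0 ≤ Y * (Z * (7 / 2)) ^ 3 := by positivity
    linarith
  intro a b c _ _ _ χ₁ χ₂ χ₃ hχ₁ hχ₂ hχ₃ h1 h2 h3 x K hx hx1 hK
  set F : ℂ → ℂ := fun s => χ₁.LFunction s * (χ₂.LFunction s * χ₃.LFunction s) with hF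
  have hFd : Differentiable ℂ F :=
    (DirichletCharacter.differentiable_LFunction hχ₁).mul
      ((DirichletCharacter.differentiable_LFunction hχ₂).mul
        (DirichletCharacter.differentiable_LFunction hχ₃))
  set P : ℂ → ℂ := fun s => zetaPoleRemoved s * F s with hP
  have hPd : Differentiable ℂ P := differentiable_zetaPoleRemoved.mul hFd
  have hP1 : P 1 = F 1 := by simp only [hP, zetaPoleRemoved_one, one_mul]
  have hF1 : ‖F 1‖ ≤ Z ^ 3 * (a * b * c) := by
    have e1 := hZ a χ₁ hχ₁ 1 (by norm_num)
    have e2 := hZ b χ₂ hχ₂ 1 (by norm_num)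
    have e3 := hZ c χ₃ hχ₃ 1 (by norm_num)
    simp only [norm_one, mul_one] at e1 e2 e3
    calc ‖F 1‖ = ‖χ₁.LFunction 1‖ * (‖χ₂.LFunction 1‖ * ‖χ₃.LFunction 1‖) := by
          simp only [hF, norm_mul]
      _ ≤ (Z * a) * ((Z * b) * (Z * c)) := by gcongr
      _ = _ := by ring
  have hH : Differentiable ℂ (dslope P 1) := by
    have := (Complex.differentiableOn_dslope (c := 1) Filter.univ_mem).mpr hPd.differentiableOn
    rwa [differentiableOn_univ] at this
  have hHne : ∀ s, s ≠ 1 → dslope P 1 s = riemannZeta s * F s - F 1 * (s - 1)⁻¹ := by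
    intro s hs
    have hs' : s - 1 ≠ 0 := sub_ne_zero.mpr hs
    rw [dslope_of_ne _ hs, slope_def_field, hP1]
    simp only [hP]
    rw [zetaPoleRemoved_of_ne hs]
    field_simp
  have hser : ∀ s : ℂ, 1 < s.re → LSeries (quadCoeff χ₁ χ₂ χ₃) s = riemannZeta s * F s := by
    intro s hs
    rw [(LSeries_quadCoeff hs).2, hF, mul_assoc]
  have habs : LSeries.abscissaOfAbsConv (quadCoeff χ₁ χ₂ χ₃) < ((2 : ℝ) : EReal) := by
    refine lt_of_le_of_lt (LSeries.abscissaOfAbsConv_le_of_forall_lt_LSeriesSummable' (x := 1)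
      fun y hy => ?_) (by exact_mod_cast (one_lt_two : (1 : ℝ) < 2))
    exact (LSeries_quadCoeff (by
      rw [Complex.ofReal_re]; exact_mod_cast hy)).1
  have hnonneg : ∀ m, 0 ≤ (-1 : ℂ) ^ m * iteratedDeriv m (LSeries (quadCoeff χ₁ χ₂ χ₃)) 2 := by
    intro m
    have := ArithmeticFunction.iteratedDeriv_LSeries_alternating (quadCoeff χ₁ χ₂ χ₃)
      (quadCoeff_nonneg h1 h2 h3) habs m
    simpa using this
  set b' : ℕ → ℝ := fun m =>
    ((-1 : ℂ) ^ m * iteratedDeriv m (LSeries (quadCoeff χ₁ χ₂ χ₃)) 2).re / m.factorial with hb'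
  have hder : ∀ m, iteratedDeriv m (LSeries (quadCoeff χ₁ χ₂ χ₃)) 2 =
      (-1) ^ m * m.factorial * (b' m : ℂ) := by
    intro m
    have e := Complex.eq_re_of_ofReal_le (hnonneg m : ((0 : ℝ) : ℂ) ≤ _)
    have hm : (m.factorial : ℂ) ≠ 0 := by exact_mod_cast m.factorial_ne_zero
    simp only [hb']
    push_cast
    rw [← e]
    field_simp
    rw [← pow_mul, mul_comm m 2, pow_mul]; simp
  have hb : ∀ m, 0 ≤ b' m := fun m => div_nonneg (Complex.le_def.mp (hnonneg m)).1 (by positivity)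
  have hb0 : 1 ≤ b' 0 := by
    have hs := (LSeries_quadCoeff (χ₁ := χ₁) (χ₂ := χ₂) (χ₃ := χ₃)
      (show 1 < (2 : ℂ).re by norm_num)).1
    simp only [hb', pow_zero, one_mul, iteratedDeriv_zero, Nat.factorial_zero, Nat.cast_one,
      div_one]
    have hs' : Summable (fun n => (LSeries.term (quadCoeff χ₁ χ₂ χ₃) 2 n).re) :=
      Complex.reCLM.summable hs
    have hterm : ∀ n, 0 ≤ (LSeries.term (quadCoeff χ₁ χ₂ χ₃) 2 n).re := fun n =>
      (Complex.le_def.mp (by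
        have := LSeries.term_nonneg (a := quadCoeff χ₁ χ₂ χ₃) (n := n)
          (quadCoeff_nonneg h1 h2 h3 n) 2
        simpa using this)).1
    calc (1 : ℝ) = (LSeries.term (quadCoeff χ₁ χ₂ χ₃) 2 1).re := by
          simp [LSeries.term, quadCoeff_one]
      _ ≤ ∑' n, (LSeries.term (quadCoeff χ₁ χ₂ χ₃) 2 n).re :=
          hs'.le_tsum 1 fun n _ => hterm n
      _ = _ := by rw [LSeries, Complex.re_tsum hs]
  have hM : ∀ s, ‖s - 2‖ = 3 / 2 → ‖dslope P 1 s‖ ≤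
      2 * (Y * (Z * (7 / 2)) ^ 3 + Z ^ 3) * (a * b * c) := by
    intro s hs
    have hs1 : 1 / 2 ≤ ‖s - 1‖ := by
      have := norm_sub_norm_le (s - 2) (-1)
      rw [hs] at this
      have e : s - 2 - -1 = s - 1 := by ring
      rw [e] at this; simp at this; linarith
    have hne : s ≠ 1 := by rintro rfl; norm_num at hs1
    have hre : 1 / 2 ≤ s.re := by
      have := (abs_le.mp ((Complex.abs_re_le_norm (s - 2)).trans hs.le)).1
      simp at this; linarith
    have hsn : ‖s‖ ≤ 7 / 2 := by
      have := norm_add_le (s - 2) 2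
      rw [hs] at this; simp at this; linarith
    have e1 := hZ a χ₁ hχ₁ s hre
    have e2 := hZ b χ₂ hχ₂ s hre
    have e3 := hZ c χ₃ hχ₃ s hre
    have hPs : ‖P s‖ ≤ Y * (Z * (7 / 2)) ^ 3 * (a * b * c) := by
      calc ‖P s‖ = ‖zetaPoleRemoved s‖ *
            (‖χ₁.LFunction s‖ * (‖χ₂.LFunction s‖ * ‖χ₃.LFunction s‖)) := by
            simp only [hP, hF, norm_mul]
        _ ≤ Y * ((Z * a * (7 / 2)) * ((Z * b * (7 / 2)) * (Z * c * (7 / 2)))) := by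
            gcongr
            · exact hY s (by simp [dist_eq_norm, hs])
            · exact e1.trans (by gcongr)
            · exact e2.trans (by gcongr)
            · exact e3.trans (by gcongr)
        _ = _ := by ring
    rw [dslope_of_ne _ hne, slope_def_field, norm_div, hP1, div_le_iff₀ (by linarith)]
    calc ‖P s - F 1‖ ≤ ‖P s‖ + ‖F 1‖ := norm_sub_le _ _
      _ ≤ (Y * (Z * (7 / 2)) ^ 3 + Z ^ 3) * (a * b * c) := by linarith
      _ = 2 * (Y * (Z * (7 / 2)) ^ 3 + Z ^ 3) * (a * b * c) * (1 / 2) := by ring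
      _ ≤ _ := by gcongr
  have hHb : ∀ m, iteratedDeriv m (dslope P 1) 2 = (-1) ^ m * m.factorial * (b' m - F 1) := by
    intro m
    have hev : dslope P 1 =ᶠ[𝓝 2] (LSeries (quadCoeff χ₁ χ₂ χ₃) - fun s => F 1 * (s - 1)⁻¹) := by
      have ho : {s : ℂ | 1 < s.re} ∈ 𝓝 (2 : ℂ) :=
        (isOpen_lt continuous_const Complex.continuous_re).mem_nhds (by norm_num)
      filter_upwards [ho] with s hs
      have hs1 : s ≠ 1 := by rintro rfl; simp at hs
      rw [Pi.sub_apply, hser s hs, hHne s hs1]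
    have hc : ContDiffAt ℂ m (fun s : ℂ => (s - 1)⁻¹) 2 := by
      refine ContDiffAt.inv (by fun_prop) (by norm_num)
    have hL : ContDiffAt ℂ m (LSeries (quadCoeff χ₁ χ₂ χ₃)) 2 := by
      refine AnalyticAt.contDiffAt (LSeries_analyticOnNhd _ 2 ?_)
      simpa using habs
    rw [hev.iteratedDeriv_eq, iteratedDeriv_sub hL (contDiffAt_const.mul hc),
      iteratedDeriv_const_mul _ hc, iteratedDeriv_sub_one_inv, hder]
    ring
  have key := estermann_lower_bound hH hb hb0 hM hHb hx hx1 hK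
  have hx0 : ((x : ℂ)) ≠ 1 := by
    intro h; have : x = 1 := by exact_mod_cast h
    linarith
  have hx2 : (x : ℂ) - 1 ≠ 0 := sub_ne_zero.mpr hx0
  rw [hHne _ hx0, div_eq_mul_inv (F 1), sub_add_cancel] at key
  simpa only [hF, mul_assoc] using key
end

section
open Filter Topology DirichletCharacter

lemma exists_norm_LFunction_le_rpow {ε : ℝ} (hε : 0 < ε) : ∃ C : ℝ, 1 ≤ C ∧
    ∀ (q : ℕ) [NeZero q] (χ : DirichletCharacter ℂ q), χ ≠ 1 → ∀ s : ℂ, 1 < s.re →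
      ‖χ.LFunction s‖ ≤ C * (q * ‖s‖) ^ ε := by
  obtain ⟨C, hC1, hC⟩ := exists_norm_LSeries_log_pow_le 0 hε
  refine ⟨C, hC1, fun q _ χ hχ s hs => ?_⟩
  have hq : (1 : ℝ) ≤ q := by exact_mod_cast NeZero.one_le
  have := hC (fun n => χ n) q s (fun n => χ.norm_le_one _) hq (norm_sum_range_char_le hχ) hs
  rw [LFunction_eq_LSeries χ hs]
  simpa using this

lemma exists_norm_LFunction_one_le_rpow {ε : ℝ} (hε : 0 < ε) : ∃ C : ℝ, 1 ≤ C ∧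
    ∀ (q : ℕ) [NeZero q] (χ : DirichletCharacter ℂ q), χ ≠ 1 →
      ‖χ.LFunction 1‖ ≤ C * (q : ℝ) ^ ε := by
  obtain ⟨C, hC1, hC⟩ := exists_norm_LFunction_le_rpow hε
  refine ⟨C, hC1, fun q _ χ hχ => ?_⟩
  have hL : Tendsto (fun x : ℝ => ‖χ.LFunction (x : ℂ)‖) (𝓝[>] 1) (𝓝 ‖χ.LFunction 1‖) := by
    have h1 : Continuous fun x : ℝ => ‖χ.LFunction (x : ℂ)‖ :=
      ((differentiable_LFunction hχ).continuous.comp Complex.continuous_ofReal).norm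
    have := (h1.tendsto 1).mono_left (nhdsWithin_le_nhds (s := Set.Ioi 1))
    simpa using this
  have hR : Tendsto (fun x : ℝ => C * (q * ‖(x : ℂ)‖) ^ ε) (𝓝[>] 1) (𝓝 (C * (q : ℝ) ^ ε)) := by
    have h1 : Continuous fun x : ℝ => C * (q * ‖(x : ℂ)‖) ^ ε := by
      refine continuous_const.mul (Continuous.rpow_const ?_ fun _ => Or.inr hε.le)
      exact continuous_const.mul Complex.continuous_ofReal.norm
    have := (h1.tendsto 1).mono_left (nhdsWithin_le_nhds (s := Set.Ioi 1))
    simpa using this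
  refine le_of_tendsto_of_tendsto hL hR ?_
  filter_upwards [self_mem_nhdsWithin] with x hx
  exact hC q χ hχ x (by simpa using hx)

lemma LFunction_re_pos_of_ne_zero {q : ℕ} [NeZero q] {χ : DirichletCharacter ℂ q} (hχ : χ ≠ 1)
    (hχ2 : χ ^ 2 = 1) {β : ℝ} (hβ : 0 < β) (hβ2 : β ≤ 2)
    (h : ∀ x : ℝ, β ≤ x → x < 1 → χ.LFunction x ≠ 0) :
    0 < (χ.LFunction β).re := by
  by_contra! hneg
  have hc : Continuous fun x : ℝ => (χ.LFunction (x : ℂ)).re :=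
    Complex.continuous_re.comp
      ((differentiable_LFunction hχ).continuous.comp Complex.continuous_ofReal)
  obtain ⟨x, hx, hx0⟩ := intermediate_value_Icc hβ2 hc.continuousOn
    ⟨hneg, (LFunction_two_re_pos χ).le⟩
  have hx0' : χ.LFunction x = 0 :=
    Complex.ext hx0 (LFunction_im_eq_zero hχ hχ2 (hβ.trans_le hx.1))
  rcases lt_or_ge x 1 with h1 | h1
  · exact h x hx.1 h1 hx0'
  · exact LFunction_ne_zero_of_one_le_re χ (Or.inl hχ) (by simpa using h1) hx0'

/-- There is a fixed real character and a point `β` close to `1` at which the product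
`ζ(β) L(β, ψ₁) L(β, ψ₂) L(β, ψ₁ψ₂)` is never positive. -/
lemma exists_nonpos_point {δ : ℝ} (hδ : 0 < δ) (hδ1 : δ ≤ 1 / 8)
    (hex : ∃ (q : ℕ) (_ : NeZero q) (χ : DirichletCharacter ℂ q), χ ≠ 1 ∧ χ ^ 2 = 1) :
    ∃ (a : ℕ) (_ : NeZero a) (χ₁ : DirichletCharacter ℂ a) (β : ℝ), χ₁ ≠ 1 ∧ χ₁ ^ 2 = 1 ∧
      1 - δ ≤ β ∧ β < 1 ∧ ∀ (b c : ℕ) [NeZero b] [NeZero c] (χ₂ : DirichletCharacter ℂ b)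
      (χ₃ : DirichletCharacter ℂ c), χ₂ ≠ 1 → χ₂ ^ 2 = 1 → χ₃ ≠ 1 → χ₃ ^ 2 = 1 →
      (riemannZeta β * χ₁.LFunction β * (χ₂.LFunction β * χ₃.LFunction β)).re ≤ 0 := by
  by_cases hz : ∃ (q : ℕ) (_ : NeZero q) (χ : DirichletCharacter ℂ q) (β : ℝ),
      χ ≠ 1 ∧ χ ^ 2 = 1 ∧ 1 - δ ≤ β ∧ β < 1 ∧ χ.LFunction β = 0
  · obtain ⟨q, hq, χ, β, h1, h2, h3, h4, h5⟩ := hz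
    refine ⟨q, hq, χ, β, h1, h2, h3, h4, ?_⟩
    intros
    rw [h5]; simp
  · push Not at hz
    obtain ⟨q, hq, χ, h1, h2⟩ := hex
    have hcz : ContinuousAt (fun x : ℝ => (zetaPoleRemoved x).re) 1 :=
      (Complex.continuous_re.comp
        (differentiable_zetaPoleRemoved.continuous.comp Complex.continuous_ofReal)).continuousAt
    have hev : ∀ᶠ x : ℝ in 𝓝 1, 0 < (zetaPoleRemoved x).re := by
      refine hcz.eventually (lt_mem_nhds ?_)
      simp [zetaPoleRemoved_one]
    have hev2 : ∀ᶠ x : ℝ in 𝓝[<] 1, 0 < (zetaPoleRemoved x).re := hev.filter_mono nhdsWithin_le_nhds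
    have hev3 : ∀ᶠ x : ℝ in 𝓝[<] 1, 1 - δ ≤ x := by
      have h0 : 1 - δ < 1 := by linarith
      filter_upwards [Ioo_mem_nhdsLT h0] with x hx using hx.1.le
    obtain ⟨β, hβ1, hβ2, hβ3⟩ := (hev2.and (hev3.and self_mem_nhdsWithin)).exists
    have hβ3 : β < 1 := hβ3
    have hβ0 : 0 < β := by linarith
    refine ⟨q, hq, χ, β, h1, h2, hβ2, hβ3, ?_⟩
    intro b c _ _ χ₂ χ₃ h3 h4 h5 h6
    have hpos : ∀ (d : ℕ) [NeZero d] (ψ : DirichletCharacter ℂ d), ψ ≠ 1 → ψ ^ 2 = 1 →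
        ∃ y : ℝ, 0 < y ∧ ψ.LFunction β = y := by
      intro d hd ψ hψ hψ2
      refine ⟨(ψ.LFunction β).re, LFunction_re_pos_of_ne_zero hψ hψ2 hβ0 (by linarith)
        fun x hx hx1 => hz d hd ψ x hψ hψ2 (hβ2.trans hx) hx1, ?_⟩
      exact Complex.ext rfl (by simpa using LFunction_im_eq_zero hψ hψ2 hβ0)
    obtain ⟨y1, hy1, e1⟩ := hpos q χ h1 h2
    obtain ⟨y2, hy2, e2⟩ := hpos b χ₂ h3 h4
    obtain ⟨y3, hy3, e3⟩ := hpos c χ₃ h5 h6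
    have hne : (β : ℂ) ≠ 1 := by
      intro h; have : β = 1 := by exact_mod_cast h
      linarith
    rw [zetaPoleRemoved_of_ne hne] at hβ1
    have e4 : (((β : ℂ) - 1) * riemannZeta β).re = (β - 1) * (riemannZeta β).re := by
      rw [← Complex.re_ofReal_mul]; push_cast; rfl
    rw [e4] at hβ1
    have hzn : (riemannZeta β).re ≤ 0 := by
      by_contra! h
      nlinarith
    rw [e1, e2, e3]
    have e5 : riemannZeta β * (y1 : ℂ) * ((y2 : ℂ) * y3) =
        ((y1 * (y2 * y3) : ℝ) : ℂ) * riemannZeta β := by push_cast; ring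
    rw [e5, Complex.re_ofReal_mul]
    exact mul_nonpos_of_nonneg_of_nonpos (by positivity) hzn

lemma changeLevel_mul_ne_one {a b : ℕ} [NeZero a] [NeZero b] {χ₁ : DirichletCharacter ℂ a}
    {χ₂ : DirichletCharacter ℂ b} (h1 : χ₁ ^ 2 = 1) (h2 : χ₂.IsPrimitive) (hab : a < b) :
    changeLevel (Nat.dvd_mul_right a b) χ₁ * changeLevel (Nat.dvd_mul_left b a) χ₂ ≠ 1 := by
  intro h
  have hsq : (changeLevel (Nat.dvd_mul_right a b) χ₁) ^ 2 = 1 := by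
    rw [← map_pow, h1, map_one]
  have : changeLevel (Nat.dvd_mul_left b a) χ₂ = changeLevel (Nat.dvd_mul_right a b) χ₁ := by
    calc _ = (changeLevel (Nat.dvd_mul_right a b) χ₁) ^ 2 *
          changeLevel (Nat.dvd_mul_left b a) χ₂ := by rw [hsq, one_mul]
      _ = _ := by rw [sq, mul_assoc, h, mul_one]
  have hc := congrArg conductor this
  rw [conductor_changeLevel, conductor_changeLevel] at hc
  have h3 : conductor χ₁ ≤ a := Nat.le_of_dvd (NeZero.pos a) (conductor_dvd_level χ₁)
  have h4 : conductor χ₂ = b := h2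
  omega

lemma changeLevel_natCast {d m : ℕ} (hm : d ∣ m) (χ : DirichletCharacter ℂ d) {n : ℕ}
    (hn : n.Coprime m) : changeLevel hm χ n = χ n := by
  simpa using changeLevel_eq_cast_of_dvd' χ hm (Nat.isCoprime_iff_coprime.mpr hn)

lemma changeLevel_mul_apply {a b : ℕ} (χ₁ : DirichletCharacter ℂ a)
    (χ₂ : DirichletCharacter ℂ b) (n : ℕ) :
    (changeLevel (Nat.dvd_mul_right a b) χ₁ * changeLevel (Nat.dvd_mul_left b a) χ₂) n =
      χ₁ n * χ₂ n := by
  rw [MulChar.mul_apply]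
  by_cases hn : n.Coprime (a * b)
  · rw [changeLevel_natCast _ _ hn, changeLevel_natCast _ _ hn]
  · rw [MulChar.map_nonunit _ (by rwa [ZMod.isUnit_iff_coprime]), zero_mul]
    rw [ Nat.coprime_mul_iff_right, not_and_or] at hn
    rcases hn with hn | hn
    · rw [MulChar.map_nonunit χ₁ (by rwa [ZMod.isUnit_iff_coprime]), zero_mul]
    · rw [MulChar.map_nonunit χ₂ (by rwa [ZMod.isUnit_iff_coprime]), mul_zero]
end

section
open DirichletCharacter

lemma exists_norm_LFunction_one_ge_of_le (a : ℕ) : ∃ c : ℝ, 0 < c ∧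
    ∀ (b : ℕ) [NeZero b] (χ : DirichletCharacter ℂ b), b ≤ a → χ ≠ 1 → c ≤ ‖χ.LFunction 1‖ := by
  have h : ∀ b : ℕ, ∃ M : ℝ, 0 ≤ M ∧ ∀ (_ : NeZero b) (χ : DirichletCharacter ℂ b),
      ‖χ.LFunction 1‖⁻¹ ≤ M := by
    intro b
    rcases eq_or_ne b 0 with rfl | hb
    · exact ⟨0, le_rfl, fun h => absurd rfl h.out⟩
    · have : NeZero b := ⟨hb⟩
      obtain ⟨M, hM⟩ := (Set.finite_range
        fun χ : DirichletCharacter ℂ b => ‖χ.LFunction 1‖⁻¹).bddAbove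
      refine ⟨max M 0, le_max_right _ _, fun _ χ => (hM ⟨χ, rfl⟩).trans (le_max_left _ _)⟩
  choose M hM0 hM using h
  have hS : 0 < 1 + ∑ b ∈ range (a + 1), M b :=
    add_pos_of_pos_of_nonneg one_pos (sum_nonneg fun b _ => hM0 b)
  refine ⟨(1 + ∑ b ∈ range (a + 1), M b)⁻¹, by positivity, fun b hb χ hba hχ => ?_⟩
  have hpos : 0 < ‖χ.LFunction 1‖ := norm_pos_iff.mpr (LFunction_apply_one_ne_zero hχ)
  rw [inv_le_comm₀ hS hpos]
  have := single_le_sum (f := M) (fun b _ => hM0 b) (mem_range.mpr (Nat.lt_succ_of_le hba))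
  linarith [hM b hb χ]

lemma exp_ceil_bounds {X : ℝ} (hX : 2 ≤ X) : ∃ K : ℕ, 0 < K ∧ X * (3 / 4 : ℝ) ^ K ≤ 1 ∧
    (K : ℝ) ≤ 4 * Real.log X + 1 := by
  have hX0 : 0 < X := by linarith
  have hlog : 0 < Real.log X := Real.log_pos (by linarith)
  refine ⟨⌈4 * Real.log X⌉₊, Nat.ceil_pos.mpr (by positivity), ?_,
    (Nat.ceil_lt_add_one (by positivity)).le⟩
  have h1 : (3 / 4 : ℝ) ≤ Real.exp (-(1 / 4)) := by
    have := Real.add_one_le_exp (-(1 / 4) : ℝ)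
    linarith
  calc X * (3 / 4 : ℝ) ^ ⌈4 * Real.log X⌉₊ ≤ X * Real.exp (-(1 / 4)) ^ ⌈4 * Real.log X⌉₊ := by gcongr
    _ = Real.exp (Real.log X + ⌈4 * Real.log X⌉₊ * (-(1 / 4))) := by
        rw [Real.exp_add, Real.exp_log hX0, ← Real.exp_nat_mul]
    _ ≤ Real.exp 0 := by
        gcongr
        have := Nat.le_ceil (4 * Real.log X)
        linarith
    _ = 1 := Real.exp_zero

/-- **Siegel's theorem**. -/
theorem siegel {ε : ℝ} (hε : 0 < ε) : ∃ c : ℝ, 0 < c ∧ ∀ (r : ℕ) [NeZero r]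
    (ψ : DirichletCharacter ℂ r), ψ.IsPrimitive → ψ ≠ 1 → ψ ^ 2 = 1 →
      c * (r : ℝ) ^ (-ε) ≤ ‖ψ.LFunction 1‖ := by
  by_cases hex : ∃ (q : ℕ) (_ : NeZero q) (χ : DirichletCharacter ℂ q), χ ≠ 1 ∧ χ ^ 2 = 1
  swap
  · exact ⟨1, one_pos, fun r hr ψ _ h1 h2 => absurd ⟨r, hr, ψ, h1, h2⟩ hex⟩
  set δ : ℝ := min ε 1 / 9 with hδ
  have hδ0 : 0 < δ := by positivity
  have hδ1 : δ ≤ 1 / 8 := by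
    have := min_le_right ε 1
    linarith
  have hδε : 9 * δ ≤ ε := by
    have := min_le_left ε 1
    linarith
  obtain ⟨a, ha, χ₁, β, h1, h2, hβ1, hβ2, hneg⟩ := exists_nonpos_point hδ0 hδ1 hex
  obtain ⟨C0, hC01, hC0⟩ := exists_le_quadratic_product
  obtain ⟨C1, hC11, hC1⟩ := exists_norm_LFunction_one_le_rpow hδ0
  obtain ⟨c2, hc2, hc2'⟩ := exists_norm_LFunction_one_ge_of_le a
  have hL1 : 0 < ‖χ₁.LFunction 1‖ := norm_pos_iff.mpr (LFunction_apply_one_ne_zero h1)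
  have ha1 : (1 : ℝ) ≤ a := by exact_mod_cast NeZero.one_le
  set W : ℝ := 6 * C1 * ‖χ₁.LFunction 1‖ * ((a : ℝ) ^ δ * (8 * C0 * a ^ 2) ^ (4 * δ)) with hW
  have hW0 : 0 < W := by positivity
  refine ⟨min c2 ((1 - β) / W), lt_min hc2 (div_pos (by linarith) hW0), ?_⟩
  intro b hb χ₂ hprim h3 h4
  have hb1 : (1 : ℝ) ≤ b := by exact_mod_cast NeZero.one_le
  rcases le_or_gt b a with hba | hab
  · calc min c2 ((1 - β) / W) * (b : ℝ) ^ (-ε) ≤ c2 * 1 := by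
          gcongr
          · exact min_le_left _ _
          · exact Real.rpow_le_one_of_one_le_of_nonpos hb1 (by linarith)
      _ ≤ _ := by rw [mul_one]; exact hc2' b χ₂ hba h3
  have hlev := Nat.dvd_mul_right a b
  have hlev' := Nat.dvd_mul_left b a
  set χ₃ := changeLevel hlev χ₁ * changeLevel hlev' χ₂ with hχ₃
  have h5 : χ₃ ≠ 1 := changeLevel_mul_ne_one h2 hprim hab
  have h6 : χ₃ ^ 2 = 1 := by
    rw [hχ₃, mul_pow, ← map_pow, ← map_pow, h2, h4, map_one, map_one, one_mul]
  have : NeZero (a * b) := ⟨mul_ne_zero (NeZero.ne a) (NeZero.ne b)⟩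
  set X : ℝ := 8 * C0 * a ^ 2 * b ^ 2 with hX
  have hX2 : 2 ≤ X := by
    have : 1 ≤ C0 * a ^ 2 * b ^ 2 :=
      one_le_mul_of_one_le_of_one_le (one_le_mul_of_one_le_of_one_le hC01 (one_le_pow₀ ha1))
        (one_le_pow₀ hb1)
    rw [hX]; linarith
  obtain ⟨K, hK0, hK1, hK2⟩ := exp_ceil_bounds hX2
  have key := (hC0 a b (a * b) χ₁ χ₂ χ₃ h1 h3 h5 h2 h4 (changeLevel_mul_apply χ₁ χ₂) β K
    (by linarith) hβ2 hK0).trans (hneg b (a * b) χ₂ χ₃ h3 h4 h5 h6)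
  have e1 : 4 * (C0 * (a * b * ((a * b : ℕ) : ℝ))) * (3 / 4) ^ K ≤ 1 / 2 := by
    have : 4 * (C0 * (a * b * ((a * b : ℕ) : ℝ))) * (3 / 4) ^ K = X * (3 / 4) ^ K / 2 := by
      rw [hX]; push_cast; ring
    linarith
  have hβ0 : 0 < 1 - β := by linarith
  have e2 : (2 - β) ^ K ≤ 3 * X ^ (4 * δ) := by
    have hX0 : 0 < X := by linarith
    calc (2 - β) ^ K ≤ Real.exp (1 - β) ^ K := by
          gcongr
          · linarith
          · linarith [Real.add_one_le_exp (1 - β)]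
      _ = Real.exp (K * (1 - β)) := (Real.exp_nat_mul _ _).symm
      _ ≤ Real.exp ((4 * Real.log X + 1) * δ) := by
          gcongr <;> linarith
      _ = Real.exp δ * X ^ (4 * δ) := by
          rw [Real.rpow_def_of_pos hX0, ← Real.exp_add]; ring_nf
      _ ≤ 3 * X ^ (4 * δ) := by
          gcongr
          calc Real.exp δ ≤ Real.exp 1 := Real.exp_le_exp.mpr (by linarith)
            _ ≤ 3 := by linarith [Real.exp_one_lt_d9]
  have e3 : 1 / 2 * (1 - β) ≤
      ‖χ₁.LFunction 1 * (χ₂.LFunction 1 * χ₃.LFunction 1)‖ * (2 - β) ^ K := by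
    rw [← le_div_iff₀ hβ0]
    linarith
  have e4 := hC1 (a * b) χ₃ h5
  have e5 : (1 - β) ≤ ‖χ₂.LFunction 1‖ * (W * (b : ℝ) ^ ε) := by
    have : 1 / 2 * (1 - β) ≤ ‖χ₁.LFunction 1‖ * (‖χ₂.LFunction 1‖ * (C1 * ((a * b : ℕ) : ℝ) ^ δ)) *
        (3 * X ^ (4 * δ)) := by
      refine e3.trans ?_
      rw [norm_mul, norm_mul]
      have : 0 ≤ 2 - β := by linarith
      gcongr
    have e6 : ((a * b : ℕ) : ℝ) ^ δ * X ^ (4 * δ) =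
        (a : ℝ) ^ δ * (8 * C0 * a ^ 2) ^ (4 * δ) * (b : ℝ) ^ (9 * δ) := by
      rw [hX, Real.mul_rpow (by positivity) (by positivity), Nat.cast_mul,
        Real.mul_rpow (by positivity) (by positivity), ← Real.rpow_natCast (b : ℝ) 2,
        ← Real.rpow_mul (by positivity), show (9 * δ) = δ + (2 : ℕ) * (4 * δ) by push_cast; ring,
        Real.rpow_add (by positivity)]
      ring
    calc 1 - β ≤ 6 * C1 * ‖χ₁.LFunction 1‖ * ‖χ₂.LFunction 1‖ *
          (((a * b : ℕ) : ℝ) ^ δ * X ^ (4 * δ)) := by linarith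
      _ = ‖χ₂.LFunction 1‖ * (W * (b : ℝ) ^ (9 * δ)) := by rw [e6, hW]; ring
      _ ≤ _ := by gcongr
  calc min c2 ((1 - β) / W) * (b : ℝ) ^ (-ε) ≤ (1 - β) / W * (b : ℝ) ^ (-ε) := by
        gcongr; exact min_le_right _ _
    _ = (1 - β) / (W * (b : ℝ) ^ ε) := by
        rw [Real.rpow_neg (by positivity), ← div_eq_mul_inv, div_div]
    _ ≤ _ := by rwa [div_le_iff₀ (by positivity)]
end

section
open DirichletCharacter

lemma prod_one_add_inv_primeFactors_le {r : ℕ} (hr : r ≠ 0) :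
    ∏ p ∈ r.primeFactors, (1 + (p : ℝ)⁻¹) ≤ 1 + Real.log r := by
  rw [prod_one_add]
  have hinj : Set.InjOn (fun t : Finset ℕ => ∏ p ∈ t, p) (r.primeFactors.powerset : Set (Finset ℕ)) := by
    intro t ht u hu h
    have ht' : ∀ p ∈ t, p.Prime := fun p hp =>
      Nat.prime_of_mem_primeFactors ((mem_powerset.mp ht) hp)
    have hu' : ∀ p ∈ u, p.Prime := fun p hp =>
      Nat.prime_of_mem_primeFactors ((mem_powerset.mp hu) hp)
    rw [← Nat.primeFactors_prod ht', ← Nat.primeFactors_prod hu']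
    exact congrArg Nat.primeFactors h
  calc ∑ t ∈ r.primeFactors.powerset, ∏ p ∈ t, (p : ℝ)⁻¹
      = ∑ n ∈ r.primeFactors.powerset.image (fun t => ∏ p ∈ t, p), (n : ℝ)⁻¹ := by
        rw [sum_image hinj]
        exact sum_congr rfl fun t _ => by push_cast; rw [prod_inv_distrib]
    _ ≤ ∑ n ∈ Icc 1 r, (n : ℝ)⁻¹ := by
        refine sum_le_sum_of_subset_of_nonneg (fun n hn => ?_) fun _ _ _ => by positivity
        obtain ⟨t, ht, rfl⟩ := mem_image.mp hn
        have hdvd : ∏ p ∈ t, p ∣ r :=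
          (prod_dvd_prod_of_subset _ _ _ (mem_powerset.mp ht)).trans (Nat.prod_primeFactors_dvd r)
        exact mem_Icc.mpr ⟨Nat.pos_of_dvd_of_pos hdvd (Nat.pos_of_ne_zero hr),
          Nat.le_of_dvd (Nat.pos_of_ne_zero hr) hdvd⟩
    _ = (harmonic r : ℝ) := by rw [harmonic_eq_sum_Icc]; push_cast; rfl
    _ ≤ 1 + Real.log r := harmonic_le_one_add_log r

lemma norm_LFunctionTrivChar_le {r : ℕ} [NeZero r] {s : ℂ} (hs : 1 < s.re) :
    ‖LFunctionTrivChar r s‖ ≤ (1 + Real.log r) * ‖riemannZeta s‖ := by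
  have h1 : s ≠ 1 := by rintro rfl; simp at hs
  rw [LFunctionTrivChar_eq_mul_riemannZeta h1, norm_mul, norm_prod]
  gcongr
  refine le_trans (prod_le_prod (fun _ _ => norm_nonneg _) fun p hp => ?_)
    (prod_one_add_inv_primeFactors_le (NeZero.ne r))
  have hp := Nat.prime_of_mem_primeFactors hp
  refine (norm_sub_le _ _).trans ?_
  rw [norm_one, Complex.norm_natCast_cpow_of_pos hp.pos, ← Real.rpow_neg_one]
  gcongr
  · exact_mod_cast hp.one_le
  · rw [Complex.neg_re]; linarith

lemma norm_LFunctionTrivChar_real_le {r : ℕ} [NeZero r] {x : ℝ} (hx : 1 < x) :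
    ‖LFunctionTrivChar r x‖ ≤ ‖riemannZeta x‖ := by
  have h1 : (x : ℂ) ≠ 1 := by
    intro h; have : x = 1 := by exact_mod_cast h
    linarith
  rw [LFunctionTrivChar_eq_mul_riemannZeta h1, norm_mul, norm_prod]
  refine mul_le_of_le_one_left (norm_nonneg _) (prod_le_one (fun _ _ => norm_nonneg _) fun p hp => ?_)
  have hp := Nat.prime_of_mem_primeFactors hp
  have e : (1 : ℂ) - (p : ℂ) ^ (-(x : ℂ)) = ((1 - (p : ℝ) ^ (-x) : ℝ) : ℂ) := by
    push_cast
    rw [Complex.ofReal_cpow (by positivity)]; simp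
  rw [e, Complex.norm_real, Real.norm_eq_abs, abs_le]
  have h2 : (p : ℝ) ^ (-x) ≤ 1 :=
    Real.rpow_le_one_of_one_le_of_nonpos (by exact_mod_cast hp.one_le) (by linarith)
  have h3 : 0 ≤ (p : ℝ) ^ (-x) := by positivity
  constructor <;> linarith

lemma exists_norm_deriv_LFunction_le_rpow {ε : ℝ} (hε : 0 < ε) : ∃ C : ℝ, 1 ≤ C ∧
    ∀ (q : ℕ) [NeZero q] (χ : DirichletCharacter ℂ q), χ ≠ 1 → ∀ s : ℂ, 1 ≤ s.re →
      ‖deriv χ.LFunction s‖ ≤ C * (q * ‖s‖) ^ ε := by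
  obtain ⟨C, hC1, hC⟩ := exists_norm_LSeries_log_pow_le 1 hε
  refine ⟨C, hC1, fun q _ χ hχ s hs => ?_⟩
  have hq : (1 : ℝ) ≤ q := by exact_mod_cast NeZero.one_le
  have hlt : ∀ s ∈ {s : ℂ | 1 < s.re}, ‖deriv χ.LFunction s‖ ≤ C * (q * ‖s‖) ^ ε := by
    intro s hs
    have := hC (fun n => χ n) q s (fun n => χ.norm_le_one _) hq (norm_sum_range_char_le hχ) hs
    rw [deriv_LFunction_eq_deriv_LSeries χ hs, LSeries_deriv, norm_neg]
    · have e : LSeries.logMul (fun n => χ n) = fun n : ℕ => χ n * ((Real.log n ^ 1 : ℝ) : ℂ) := by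
        ext n
        simp [LSeries.logMul, mul_comm, ← Complex.natCast_log]
      rw [e]; exact this
    · refine lt_of_le_of_lt (LSeries.abscissaOfAbsConv_le_of_forall_lt_LSeriesSummable' (x := 1)
        fun y hy => ?_) (by exact_mod_cast (show (1 : ℝ) < s.re from hs))
      exact LSeriesSummable_of_bounded_of_one_lt_re (m := 1) (fun n _ => χ.norm_le_one _)
        (by rw [Complex.ofReal_re]; exact_mod_cast hy)
  have hcl : s ∈ closure {s : ℂ | 1 < s.re} := by
    rw [Complex.closure_setOfPred_lt_re]; exact hs
  refine le_on_closure hlt (Continuous.continuousOn ?_) (Continuous.continuousOn ?_) hcl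
  · exact ((differentiable_LFunction hχ).contDiff.continuous_deriv le_rfl).norm
  · exact continuous_const.mul (Continuous.rpow_const (continuous_const.mul continuous_norm)
      fun _ => Or.inr hε.le)

lemma exists_le_norm_LFunction_of_bounds : ∃ c : ℝ, 0 < c ∧
    ∀ (r : ℕ) [NeZero r] (ψ : DirichletCharacter ℂ r), ψ ≠ 1 → ∀ (x y Y D : ℝ), 0 < x → x ≤ 1 →
      1 ≤ Y → 1 ≤ D →
      (∀ u : ℝ, x ≤ u → u ≤ 1 → ‖(ψ ^ 2).LFunction (1 + u + 2 * Complex.I * y)‖ ≤ Y) →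
      (∀ u : ℝ, x ≤ u → u ≤ 1 → ‖deriv ψ.LFunction (1 + u + Complex.I * y)‖ ≤ D) →
      c / (Y * D ^ 3) ≤ ‖ψ.LFunction (1 + x + Complex.I * y)‖ := by
  obtain ⟨C, hC1, hC⟩ := exists_norm_riemannZeta_le (ε := 1) one_pos le_rfl
  set Zc : ℝ := 1 + 2 * C with hZc
  have hZc1 : 1 ≤ Zc := by linarith
  have hzeta : ∀ u : ℝ, 0 < u → u ≤ 1 → ‖riemannZeta (1 + u : ℝ)‖ ≤ Zc / u := by
    intro u hu hu1
    have := hC (1 + u : ℝ) (by simpa using hu)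
    have e : ((1 + u : ℝ) : ℂ) - 1 = (u : ℂ) := by push_cast; ring
    rw [e, Complex.norm_real, Complex.norm_real, Real.norm_of_nonneg hu.le,
      Real.norm_of_nonneg (by linarith), Real.rpow_one] at this
    refine this.trans ?_
    rw [hZc, add_div]
    gcongr
    rw [le_div_iff₀ hu]
    nlinarith [mul_nonneg hu.le (sub_nonneg.mpr hu1)]
  refine ⟨1 / (16 * Zc ^ 3), by positivity, ?_⟩
  intro r _ ψ hψ x y Y D hx hx1 hY hD hYb hDb
  set A : ℝ := Zc ^ 3 * Y with hA
  have hA1 : 1 ≤ A := one_le_mul_of_one_le_of_one_le (one_le_pow₀ hZc1) hY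
  set η : ℝ := 1 / (16 * A * D ^ 4) with hη
  have hη0 : 0 < η := by positivity
  have hη1 : η ≤ 1 := by
    rw [hη, div_le_one (by positivity)]
    have : 1 ≤ A * D ^ 4 := one_le_mul_of_one_le_of_one_le hA1 (one_le_pow₀ hD)
    linarith
  set u : ℝ := max x η with hu
  have hu0 : 0 < u := hx.trans_le (le_max_left _ _)
  have hu1 : u ≤ 1 := max_le hx1 hη1
  set f : ℝ → ℂ := fun u => ψ.LFunction (1 + u + Complex.I * y) with hf
  have h341 : (1 / (8 * A * D ^ 3)) ^ 4 ≤ ‖f u‖ ^ 4 := by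
    have h := norm_LFunction_product_ge_one ψ hu0 y
    rw [norm_mul, norm_mul, norm_pow, norm_pow] at h
    have h0 : ‖LFunctionTrivChar r (1 + u)‖ ≤ Zc / u := by
      have := norm_LFunctionTrivChar_real_le (r := r) (x := 1 + u) (by linarith)
      exact (by simpa using this : ‖LFunctionTrivChar r (1 + u)‖ ≤ _).trans
        (by simpa using hzeta u hu0 hu1)
    have h2 : 1 ≤ (Zc / u) ^ 3 * ‖f u‖ ^ 4 * Y := by
      refine h.le.trans ?_
      gcongr
      exact hYb u (le_max_left _ _) hu1
    have h3 : u ^ 3 ≤ A * ‖f u‖ ^ 4 := by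
      have : (Zc / u) ^ 3 * ‖f u‖ ^ 4 * Y = (A * ‖f u‖ ^ 4) / u ^ 3 := by
        rw [hA]; field_simp
      rwa [this, one_le_div (by positivity)] at h2
    have h4 : η ^ 3 ≤ A * ‖f u‖ ^ 4 :=
      (pow_le_pow_left₀ hη0.le (le_max_right _ _) 3).trans h3
    have h5 : (1 / (8 * A * D ^ 3)) ^ 4 = η ^ 3 / A := by
      rw [hη]; field_simp; norm_num
    rw [h5, div_le_iff₀ (by positivity)]
    linarith
  have hfu : 1 / (8 * A * D ^ 3) ≤ ‖f u‖ := le_of_pow_le_pow_left₀ (by norm_num) (norm_nonneg _) h341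
  have hder : ∀ v : ℝ, HasDerivAt f (deriv ψ.LFunction (1 + v + Complex.I * y)) v := by
    intro v
    have h1 : HasDerivAt (fun v : ℝ => (1 : ℂ) + v + Complex.I * y) 1 v := by
      have := (Complex.ofRealCLM.hasDerivAt (x := v))
      simpa using (this.const_add 1).add_const (Complex.I * y)
    have h2 := ((differentiable_LFunction hψ) (1 + v + Complex.I * y)).hasDerivAt.comp v h1
    rw [mul_one] at h2
    exact h2
  have hdiff : ‖f u - f x‖ ≤ D * (u - x) := by
    refine norm_image_sub_le_of_norm_deriv_le_segment' (f := f)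
      (fun v _ => (hder v).hasDerivWithinAt) (fun v hv => ?_) u ⟨le_max_left _ _, le_rfl⟩
    exact hDb v hv.1 (hv.2.le.trans hu1)
  have hux : u - x ≤ η := by
    rcases max_cases x η with h | h <;> rw [hu, h.1] <;> linarith
  have h6 : ‖f u‖ ≤ ‖f x‖ + D * η := by
    have h7 := norm_sub_norm_le (f u) (f x)
    have h8 : D * (u - x) ≤ D * η := by gcongr
    linarith
  have h9 : D * η = 1 / (16 * A * D ^ 3) := by rw [hη]; field_simp
  have h10 : 1 / (8 * A * D ^ 3) = 2 * (1 / (16 * A * D ^ 3)) := by field_simp; norm_num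
  have h11 : 1 / (16 * Zc ^ 3) / (Y * D ^ 3) = 1 / (16 * A * D ^ 3) := by
    rw [hA, div_div]; ring_nf
  rw [h11]
  have : ‖f x‖ = ‖ψ.LFunction (1 + x + Complex.I * y)‖ := rfl
  linarith
end

section
open DirichletCharacter

lemma one_add_log_le_rpow {δ : ℝ} (hδ : 0 < δ) : ∃ C : ℝ, 1 ≤ C ∧ ∀ r : ℝ, 1 ≤ r →
    1 + Real.log r ≤ C * r ^ δ := by
  refine ⟨1 + δ⁻¹, by linarith [inv_pos.mpr hδ], fun r hr => ?_⟩
  have h1 := Real.log_le_rpow_div (by linarith : 0 ≤ r) hδ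
  have h2 := Real.one_le_rpow hr hδ.le
  rw [div_eq_inv_mul] at h1
  linarith

/-- A lower bound for `L(s, ψ)` to the right of the line `re s = 1`. -/
theorem exists_le_norm_LFunction_rpow {ε : ℝ} (hε : 0 < ε) : ∃ c : ℝ, 0 < c ∧
    ∀ (r : ℕ) [NeZero r] (ψ : DirichletCharacter ℂ r), ψ.IsPrimitive → ψ ≠ 1 → ∀ s : ℂ,
      1 < s.re → s.re ≤ 2 → c * (r * ‖s‖) ^ (-ε) ≤ ‖ψ.LFunction s‖ := by
  obtain ⟨δ, hδ⟩ : ∃ z : ℝ, z = min ε 1 / 6 := ⟨_, rfl⟩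
  have hδ0 : 0 < δ := by rw [hδ]; positivity
  have hδ1 : δ ≤ 1 := by
    have := min_le_right ε 1
    linarith
  have hδε : 6 * δ ≤ ε := by
    have := min_le_left ε 1
    linarith
  obtain ⟨C1, hC11, hC1⟩ := exists_norm_LFunction_le_rpow hδ0
  obtain ⟨C2, hC21, hC2⟩ := exists_norm_deriv_LFunction_le_rpow hδ0
  obtain ⟨C3, hC31, hC3⟩ := exists_norm_riemannZeta_le hδ0 hδ1
  obtain ⟨C4, hC41, hC4⟩ := one_add_log_le_rpow hδ0
  obtain ⟨c0, hc0, hmain⟩ := exists_le_norm_LFunction_of_bounds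
  obtain ⟨c1', hc1', hsiegel⟩ := siegel hδ0
  obtain ⟨c1, hc1⟩ : ∃ z : ℝ, z = min c1' 1 := ⟨_, rfl⟩
  have hc10 : 0 < c1 := hc1 ▸ lt_min hc1' one_pos
  have hc11 : c1 ≤ 1 := hc1 ▸ min_le_right _ _
  obtain ⟨C, hC⟩ : ∃ z : ℝ, z = 4 * (C1 + C2 + C3 + C4) := ⟨_, rfl⟩
  have hCge : 16 ≤ C := by linarith
  obtain ⟨Y0, hY0⟩ : ∃ z : ℝ, z = 3 * C ^ 2 / c1 := ⟨_, rfl⟩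
  have hY0C : C ≤ Y0 := by
    rw [hY0, le_div_iff₀ hc10]
    nlinarith
  refine ⟨min (c1 / 2) (c0 / (Y0 * C ^ 3)), lt_min (by positivity)
    (div_pos hc0 (mul_pos (by linarith) (pow_pos (by linarith) 3))), ?_⟩
  intro r _ ψ hprim hψ s hs1 hs2
  have hr1 : (1 : ℝ) ≤ r := by exact_mod_cast NeZero.one_le
  have hsn : 1 ≤ ‖s‖ := hs1.le.trans ((le_abs_self _).trans (Complex.abs_re_le_norm s))
  obtain ⟨T, hT⟩ : ∃ z : ℝ, z = r * ‖s‖ := ⟨_, rfl⟩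
  have hT1 : 1 ≤ T := hT ▸ one_le_mul_of_one_le_of_one_le hr1 hsn
  have hT0 : 0 < T := by linarith
  have hrT : (r : ℝ) ≤ T := hT ▸ le_mul_of_one_le_right (by linarith) hsn
  have hsT : ‖s‖ ≤ T := hT ▸ le_mul_of_one_le_left (by linarith) hr1
  have hTle : ∀ a b : ℝ, a ≤ b → T ^ a ≤ T ^ b := fun a b h =>
    Real.rpow_le_rpow_of_exponent_le hT1 h
  have hTpos : ∀ a : ℝ, 0 < T ^ a := fun a => Real.rpow_pos_of_pos hT0 a
  -- comparison of heights on the relevant segments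
  have h4 : ∀ {w : ℂ}, ‖w‖ ≤ 4 * ‖s‖ → (r * ‖w‖) ^ δ ≤ 4 * T ^ δ := by
    intro w hw
    calc (r * ‖w‖) ^ δ ≤ (4 * T) ^ δ := by
          refine Real.rpow_le_rpow (by positivity) ?_ hδ0.le
          rw [hT]; have := mul_le_mul_of_nonneg_left hw (by linarith : (0 : ℝ) ≤ r); linarith
      _ = 4 ^ δ * T ^ δ := Real.mul_rpow (by norm_num) hT0.le
      _ ≤ 4 * T ^ δ := by
          gcongr
          calc (4 : ℝ) ^ δ ≤ 4 ^ (1 : ℝ) := Real.rpow_le_rpow_of_exponent_le (by norm_num) hδ1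
            _ = 4 := by norm_num
  obtain ⟨x, y, hsxy, hx0, hx1⟩ : ∃ x y : ℝ, s = 1 + x + Complex.I * y ∧ 0 < x ∧ x ≤ 1 :=
    ⟨s.re - 1, s.im, by apply Complex.ext <;> simp, by linarith, by linarith⟩
  have hyn : |y| ≤ ‖s‖ := by
    have := Complex.abs_im_le_norm s
    rw [hsxy] at this ⊢; simpa using this
  have hw1 : ∀ u : ℝ, x ≤ u → u ≤ 1 → ‖(1 : ℂ) + u + Complex.I * y‖ ≤ 4 * ‖s‖ := by
    intro u hu hu1
    calc ‖(1 : ℂ) + u + Complex.I * y‖ ≤ ‖(1 : ℂ)‖ + ‖(u : ℂ)‖ + ‖Complex.I * y‖ := norm_add₃_le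
      _ = 1 + |u| + |y| := by simp
      _ ≤ 4 * ‖s‖ := by rw [abs_of_pos (by linarith)]; linarith
  have hw2 : ∀ u : ℝ, x ≤ u → u ≤ 1 → ‖(1 : ℂ) + u + 2 * Complex.I * y‖ ≤ 4 * ‖s‖ := by
    intro u hu hu1
    calc ‖(1 : ℂ) + u + 2 * Complex.I * y‖ ≤ ‖(1 : ℂ)‖ + ‖(u : ℂ)‖ + ‖2 * Complex.I * y‖ :=
          norm_add₃_le
      _ = 1 + |u| + 2 * |y| := by simp
      _ ≤ 4 * ‖s‖ := by rw [abs_of_pos (by linarith)]; linarith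
  have hre2 : ∀ u : ℝ, ((1 : ℂ) + u + 2 * Complex.I * y).re = 1 + u := by intro u; simp
  have hre1 : ∀ u : ℝ, ((1 : ℂ) + u + Complex.I * y).re = 1 + u := by intro u; simp
  have hD : ∀ u : ℝ, x ≤ u → u ≤ 1 → ‖deriv ψ.LFunction (1 + u + Complex.I * y)‖ ≤ C * T ^ δ := by
    intro u hu hu1
    refine (hC2 r ψ hψ _ (by rw [hre1]; linarith)).trans ?_
    calc C2 * (r * ‖(1 : ℂ) + u + Complex.I * y‖) ^ δ ≤ C2 * (4 * T ^ δ) := by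
          gcongr; exact h4 (hw1 u hu hu1)
      _ = (4 * C2) * T ^ δ := by ring
      _ ≤ C * T ^ δ := by gcongr; linarith
  have hD1 : 1 ≤ C * T ^ δ :=
    one_le_mul_of_one_le_of_one_le (by linarith) (Real.one_le_rpow hT1 hδ0.le)
  have hY00 : 0 < Y0 := by linarith
  have hC00 : 0 < C := by linarith
  -- the conclusion from a bound for `L(s, ψ²)`
  have hfin : (∀ u : ℝ, x ≤ u → u ≤ 1 →
      ‖(ψ ^ 2).LFunction (1 + u + 2 * Complex.I * y)‖ ≤ Y0 * T ^ (3 * δ)) →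
      min (c1 / 2) (c0 / (Y0 * C ^ 3)) * T ^ (-ε) ≤ ‖ψ.LFunction s‖ := by
    intro hY
    have hY1 : 1 ≤ Y0 * T ^ (3 * δ) :=
      one_le_mul_of_one_le_of_one_le (by linarith) (Real.one_le_rpow hT1 (by linarith))
    have := hmain r ψ hψ x y _ _ hx0 hx1 hY1 hD1 hY hD
    rw [← hsxy] at this
    refine le_trans ?_ this
    have e : c0 / (Y0 * T ^ (3 * δ) * (C * T ^ δ) ^ 3) = c0 / (Y0 * C ^ 3) * T ^ (-(6 * δ)) := by
      rw [Real.rpow_neg hT0.le, mul_pow, ← Real.rpow_mul_natCast hT0.le δ 3,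
        show 6 * δ = 3 * δ + δ * (3 : ℕ) by push_cast; ring, Real.rpow_add hT0]
      have := (hTpos (3 * δ)).ne'
      have := (hTpos (δ * (3 : ℕ))).ne'
      field_simp
    rw [e]
    refine mul_le_mul (min_le_right _ _) (hTle _ _ (by linarith)) (hTpos _).le (by positivity)
  rw [← hT]
  by_cases hψ2 : ψ ^ 2 = 1
  swap
  · refine hfin ?_
    intro u hu hu1
    have hb := hC1 r _ hψ2 (1 + u + 2 * Complex.I * y) (by rw [hre2]; linarith)
    refine hb.trans ?_
    calc C1 * (r * ‖(1 : ℂ) + u + 2 * Complex.I * y‖) ^ δ ≤ C1 * (4 * T ^ δ) := by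
          gcongr; exact h4 (hw2 u hu hu1)
      _ = (4 * C1) * T ^ δ := by ring
      _ ≤ Y0 * T ^ (3 * δ) := by
          refine mul_le_mul ?_ (hTle _ _ (by linarith)) (hTpos _).le (by linarith)
          refine le_trans ?_ hY0C
          rw [hC]; linarith
  obtain ⟨κ, hκ⟩ : ∃ z : ℝ, z = c1 / (2 * C) * T ^ (-(2 * δ)) := ⟨_, rfl⟩
  have hκ0 : 0 < κ := by have := hTpos (-(2 * δ)); rw [hκ]; positivity
  rcases le_or_gt ‖s - 1‖ κ with hsκ | hsκ
  · have hs0 : c1 * T ^ (-δ) ≤ ‖ψ.LFunction 1‖ := by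
      refine le_trans ?_ (hsiegel r ψ hprim hψ hψ2)
      refine mul_le_mul (hc1 ▸ min_le_left _ _)
        (Real.rpow_le_rpow_of_nonpos (by linarith) hrT (by linarith)) (hTpos _).le hc1'.le
    have hseg : ‖ψ.LFunction s - ψ.LFunction 1‖ ≤ C * T ^ δ * ‖s - 1‖ := by
      refine Convex.norm_image_sub_le_of_norm_deriv_le (s := segment ℝ 1 s)
        (fun w _ => differentiable_LFunction hψ w) (fun w hw => ?_) (convex_segment 1 s)
        (left_mem_segment ℝ 1 s) (right_mem_segment ℝ 1 s)
      obtain ⟨a, b, ha, hb, hab, rfl⟩ := hw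
      have hwre : 1 ≤ (a • (1 : ℂ) + b • s).re := by
        simp only [Complex.add_re, Complex.real_smul, Complex.re_ofReal_mul, Complex.one_re]
        have := mul_nonneg hb (sub_nonneg.2 hs1.le)
        linarith
      have hwn : ‖a • (1 : ℂ) + b • s‖ ≤ 4 * ‖s‖ := by
        calc _ ≤ ‖a • (1 : ℂ)‖ + ‖b • s‖ := norm_add_le _ _
          _ = a + b * ‖s‖ := by
              rw [norm_smul, norm_smul, Real.norm_of_nonneg ha, Real.norm_of_nonneg hb]; simp
          _ ≤ _ := by
              have e1 := mul_nonneg ha (sub_nonneg.2 hsn)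
              have e2 : (a + b) * ‖s‖ = ‖s‖ := by rw [hab, one_mul]
              linarith
      refine (hC2 r ψ hψ _ hwre).trans ?_
      calc C2 * (r * ‖a • (1 : ℂ) + b • s‖) ^ δ ≤ C2 * (4 * T ^ δ) := by
            gcongr; exact h4 hwn
        _ = (4 * C2) * T ^ δ := by ring
        _ ≤ C * T ^ δ := by gcongr; linarith
    have hsmall : C * T ^ δ * ‖s - 1‖ ≤ c1 / 2 * T ^ (-δ) := by
      calc C * T ^ δ * ‖s - 1‖ ≤ C * T ^ δ * κ := by gcongr
        _ = c1 / 2 * (T ^ δ * T ^ (-(2 * δ))) := by rw [hκ]; field_simp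
        _ = c1 / 2 * T ^ (-δ) := by rw [← Real.rpow_add hT0]; ring_nf
    have h5 := norm_sub_norm_le (ψ.LFunction 1) (ψ.LFunction s)
    rw [norm_sub_rev (ψ.LFunction 1)] at h5
    calc min (c1 / 2) (c0 / (Y0 * C ^ 3)) * T ^ (-ε) ≤ c1 / 2 * T ^ (-δ) :=
           mul_le_mul (min_le_left _ _) (hTle _ _ (by linarith)) (hTpos _).le (by linarith)
      _ ≤ _ := by linarith
  · refine hfin fun u hu hu1 => ?_
    obtain ⟨w, hw⟩ : ∃ w : ℂ, w = 1 + u + 2 * Complex.I * y := ⟨_, rfl⟩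
    have hwn := hw2 u hu hu1
    have hwre0 := hre2 u
    rw [← hw] at hwn hwre0 ⊢
    have hwre : 1 < w.re := by rw [hwre0]; linarith
    have hws : κ ≤ ‖w - 1‖ := by
      refine hsκ.le.trans (abs_le_of_sq_le_sq' ?_ (norm_nonneg _)).2
      rw [Complex.sq_norm, Complex.sq_norm, Complex.normSq_apply, Complex.normSq_apply, hsxy, hw]
      simp
      have e1 := mul_self_le_mul_self hx0.le hu
      have e2 := mul_self_nonneg y
      linarith
    have hz : ‖riemannZeta w‖ ≤ 3 * C / c1 * T ^ (2 * δ) := by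
      refine (hC3 w hwre).trans ?_
      have e1 : 1 / ‖w - 1‖ ≤ 2 * C / c1 * T ^ (2 * δ) := by
        refine (one_div_le_one_div_of_le hκ0 hws).trans (le_of_eq ?_)
        rw [hκ, Real.rpow_neg hT0.le]
        have := (hTpos (2 * δ)).ne'
        field_simp
      have e2 : C3 * ‖w‖ ^ δ ≤ C / c1 * T ^ (2 * δ) := by
        have h6 : ‖w‖ ^ δ ≤ 4 * T ^ δ := by
          refine le_trans ?_ (h4 hwn)
          exact Real.rpow_le_rpow (norm_nonneg _)
            (le_mul_of_one_le_left (norm_nonneg _) hr1) hδ0.le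
        calc C3 * ‖w‖ ^ δ ≤ C3 * (4 * T ^ δ) := by gcongr
          _ = (4 * C3) * T ^ δ := by ring
          _ ≤ C / c1 * T ^ (2 * δ) := by
            refine mul_le_mul ?_ (hTle _ _ (by linarith)) (hTpos _).le (by positivity)
            rw [le_div_iff₀ hc10]
            have : 4 * C3 * c1 ≤ 4 * C3 * 1 := by gcongr
            refine this.trans ?_
            rw [hC]; linarith
      calc _ ≤ 2 * C / c1 * T ^ (2 * δ) + C / c1 * T ^ (2 * δ) := add_le_add e1 e2
        _ = _ := by ring
    have htriv := norm_LFunctionTrivChar_le (r := r) hwre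
    have hlog : 1 + Real.log r ≤ C * T ^ δ := by
      refine (hC4 r hr1).trans ?_
      gcongr
      rw [hC]; linarith
    rw [hψ2]
    change ‖LFunctionTrivChar r w‖ ≤ _
    calc ‖LFunctionTrivChar r w‖ ≤ (1 + Real.log r) * ‖riemannZeta w‖ := htriv
      _ ≤ (C * T ^ δ) * (3 * C / c1 * T ^ (2 * δ)) := by gcongr
      _ = Y0 * (T ^ δ * T ^ (2 * δ)) := by rw [hY0]; ring
      _ = Y0 * T ^ (3 * δ) := by rw [← Real.rpow_add hT0]; ring_nf
end

section
open DirichletCharacter ArithmeticFunction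

lemma LSeriesSummable_vonMangoldt_log_pow {q : ℕ} (χ : DirichletCharacter ℂ q) (j : ℕ) {s : ℂ}
    (hs : 1 < s.re) :
    LSeriesSummable (fun n => χ n * ((Λ n * Real.log n ^ j : ℝ) : ℂ)) s := by
  have h := LSeriesSummable_mul_log_pow (a := fun n => χ n * ((Λ n / Real.log n : ℝ) : ℂ))
    (fun n => ?_) (j + 1) hs
  · refine (LSeriesSummable_congr s fun {n} _ => ?_).mp h
    simp only [mul_assoc, ← Complex.ofReal_mul]
    congr 2
    by_cases h0 : Real.log n = 0
    · have : Λ n = 0 := le_antisymm (h0 ▸ vonMangoldt_le_log) vonMangoldt_nonneg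
      simp [this]
    · field_simp
      ring
  · rw [norm_mul, Complex.norm_real, Real.norm_eq_abs]
    refine mul_le_one₀ (χ.norm_le_one _) (abs_nonneg _) ?_
    rw [abs_of_nonneg (div_nonneg vonMangoldt_nonneg (Real.log_natCast_nonneg n))]
    exact div_le_one_of_le₀ vonMangoldt_le_log (Real.log_natCast_nonneg n)

/-- Leibniz rule expressing higher derivatives of the Dirichlet series of a character. -/
lemma LSeries_log_pow_succ {q : ℕ} (χ : DirichletCharacter ℂ q) (k : ℕ) {s : ℂ} (hs : 1 < s.re) :
    LSeries (fun n => χ n * ((Real.log n ^ (k + 1) : ℝ) : ℂ)) s =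
      ∑ j ∈ range (k + 1), (k.choose j : ℂ) *
        (LSeries (fun n => χ n * ((Λ n * Real.log n ^ j : ℝ) : ℂ)) s *
          LSeries (fun n => χ n * ((Real.log n ^ (k - j) : ℝ) : ℂ)) s) := by
  have h1 : ∀ j, LSeriesSummable (fun n => χ n * ((Real.log n ^ j : ℝ) : ℂ)) s := fun j =>
    LSeriesSummable_mul_log_pow (fun n => χ.norm_le_one _) j hs
  have h2 := fun j => LSeriesSummable_vonMangoldt_log_pow χ j hs
  rw [sum_congr rfl fun j _ => by rw [← LSeries_convolution' (h2 j) (h1 (k - j)), ← LSeries_smul],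
    ← LSeries_sum (fun j _ => ((h2 j).convolution (h1 (k - j))).smul _)]
  refine LSeries_congr (fun {n} hn => ?_) s
  simp only [Finset.sum_apply, Pi.smul_apply, LSeries.convolution_def, smul_eq_mul, mul_sum]
  rw [sum_comm]
  have e : ((Real.log n ^ (k + 1) : ℝ) : ℂ) =
      ∑ p ∈ n.divisorsAntidiagonal, ((Λ p.1 * Real.log n ^ k : ℝ) : ℂ) := by
    rw [← Complex.ofReal_sum, ← sum_mul, Nat.sum_divisorsAntidiagonal (fun i _ => Λ i),
      vonMangoldt_sum]
    ring_nf
  rw [e, mul_sum]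
  refine sum_congr rfl fun p hp => ?_
  obtain ⟨hp, -⟩ := Nat.mem_divisorsAntidiagonal.mp hp
  have hp1 : p.1 ≠ 0 := by rintro h; simp [h] at hp; omega
  have hp2 : p.2 ≠ 0 := by rintro h; simp [h] at hp; omega
  have hlog : Real.log n = Real.log p.1 + Real.log p.2 := by
    rw [← hp, Nat.cast_mul, Real.log_mul (by exact_mod_cast hp1) (by exact_mod_cast hp2)]
  rw [hlog, add_pow, ← hp]
  push_cast
  rw [map_mul, mul_sum, mul_sum]
  refine sum_congr rfl fun j _ => ?_
  ring

theorem exists_norm_LSeries_vonMangoldt_log_pow_le (k : ℕ) : ∀ {ε : ℝ}, 0 < ε →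
    ∃ C : ℝ, 1 ≤ C ∧ ∀ (r : ℕ) [NeZero r] (ψ : DirichletCharacter ℂ r), ψ.IsPrimitive → ψ ≠ 1 →
      ∀ s : ℂ, 1 < s.re → s.re ≤ 2 →
        ‖LSeries (fun n => ψ n * ((Λ n * Real.log n ^ k : ℝ) : ℂ)) s‖ ≤ C * (r * ‖s‖) ^ ε := by
  induction k using Nat.strong_induction_on with
  | _ k ih =>
    intro ε hε
    have hε3 : 0 < ε / 3 := by positivity
    choose! A hA1 hA using fun j => exists_norm_LSeries_log_pow_le j hε3
    obtain ⟨c, hc, hlow⟩ := exists_le_norm_LFunction_rpow hε3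
    choose! G hG1 hG using fun j (hj : j < k) => ih j hj hε3
    obtain ⟨S, hS⟩ : ∃ S : ℝ, S = A (k + 1) + ∑ j ∈ range k, (k.choose j : ℝ) * (G j * A (k - j)) :=
      ⟨_, rfl⟩
    have hS1 : 1 ≤ S := by
      have : 0 ≤ ∑ j ∈ range k, (k.choose j : ℝ) * (G j * A (k - j)) := by
        refine sum_nonneg fun j hj => ?_
        have := hG1 j (mem_range.mp hj)
        have := hA1 (k - j)
        positivity
      linarith [hA1 (k + 1)]
    refine ⟨max 1 (S / c), le_max_left _ _, ?_⟩
    intro r _ ψ hprim hψ s hs1 hs2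
    have hr1 : (1 : ℝ) ≤ r := by exact_mod_cast NeZero.one_le
    have hsn : 1 ≤ ‖s‖ := hs1.le.trans ((le_abs_self _).trans (Complex.abs_re_le_norm s))
    obtain ⟨T, hT⟩ : ∃ T : ℝ, T = r * ‖s‖ := ⟨_, rfl⟩
    have hT1 : 1 ≤ T := hT ▸ one_le_mul_of_one_le_of_one_le hr1 hsn
    have hT0 : 0 < T := by linarith
    have hU1 : 1 ≤ T ^ (ε / 3) := Real.one_le_rpow hT1 hε3.le
    have hL : ∀ j, ‖LSeries (fun n => ψ n * ((Real.log n ^ j : ℝ) : ℂ)) s‖ ≤ A j * T ^ (ε / 3) := by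
      intro j
      rw [hT]
      exact hA j (fun n => ψ n) r s (fun n => ψ.norm_le_one _) hr1
        (fun n => norm_sum_range_char_le hψ n) hs1
    have hlow' := hlow r ψ hprim hψ s hs1 hs2
    have hrec := LSeries_log_pow_succ ψ k hs1
    rw [sum_range_succ] at hrec
    have h0 : LSeries (fun n => ψ n * ((Real.log n ^ (k - k) : ℝ) : ℂ)) s = ψ.LFunction s := by
      rw [LFunction_eq_LSeries ψ hs1]; simp
    rw [h0, Nat.choose_self, Nat.cast_one, one_mul] at hrec
    rw [← hT] at hlow' ⊢
    obtain ⟨g, hg⟩ : ∃ g, g = LSeries (fun n => ψ n * ((Λ n * Real.log n ^ k : ℝ) : ℂ)) s :=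
      ⟨_, rfl⟩
    rw [← hg] at hrec ⊢
    have hup : ‖g * ψ.LFunction s‖ ≤ S * (T ^ (ε / 3) * T ^ (ε / 3)) := by
      rw [← sub_eq_iff_eq_add'.mpr hrec, hS, add_mul]
      refine (norm_sub_le _ _).trans (add_le_add ?_ ?_)
      · refine (hL (k + 1)).trans ?_
        have := hA1 (k + 1)
        gcongr
        exact le_mul_of_one_le_left (by linarith) hU1
      · refine (norm_sum_le _ _).trans ?_
        rw [sum_mul]
        refine sum_le_sum fun j hj => ?_
        rw [norm_mul, norm_mul, Complex.norm_natCast, mul_assoc]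
        have hj := mem_range.mp hj
        have b1 := hG j hj r ψ hprim hψ s hs1 hs2
        rw [← hT] at b1
        have b2 := hL (k - j)
        refine mul_le_mul_of_nonneg_left ?_ (Nat.cast_nonneg _)
        calc _ ≤ (G j * T ^ (ε / 3)) * (A (k - j) * T ^ (ε / 3)) := by
              refine mul_le_mul b1 b2 (norm_nonneg _) ((norm_nonneg _).trans b1)
          _ = _ := by ring
    rw [norm_mul] at hup
    have hinv : T ^ (-(ε / 3)) * T ^ (ε / 3) = 1 := by
      rw [← Real.rpow_add hT0]; simp
    have e3 : T ^ ε = T ^ (ε / 3) * T ^ (ε / 3) * T ^ (ε / 3) := by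
      rw [← Real.rpow_add hT0, ← Real.rpow_add hT0]; ring_nf
    have : ‖g‖ * (c * T ^ (-(ε / 3))) ≤ S * (T ^ (ε / 3) * T ^ (ε / 3)) :=
      (mul_le_mul_of_nonneg_left hlow' (norm_nonneg _)).trans hup
    have h9 : ‖g‖ * c ≤ S * T ^ ε := by
      calc ‖g‖ * c = ‖g‖ * (c * T ^ (-(ε / 3))) * T ^ (ε / 3) := by
            rw [mul_assoc, mul_assoc c, hinv, mul_one]
        _ ≤ S * (T ^ (ε / 3) * T ^ (ε / 3)) * T ^ (ε / 3) := by gcongr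
        _ = S * T ^ ε := by rw [e3]; ring
    calc ‖g‖ ≤ S * T ^ ε / c := by rwa [le_div_iff₀ hc]
      _ = S / c * T ^ ε := by ring
      _ ≤ _ := by gcongr; exact le_max_right _ _
end

section
open MeasureTheory Complex

lemma norm_cpow_sub_half_le {σ y : ℝ} (hσ : 1 ≤ σ) :
    ‖(σ : ℂ) + y * I‖ ^ (1 / 2 : ℝ) * ‖1 / ((σ : ℂ) + y * I) - 1 / ((σ : ℂ) + y * I + 1)‖ ≤
      (1 + ‖y‖ ^ 2) ^ (-(3 / 2 : ℝ) / 2) := by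
  obtain ⟨s, hs⟩ : ∃ s : ℂ, s = (σ : ℂ) + y * I := ⟨_, rfl⟩
  have hre : s.re = σ := by simp [hs]
  have him : s.im = y := by simp [hs]
  rw [← hs]
  have hn1 : 1 ≤ ‖s‖ := hσ.trans (hre ▸ re_le_norm s)
  have hn0 : 0 < ‖s‖ := by linarith
  have hs0 : s ≠ 0 := norm_pos_iff.mp hn0
  have hs1 : ‖s‖ ≤ ‖s + 1‖ := by
    refine (abs_le_of_sq_le_sq' ?_ (norm_nonneg _)).2
    rw [Complex.sq_norm, Complex.sq_norm, normSq_apply, normSq_apply]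
    simp
    nlinarith
  have hs10 : s + 1 ≠ 0 := norm_pos_iff.mp (hn0.trans_le hs1)
  have e : 1 / s - 1 / (s + 1) = 1 / (s * (s + 1)) := by field_simp; ring
  have hsq : 1 + ‖y‖ ^ 2 ≤ ‖s‖ ^ 2 := by
    rw [Complex.sq_norm, normSq_apply, hre, him, Real.norm_eq_abs, sq_abs]
    nlinarith
  rw [e, norm_div, norm_one, norm_mul]
  calc ‖s‖ ^ (1 / 2 : ℝ) * (1 / (‖s‖ * ‖s + 1‖)) ≤ ‖s‖ ^ (1 / 2 : ℝ) * (1 / (‖s‖ * ‖s‖)) := by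
        gcongr
    _ = (‖s‖ ^ 2) ^ (-(3 / 2 : ℝ) / 2) := by
        rw [← Real.rpow_natCast, ← Real.rpow_mul hn0.le, ← pow_two, ← Real.rpow_natCast,
          one_div (‖s‖ ^ _), ← Real.rpow_neg hn0.le, ← Real.rpow_add hn0]
        norm_num
    _ ≤ _ := by
        refine Real.rpow_le_rpow_of_nonpos (by positivity) hsq (by norm_num)

lemma integrable_cesaroKernel {σ : ℝ} (hσ : 1 ≤ σ) :
    Integrable fun y : ℝ => 1 / ((σ : ℂ) + y * I) - 1 / ((σ : ℂ) + y * I + 1) := by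
  have h : Integrable fun y : ℝ => (1 + ‖y‖ ^ 2) ^ (-(3 / 2 : ℝ) / 2) :=
    integrable_rpow_neg_one_add_norm_sq (by simp; norm_num)
  have hne : ∀ y : ℝ, (σ : ℂ) + y * I ≠ 0 := fun y h => by
    have := congrArg re h; simp at this; linarith
  have hne1 : ∀ y : ℝ, (σ : ℂ) + y * I + 1 ≠ 0 := fun y h => by
    have := congrArg re h; simp at this; linarith
  refine h.mono' ?_ (Filter.Eventually.of_forall fun y => ?_)
  · refine Continuous.aestronglyMeasurable ?_
    exact (continuous_const.div (by fun_prop) hne).sub (continuous_const.div (by fun_prop) hne1)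
  · refine le_trans ?_ (norm_cpow_sub_half_le hσ)
    refine le_mul_of_one_le_left (norm_nonneg _) (Real.one_le_rpow ?_ (by norm_num))
    refine hσ.trans (le_trans (le_of_eq ?_) (re_le_norm _))
    simp

lemma cesaro_mellin_inversion {σ x : ℝ} (hσ : 1 ≤ σ) (hx : 0 < x) :
    ∫ y : ℝ, (x : ℂ) ^ (-((σ : ℂ) + y * I)) *
      (1 / ((σ : ℂ) + y * I) - 1 / ((σ : ℂ) + y * I + 1)) =
      2 * Real.pi * ((max (1 - x) 0 : ℝ) : ℂ) := by
  obtain ⟨f, hf⟩ : ∃ f : ℝ → ℂ, f = fun t => (Set.Ioc 0 1).indicator (fun _ => (1 : ℂ)) t -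
    (Set.Ioc 0 1).indicator (fun t : ℝ => (t : ℂ) ^ (1 : ℂ)) t := ⟨_, rfl⟩
  have hval : ∀ t : ℝ, 0 < t → f t = ((max (1 - t) 0 : ℝ) : ℂ) := by
    intro t ht
    rw [hf]
    by_cases h1 : t ≤ 1
    · simp [Set.indicator, ht, h1]
    · simp [Set.indicator, ht, h1, max_eq_right (by linarith : 1 - t ≤ 0)]
  have hM : ∀ s : ℂ, 0 < s.re → HasMellin f s (1 / s - 1 / (s + 1)) := by
    intro s hs
    have h1 := hasMellin_one_Ioc hs
    have h2 := hasMellin_cpow_Ioc 1 (s := s) (by simp; linarith)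
    have := hasMellin_sub h1.1 h2.1
    rw [h1.2, h2.2] at this
    rw [hf]; exact this
  have hre : ∀ y : ℝ, 0 < ((σ : ℂ) + y * I).re := fun y => by simp; linarith
  have hinv := mellinInv_mellin_eq σ f hx (hM σ (by simp; linarith)).1 ?_ ?_
  · rw [mellinInv, hval x hx] at hinv
    simp only [fun y : ℝ => (hM _ (hre y)).2, smul_eq_mul, real_smul] at hinv
    have : (Real.pi : ℂ) ≠ 0 := by exact_mod_cast Real.pi_ne_zero
    rw [← hinv, ← mul_assoc, show 2 * (Real.pi : ℂ) * ((1 / (2 * Real.pi) : ℝ) : ℂ) = 1 by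
      push_cast; field_simp, one_mul]
  · refine (integrable_cesaroKernel hσ).congr (Filter.Eventually.of_forall fun y => ?_)
    exact (hM _ (hre y)).2.symm
  · have hc : ContinuousAt (fun t : ℝ => ((max (1 - t) 0 : ℝ) : ℂ)) x := by fun_prop
    refine hc.congr ?_
    filter_upwards [Ioi_mem_nhds hx] with t ht
    exact (hval t ht).symm

/-- A truncated Perron-type bound for Cesàro means. -/
theorem exists_norm_sum_mul_sub_le : ∃ C : ℝ, 0 < C ∧ ∀ (a : ℕ → ℂ) (σ K : ℝ), 1 ≤ σ → a 0 = 0 →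
    LSeriesSummable a σ → (∀ y : ℝ, ‖LSeries a (σ + y * I)‖ ≤ K * ‖(σ : ℂ) + y * I‖ ^ (1 / 2 : ℝ)) →
    ∀ x : ℕ, ‖∑ n ∈ range x, a n * (((x : ℝ) - n : ℝ) : ℂ)‖ ≤ C * K * (x : ℝ) ^ (1 + σ) := by
  have hint : Integrable fun y : ℝ => (1 + ‖y‖ ^ 2) ^ (-(3 / 2 : ℝ) / 2) :=
    integrable_rpow_neg_one_add_norm_sq (by simp; norm_num)
  refine ⟨max 1 (∫ y : ℝ, (1 + ‖y‖ ^ 2) ^ (-(3 / 2 : ℝ) / 2)), by positivity, ?_⟩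
  intro a σ K hσ ha0 hsum hK x
  rcases Nat.eq_zero_or_pos x with rfl | hx
  · simp
    have : (0 : ℝ) ^ (1 + σ) = 0 := Real.zero_rpow (by linarith)
    rw [this]; simp
  have hx0 : (0 : ℝ) < x := by exact_mod_cast hx
  obtain ⟨k, hk⟩ : ∃ k : ℝ → ℂ, k = fun y : ℝ =>
    1 / ((σ : ℂ) + y * I) - 1 / ((σ : ℂ) + y * I + 1) := ⟨_, rfl⟩
  have hkint : Integrable k := hk ▸ integrable_cesaroKernel hσ
  have hre : ∀ y : ℝ, ((σ : ℂ) + y * I).re = σ := fun y => by simp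
  have hxn : ∀ y : ℝ, ‖(x : ℂ) ^ ((σ : ℂ) + y * I)‖ = (x : ℝ) ^ σ := fun y => by
    rw [norm_natCast_cpow_of_pos hx, hre]
  have hcx : Continuous fun y : ℝ => (x : ℂ) ^ ((σ : ℂ) + y * I) := by
    refine Continuous.const_cpow (by fun_prop) (Or.inl (by exact_mod_cast hx.ne'))
  obtain ⟨F, hF⟩ : ∃ F : ℕ → ℝ → ℂ, F = fun n (y : ℝ) =>
    LSeries.term a ((σ : ℂ) + y * I) n * ((x : ℂ) ^ ((σ : ℂ) + y * I) * k y) := ⟨_, rfl⟩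
  have hterm : ∀ n (y : ℝ), ‖LSeries.term a ((σ : ℂ) + y * I) n‖ = ‖LSeries.term a σ n‖ := by
    intro n y
    rw [LSeries.norm_term_eq, LSeries.norm_term_eq, hre, ofReal_re]
  have hFint : ∀ n, Integrable (F n) := by
    intro n
    have h1 : Integrable fun y : ℝ => (x : ℂ) ^ ((σ : ℂ) + y * I) * k y :=
      hkint.bdd_mul hcx.aestronglyMeasurable (Filter.Eventually.of_forall fun y => (hxn y).le)
    rw [hF]
    refine h1.bdd_mul ?_ (Filter.Eventually.of_forall fun y => (hterm n y).le)
    refine Continuous.aestronglyMeasurable ?_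
    rcases eq_or_ne n 0 with rfl | hn
    · simp only [LSeries.term_zero]; exact continuous_const
    · simp only [LSeries.term_of_ne_zero hn]
      refine continuous_const.div (Continuous.const_cpow (by fun_prop)
        (Or.inl (by exact_mod_cast hn))) fun y => ?_
      rw [Complex.cpow_ne_zero_iff]; left; exact_mod_cast hn
  have hFnorm : ∀ n, ∫ y, ‖F n y‖ = ‖LSeries.term a σ n‖ * ((x : ℝ) ^ σ * ∫ y, ‖k y‖) := by
    intro n
    rw [← integral_const_mul, ← integral_const_mul]
    refine integral_congr_ae (Filter.Eventually.of_forall fun y => ?_)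
    simp only [hF, norm_mul, hterm, hxn]
  have hFsum : Summable fun n => ∫ y, ‖F n y‖ := by
    simp only [hFnorm]
    exact (hsum.norm).mul_right _
  have key := hasSum_integral_of_summable_integral_norm hFint hFsum
  have hval : ∀ n, ∫ y, F n y = a n * (2 * Real.pi * ((max (1 - (n : ℝ) / x) 0 : ℝ) : ℂ)) := by
    intro n
    rcases eq_or_ne n 0 with rfl | hn
    · simp [hF, ha0]
    have hn0 : (0 : ℝ) < n := by exact_mod_cast Nat.pos_of_ne_zero hn
    rw [← cesaro_mellin_inversion hσ (div_pos hn0 hx0), ← integral_const_mul]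
    refine integral_congr_ae (Filter.Eventually.of_forall fun y => ?_)
    simp only [hF, hk, LSeries.term_of_ne_zero hn]
    rw [cpow_neg, ofReal_div, Complex.div_cpow_ofReal_nonneg hn0.le hx0.le]
    simp only [ofReal_natCast]
    have h1 : (n : ℂ) ^ ((σ : ℂ) + y * I) ≠ 0 := by
      rw [Complex.cpow_ne_zero_iff]; left; exact_mod_cast hn
    field_simp
  have hsupp : ∀ n ∉ range x, ∫ y, F n y = 0 := by
    intro n hn
    have : (x : ℝ) ≤ n := by exact_mod_cast not_lt.mp (fun h => hn (mem_range.mpr h))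
    rw [hval, max_eq_right]
    · simp
    · rw [sub_nonpos, le_div_iff₀ hx0]; linarith
  have hfin := key.unique (hasSum_sum_of_ne_finset_zero hsupp)
  have htot : ∀ y : ℝ, ‖∑' n, F n y‖ ≤
      K * (x : ℝ) ^ σ * (1 + ‖y‖ ^ 2) ^ (-(3 / 2 : ℝ) / 2) := by
    intro y
    have hK0 : 0 ≤ K := by
      have h1 := (norm_nonneg _).trans (hK 0)
      refine nonneg_of_mul_nonneg_left h1 (Real.rpow_pos_of_pos ?_ _)
      rw [norm_pos_iff]; intro h
      have := congrArg re h; simp at this; linarith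
    have : ∑' n, F n y = LSeries a ((σ : ℂ) + y * I) * ((x : ℂ) ^ ((σ : ℂ) + y * I) * k y) := by
      rw [hF]; simp only [tsum_mul_right]; rfl
    rw [this, norm_mul, norm_mul, hxn]
    calc _ ≤ (K * ‖(σ : ℂ) + y * I‖ ^ (1 / 2 : ℝ)) * ((x : ℝ) ^ σ * ‖k y‖) := by
          gcongr; exact hK y
      _ = K * (x : ℝ) ^ σ * (‖(σ : ℂ) + y * I‖ ^ (1 / 2 : ℝ) * ‖k y‖) := by ring
      _ ≤ _ := by
          have := norm_cpow_sub_half_le (y := y) hσ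
          rw [hk]; gcongr
  have hbound : ‖∫ y, ∑' n, F n y‖ ≤
      K * (x : ℝ) ^ σ * ∫ y : ℝ, (1 + ‖y‖ ^ 2) ^ (-(3 / 2 : ℝ) / 2) := by
    rw [← integral_const_mul]
    exact norm_integral_le_of_norm_le (hint.const_mul _) (Filter.Eventually.of_forall htot)
  rw [hfin] at hbound
  have e : ∑ n ∈ range x, ∫ y, F n y =
      (2 * Real.pi / x) * ∑ n ∈ range x, a n * (((x : ℝ) - n : ℝ) : ℂ) := by
    rw [mul_sum]
    refine sum_congr rfl fun n hn => ?_
    have h1 : (n : ℝ) ≤ x := by exact_mod_cast (mem_range.mp hn).le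
    rw [hval, max_eq_left (by rw [sub_nonneg, div_le_one hx0]; exact h1)]
    have : (x : ℂ) ≠ 0 := by exact_mod_cast hx.ne'
    push_cast
    field_simp
  rw [e, norm_mul] at hbound
  have e2 : ‖(2 * Real.pi / x : ℂ)‖ = 2 * Real.pi / x := by
    rw [norm_div, norm_mul, Complex.norm_natCast, norm_real, Real.norm_of_nonneg Real.pi_pos.le]; simp
  rw [e2] at hbound
  obtain ⟨W, hW⟩ : ∃ W, W = ‖∑ n ∈ range x, a n * (((x : ℝ) - n : ℝ) : ℂ)‖ := ⟨_, rfl⟩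
  rw [← hW] at hbound ⊢
  have hW0 : 0 ≤ W := hW ▸ norm_nonneg _
  have hxs : (x : ℝ) ^ (1 + σ) = x * (x : ℝ) ^ σ := by rw [Real.rpow_add hx0, Real.rpow_one]
  have hI0 : 0 ≤ ∫ y : ℝ, (1 + ‖y‖ ^ 2) ^ (-(3 / 2 : ℝ) / 2) :=
    integral_nonneg fun y => Real.rpow_nonneg (by positivity) _
  have hKx : 0 ≤ K * (x : ℝ) ^ σ := by
    have := (norm_nonneg _).trans (htot 0)
    simpa using this
  have h1 : 1 / x * W ≤ 2 * Real.pi / x * W := by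
    gcongr
    linarith [Real.pi_gt_three]
  have h2 := h1.trans hbound
  rw [one_div, inv_mul_le_iff₀ hx0] at h2
  refine h2.trans ?_
  rw [hxs]
  calc _ = (∫ y : ℝ, (1 + ‖y‖ ^ 2) ^ (-(3 / 2 : ℝ) / 2)) * (x * (K * (x : ℝ) ^ σ)) := by ring
    _ ≤ max 1 (∫ y : ℝ, (1 + ‖y‖ ^ 2) ^ (-(3 / 2 : ℝ) / 2)) * (x * (K * (x : ℝ) ^ σ)) := by
        gcongr; exact le_max_right _ _
    _ = _ := by ring
end

section
open DirichletCharacter ArithmeticFunction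

/-- Recovering a partial sum from two Cesàro means. -/
lemma norm_sum_le_of_cesaro {a : ℕ → ℂ} {x H : ℕ} {M E : ℝ} (hH : 0 < H)
    (h1 : ‖∑ n ∈ range x, a n * (((x : ℝ) - n : ℝ) : ℂ)‖ ≤ E)
    (h2 : ‖∑ n ∈ range (x + H), a n * ((((x + H : ℕ) : ℝ) - n : ℝ) : ℂ)‖ ≤ E)
    (hM : ∀ n ∈ range (x + H), ‖a n‖ ≤ M) :
    ‖∑ n ∈ range x, a n‖ ≤ 2 * E / H + H * M := by
  have hH0 : (0 : ℝ) < H := by exact_mod_cast hH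
  have hM0 : 0 ≤ M := (norm_nonneg _).trans (hM 0 (mem_range.mpr (by omega)))
  have e : (H : ℂ) * ∑ n ∈ range x, a n =
      ∑ n ∈ range (x + H), a n * ((((x + H : ℕ) : ℝ) - n : ℝ) : ℂ) -
        ∑ n ∈ range x, a n * (((x : ℝ) - n : ℝ) : ℂ) -
        ∑ n ∈ Ico x (x + H), a n * ((((x + H : ℕ) : ℝ) - n : ℝ) : ℂ) := by
    rw [← sum_range_add_sum_Ico _ (Nat.le_add_right x H), mul_sum, sub_right_comm,
      add_sub_cancel_right, ← sum_sub_distrib]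
    refine sum_congr rfl fun n _ => ?_
    push_cast
    ring
  have h3 : ‖∑ n ∈ Ico x (x + H), a n * ((((x + H : ℕ) : ℝ) - n : ℝ) : ℂ)‖ ≤ H * (M * H) := by
    refine (norm_sum_le_of_le (f := fun n => a n * ((((x + H : ℕ) : ℝ) - n : ℝ) : ℂ))
      (n := fun _ => M * H) _ fun n hn => ?_).trans (by simp)
    rw [norm_mul, Complex.norm_real, Real.norm_eq_abs]
    obtain ⟨hn1, hn2⟩ := mem_Ico.mp hn
    have b1 : (x : ℝ) ≤ n := by exact_mod_cast hn1
    have b2 : (n : ℝ) ≤ (x + H : ℕ) := by exact_mod_cast hn2.le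
    refine mul_le_mul (hM n (mem_range.mpr hn2)) ?_ (abs_nonneg _) hM0
    rw [abs_of_nonneg (by linarith)]
    push_cast at b2 ⊢
    linarith
  have h4 : H * ‖∑ n ∈ range x, a n‖ ≤ E + E + H * (M * H) := by
    calc H * ‖∑ n ∈ range x, a n‖ = ‖(H : ℂ) * ∑ n ∈ range x, a n‖ := by
          rw [norm_mul, Complex.norm_natCast]
      _ ≤ _ := by
          rw [e]
          exact (norm_sub_le _ _).trans (add_le_add ((norm_sub_le _ _).trans (add_le_add h2 h1)) h3)
  rw [← mul_le_mul_iff_right₀ hH0]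
  refine h4.trans (le_of_eq ?_)
  field_simp
  ring

lemma norm_char_mul_vonMangoldt_le {q : ℕ} (χ : DirichletCharacter ℂ q) (n : ℕ) {w : ℝ}
    (hw : 0 ≤ w) : ‖χ n * ((Λ n * w : ℝ) : ℂ)‖ ≤ Real.log n * w := by
  rw [norm_mul, Complex.norm_real, Real.norm_of_nonneg (mul_nonneg vonMangoldt_nonneg hw)]
  calc _ ≤ 1 * (Λ n * w) :=
        mul_le_mul_of_nonneg_right (χ.norm_le_one _) (mul_nonneg vonMangoldt_nonneg hw)
    _ ≤ _ := by rw [one_mul]; exact mul_le_mul_of_nonneg_right vonMangoldt_le_log hw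

lemma one_le_log_natCast {N : ℕ} (hN : 3 ≤ N) : 1 ≤ Real.log N := by
  rw [Real.le_log_iff_exp_le (by positivity)]
  have : (3 : ℝ) ≤ N := by exact_mod_cast hN
  linarith [Real.exp_one_lt_d9]

/-- Bound for the logarithmically weighted prime sums. -/
lemma exists_norm_sum_log_pow_le (κ B : ℕ) : ∃ C : ℝ, 0 < C ∧ ∀ N : ℕ, 3 ≤ N →
    ∀ (r : ℕ) [NeZero r] (ψ : DirichletCharacter ℂ r), ψ.IsPrimitive → ψ ≠ 1 →
      (r : ℝ) ≤ Real.log N ^ B → ∀ x ≤ N + 1,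
        ‖∑ n ∈ range x, ψ n * ((Λ n * Real.log n ^ (2 * κ) : ℝ) : ℂ)‖ ≤
          C * N * Real.log N ^ (κ + B + 1) := by
  obtain ⟨C1, hC11, hC1⟩ := exists_norm_LSeries_vonMangoldt_log_pow_le (2 * κ)
    (show (0 : ℝ) < 1 / 2 by norm_num)
  obtain ⟨C2, hC20, hC2⟩ := exists_norm_sum_mul_sub_le
  obtain ⟨C3, hC31, hC3⟩ := exists_log_pow_le κ one_pos
  refine ⟨2 * (C2 * C1 * 1000) + (1 + C3) * 4 ^ (2 * κ + 1), by positivity, ?_⟩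
  intro N hN r _ ψ hprim hψ hrL x hx
  have hL1 := one_le_log_natCast hN
  obtain ⟨L, hL⟩ : ∃ L, L = Real.log N := ⟨_, rfl⟩
  rw [← hL] at hL1 hrL ⊢
  have hL0 : 0 < L := by linarith
  have hN0 : (3 : ℝ) ≤ N := by exact_mod_cast hN
  have hr1 : (1 : ℝ) ≤ r := by exact_mod_cast NeZero.one_le
  obtain ⟨a, ha⟩ : ∃ a : ℕ → ℂ, a = fun n : ℕ => ψ n * ((Λ n * Real.log n ^ (2 * κ) : ℝ) : ℂ) :=
    ⟨_, rfl⟩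
  obtain ⟨H, hH⟩ : ∃ H : ℕ, H = ⌈(N : ℝ) / L ^ κ⌉₊ := ⟨_, rfl⟩
  have hLκ : 1 ≤ L ^ κ := one_le_pow₀ hL1
  have hH0 : 0 < H := by rw [hH, Nat.ceil_pos]; positivity
  have hHN : H ≤ N := by
    rw [hH, Nat.ceil_le]
    exact div_le_self (by positivity) hLκ
  have hHle : (H : ℝ) ≤ (1 + C3) * N / L ^ κ := by
    have h1 := (Nat.ceil_lt_add_one (show 0 ≤ (N : ℝ) / L ^ κ by positivity)).le
    rw [← hH] at h1
    have h2 := hC3 N (by linarith)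
    rw [Real.rpow_one, ← hL] at h2
    have h3 : 1 ≤ C3 * N / L ^ κ := by rwa [one_le_div (by positivity)]
    calc (H : ℝ) ≤ N / L ^ κ + C3 * N / L ^ κ := by linarith
      _ = _ := by ring
  have hHge : (N : ℝ) / L ^ κ ≤ H := by rw [hH]; exact Nat.le_ceil _
  have hσ : 1 < 1 + 1 / L := by have : 0 < 1 / L := by positivity
                                linarith
  have hσ2 : 1 + 1 / L ≤ 2 := by
    have : 1 / L ≤ 1 := by rw [div_le_one hL0]; exact hL1
    linarith
  have hsum : LSeriesSummable a ((1 + 1 / L : ℝ) : ℂ) := by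
    rw [ha]; exact LSeriesSummable_vonMangoldt_log_pow ψ _ (by simpa using hL0)
  have hG : ∀ y : ℝ, ‖LSeries a (((1 + 1 / L : ℝ) : ℂ) + y * Complex.I)‖ ≤
      (C1 * r) * ‖((1 + 1 / L : ℝ) : ℂ) + y * Complex.I‖ ^ (1 / 2 : ℝ) := by
    intro y
    have hre : (((1 + 1 / L : ℝ) : ℂ) + y * Complex.I).re = 1 + 1 / L := by simp
    have := hC1 r ψ hprim hψ (((1 + 1 / L : ℝ) : ℂ) + y * Complex.I) (by rw [hre]; exact hσ)
      (by rw [hre]; exact hσ2)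
    rw [← ha] at this
    refine this.trans ?_
    rw [Real.mul_rpow (by positivity) (norm_nonneg _), mul_assoc]
    gcongr
    calc (r : ℝ) ^ (1 / 2 : ℝ) ≤ (r : ℝ) ^ (1 : ℝ) :=
          Real.rpow_le_rpow_of_exponent_le hr1 (by norm_num)
      _ = r := Real.rpow_one _
  have hT := hC2 a (1 + 1 / L) (C1 * r) hσ.le (by rw [ha]; simp) hsum hG
  have hpow : ∀ z : ℕ, z ≤ 3 * N → (z : ℝ) ^ (1 + (1 + 1 / L)) ≤ 1000 * (N : ℝ) ^ 2 := by
    intro z hz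
    have hz' : (z : ℝ) ≤ 3 * N := by exact_mod_cast hz
    have h3N : (0 : ℝ) < 3 * N := by positivity
    have h1 : (3 * N : ℝ) ^ (1 / L) ≤ 9 := by
      calc (3 * N : ℝ) ^ (1 / L) ≤ ((N : ℝ) ^ (2 : ℝ)) ^ (1 / L) := by
            refine Real.rpow_le_rpow h3N.le ?_ (by positivity)
            rw [Real.rpow_two]; nlinarith
        _ = Real.exp 2 := by
            rw [← Real.rpow_mul (by positivity), Real.rpow_def_of_pos (by positivity), ← hL]
            congr 1; field_simp
        _ = Real.exp 1 ^ 2 := by rw [← Real.exp_nat_mul]; norm_num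
        _ ≤ 3 ^ 2 := by
            have := Real.exp_one_lt_d9
            gcongr; linarith
        _ = 9 := by norm_num
    calc (z : ℝ) ^ (1 + (1 + 1 / L)) ≤ (3 * N : ℝ) ^ (1 + (1 + 1 / L)) :=
          Real.rpow_le_rpow (by positivity) hz' (by positivity)
      _ = (3 * N : ℝ) ^ 2 * (3 * N : ℝ) ^ (1 / L) := by
          rw [show 1 + (1 + 1 / L) = 2 + 1 / L by ring, Real.rpow_add h3N, Real.rpow_two]
      _ ≤ (3 * N : ℝ) ^ 2 * 9 := by gcongr
      _ ≤ _ := by nlinarith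
  have hT' : ∀ z : ℕ, z ≤ 3 * N → ‖∑ n ∈ range z, a n * (((z : ℝ) - n : ℝ) : ℂ)‖ ≤
      (C2 * C1 * 1000) * L ^ B * (N : ℝ) ^ 2 := by
    intro z hz
    calc _ ≤ C2 * (C1 * r) * (z : ℝ) ^ (1 + (1 + 1 / L)) := hT z
      _ ≤ C2 * (C1 * L ^ B) * (1000 * (N : ℝ) ^ 2) := by gcongr; exact hpow z hz
      _ = _ := by ring
  have hM : ∀ n ∈ range (x + H), ‖a n‖ ≤ (4 * L) ^ (2 * κ + 1) := by
    intro n hn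
    have hn := mem_range.mp hn
    rw [ha]
    refine (norm_char_mul_vonMangoldt_le ψ n (pow_nonneg (Real.log_natCast_nonneg n) _)).trans ?_
    rw [← pow_succ']
    refine pow_le_pow_left₀ (Real.log_natCast_nonneg n) ?_ _
    rcases Nat.eq_zero_or_pos n with rfl | hn0
    · simp; linarith
    have h1 : (n : ℝ) ≤ (N : ℝ) ^ 2 := by
      have : n ≤ N ^ 2 := by nlinarith
      exact_mod_cast this
    calc Real.log n ≤ Real.log ((N : ℝ) ^ 2) :=
          Real.log_le_log (by exact_mod_cast hn0) h1
      _ = 2 * L := by rw [Real.log_pow, hL]; norm_num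
      _ ≤ 4 * L := by linarith
  have hfin := norm_sum_le_of_cesaro hH0 (hT' x (by omega)) (hT' (x + H) (by omega)) hM
  rw [ha] at hfin
  refine hfin.trans ?_
  have f1 : 2 * ((C2 * C1 * 1000) * L ^ B * (N : ℝ) ^ 2) / H ≤
      2 * (C2 * C1 * 1000) * N * L ^ (κ + B + 1) := by
    calc _ ≤ 2 * ((C2 * C1 * 1000) * L ^ B * (N : ℝ) ^ 2) / (N / L ^ κ) := by gcongr
      _ = 2 * (C2 * C1 * 1000) * N * (L ^ (κ + B) * 1) := by rw [pow_add]; field_simp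
      _ ≤ 2 * (C2 * C1 * 1000) * N * (L ^ (κ + B) * L) := by gcongr
      _ = _ := by ring
  have f2 : (H : ℝ) * (4 * L) ^ (2 * κ + 1) ≤
      (1 + C3) * 4 ^ (2 * κ + 1) * N * L ^ (κ + B + 1) := by
    calc _ ≤ (1 + C3) * N / L ^ κ * (4 * L) ^ (2 * κ + 1) := by gcongr
      _ = (1 + C3) * 4 ^ (2 * κ + 1) * N * L ^ (κ + 1) := by
          rw [mul_pow, show 2 * κ + 1 = κ + (κ + 1) by ring, pow_add L κ (κ + 1)]; field_simp
      _ ≤ _ := by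
          gcongr
          omega
  linarith
end

section
open DirichletCharacter ArithmeticFunction

lemma Ioc_eq_Ico_succ (a b : ℕ) : Ioc a b = Ico (a + 1) (b + 1) := by
  ext i; simp only [mem_Ioc, mem_Ico]; omega

lemma sum_vonMangoldt_not_coprime_le {m : ℕ} (hm : m ≠ 0) (N : ℕ) :
    ∑ n ∈ range (N + 1) with ¬ n.Coprime m, Λ n ≤ (Nat.log 2 N + 1) * Real.log m := by
  obtain ⟨J, hJ⟩ : ∃ J, J = Nat.log 2 N + 1 := ⟨_, rfl⟩
  calc ∑ n ∈ range (N + 1) with ¬ n.Coprime m, Λ n ≤ ∑ n ∈ (m ^ J).divisors, Λ n := by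
        rw [← sum_filter_ne_zero (s := {n ∈ range (N + 1) | ¬ n.Coprime m})]
        refine sum_le_sum_of_subset_of_nonneg (fun n hn => ?_) fun _ _ _ => vonMangoldt_nonneg
        simp only [mem_filter, mem_range] at hn
        obtain ⟨⟨hnN, hcop⟩, hne⟩ := hn
        rw [Nat.mem_divisors]
        refine ⟨?_, pow_ne_zero _ hm⟩
        obtain ⟨p, k, hp, hk, rfl⟩ := (isPrimePow_nat_iff _).mp (vonMangoldt_ne_zero_iff.mp hne)
        have hpm : p ∣ m := by
          by_contra h
          exact hcop (((hp.coprime_iff_not_dvd).mpr h).pow_left k)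
        have hkJ : k ≤ J := by
          have h1 : 2 ^ k ≤ N := (Nat.pow_le_pow_left hp.two_le k).trans (by omega)
          have := Nat.le_log_of_pow_le (by norm_num) h1
          omega
        exact (pow_dvd_pow_of_dvd hpm k).trans (pow_dvd_pow m hkJ)
    _ = Real.log ((m ^ J : ℕ) : ℝ) := vonMangoldt_sum
    _ = _ := by rw [hJ]; push_cast; rw [Real.log_pow]; push_cast; ring

/-- Siegel–Walfisz theorem for primitive characters. -/
theorem exists_norm_sum_primitive_le (A B : ℕ) : ∃ C : ℝ, 0 < C ∧ ∀ N : ℕ, 3 ≤ N →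
    ∀ (r : ℕ) [NeZero r] (ψ : DirichletCharacter ℂ r), ψ.IsPrimitive → ψ ≠ 1 →
      (r : ℝ) ≤ Real.log N ^ B → ∀ x ≤ N,
        ‖∑ n ∈ range (x + 1), ψ n * (Λ n : ℂ)‖ ≤ C * N / Real.log N ^ A := by
  obtain ⟨κ, hκ⟩ : ∃ κ, κ = A + B + 1 := ⟨_, rfl⟩
  obtain ⟨C, hC, hmain⟩ := exists_norm_sum_log_pow_le κ B
  obtain ⟨C3, hC31, hC3⟩ := exists_log_pow_le (A + 1) (show (0 : ℝ) < 1 / 2 by norm_num)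
  refine ⟨2 * C3 + 2 ^ (2 * κ) * (2 * C), by positivity, ?_⟩
  intro N hN r _ ψ hprim hψ hrL x hx
  have hN0 : (3 : ℝ) ≤ N := by exact_mod_cast hN
  have hL1 := one_le_log_natCast hN
  have hmain' := hmain N hN r ψ hprim hψ hrL
  have hC3' := hC3 N (by linarith)
  obtain ⟨L, hL⟩ : ∃ L, L = Real.log N := ⟨_, rfl⟩
  have hlogle : ∀ n : ℕ, n ≤ N → Real.log n ≤ L := by
    intro n hn
    rcases Nat.eq_zero_or_pos n with rfl | hn0
    · simp; linarith
    · rw [hL]; exact Real.log_le_log (by exact_mod_cast hn0) (by exact_mod_cast hn)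
  rw [← hL] at hL1 hmain' hC3' ⊢
  have hL0 : 0 < L := by linarith
  rw [← Real.sqrt_eq_rpow] at hC3'
  obtain ⟨s, hs⟩ : ∃ s, s = Nat.sqrt N := ⟨_, rfl⟩
  have hs1 : (s : ℝ) ≤ Real.sqrt N := hs ▸ Real.nat_sqrt_le_real_sqrt
  have hs2 : Real.sqrt N ≤ s + 1 := hs ▸ Real.real_sqrt_le_nat_sqrt_succ
  have hsq : 1 ≤ Real.sqrt N := Real.one_le_sqrt.mpr (by linarith)
  have hsqN : Real.sqrt N * Real.sqrt N = N := Real.mul_self_sqrt (by linarith)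
  have hsmall : ∀ z ≤ s, z ≤ N → ‖∑ n ∈ range (z + 1), ψ n * (Λ n : ℂ)‖ ≤ 2 * C3 * N / L ^ A := by
    intro z hz hzN
    have h1 : ‖∑ n ∈ range (z + 1), ψ n * (Λ n : ℂ)‖ ≤ (z + 1) * L := by
      refine (norm_sum_le_of_le (n := fun _ => L) _ fun n hn => ?_).trans (by simp)
      have := norm_char_mul_vonMangoldt_le ψ n zero_le_one
      rw [mul_one, mul_one] at this
      exact this.trans (hlogle n (by have := mem_range.mp hn; omega))
    refine h1.trans ?_
    have hz' : (z : ℝ) ≤ s := by exact_mod_cast hz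
    rw [le_div_iff₀ (by positivity)]
    calc (z + 1) * L * L ^ A = (z + 1) * L ^ (A + 1) := by ring
      _ ≤ (2 * Real.sqrt N) * (C3 * Real.sqrt N) := by
          gcongr; linarith
      _ = 2 * C3 * N := by linear_combination (2 * C3) * hsqN
  rcases le_or_gt x s with hxs | hxs
  · refine (hsmall x hxs hx).trans ?_
    gcongr
    have : 0 ≤ 2 ^ (2 * κ) * (2 * C) := by positivity
    linarith
  have hlogge : ∀ n : ℕ, s < n → L / 2 ≤ Real.log n := by
    intro n hn
    rw [hL, ← Real.log_sqrt (by linarith)]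
    refine Real.log_le_log (by positivity) (hs2.trans ?_)
    exact_mod_cast hn
  obtain ⟨w, hw⟩ : ∃ w : ℕ → ℝ, w = fun n : ℕ => (Real.log n ^ (2 * κ))⁻¹ := ⟨_, rfl⟩
  have hbig : ‖∑ n ∈ Ioc s x, ψ n * (Λ n : ℂ)‖ ≤ 2 ^ (2 * κ) * (2 * C) * N / L ^ A := by
    have hpos : ∀ n : ℕ, s < n → 0 < Real.log n := fun n hn => by linarith [hlogge n hn]
    have h1 := norm_sum_mul_le_of_antitone (w := w)
      (a := fun n : ℕ => ψ n * ((Λ n * Real.log n ^ (2 * κ) : ℝ) : ℂ))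
      (B := C * N * L ^ (κ + B + 1) + C * N * L ^ (κ + B + 1)) (m := s) (n := x)
      (fun i hi => ?_) (fun i hi _ => ?_) (fun k hk1 hk2 => ?_)
    · have h2 := h1.resolve_right (by omega)
      have e : ∑ i ∈ Ioc s x, (w i : ℂ) * (ψ i * ((Λ i * Real.log i ^ (2 * κ) : ℝ) : ℂ)) =
          ∑ n ∈ Ioc s x, ψ n * (Λ n : ℂ) := by
        refine sum_congr rfl fun i hi => ?_
        have : Real.log i ≠ 0 := (hpos i (mem_Ioc.mp hi).1).ne'
        simp only [hw]
        generalize Real.log i = t at this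
        have h3 : (t : ℂ) ≠ 0 := by exact_mod_cast this
        push_cast
        field_simp
      rw [e] at h2
      refine h2.trans ?_
      have hw1 : w (s + 1) ≤ 2 ^ (2 * κ) / L ^ (2 * κ) := by
        rw [hw]
        calc (Real.log (s + 1 : ℕ) ^ (2 * κ))⁻¹ ≤ ((L / 2) ^ (2 * κ))⁻¹ := by
              gcongr; exact hlogge _ (by omega)
          _ = _ := by rw [div_pow, inv_div]
      calc _ ≤ 2 ^ (2 * κ) / L ^ (2 * κ) * (C * N * L ^ (κ + B + 1) + C * N * L ^ (κ + B + 1)) := by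
            gcongr
        _ = 2 ^ (2 * κ) * (2 * C) * N / L ^ A := by
            have : L ^ (2 * κ) = L ^ (κ + B + 1) * L ^ A := by
              rw [← pow_add]; congr 1; omega
            rw [this]
            field_simp
            ring
    · rw [hw]; exact inv_nonneg.mpr (pow_nonneg (Real.log_natCast_nonneg i) _)
    · have hi := (mem_Ioc.mp hi).1
      rw [hw]
      have := hpos i hi
      simp only
      have h0 : (0 : ℝ) < i := by exact_mod_cast (show 0 < i by omega)
      have h1 : (i : ℝ) ≤ (i + 1 : ℕ) := by exact_mod_cast Nat.le_succ i
      exact inv_anti₀ (by positivity) (pow_le_pow_left₀ this.le (Real.log_le_log h0 h1) _)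
    · have e : ∑ i ∈ Ioc s k, ψ i * ((Λ i * Real.log i ^ (2 * κ) : ℝ) : ℂ) =
          ∑ i ∈ range (k + 1), ψ i * ((Λ i * Real.log i ^ (2 * κ) : ℝ) : ℂ) -
          ∑ i ∈ range (s + 1), ψ i * ((Λ i * Real.log i ^ (2 * κ) : ℝ) : ℂ) := by
        rw [← sum_Ico_eq_sub _ (by omega), Ioc_eq_Ico_succ]
      rw [e]
      exact (norm_sub_le _ _).trans (add_le_add (hmain' _ (by omega)) (hmain' _ (by omega)))
  have e : ∑ n ∈ range (x + 1), ψ n * (Λ n : ℂ) =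
      ∑ n ∈ range (s + 1), ψ n * (Λ n : ℂ) + ∑ n ∈ Ioc s x, ψ n * (Λ n : ℂ) := by
    rw [← sum_range_add_sum_Ico _ (show s + 1 ≤ x + 1 by omega), Ioc_eq_Ico_succ]
  rw [e]
  refine (norm_add_le _ _).trans ((add_le_add (hsmall s le_rfl (by omega)) hbig).trans ?_)
  rw [← add_div, ← add_mul]

/-- Siegel–Walfisz theorem for non-principal characters. -/
theorem exists_norm_sum_char_vonMangoldt_le (A B : ℕ) : ∃ C : ℝ, 0 < C ∧ ∀ N : ℕ, 3 ≤ N →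
    ∀ (r : ℕ) [NeZero r] (ψ : DirichletCharacter ℂ r), ψ ≠ 1 →
      (r : ℝ) ≤ Real.log N ^ B → ∀ x ≤ N,
        ‖∑ n ∈ range (x + 1), ψ n * (Λ n : ℂ)‖ ≤ C * N / Real.log N ^ A := by
  obtain ⟨C, hC, hmain⟩ := exists_norm_sum_primitive_le A B
  obtain ⟨C3, hC31, hC3⟩ := exists_log_pow_le (B + 1 + A) one_pos
  refine ⟨C + 3 * C3, by positivity, ?_⟩
  intro N hN r _ ψ hψ hrL x hx
  have hN0 : (3 : ℝ) ≤ N := by exact_mod_cast hN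
  have hL1 := one_le_log_natCast hN
  have hr0 : r ≠ 0 := NeZero.ne r
  have hr1 : (1 : ℝ) ≤ r := by exact_mod_cast NeZero.one_le
  have hdvd := ψ.conductor_dvd_level
  have : NeZero ψ.conductor := ⟨fun h => hr0 (by rw [h] at hdvd; exact Nat.eq_zero_of_zero_dvd hdvd)⟩
  have hcr : (ψ.conductor : ℝ) ≤ r := by exact_mod_cast Nat.le_of_dvd (Nat.pos_of_ne_zero hr0) hdvd
  have hne : ψ.primitiveCharacter ≠ 1 := by
    intro h
    apply hψ
    rw [← ψ.changeLevel_primitiveCharacter, h, changeLevel_one]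
  have h1 := hmain N hN ψ.conductor ψ.primitiveCharacter ψ.primitiveCharacter_isPrimitive hne
    (hcr.trans hrL) x hx
  have hC3' := hC3 N (by linarith)
  rw [Real.rpow_one] at hC3'
  have hdiff : ‖∑ n ∈ range (x + 1), ψ n * (Λ n : ℂ) -
      ∑ n ∈ range (x + 1), ψ.primitiveCharacter n * (Λ n : ℂ)‖ ≤ 3 * C3 * N / Real.log N ^ A := by
    rw [← sum_sub_distrib]
    have h2 : ‖∑ n ∈ range (x + 1), (ψ n * (Λ n : ℂ) - ψ.primitiveCharacter n * (Λ n : ℂ))‖ ≤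
        ∑ n ∈ range (x + 1) with ¬ n.Coprime r, Λ n := by
      rw [sum_filter]
      refine norm_sum_le_of_le _ fun n _ => ?_
      split_ifs with hn
      · have := changeLevel_natCast hdvd ψ.primitiveCharacter hn
        rw [ψ.changeLevel_primitiveCharacter] at this
        rw [this]; simp
      · have : ψ n = 0 := ψ.map_nonunit (by rwa [ZMod.isUnit_iff_coprime])
        rw [this, zero_mul, zero_sub, norm_neg, norm_mul, Complex.norm_real,
          Real.norm_of_nonneg vonMangoldt_nonneg]
        exact mul_le_of_le_one_left vonMangoldt_nonneg (norm_le_one _ _)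
    refine h2.trans ((sum_vonMangoldt_not_coprime_le hr0 x).trans ?_)
    rw [le_div_iff₀ (by positivity)]
    have h3 : (Nat.log 2 x : ℝ) + 1 ≤ 3 * Real.log N := by
      have h4 : (Nat.log 2 x : ℝ) ≤ Nat.log 2 N := by exact_mod_cast Nat.log_mono_right hx
      have h5 : (Nat.log 2 N : ℝ) * Real.log 2 ≤ Real.log N := by
        rw [← Real.log_pow]
        refine Real.log_le_log (by positivity) ?_
        exact_mod_cast Nat.pow_log_le_self 2 (by omega)
      have h6 := Real.log_two_gt_d9
      have h7 : (Nat.log 2 N : ℝ) * (1 / 2) ≤ (Nat.log 2 N : ℝ) * Real.log 2 := by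
        gcongr; linarith
      linarith
    have h8 : Real.log r ≤ Real.log N ^ B := by
      have := Real.log_le_sub_one_of_pos (by linarith : (0 : ℝ) < r)
      linarith
    calc _ ≤ 3 * Real.log N * Real.log N ^ B * Real.log N ^ A := by
          gcongr
      _ = 3 * Real.log N ^ (B + 1 + A) := by ring
      _ ≤ 3 * (C3 * N) := by gcongr
      _ = _ := by ring
  have := norm_add_le (∑ n ∈ range (x + 1), ψ.primitiveCharacter n * (Λ n : ℂ))
    (∑ n ∈ range (x + 1), ψ n * (Λ n : ℂ) -
      ∑ n ∈ range (x + 1), ψ.primitiveCharacter n * (Λ n : ℂ))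
  rw [add_sub_cancel] at this
  refine this.trans ((add_le_add h1 hdiff).trans (le_of_eq ?_))
  rw [← add_div]
  ring
end

section
open Complex

/-- The additive character `x ↦ exp (2 π i x)`. -/
def ex (x : ℝ) : ℂ := Complex.exp (2 * Real.pi * x * I)

lemma ex_add (x y : ℝ) : ex (x + y) = ex x * ex y := by
  rw [ex, ex, ex, ← Complex.exp_add]; push_cast; ring_nf

lemma ex_zero : ex 0 = 1 := by simp [ex]

lemma ex_intCast (n : ℤ) : ex n = 1 := by
  rw [ex, Complex.exp_eq_one_iff]
  exact ⟨n, by push_cast; ring⟩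

lemma ex_add_intCast (x : ℝ) (n : ℤ) : ex (x + n) = ex x := by
  rw [ex_add, ex_intCast, mul_one]

lemma norm_ex (x : ℝ) : ‖ex x‖ = 1 := by
  rw [ex, show (2 * Real.pi * x * I : ℂ) = ((2 * Real.pi * x : ℝ) : ℂ) * I by push_cast; ring]
  exact norm_exp_ofReal_mul_I _

lemma ex_neg (x : ℝ) : ex (-x) = (starRingEnd ℂ) (ex x) := by
  rw [ex, ex, ← Complex.exp_conj]
  congr 1
  simp only [map_mul, Complex.conj_ofReal, Complex.conj_I, map_ofNat]
  push_cast
  ring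

lemma ex_mul_conj (x y : ℝ) : ex x * (starRingEnd ℂ) (ex y) = ex (x - y) := by
  rw [← ex_neg, ← ex_add, sub_eq_add_neg]

lemma ex_nat_mul (n : ℕ) (x : ℝ) : ex (n * x) = ex x ^ n := by
  rw [ex, ex, ← Complex.exp_nat_mul]; push_cast; ring_nf

lemma norm_ex_sub_one (x : ℝ) : ‖ex x - 1‖ = 2 * |Real.sin (Real.pi * x)| := by
  have h := Complex.norm_exp_I_mul_ofReal_sub_one (2 * Real.pi * x)
  rw [show (I * ((2 * Real.pi * x : ℝ) : ℂ)) = 2 * Real.pi * x * I by push_cast; ring] at h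
  rw [ex, h, norm_mul, Real.norm_eq_abs, Real.norm_eq_abs]
  rw [show 2 * Real.pi * x / 2 = Real.pi * x by ring]
  norm_num

lemma norm_ex_sub_one_le (x : ℝ) : ‖ex x - 1‖ ≤ 2 * Real.pi * |x| := by
  rw [norm_ex_sub_one]
  have := Real.abs_sin_le_abs (x := Real.pi * x)
  rw [abs_mul, abs_of_pos Real.pi_pos] at this
  linarith

lemma norm_ex_sub_ex_le (x y : ℝ) : ‖ex x - ex y‖ ≤ 2 * Real.pi * |x - y| := by
  have : ex x - ex y = ex y * (ex (x - y) - 1) := by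
    rw [mul_sub, ← ex_add, mul_one]; congr 2; ring
  rw [this, norm_mul, norm_ex, one_mul]
  exact norm_ex_sub_one_le _

lemma le_sin_pi_mul {u : ℝ} (h0 : 0 ≤ u) (h1 : u ≤ 1 / 2) : 2 * u ≤ Real.sin (Real.pi * u) := by
  have := Real.mul_le_sin (x := Real.pi * u) (by positivity) (by nlinarith [Real.pi_pos])
  have e : 2 / Real.pi * (Real.pi * u) = 2 * u := by field_simp
  rwa [e] at this

lemma inv_sin_pi_mul_le {u : ℝ} (h0 : 0 < u) (h1 : u < 1) :
    0 < Real.sin (Real.pi * u) ∧ (Real.sin (Real.pi * u))⁻¹ ≤ (1 / 2) * (u⁻¹ + (1 - u)⁻¹) := by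
  have h1' : 0 < 1 - u := by linarith
  have hi1 := inv_pos.mpr h0
  have hi2 := inv_pos.mpr h1'
  rcases le_total u (1 / 2) with h | h
  · have h2 := le_sin_pi_mul h0.le h
    have h3 : 0 < Real.sin (Real.pi * u) := by linarith
    refine ⟨h3, ?_⟩
    have : (Real.sin (Real.pi * u))⁻¹ ≤ (2 * u)⁻¹ := inv_anti₀ (by linarith) h2
    rw [mul_inv] at this
    linarith
  · have h2 := le_sin_pi_mul h1'.le (by linarith)
    rw [show Real.pi * (1 - u) = Real.pi - Real.pi * u by ring, Real.sin_pi_sub] at h2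
    have h3 : 0 < Real.sin (Real.pi * u) := by linarith
    refine ⟨h3, ?_⟩
    have : (Real.sin (Real.pi * u))⁻¹ ≤ (2 * (1 - u))⁻¹ := inv_anti₀ (by linarith) (by linarith)
    rw [mul_inv] at this
    linarith

lemma ex_fract (x : ℝ) : ex (Int.fract x) = ex x := by
  rw [← ex_add_intCast (Int.fract x) ⌊x⌋, Int.fract_add_floor]

/-- Geometric sums of `ex`. -/
lemma norm_sum_ex_le {θ : ℝ} (h : 0 < Int.fract θ) (m n : ℕ) :
    ‖∑ k ∈ Ico m n, ex (k * θ)‖ ≤ (1 / 2) * ((Int.fract θ)⁻¹ + (1 - Int.fract θ)⁻¹) := by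
  have hlt := Int.fract_lt_one θ
  obtain ⟨h1, h2⟩ := inv_sin_pi_mul_le h hlt
  refine le_trans ?_ h2
  have hne : ‖ex θ - 1‖ = 2 * Real.sin (Real.pi * Int.fract θ) := by
    rw [← ex_fract, norm_ex_sub_one, abs_of_pos h1]
  have hne' : ex θ ≠ 1 := by
    intro h0
    rw [h0, sub_self, norm_zero] at hne
    linarith
  rcases le_or_gt n m with hmn | hmn
  · rw [Ico_eq_empty (by omega), sum_empty, norm_zero]; positivity
  have e : ∑ k ∈ Ico m n, ex (k * θ) = (ex θ ^ n - ex θ ^ m) / (ex θ - 1) := by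
    rw [← geom_sum_Ico hne' hmn.le]
    exact sum_congr rfl fun k _ => ex_nat_mul k θ
  rw [e, norm_div, hne]
  have h3 : ‖ex θ ^ n - ex θ ^ m‖ ≤ 2 := by
    refine (norm_sub_le _ _).trans ?_
    rw [norm_pow, norm_pow, norm_ex]; norm_num
  rw [div_le_iff₀ (by positivity)]
  have : (Real.sin (Real.pi * Int.fract θ))⁻¹ * (2 * Real.sin (Real.pi * Int.fract θ)) = 2 := by
    field_simp
  linarith

/-- Sum of reciprocals of points in `[δ, 1)` that are `δ`-separated. -/
lemma sum_inv_le_of_separated {ι : Type*} (S : Finset ι) (u : ι → ℝ) {δ : ℝ} (hδ : 0 < δ)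
    (hδ1 : δ ≤ 1) (hu : ∀ i ∈ S, δ ≤ u i ∧ u i < 1)
    (hsep : ∀ i ∈ S, ∀ j ∈ S, i ≠ j → δ ≤ |u i - u j|) :
    ∑ i ∈ S, (u i)⁻¹ ≤ δ⁻¹ * (1 + Real.log δ⁻¹) := by
  obtain ⟨K, hK⟩ : ∃ K, K = ⌊δ⁻¹⌋₊ := ⟨_, rfl⟩
  have hpos : ∀ i ∈ S, 0 ≤ u i / δ := fun i hi => by
    exact div_nonneg (hδ.le.trans (hu i hi).1) hδ.le
  have hmem : ∀ i ∈ S, ⌊u i / δ⌋₊ ∈ Icc 1 K := fun i hi => by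
    obtain ⟨h1, h2⟩ := hu i hi
    rw [mem_Icc, hK]
    refine ⟨Nat.le_floor ?_, Nat.floor_le_floor ?_⟩
    · rw [Nat.cast_one]; exact (one_le_div hδ).mpr h1
    · rw [div_eq_mul_inv]; exact mul_le_of_le_one_left (by positivity) h2.le
  have hinj : Set.InjOn (fun i => ⌊u i / δ⌋₊) S := by
    intro i hi j hj hij
    by_contra hne
    have h1 := hsep i hi j hj hne
    simp only at hij
    have a1 := Nat.floor_le (hpos i hi)
    have a2 := Nat.lt_floor_add_one (u i / δ)
    have b1 := Nat.floor_le (hpos j hj)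
    have b2 := Nat.lt_floor_add_one (u j / δ)
    rw [hij] at a1 a2
    have : |u i / δ - u j / δ| < 1 := by rw [abs_lt]; constructor <;> linarith
    rw [← sub_div, abs_div, abs_of_pos hδ, div_lt_one hδ] at this
    linarith
  have hharm : (∑ k ∈ Icc 1 K, ((k : ℝ))⁻¹) ≤ 1 + Real.log δ⁻¹ := by
    have h := harmonic_floor_le_one_add_log δ⁻¹ ((one_le_inv₀ hδ).mpr hδ1)
    rw [← hK, harmonic_eq_sum_Icc] at h
    push_cast at h
    exact h
  calc ∑ i ∈ S, (u i)⁻¹ ≤ ∑ i ∈ S, δ⁻¹ * ((⌊u i / δ⌋₊ : ℕ) : ℝ)⁻¹ := by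
        refine sum_le_sum fun i hi => ?_
        rw [← mul_inv]
        have h1 : (1 : ℝ) ≤ (⌊u i / δ⌋₊ : ℕ) := by exact_mod_cast (mem_Icc.mp (hmem i hi)).1
        refine inv_anti₀ (by positivity) ?_
        have := Nat.floor_le (hpos i hi)
        rwa [le_div_iff₀' hδ] at this
    _ = δ⁻¹ * ∑ k ∈ S.image (fun i => ⌊u i / δ⌋₊), ((k : ℝ))⁻¹ := by
        rw [mul_sum, sum_image hinj]
    _ ≤ δ⁻¹ * ∑ k ∈ Icc 1 K, ((k : ℝ))⁻¹ := by
        refine mul_le_mul_of_nonneg_left ?_ (by positivity)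
        refine sum_le_sum_of_subset_of_nonneg ?_ fun _ _ _ => by positivity
        intro k hk
        obtain ⟨i, hi, rfl⟩ := mem_image.mp hk
        exact hmem i hi
    _ ≤ _ := mul_le_mul_of_nonneg_left hharm (by positivity)

lemma one_sub_fract_eq {x : ℝ} (h : 0 < Int.fract x) : 1 - Int.fract x = Int.fract (-x) := by
  rw [Int.fract_neg h.ne']

/-- Duality for bilinear forms. -/
lemma sum_norm_sq_le_of_dual {ι κ : Type*} (S : Finset ι) (T : Finset κ) (c : ι → κ → ℂ) (K : ℝ)
    (hK : 0 ≤ K)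
    (hdual : ∀ b : ι → ℂ, ∑ n ∈ T, ‖∑ i ∈ S, b i * c i n‖ ^ 2 ≤ K * ∑ i ∈ S, ‖b i‖ ^ 2)
    (a : κ → ℂ) : ∑ i ∈ S, ‖∑ n ∈ T, a n * c i n‖ ^ 2 ≤ K * ∑ n ∈ T, ‖a n‖ ^ 2 := by
  obtain ⟨s, hs⟩ : ∃ s : ι → ℂ, s = fun i => ∑ n ∈ T, a n * c i n := ⟨_, rfl⟩
  obtain ⟨X, hX⟩ : ∃ X, X = ∑ i ∈ S, ‖s i‖ ^ 2 := ⟨_, rfl⟩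
  have hgoal : ∑ i ∈ S, ‖∑ n ∈ T, a n * c i n‖ ^ 2 = X := by rw [hX, hs]
  rw [hgoal]
  have hX0 : 0 ≤ X := hX ▸ sum_nonneg fun _ _ => by positivity
  have h1 : (X : ℂ) = ∑ n ∈ T, a n * ∑ i ∈ S, (starRingEnd ℂ) (s i) * c i n := by
    rw [hX]
    push_cast
    simp_rw [mul_sum]
    rw [sum_comm]
    refine sum_congr rfl fun i _ => ?_
    rw [← Complex.mul_conj', mul_comm]
    conv_lhs => rw [hs]
    simp only
    rw [mul_sum]
    exact sum_congr rfl fun n _ => by rw [hs]; ring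
  have h2 : X ≤ ∑ n ∈ T, ‖a n‖ * ‖∑ i ∈ S, (starRingEnd ℂ) (s i) * c i n‖ := by
    calc X = ‖(X : ℂ)‖ := by rw [Complex.norm_real, Real.norm_of_nonneg hX0]
      _ ≤ _ := by rw [h1]; exact norm_sum_le_of_le _ fun n _ => (norm_mul _ _).le
  have h3 := sum_mul_sq_le_sq_mul_sq T (fun n => ‖a n‖)
    (fun n => ‖∑ i ∈ S, (starRingEnd ℂ) (s i) * c i n‖)
  have h4 := hdual fun i => (starRingEnd ℂ) (s i)
  simp only [RCLike.norm_conj] at h4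
  rw [← hX] at h4
  have ha : 0 ≤ ∑ n ∈ T, ‖a n‖ ^ 2 := sum_nonneg fun _ _ => by positivity
  rcases hX0.eq_or_lt with h0 | h0
  · rw [← h0]; positivity
  have h5 : X ^ 2 ≤ (∑ n ∈ T, ‖a n‖ ^ 2) * (K * X) :=
    (pow_le_pow_left₀ hX0 h2 2).trans (h3.trans (mul_le_mul_of_nonneg_left h4 ha))
  have h6 : X * X ≤ (K * ∑ n ∈ T, ‖a n‖ ^ 2) * X := by rw [← sq]; linarith
  exact le_of_mul_le_mul_right h6 h0

/-- The additive large sieve inequality, with a logarithmic loss. -/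
theorem additive_large_sieve {ι : Type*} (S : Finset ι) (α : ι → ℝ) {δ : ℝ} (hδ : 0 < δ)
    (hδ1 : δ ≤ 1) (hsep : ∀ i ∈ S, ∀ j ∈ S, i ≠ j → δ ≤ Int.fract (α i - α j)) (m n : ℕ)
    (a : ℕ → ℂ) :
    ∑ i ∈ S, ‖∑ k ∈ Ico m n, a k * ex (k * α i)‖ ^ 2 ≤
      ((n - m : ℕ) + δ⁻¹ * (1 + Real.log δ⁻¹)) * ∑ k ∈ Ico m n, ‖a k‖ ^ 2 := by
  classical
  have hlog : 0 ≤ Real.log δ⁻¹ := Real.log_nonneg ((one_le_inv₀ hδ).mpr hδ1)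
  have hδi : 0 < δ⁻¹ := by positivity
  refine sum_norm_sq_le_of_dual S (Ico m n) (fun i k => ex (k * α i)) _ (by positivity) ?_ a
  intro b
  obtain ⟨G, hG⟩ : ∃ G : ι → ι → ℝ, G = fun i j => ‖∑ k ∈ Ico m n, ex (k * (α i - α j))‖ :=
    ⟨_, rfl⟩
  have hGsymm : ∀ i j, G i j = G j i := by
    intro i j
    rw [hG]
    simp only
    rw [← RCLike.norm_conj, map_sum]
    congr 1
    refine sum_congr rfl fun k _ => ?_
    rw [← ex_neg]; congr 1; ring
  have hrow : ∀ i ∈ S, ∑ j ∈ S, G i j ≤ (n - m : ℕ) + δ⁻¹ * (1 + Real.log δ⁻¹) := by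
    intro i hi
    rw [← add_sum_erase S _ hi]
    refine add_le_add ?_ ?_
    · rw [hG]; simp [ex_zero]
    have hfr : ∀ j ∈ S.erase i, δ ≤ Int.fract (α i - α j) := fun j hj =>
      hsep i hi j (mem_of_mem_erase hj) (ne_of_mem_erase hj).symm
    have hfr' : ∀ j ∈ S.erase i, δ ≤ Int.fract (α j - α i) := fun j hj =>
      hsep j (mem_of_mem_erase hj) i hi (ne_of_mem_erase hj)
    have hsum : ∀ j ∈ S.erase i, 1 - Int.fract (α i - α j) = Int.fract (α j - α i) := fun j hj => by
      rw [one_sub_fract_eq (hδ.trans_le (hfr j hj)), neg_sub]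
    have hdiff : ∀ x y : ℝ, δ ≤ Int.fract (x - y) → δ ≤ Int.fract (y - x) →
        δ ≤ |Int.fract x - Int.fract y| := by
      intro x y h1 h2
      have key : ∀ x y : ℝ, δ ≤ Int.fract (x - y) → 0 ≤ Int.fract x - Int.fract y →
          δ ≤ |Int.fract x - Int.fract y| := by
        intro x y h1 h
        have e : Int.fract (x - y) = Int.fract x - Int.fract y := by
          rw [Int.fract_eq_iff]
          refine ⟨h, by linarith [Int.fract_lt_one x, Int.fract_nonneg y], ⌊x⌋ - ⌊y⌋, ?_⟩
          rw [Int.fract, Int.fract]; push_cast; ring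
        rw [abs_of_nonneg h, ← e]; exact h1
      rcases le_total 0 (Int.fract x - Int.fract y) with h | h
      · exact key x y h1 h
      · rw [abs_sub_comm]; exact key y x h2 (by linarith)
    have hA := sum_inv_le_of_separated (S.erase i) (fun j => Int.fract (α i - α j)) hδ hδ1
      (fun j hj => ⟨hfr j hj, Int.fract_lt_one _⟩) (fun j hj l hl hjl => by
        apply hdiff
        · rw [sub_sub_sub_cancel_left]
          exact hsep l (mem_of_mem_erase hl) j (mem_of_mem_erase hj) hjl.symm
        · rw [sub_sub_sub_cancel_left]
          exact hsep j (mem_of_mem_erase hj) l (mem_of_mem_erase hl) hjl)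
    have hB := sum_inv_le_of_separated (S.erase i) (fun j => Int.fract (α j - α i)) hδ hδ1
      (fun j hj => ⟨hfr' j hj, Int.fract_lt_one _⟩) (fun j hj l hl hjl => by
        apply hdiff
        · rw [sub_sub_sub_cancel_right]
          exact hsep j (mem_of_mem_erase hj) l (mem_of_mem_erase hl) hjl
        · rw [sub_sub_sub_cancel_right]
          exact hsep l (mem_of_mem_erase hl) j (mem_of_mem_erase hj) hjl.symm)
    calc ∑ j ∈ S.erase i, G i j ≤ ∑ j ∈ S.erase i, (1 / 2) *
          ((Int.fract (α i - α j))⁻¹ + (Int.fract (α j - α i))⁻¹) := by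
          refine sum_le_sum fun j hj => ?_
          rw [← hsum j hj, hG]
          exact norm_sum_ex_le (hδ.trans_le (hfr j hj)) m n
      _ = (1 / 2) * (∑ j ∈ S.erase i, (Int.fract (α i - α j))⁻¹ +
          ∑ j ∈ S.erase i, (Int.fract (α j - α i))⁻¹) := by
          rw [← mul_sum, sum_add_distrib]
      _ ≤ _ := by linarith
  have hexp : ((∑ k ∈ Ico m n, ‖∑ i ∈ S, b i * ex (k * α i)‖ ^ 2 : ℝ) : ℂ) =
      ∑ i ∈ S, ∑ j ∈ S, b i * (starRingEnd ℂ) (b j) * ∑ k ∈ Ico m n, ex (k * (α i - α j)) := by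
    push_cast
    simp_rw [← Complex.mul_conj', map_sum, sum_mul_sum, mul_sum]
    rw [sum_comm]
    refine sum_congr rfl fun i _ => ?_
    rw [sum_comm]
    refine sum_congr rfl fun j _ => sum_congr rfl fun k _ => ?_
    rw [mul_sub, ← ex_mul_conj, map_mul]
    ring
  have hle : ∑ k ∈ Ico m n, ‖∑ i ∈ S, b i * ex (k * α i)‖ ^ 2 ≤
      ∑ i ∈ S, ∑ j ∈ S, ‖b i‖ * ‖b j‖ * G i j := by
    calc _ = ‖((∑ k ∈ Ico m n, ‖∑ i ∈ S, b i * ex (k * α i)‖ ^ 2 : ℝ) : ℂ)‖ := by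
          rw [Complex.norm_real, Real.norm_of_nonneg (sum_nonneg fun _ _ => by positivity)]
      _ ≤ _ := by
          rw [hexp]
          refine norm_sum_le_of_le _ fun i _ => norm_sum_le_of_le _ fun j _ => ?_
          rw [norm_mul, norm_mul, RCLike.norm_conj, hG]
  refine hle.trans ?_
  have hG0 : ∀ i j, 0 ≤ G i j := fun i j => by rw [hG]; positivity
  calc ∑ i ∈ S, ∑ j ∈ S, ‖b i‖ * ‖b j‖ * G i j
      ≤ ∑ i ∈ S, ∑ j ∈ S, ((1 / 2) * (‖b i‖ ^ 2 * G i j) + (1 / 2) * (‖b j‖ ^ 2 * G j i)) := by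
        refine sum_le_sum fun i _ => sum_le_sum fun j _ => ?_
        rw [hGsymm j i]
        have := mul_nonneg (sq_nonneg (‖b i‖ - ‖b j‖)) (hG0 i j)
        linarith
    _ = ∑ i ∈ S, ‖b i‖ ^ 2 * ∑ j ∈ S, G i j := by
        simp_rw [sum_add_distrib, ← mul_sum]
        rw [sum_comm (f := fun i j => ‖b j‖ ^ 2 * G j i)]
        simp_rw [← mul_sum]
        ring
    _ ≤ ∑ i ∈ S, ‖b i‖ ^ 2 * ((n - m : ℕ) + δ⁻¹ * (1 + Real.log δ⁻¹)) :=
        sum_le_sum fun i hi => mul_le_mul_of_nonneg_left (hrow i hi) (by positivity)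
    _ = _ := by rw [← sum_mul, mul_comm]
end

section
open Complex DirichletCharacter

lemma conj_char_eq {r : ℕ} [NeZero r] (ψ : DirichletCharacter ℂ r) {a : ZMod r} (ha : IsUnit a) :
    (starRingEnd ℂ) (ψ a) = ψ a⁻¹ := by
  obtain ⟨u, rfl⟩ := ha
  have h1 : ψ (u : ZMod r)⁻¹ * ψ u = 1 := by
    rw [← map_mul, ZMod.inv_mul_of_unit _ u.isUnit, map_one]
  have h2 : ψ (u : ZMod r) * (starRingEnd ℂ) (ψ u) = 1 := by
    rw [Complex.mul_conj', ψ.unit_norm_eq_one u]; norm_num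
  calc (starRingEnd ℂ) (ψ u) = ψ (u : ZMod r)⁻¹ * ψ u * (starRingEnd ℂ) (ψ u) := by rw [h1, one_mul]
    _ = ψ (u : ZMod r)⁻¹ := by rw [mul_assoc, h2, mul_one]

lemma sum_conj_char_mul_char {r : ℕ} [NeZero r] {a : ZMod r} (ha : IsUnit a) (b : ZMod r) :
    ∑ ψ : DirichletCharacter ℂ r, (starRingEnd ℂ) (ψ a) * ψ b =
      if a = b then (r.totient : ℂ) else 0 := by
  rw [← sum_char_inv_mul_char_eq ℂ ha b]
  exact sum_congr rfl fun ψ _ => by rw [conj_char_eq ψ ha]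

lemma sum_zmod_eq_sum_range {M : Type*} [AddCommMonoid M] {r : ℕ} [NeZero r] (f : ZMod r → M) :
    ∑ x, f x = ∑ a ∈ range r, f a := by
  refine sum_nbij' (fun x => x.val) (fun a => (a : ZMod r)) ?_ ?_ ?_ ?_ ?_
  · exact fun x _ => mem_range.mpr x.val_lt
  · exact fun _ _ => mem_univ _
  · exact fun x _ => ZMod.natCast_zmod_val x
  · exact fun a ha => ZMod.val_cast_of_lt (mem_range.mp ha)
  · exact fun x _ => by rw [ZMod.natCast_zmod_val]

lemma stdAddChar_natCast_mul {r : ℕ} [NeZero r] (k a : ℕ) :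
    ZMod.stdAddChar ((a : ZMod r) * (k : ZMod r)) = ex (k * ((a : ℝ) / r)) := by
  have := ZMod.stdAddChar_coe (N := r) ((a * k : ℕ) : ℤ)
  push_cast at this
  rw [this, ex]
  congr 1
  push_cast
  ring

lemma gaussSum_mul_star_of_isPrimitive {r : ℕ} [NeZero r] {ψ : DirichletCharacter ℂ r}
    (hψ : ψ.IsPrimitive) : gaussSum ψ ZMod.stdAddChar * star (gaussSum ψ ZMod.stdAddChar) = r := by
  obtain ⟨τ, hτ⟩ : ∃ τ, τ = gaussSum ψ ZMod.stdAddChar := ⟨_, rfl⟩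
  rw [star_gaussSum_eq, ← hτ]
  conv_lhs => rw [gaussSum, mul_sum]
  have h1 : ∀ x : ZMod r, τ * (ψ⁻¹ x * (ZMod.stdAddChar)⁻¹ x) =
      ∑ a, ψ a * ZMod.stdAddChar (x * (a - 1)) := by
    intro x
    have := gaussSum_mulShift_of_isPrimitive (ZMod.stdAddChar (N := r)) hψ x
    rw [← hτ] at this
    rw [← mul_assoc, mul_comm τ, ← this, gaussSum, sum_mul]
    refine sum_congr rfl fun a _ => ?_
    rw [AddChar.mulShift_apply, mul_assoc, AddChar.inv_apply, ← AddChar.map_add_eq_mul]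
    congr 2
    ring
  simp_rw [h1]
  rw [sum_comm]
  simp_rw [← mul_sum, AddChar.sum_mulShift _ (ZMod.isPrimitive_stdAddChar r), sub_eq_zero]
  simp [ZMod.card]

/-- The finset of primitive Dirichlet characters of a given level. -/
def primChars (r : ℕ) : Finset (DirichletCharacter ℂ r) := by
  classical exact univ.filter fun ψ => ψ.IsPrimitive

lemma mem_primChars {r : ℕ} {ψ : DirichletCharacter ℂ r} : ψ ∈ primChars r ↔ ψ.IsPrimitive := by
  classical
  rw [primChars, mem_filter]
  simp

lemma sum_norm_sq_sum_char {r : ℕ} [NeZero r] (F : ℕ → ℂ) :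
    ∑ ψ : DirichletCharacter ℂ r, ‖∑ a ∈ range r with a.Coprime r, F a * ψ a‖ ^ 2 =
      r.totient * ∑ a ∈ range r with a.Coprime r, ‖F a‖ ^ 2 := by
  suffices h : ((∑ ψ : DirichletCharacter ℂ r, ‖∑ a ∈ range r with a.Coprime r, F a * ψ a‖ ^ 2 : ℝ)
      : ℂ) = ((r.totient * ∑ a ∈ range r with a.Coprime r, ‖F a‖ ^ 2 : ℝ) : ℂ) by exact_mod_cast h
  push_cast
  simp_rw [← Complex.mul_conj', map_sum, sum_mul_sum, mul_sum]
  rw [sum_comm]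
  refine sum_congr rfl fun a ha => ?_
  rw [sum_comm, sum_eq_single_of_mem a ha]
  · have hu := (ZMod.isUnit_iff_coprime a r).mpr (mem_filter.mp ha).2
    have h := sum_conj_char_mul_char hu a
    rw [if_pos rfl] at h
    rw [← h, sum_mul]
    refine sum_congr rfl fun ψ _ => ?_
    rw [map_mul]; ring
  · intro b hb hab
    obtain ⟨hb1, hb2⟩ := mem_filter.mp hb
    have hu := (ZMod.isUnit_iff_coprime b r).mpr hb2
    have h := sum_conj_char_mul_char hu a
    rw [if_neg] at h
    · calc _ = F a * (starRingEnd ℂ) (F b) *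
            ∑ ψ : DirichletCharacter ℂ r, (starRingEnd ℂ) (ψ b) * ψ a := by
            rw [mul_sum]
            exact sum_congr rfl fun ψ _ => by rw [map_mul]; ring
        _ = 0 := by rw [h, mul_zero]
    · intro h
      rw [ZMod.natCast_eq_natCast_iff', Nat.mod_eq_of_lt (mem_range.mp hb1),
        Nat.mod_eq_of_lt (mem_range.mp (mem_filter.mp ha).1)] at h
      exact hab h

lemma sum_primChars_le {r : ℕ} (hr : r ≠ 0) (m n : ℕ) (c : ℕ → ℂ) :
    (r / r.totient : ℝ) * ∑ ψ ∈ primChars r, ‖∑ k ∈ Ico m n, c k * ψ k‖ ^ 2 ≤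
      ∑ a ∈ range r with a.Coprime r, ‖∑ k ∈ Ico m n, c k * ex (k * ((a : ℝ) / r))‖ ^ 2 := by
  have : NeZero r := ⟨hr⟩
  have hφ : (0 : ℝ) < r.totient := by exact_mod_cast Nat.totient_pos.mpr (Nat.pos_of_ne_zero hr)
  rw [div_mul_eq_mul_div, div_le_iff₀ hφ, mul_comm _ (r.totient : ℝ), ← sum_norm_sq_sum_char,
    mul_sum]
  have hinv : ∀ ψ ∈ primChars r, ψ⁻¹ ∈ primChars r := by
    intro ψ hψ
    rw [mem_primChars] at hψ ⊢
    rw [IsPrimitive] at hψ ⊢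
    rwa [conductor_inv]
  calc ∑ ψ ∈ primChars r, (r : ℝ) * ‖∑ k ∈ Ico m n, c k * ψ k‖ ^ 2
      = ∑ ψ ∈ primChars r, (r : ℝ) * ‖∑ k ∈ Ico m n, c k * ψ⁻¹ k‖ ^ 2 := by
        refine sum_nbij' (fun ψ => ψ⁻¹) (fun ψ => ψ⁻¹) hinv hinv ?_ ?_ ?_
        · exact fun ψ _ => inv_inv ψ
        · exact fun ψ _ => inv_inv ψ
        · exact fun ψ _ => by rw [inv_inv]
    _ ≤ _ := by
        refine (sum_le_sum fun ψ hψ => le_of_eq ?_).trans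
          (sum_le_sum_of_subset_of_nonneg (subset_univ _) fun _ _ _ => by positivity)
        rw [mem_primChars] at hψ
        obtain ⟨τ, hτ⟩ : ∃ τ, τ = gaussSum ψ ZMod.stdAddChar := ⟨_, rfl⟩
        have h1 := gaussSum_mul_star_of_isPrimitive hψ
        have h2 : (r : ℝ) = ‖τ‖ ^ 2 := by
          rw [← hτ] at h1
          have := Complex.mul_conj' τ
          rw [starRingEnd_apply, h1] at this
          exact_mod_cast this
        refine (congrArg (· * _) h2).trans ?_
        rw [← mul_pow, ← norm_mul]
        congr 2
        simp_rw [sum_mul]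
        rw [sum_comm, mul_sum]
        refine sum_congr rfl fun k _ => ?_
        have h3 := gaussSum_mulShift_of_isPrimitive (ZMod.stdAddChar (N := r)) hψ k
        rw [← hτ] at h3
        rw [show τ * (c k * ψ⁻¹ k) = c k * (ψ⁻¹ k * τ) by ring, ← h3, gaussSum,
          sum_zmod_eq_sum_range, mul_sum, sum_filter]
        refine sum_congr rfl fun a _ => ?_
        split_ifs with ha
        · rw [AddChar.mulShift_apply, mul_comm (k : ZMod r), stdAddChar_natCast_mul]; ring
        · have : ψ a = 0 := ψ.map_nonunit (by rwa [ZMod.isUnit_iff_coprime])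
          rw [this]; simp

lemma inv_sq_le_fract_sub {R r s a b : ℕ} (hr : r ∈ Icc 1 R) (hs : s ∈ Icc 1 R)
    (ha : a < r) (hb : b < s) (har : a.Coprime r) (hbs : b.Coprime s) (hne : ¬ (r = s ∧ a = b)) :
    ((R : ℝ) ^ 2)⁻¹ ≤ Int.fract ((a : ℝ) / r - (b : ℝ) / s) := by
  obtain ⟨hr1, hrR⟩ := mem_Icc.mp hr
  obtain ⟨hs1, hsR⟩ := mem_Icc.mp hs
  have hr0 : (0 : ℝ) < r := by exact_mod_cast hr1
  have hs0 : (0 : ℝ) < s := by exact_mod_cast hs1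
  obtain ⟨f, hf⟩ : ∃ f, f = ⌊(a : ℝ) / r - (b : ℝ) / s⌋ := ⟨_, rfl⟩
  obtain ⟨z, hz⟩ : ∃ z : ℤ, z = a * s - b * r - f * (r * s) := ⟨_, rfl⟩
  have e : Int.fract ((a : ℝ) / r - (b : ℝ) / s) = z / (r * s) := by
    rw [Int.fract, ← hf, hz]
    push_cast
    field_simp
  have hrs : (0 : ℝ) < r * s := by positivity
  have hRR : (r : ℝ) * s ≤ (R : ℝ) ^ 2 := by
    rw [sq]
    have h1 : (r : ℝ) ≤ R := by exact_mod_cast hrR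
    have h2 : (s : ℝ) ≤ R := by exact_mod_cast hsR
    gcongr
  have hz0 : 0 ≤ z := by
    have h := Int.fract_nonneg ((a : ℝ) / r - (b : ℝ) / s)
    rw [e, le_div_iff₀ hrs, zero_mul] at h
    exact_mod_cast h
  have hzne : z ≠ 0 := by
    intro h
    rw [h] at e
    have h1 : (a : ℝ) / r < 1 := (div_lt_one hr0).mpr (by exact_mod_cast ha)
    have h2 : (b : ℝ) / s < 1 := (div_lt_one hs0).mpr (by exact_mod_cast hb)
    have h3 : 0 ≤ (a : ℝ) / r := by positivity
    have h4 : 0 ≤ (b : ℝ) / s := by positivity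
    have h5 : f = 0 := by
      have h6 := Int.self_sub_floor ((a : ℝ) / r - (b : ℝ) / s)
      rw [← hf, e, Int.cast_zero, zero_div] at h6
      have h7 : (f : ℝ) < 1 := by linarith
      have h8 : (-1 : ℝ) < f := by linarith
      have h9 : f < 1 := by exact_mod_cast h7
      have h10 : -1 < f := by exact_mod_cast h8
      omega
    rw [h5, h] at hz
    have h6 : a * s = b * r := by
      have : (a : ℤ) * s = b * r := by linarith
      exact_mod_cast this
    have hrs : r ∣ s := har.symm.dvd_of_dvd_mul_left (h6 ▸ Dvd.intro_left b rfl)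
    have hsr : s ∣ r := hbs.symm.dvd_of_dvd_mul_left (h6.symm ▸ Dvd.intro_left a rfl)
    have hrs' := Nat.dvd_antisymm hrs hsr
    subst hrs'
    exact hne ⟨rfl, Nat.eq_of_mul_eq_mul_right hr1 h6⟩
  rw [e, inv_eq_one_div]
  have hz1 : (1 : ℝ) ≤ z := by exact_mod_cast (by omega : 1 ≤ z)
  exact div_le_div₀ (by linarith) hz1 hrs hRR

/-- The multiplicative large sieve inequality, with a logarithmic loss. -/
theorem multiplicative_large_sieve {R : ℕ} (hR : 1 ≤ R) (m n : ℕ) (c : ℕ → ℂ) :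
    ∑ r ∈ Icc 1 R, (r / r.totient : ℝ) * ∑ ψ ∈ primChars r, ‖∑ k ∈ Ico m n, c k * ψ k‖ ^ 2 ≤
      ((n - m : ℕ) + (R : ℝ) ^ 2 * (1 + 2 * Real.log R)) * ∑ k ∈ Ico m n, ‖c k‖ ^ 2 := by
  have hR' : (1 : ℝ) ≤ R := by exact_mod_cast hR
  have h := additive_large_sieve ((Icc 1 R).sigma fun r => {a ∈ range r | a.Coprime r})
    (fun x => (x.2 : ℝ) / x.1) (δ := ((R : ℝ) ^ 2)⁻¹) (by positivity)
    (inv_le_one_of_one_le₀ (one_le_pow₀ hR')) (fun x hx y hy hxy => by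
      obtain ⟨r, a⟩ := x
      obtain ⟨s, b⟩ := y
      simp only [mem_sigma, mem_filter, mem_range] at hx hy
      refine inv_sq_le_fract_sub hx.1 hy.1 hx.2.1 hy.2.1 hx.2.2 hy.2.2 ?_
      rintro ⟨rfl, rfl⟩
      exact hxy rfl) m n c
  rw [sum_sigma, inv_inv, Real.log_pow] at h
  exact (sum_le_sum fun r hr => sum_primChars_le (by have := mem_Icc.mp hr; omega) m n c).trans h
end

section

lemma card_divisors_mul_le (m n : ℕ) :
    (m * n).divisors.card ≤ m.divisors.card * n.divisors.card := by
  rw [Nat.divisors_mul]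
  exact card_mul_le

lemma sum_inv_Icc_le {N : ℕ} : ∑ n ∈ Icc 1 N, ((n : ℝ))⁻¹ ≤ 1 + Real.log N := by
  have h := harmonic_le_one_add_log N
  rw [harmonic_eq_sum_Icc] at h
  push_cast at h
  exact h

/-- Interchange of a sum over divisors. -/
lemma sum_Icc_sum_divisors {M : Type*} [AddCommMonoid M] (N : ℕ) (f : ℕ → ℕ → M) :
    ∑ n ∈ Icc 1 N, ∑ x ∈ n.divisorsAntidiagonal, f x.1 x.2 =
      ∑ d ∈ Icc 1 N, ∑ k ∈ Icc 1 (N / d), f d k := by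
  rw [sum_sigma', sum_sigma']
  refine sum_nbij' (fun x => ⟨x.2.1, x.2.2⟩) (fun x => ⟨x.1 * x.2, (x.1, x.2)⟩) ?_ ?_ ?_ ?_ ?_
  · rintro ⟨n, d, k⟩ h
    simp only [mem_sigma, mem_Icc, Nat.mem_divisorsAntidiagonal] at h ⊢
    obtain ⟨⟨h1, h2⟩, h3, h4⟩ := h
    have hd : 0 < d := Nat.pos_of_ne_zero (by rintro rfl; simp at h3; omega)
    have hk : 0 < k := Nat.pos_of_ne_zero (by rintro rfl; simp at h3; omega)
    refine ⟨⟨hd, ?_⟩, hk, ?_⟩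
    · exact (Nat.le_mul_of_pos_right d hk).trans (h3 ▸ h2)
    · rw [Nat.le_div_iff_mul_le hd, mul_comm]; omega
  · rintro ⟨d, k⟩ h
    simp only [mem_sigma, mem_Icc, Nat.mem_divisorsAntidiagonal] at h ⊢
    obtain ⟨⟨h1, h2⟩, h3, h4⟩ := h
    have h5 := Nat.mul_pos h1 h3
    rw [Nat.le_div_iff_mul_le h1, mul_comm] at h4
    exact ⟨⟨h5, h4⟩, trivial, h5.ne'⟩
  · rintro ⟨n, d, k⟩ h
    simp only [mem_sigma, mem_Icc, Nat.mem_divisorsAntidiagonal] at h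
    simp [h.2.1]
  · rintro ⟨d, k⟩ _
    rfl
  · rintro ⟨n, d, k⟩ _
    rfl

lemma sum_card_divisors_pow_div_le (j N : ℕ) :
    ∑ n ∈ Icc 1 N, (n.divisors.card : ℝ) ^ j * ((n : ℝ))⁻¹ ≤ (1 + Real.log N) ^ 2 ^ j := by
  induction j with
  | zero => simpa using sum_inv_Icc_le
  | succ j ih =>
    have h0 : 0 ≤ ∑ n ∈ Icc 1 N, (n.divisors.card : ℝ) ^ j * ((n : ℝ))⁻¹ :=
      sum_nonneg fun _ _ => by positivity
    calc ∑ n ∈ Icc 1 N, (n.divisors.card : ℝ) ^ (j + 1) * ((n : ℝ))⁻¹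
        = ∑ n ∈ Icc 1 N, ∑ x ∈ n.divisorsAntidiagonal,
            ((x.1 * x.2).divisors.card : ℝ) ^ j * ((x.1 * x.2 : ℕ) : ℝ)⁻¹ := by
          refine sum_congr rfl fun n _ => ?_
          have : ∀ x ∈ n.divisorsAntidiagonal, ((x.1 * x.2).divisors.card : ℝ) ^ j *
              ((x.1 * x.2 : ℕ) : ℝ)⁻¹ = (n.divisors.card : ℝ) ^ j * ((n : ℝ))⁻¹ := fun x hx => by
            rw [(Nat.mem_divisorsAntidiagonal.mp hx).1]
          rw [sum_congr rfl this, sum_const, ← Nat.map_div_right_divisors, card_map, nsmul_eq_mul]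
          ring
      _ = ∑ d ∈ Icc 1 N, ∑ k ∈ Icc 1 (N / d),
            ((d * k).divisors.card : ℝ) ^ j * ((d * k : ℕ) : ℝ)⁻¹ :=
          sum_Icc_sum_divisors N fun d k => ((d * k).divisors.card : ℝ) ^ j * ((d * k : ℕ) : ℝ)⁻¹
      _ ≤ ∑ d ∈ Icc 1 N, ∑ k ∈ Icc 1 N, ((d.divisors.card : ℝ) ^ j * ((d : ℝ))⁻¹) *
            ((k.divisors.card : ℝ) ^ j * ((k : ℝ))⁻¹) := by
          refine sum_le_sum fun d _ => ?_
          refine le_trans ?_ (sum_le_sum_of_subset_of_nonneg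
            (Icc_subset_Icc_right (Nat.div_le_self N d)) fun _ _ _ => by positivity)
          refine sum_le_sum fun k _ => ?_
          have h1 : ((d * k).divisors.card : ℝ) ≤ d.divisors.card * k.divisors.card := by
            exact_mod_cast card_divisors_mul_le d k
          calc ((d * k).divisors.card : ℝ) ^ j * ((d * k : ℕ) : ℝ)⁻¹
              ≤ (d.divisors.card * k.divisors.card : ℝ) ^ j * ((d * k : ℕ) : ℝ)⁻¹ := by gcongr
            _ = _ := by push_cast; rw [mul_pow, mul_inv]; ring
      _ = (∑ n ∈ Icc 1 N, (n.divisors.card : ℝ) ^ j * ((n : ℝ))⁻¹) ^ 2 := by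
          rw [sq, sum_mul_sum]
      _ ≤ ((1 + Real.log N) ^ 2 ^ j) ^ 2 := by gcongr
      _ = _ := by rw [← pow_mul, pow_succ]

/-- Moments of the divisor function. -/
theorem sum_card_divisors_pow_le (j N : ℕ) :
    ∑ n ∈ Icc 1 N, (n.divisors.card : ℝ) ^ j ≤ N * (1 + Real.log N) ^ 2 ^ j := by
  refine le_trans ?_ (mul_le_mul_of_nonneg_left (sum_card_divisors_pow_div_le j N) (by positivity))
  rw [mul_sum]
  refine sum_le_sum fun n hn => ?_
  obtain ⟨h1, h2⟩ := mem_Icc.mp hn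
  have h1' : (0 : ℝ) < n := by exact_mod_cast h1
  have h2' : (1 : ℝ) ≤ N * ((n : ℝ))⁻¹ := by
    rw [← div_eq_mul_inv, one_le_div h1']; exact_mod_cast h2
  calc (n.divisors.card : ℝ) ^ j = (n.divisors.card : ℝ) ^ j * 1 := (mul_one _).symm
    _ ≤ (n.divisors.card : ℝ) ^ j * (N * ((n : ℝ))⁻¹) := by gcongr
    _ = _ := by ring
end

section
open ArithmeticFunction

/-- Truncation of an arithmetic function to arguments `≤ U`. -/
def truncLE (f : ArithmeticFunction ℝ) (U : ℕ) : ArithmeticFunction ℝ :=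
  ⟨fun n => if n ≤ U then f n else 0, by simp⟩

lemma truncLE_apply (f : ArithmeticFunction ℝ) (U n : ℕ) :
    truncLE f U n = if n ≤ U then f n else 0 := rfl

/-- The coefficients `∑_{d ∣ m, d > U} μ(d)` from Vaughan's identity. -/
def vaughanCoeff (U : ℕ) : ArithmeticFunction ℝ :=
  ((moebius : ArithmeticFunction ℝ) - truncLE moebius U) * (zeta : ArithmeticFunction ℝ)

lemma vaughan_identity (U V : ℕ) :
    vonMangoldt = truncLE vonMangoldt V + truncLE moebius U * log -
      truncLE moebius U * truncLE vonMangoldt V * (zeta : ArithmeticFunction ℝ) +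
      vaughanCoeff U * (vonMangoldt - truncLE vonMangoldt V) := by
  have h1 : (moebius : ArithmeticFunction ℝ) * (zeta : ArithmeticFunction ℝ) = 1 :=
    coe_moebius_mul_coe_zeta
  have h2 : vonMangoldt * (zeta : ArithmeticFunction ℝ) = log := vonMangoldt_mul_zeta
  rw [vaughanCoeff]
  linear_combination (truncLE vonMangoldt V - vonMangoldt) * h1 +
    (truncLE (moebius : ArithmeticFunction ℝ) U) * h2

lemma abs_moebius_real_le (n : ℕ) : |(moebius : ArithmeticFunction ℝ) n| ≤ 1 := by
  rw [intCoe_apply]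
  have := abs_moebius_le_one (n := n)
  exact_mod_cast this

lemma vaughanCoeff_apply (U m : ℕ) : vaughanCoeff U m =
    ∑ d ∈ m.divisors, if d ≤ U then 0 else (moebius : ArithmeticFunction ℝ) d := by
  rw [vaughanCoeff, mul_apply, Nat.sum_divisorsAntidiagonal (fun d e =>
    ((moebius : ArithmeticFunction ℝ) - truncLE moebius U) d * (zeta : ArithmeticFunction ℝ) e)]
  refine sum_congr rfl fun d hd => ?_
  have hm := Nat.mem_divisors.mp hd
  have h1 : m / d ≠ 0 := (Nat.div_pos (Nat.le_of_dvd (Nat.pos_of_ne_zero hm.2) hm.1)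
    (Nat.pos_of_dvd_of_pos hm.1 (Nat.pos_of_ne_zero hm.2))).ne'
  rw [natCoe_apply, zeta_apply_ne h1, sub_eq_add_neg, ArithmeticFunction.add_apply,
    ArithmeticFunction.neg_apply, truncLE_apply]
  split_ifs <;> simp

lemma abs_vaughanCoeff_le (U m : ℕ) : |vaughanCoeff U m| ≤ m.divisors.card := by
  rw [vaughanCoeff_apply]
  refine (abs_sum_le_sum_abs _ _).trans ?_
  rw [card_eq_sum_ones, Nat.cast_sum]
  refine sum_le_sum fun d _ => ?_
  split_ifs
  · simp
  · simpa using abs_moebius_real_le d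

lemma vaughanCoeff_eq_zero {U m : ℕ} (h : m ≤ U) : vaughanCoeff U m = 0 := by
  rw [vaughanCoeff_apply]
  refine sum_eq_zero fun d hd => if_pos ?_
  exact (Nat.divisor_le hd).trans h

/-- A slowly growing sequence of cut points. -/
def cellSeq (U h : ℕ) : ℕ → ℕ
  | 0 => U
  | i + 1 => cellSeq U h i + cellSeq U h i / h

lemma cellSeq_succ (U h i : ℕ) :
    cellSeq U h (i + 1) = cellSeq U h i + cellSeq U h i / h := rfl

lemma cellSeq_mono (U h : ℕ) : Monotone (cellSeq U h) :=
  monotone_nat_of_le_succ fun i => by rw [cellSeq_succ]; exact Nat.le_add_right _ _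

lemma le_cellSeq (U h i : ℕ) : U ≤ cellSeq U h i := cellSeq_mono U h (Nat.zero_le i)

lemma sum_ite_cell (M : ℕ → ℕ) (hM : Monotone M) (I m : ℕ) :
    ∑ i ∈ range I, (if M i < m ∧ m ≤ M (i + 1) then (1 : ℝ) else 0) =
      if M 0 < m ∧ m ≤ M I then 1 else 0 := by
  induction I with
  | zero => rw [range_zero, sum_empty, if_neg]; omega
  | succ I ih =>
    rw [sum_range_succ, ih]
    have h1 := hM (Nat.zero_le I)
    have h2 := hM (Nat.le_succ I)
    rw [Nat.succ_eq_add_one] at h2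
    split_ifs <;> first | (exfalso; omega) | norm_num

/-- Weight of a pair in the cell decomposition. -/
def cellWeight (U V h y I m k : ℕ) : ℝ :=
  ∑ i ∈ range I, if (cellSeq U h i < m ∧ m ≤ cellSeq U h (i + 1)) ∧
    V < k ∧ k ≤ y / cellSeq U h i then 1 else 0

lemma cellWeight_nonneg (U V h y I m k : ℕ) : 0 ≤ cellWeight U V h y I m k :=
  sum_nonneg fun _ _ => by split_ifs <;> norm_num

lemma cellWeight_le_one (U V h y I m k : ℕ) : cellWeight U V h y I m k ≤ 1 := by
  refine (sum_le_sum (g := fun i => if cellSeq U h i < m ∧ m ≤ cellSeq U h (i + 1) then (1 : ℝ)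
    else 0) fun i _ => ?_).trans ?_
  · split_ifs with h1 h2 <;> first | exact absurd h1.1 h2 | norm_num
  · rw [sum_ite_cell _ (cellSeq_mono U h)]; split_ifs <;> norm_num

lemma cellWeight_eq {U V h y I m k : ℕ} (hU : 1 ≤ U) (hI : y ≤ cellSeq U h I) (hk : 1 ≤ k)
    (hmk : m * k ≤ y) : cellWeight U V h y I m k = if U < m ∧ V < k then 1 else 0 := by
  by_cases hV : V < k
  · have : cellWeight U V h y I m k =
        ∑ i ∈ range I, if cellSeq U h i < m ∧ m ≤ cellSeq U h (i + 1) then (1 : ℝ) else 0 := by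
      refine sum_congr rfl fun i _ => if_congr ?_ rfl rfl
      have hi := le_cellSeq U h i
      refine ⟨fun h => h.1, fun h => ⟨h, hV, ?_⟩⟩
      rw [Nat.le_div_iff_mul_le (by omega)]
      exact (Nat.mul_comm k _ ▸ Nat.mul_le_mul_right k h.1.le).trans hmk
    rw [this, sum_ite_cell _ (cellSeq_mono U h)]
    have hm : m ≤ cellSeq U h I := ((Nat.le_mul_of_pos_right m hk).trans hmk).trans hI
    refine if_congr ?_ rfl rfl
    change U < m ∧ _ ↔ _
    tauto
  · rw [if_neg (by tauto), cellWeight]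
    exact sum_eq_zero fun i _ => if_neg (by tauto)

lemma mul_le_of_mem_cell {U h y i m k : ℕ} (hm : m ≤ cellSeq U h (i + 1))
    (hk : k ≤ y / cellSeq U h i) : m * k ≤ y + y / h := by
  obtain ⟨M, hM⟩ : ∃ M, M = cellSeq U h i := ⟨_, rfl⟩
  rw [cellSeq_succ, ← hM] at hm
  rw [← hM] at hk
  have h1 : M * (y / M) ≤ y := Nat.mul_div_le y M
  have h2 : M / h * (y / M) ≤ y / h := by
    rcases Nat.eq_zero_or_pos h with rfl | hh
    · simp
    rw [Nat.le_div_iff_mul_le hh]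
    calc M / h * (y / M) * h = (M / h * h) * (y / M) := by ring
      _ ≤ M * (y / M) := Nat.mul_le_mul_right _ (Nat.div_mul_le_self M h)
      _ ≤ y := h1
  calc m * k ≤ (M + M / h) * (y / M) := Nat.mul_le_mul hm hk
    _ = M * (y / M) + M / h * (y / M) := by ring
    _ ≤ _ := by omega

lemma sum_cells_eq {U V h y I : ℕ} (g : ℕ → ℕ → ℂ) :
    ∑ i ∈ range I, ∑ m ∈ Ioc (cellSeq U h i) (cellSeq U h (i + 1)),
      ∑ k ∈ Ioc V (y / cellSeq U h i), g m k =
    ∑ n ∈ Icc 1 (y + y / h), ∑ x ∈ n.divisorsAntidiagonal,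
      (cellWeight U V h y I x.1 x.2 : ℂ) * g x.1 x.2 := by
  rw [sum_Icc_sum_divisors (y + y / h) fun m k => (cellWeight U V h y I m k : ℂ) * g m k]
  simp_rw [cellWeight]
  push_cast
  simp_rw [sum_mul]
  symm
  rw [sum_congr rfl fun m _ => sum_comm, sum_comm]
  refine sum_congr rfl fun i _ => ?_
  symm
  simp only [apply_ite Complex.ofReal, Complex.ofReal_one, Complex.ofReal_zero, ite_mul, one_mul,
    zero_mul]
  rw [← sum_product', sum_sigma', ← sum_filter]
  refine sum_nbij' (fun x => ⟨x.1, x.2⟩) (fun x => (x.1, x.2)) ?_ ?_ ?_ ?_ ?_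
  · rintro ⟨m, k⟩ hx
    simp only [mem_product, mem_Ioc, mem_filter, mem_sigma, mem_Icc] at hx ⊢
    have h1 := mul_le_of_mem_cell hx.1.2 hx.2.2
    have hm : 1 ≤ m := by omega
    refine ⟨⟨⟨hm, ?_⟩, by omega, ?_⟩, hx⟩
    · exact (Nat.le_mul_of_pos_right m (by omega)).trans h1
    · rw [Nat.le_div_iff_mul_le hm, mul_comm]; exact h1
  · rintro ⟨m, k⟩ hx
    simp only [mem_product, mem_Ioc, mem_filter, mem_sigma, mem_Icc] at hx ⊢
    exact hx.2
  · exact fun _ _ => rfl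
  · exact fun _ _ => rfl
  · exact fun _ _ => rfl

lemma sum_vonMangoldt_mul_card_le (n : ℕ) :
    ∑ x ∈ n.divisorsAntidiagonal, (x.1.divisors.card : ℝ) * vonMangoldt x.2 ≤
      n.divisors.card * Real.log n := by
  rcases Nat.eq_zero_or_pos n with rfl | hn
  · simp
  calc _ ≤ ∑ x ∈ n.divisorsAntidiagonal, (n.divisors.card : ℝ) * vonMangoldt x.2 := by
        refine sum_le_sum fun x hx => mul_le_mul_of_nonneg_right ?_ vonMangoldt_nonneg
        have h := (Nat.mem_divisorsAntidiagonal.mp hx).1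
        exact_mod_cast card_le_card (Nat.divisors_subset_of_dvd hn.ne' (h ▸ Dvd.intro _ rfl))
    _ = n.divisors.card * Real.log n := by
        rw [← mul_sum, Nat.sum_divisorsAntidiagonal' (fun _ e => vonMangoldt e), vonMangoldt_sum]

end

section
open ArithmeticFunction

lemma abs_truncLE_le {f : ArithmeticFunction ℝ} (U n : ℕ) : |truncLE f U n| ≤ |f n| := by
  rw [truncLE_apply]; split_ifs <;> simp

/-- The coefficients of the long tail produced by the cell decomposition. -/
def cellCoeff (U V h y I n : ℕ) : ℝ :=
  ∑ x ∈ n.divisorsAntidiagonal, cellWeight U V h y I x.1 x.2 * (vaughanCoeff U x.1 *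
    vonMangoldt x.2)

lemma abs_cellCoeff_le (U V h y I n : ℕ) :
    |cellCoeff U V h y I n| ≤ n.divisors.card * Real.log n := by
  refine (abs_sum_le_sum_abs _ _).trans (le_trans (sum_le_sum fun x _ => ?_)
    (sum_vonMangoldt_mul_card_le n))
  rw [abs_mul, abs_mul, abs_of_nonneg (cellWeight_nonneg _ _ _ _ _ _ _),
    abs_of_nonneg (vonMangoldt_nonneg (n := x.2))]
  refine (mul_le_of_le_one_left (by positivity [vonMangoldt_nonneg (n := x.2)])
    (cellWeight_le_one _ _ _ _ _ _ _)).trans ?_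
  exact mul_le_mul_of_nonneg_right (abs_vaughanCoeff_le _ _) vonMangoldt_nonneg

lemma norm_sum_log_mul_le {g : ℕ → ℂ} {T : ℝ} (hT : ∀ z, ‖∑ k ∈ Icc 1 z, g k‖ ≤ T) {z : ℕ} :
    ‖∑ k ∈ Icc 1 z, (Real.log k : ℂ) * g k‖ ≤ 2 * Real.log z * T := by
  have hT0 : 0 ≤ T := (norm_nonneg _).trans (hT 0)
  have hI : ∀ z : ℕ, Icc 1 z = Ioc 0 z := fun z => by ext; simp; omega
  have hlog : 0 ≤ Real.log z := Real.log_natCast_nonneg z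
  have h1 : ‖∑ k ∈ Ioc 0 z, ((Real.log z - Real.log k : ℝ) : ℂ) * g k‖ ≤ Real.log z * T := by
    have hw : ∀ i ∈ Ioc 0 z, 0 ≤ Real.log z - Real.log i := by
      intro i hi
      obtain ⟨h1, h2⟩ := mem_Ioc.mp hi
      exact sub_nonneg.mpr (Real.log_le_log (by exact_mod_cast h1) (by exact_mod_cast h2))
    have ha : ∀ i ∈ Ioc 0 z, i + 1 ∈ Ioc 0 z →
        Real.log z - Real.log (i + 1 : ℕ) ≤ Real.log z - Real.log i := by
      intro i hi _
      obtain ⟨h1, h2⟩ := mem_Ioc.mp hi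
      have : Real.log i ≤ Real.log (i + 1 : ℕ) := Real.log_le_log (by exact_mod_cast h1)
        (by push_cast; linarith)
      linarith
    rcases norm_sum_mul_le_of_antitone (a := g) (w := fun k : ℕ => Real.log z - Real.log k)
      (B := T) (m := 0) (n := z) hw ha fun k _ _ => by rw [← hI]; exact hT k with h | h
    · simpa using h
    · obtain rfl : z = 0 := by omega
      simp
  have h2 : ∑ k ∈ Icc 1 z, (Real.log k : ℂ) * g k = (Real.log z : ℂ) * ∑ k ∈ Icc 1 z, g k -
      ∑ k ∈ Ioc 0 z, ((Real.log z - Real.log k : ℝ) : ℂ) * g k := by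
    rw [hI, mul_sum, ← sum_sub_distrib]
    refine sum_congr rfl fun k _ => ?_
    rw [Complex.ofReal_sub]; ring
  rw [h2]
  refine (norm_sub_le _ _).trans ?_
  rw [norm_mul, Complex.norm_of_nonneg hlog]
  have := mul_le_mul_of_nonneg_left (hT z) hlog
  linarith

lemma sum_mul_arith_eq (F G : ArithmeticFunction ℝ) (f : ℕ → ℂ) (y : ℕ) :
    ∑ n ∈ Icc 1 y, ((F * G) n : ℂ) * f n =
      ∑ d ∈ Icc 1 y, (F d : ℂ) * ∑ k ∈ Icc 1 (y / d), (G k : ℂ) * f (d * k) := by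
  calc _ = ∑ n ∈ Icc 1 y, ∑ x ∈ n.divisorsAntidiagonal,
        (F x.1 : ℂ) * ((G x.2 : ℂ) * f (x.1 * x.2)) := by
        refine sum_congr rfl fun n _ => ?_
        rw [ArithmeticFunction.mul_apply, Complex.ofReal_sum, sum_mul]
        refine sum_congr rfl fun x hx => ?_
        rw [(Nat.mem_divisorsAntidiagonal.mp hx).1, Complex.ofReal_mul]; ring
    _ = _ := by
        rw [sum_Icc_sum_divisors y fun d k => (F d : ℂ) * ((G k : ℂ) * f (d * k))]
        exact sum_congr rfl fun d _ => (mul_sum _ _ _).symm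

lemma abs_moebius_mul_vonMangoldt_le (U V m : ℕ) :
    |(truncLE (moebius : ArithmeticFunction ℝ) U * truncLE vonMangoldt V) m| ≤ Real.log m := by
  rw [ArithmeticFunction.mul_apply]
  refine (abs_sum_le_sum_abs _ _).trans ?_
  rw [← vonMangoldt_sum, ← Nat.sum_divisorsAntidiagonal' (fun _ e => vonMangoldt e)]
  refine sum_le_sum fun x _ => ?_
  rw [abs_mul]
  have h1 := (abs_truncLE_le (f := (moebius : ArithmeticFunction ℝ)) U x.1).trans
    (abs_moebius_real_le x.1)
  have h2 := abs_truncLE_le (f := vonMangoldt) V x.2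
  rw [abs_of_nonneg (vonMangoldt_nonneg (n := x.2))] at h2
  calc _ ≤ 1 * vonMangoldt x.2 := mul_le_mul h1 h2 (abs_nonneg _) zero_le_one
    _ = _ := one_mul _

lemma moebius_mul_vonMangoldt_eq_zero {U V m : ℕ} (hm : U * V < m) :
    (truncLE (moebius : ArithmeticFunction ℝ) U * truncLE vonMangoldt V) m = 0 := by
  rw [ArithmeticFunction.mul_apply]
  refine sum_eq_zero fun x hx => ?_
  have h := (Nat.mem_divisorsAntidiagonal.mp hx).1
  rw [truncLE_apply, truncLE_apply]
  by_cases h1 : x.1 ≤ U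
  · by_cases h2 : x.2 ≤ V
    · have := Nat.mul_le_mul h1 h2
      omega
    · rw [if_neg h2, mul_zero]
  · rw [if_neg h1, zero_mul]

lemma norm_sum_le_card_mul {F : ℕ → ℂ} {W y : ℕ} {B : ℝ} (h0 : ∀ d, W < d → F d = 0)
    (hB : ∀ d ∈ Icc 1 y, d ≤ W → ‖F d‖ ≤ B) (hB0 : 0 ≤ B) : ‖∑ d ∈ Icc 1 y, F d‖ ≤ W * B := by
  have : ∑ d ∈ Icc 1 y, F d = ∑ d ∈ Icc 1 y with d ≤ W, F d := by
    rw [sum_filter]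
    refine sum_congr rfl fun d _ => ?_
    split_ifs with h
    · rfl
    · exact h0 d (by omega)
  rw [this]
  refine (norm_sum_le_of_le (n := fun _ => B) _ fun d hd => ?_).trans ?_
  · obtain ⟨h1, h2⟩ := mem_filter.mp hd
    exact hB d h1 h2
  · rw [sum_const, nsmul_eq_mul]
    refine mul_le_mul_of_nonneg_right ?_ hB0
    have : #{d ∈ Icc 1 y | d ≤ W} ≤ #(Icc 1 W) := card_le_card fun d hd => by
      simp only [mem_filter, mem_Icc] at hd ⊢; omega
    rw [Nat.card_Icc, Nat.add_sub_cancel] at this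
    exact_mod_cast this

lemma sum_vaughanCoeff_mul_eq {U V h y I : ℕ} (hU : 1 ≤ U) (hI : y ≤ cellSeq U h I)
    (f : ℕ → ℂ) :
    ∑ n ∈ Icc 1 y, ((vaughanCoeff U * (vonMangoldt - truncLE vonMangoldt V)) n : ℂ) * f n =
    ∑ i ∈ range I, ∑ m ∈ Ioc (cellSeq U h i) (cellSeq U h (i + 1)),
      ∑ k ∈ Ioc V (y / cellSeq U h i), (vaughanCoeff U m : ℂ) * (vonMangoldt k : ℂ) * f (m * k) -
    ∑ n ∈ Ioc y (y + y / h), (cellCoeff U V h y I n : ℂ) * f n := by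
  rw [sum_cells_eq fun m k => (vaughanCoeff U m : ℂ) * (vonMangoldt k : ℂ) * f (m * k)]
  have h1 : ∀ n, ∑ x ∈ n.divisorsAntidiagonal, (cellWeight U V h y I x.1 x.2 : ℂ) *
      ((vaughanCoeff U x.1 : ℂ) * (vonMangoldt x.2 : ℂ) * f (x.1 * x.2)) =
      (cellCoeff U V h y I n : ℂ) * f n := by
    intro n
    rw [cellCoeff, Complex.ofReal_sum, sum_mul]
    refine sum_congr rfl fun x hx => ?_
    rw [(Nat.mem_divisorsAntidiagonal.mp hx).1]
    push_cast; ring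
  simp_rw [h1]
  have hsplit : Icc 1 (y + y / h) = Icc 1 y ∪ Ioc y (y + y / h) := by
    ext n; simp only [mem_Icc, mem_union, mem_Ioc]
    have := Nat.zero_le (y / h)
    generalize y / h = w at *
    omega
  have hdisj : Disjoint (Icc 1 y) (Ioc y (y + y / h)) := by
    rw [disjoint_left]; intro n h1 h2
    simp only [mem_Icc, mem_Ioc] at h1 h2; omega
  rw [hsplit, sum_union hdisj, add_sub_cancel_right]
  refine sum_congr rfl fun n hn => congrArg (fun z : ℝ => (z : ℂ) * f n) ?_
  rw [ArithmeticFunction.mul_apply, cellCoeff]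
  refine sum_congr rfl fun x hx => ?_
  obtain ⟨hx1, hx0⟩ := Nat.mem_divisorsAntidiagonal.mp hx
  have hx2 : 1 ≤ x.2 := Nat.pos_of_ne_zero fun h => by rw [h] at hx1; simp at hx1; exact hx0 hx1.symm
  rw [cellWeight_eq hU hI hx2 (hx1 ▸ (mem_Icc.mp hn).2), sub_eq_add_neg,
    ArithmeticFunction.add_apply, ArithmeticFunction.neg_apply, truncLE_apply]
  by_cases hm : x.1 ≤ U
  · rw [vaughanCoeff_eq_zero hm]; simp
  · by_cases hk : x.2 ≤ V
    · rw [if_pos hk, if_neg (by omega)]; simp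
    · rw [if_neg hk, if_pos (by omega)]; simp

/-- Vaughan's identity with the bilinear part split into multiplicative cells. -/
theorem norm_sum_vonMangoldt_mul_le {N U V h y I : ℕ} (hU : 1 ≤ U) (hV : 1 ≤ V)
    (hy : y ≤ N) (hI : y ≤ cellSeq U h I) {f : ℕ → ℂ} (hf : ∀ n, ‖f n‖ ≤ 1)
    {T : ℝ} (hT : ∀ m ∈ Icc 1 (U * V), ∀ z, ‖∑ k ∈ Icc 1 z, f (m * k)‖ ≤ T) :
    ‖∑ n ∈ Icc 1 y, (vonMangoldt n : ℂ) * f n‖ ≤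
      V * Real.log N + 3 * (U * V * (Real.log N * T)) +
      ∑ i ∈ range I, ‖∑ m ∈ Ioc (cellSeq U h i) (cellSeq U h (i + 1)),
        ∑ k ∈ Ioc V (y / cellSeq U h i),
          (vaughanCoeff U m : ℂ) * (vonMangoldt k : ℂ) * f (m * k)‖ +
      ‖∑ n ∈ Ioc y (y + y / h), (cellCoeff U V h y I n : ℂ) * f n‖ := by
  have hUV' : U ≤ U * V := Nat.le_mul_of_pos_right U hV
  have hT0 : 0 ≤ T := (norm_nonneg _).trans (hT 1 (by rw [mem_Icc]; omega) 0)
  have hL : ∀ n ≤ N, Real.log (n : ℝ) ≤ Real.log N := by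
    intro n hn
    rcases Nat.eq_zero_or_pos n with rfl | h0
    · simpa using Real.log_natCast_nonneg N
    · exact Real.log_le_log (by exact_mod_cast h0) (by exact_mod_cast hn)
  have hL0 := Real.log_natCast_nonneg N
  have e1 : ‖∑ n ∈ Icc 1 y, (truncLE vonMangoldt V n : ℂ) * f n‖ ≤ V * Real.log N := by
    refine norm_sum_le_card_mul (fun d hd => ?_) (fun d hd hdV => ?_) hL0
    · rw [truncLE_apply, if_neg (by omega)]; simp
    · rw [truncLE_apply, if_pos hdV, norm_mul, Complex.norm_of_nonneg vonMangoldt_nonneg]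
      refine (mul_le_of_le_one_right vonMangoldt_nonneg (hf d)).trans ?_
      exact vonMangoldt_le_log.trans (hL d ((mem_Icc.mp hd).2.trans hy))
  have e2 : ‖∑ n ∈ Icc 1 y, ((truncLE (moebius : ArithmeticFunction ℝ) U * log) n : ℂ) * f n‖ ≤
      U * (2 * Real.log N * T) := by
    rw [sum_mul_arith_eq]
    refine norm_sum_le_card_mul (fun d hd => ?_) (fun d hd hdU => ?_) (by positivity)
    · rw [truncLE_apply, if_neg (by omega)]; simp
    · rw [norm_mul, Complex.norm_real, Real.norm_eq_abs]
      have h1 := (abs_truncLE_le (f := (moebius : ArithmeticFunction ℝ)) U d).trans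
        (abs_moebius_real_le d)
      refine (mul_le_of_le_one_left (norm_nonneg _) h1).trans ?_
      have hd1 := (mem_Icc.mp hd).1
      refine (norm_sum_log_mul_le (g := fun k => f (d * k)) (T := T)
        (fun z => hT d (by rw [mem_Icc]; omega) z)).trans ?_
      have := hL (y / d) ((Nat.div_le_self _ _).trans hy)
      gcongr
  have e3 : ‖∑ n ∈ Icc 1 y, ((truncLE (moebius : ArithmeticFunction ℝ) U *
      truncLE vonMangoldt V * (zeta : ArithmeticFunction ℝ)) n : ℂ) * f n‖ ≤
      (U * V : ℕ) * (Real.log N * T) := by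
    rw [sum_mul_arith_eq]
    refine norm_sum_le_card_mul (fun d hd => ?_) (fun d hd hdU => ?_) (by positivity)
    · rw [moebius_mul_vonMangoldt_eq_zero hd]; simp
    · rw [norm_mul, Complex.norm_real, Real.norm_eq_abs]
      refine mul_le_mul ((abs_moebius_mul_vonMangoldt_le U V d).trans
        (hL d ((mem_Icc.mp hd).2.trans hy))) ?_ (norm_nonneg _) hL0
      have hd1 := (mem_Icc.mp hd).1
      have : ∑ k ∈ Icc 1 (y / d), ((zeta : ArithmeticFunction ℝ) k : ℂ) * f (d * k) =
          ∑ k ∈ Icc 1 (y / d), f (d * k) := by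
        refine sum_congr rfl fun k hk => ?_
        have hk0 : k ≠ 0 := by have := (mem_Icc.mp hk).1; omega
        rw [natCoe_apply, zeta_apply_ne hk0]; simp
      rw [this]
      exact hT d (by rw [mem_Icc]; omega) _
  have key : ∑ n ∈ Icc 1 y, (vonMangoldt n : ℂ) * f n =
      ∑ n ∈ Icc 1 y, (truncLE vonMangoldt V n : ℂ) * f n +
      ∑ n ∈ Icc 1 y, ((truncLE (moebius : ArithmeticFunction ℝ) U * log) n : ℂ) * f n -
      ∑ n ∈ Icc 1 y, ((truncLE (moebius : ArithmeticFunction ℝ) U *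
        truncLE vonMangoldt V * (zeta : ArithmeticFunction ℝ)) n : ℂ) * f n +
      ∑ n ∈ Icc 1 y, ((vaughanCoeff U * (vonMangoldt - truncLE vonMangoldt V)) n : ℂ) * f n := by
    rw [← sum_add_distrib, ← sum_sub_distrib, ← sum_add_distrib]
    refine sum_congr rfl fun n _ => ?_
    have hv := congrArg (fun F : ArithmeticFunction ℝ => F n) (vaughan_identity U V)
    simp only [sub_eq_add_neg, ArithmeticFunction.add_apply, ArithmeticFunction.neg_apply] at hv
    rw [sub_eq_add_neg vonMangoldt]
    have hv' := congrArg (fun z : ℝ => (z : ℂ) * f n) hv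
    refine hv'.trans ?_
    push_cast
    ring
  rw [key, sum_vaughanCoeff_mul_eq (h := h) (I := I) hU hI f]
  refine (norm_add_le _ _).trans ?_
  refine (add_le_add ((norm_sub_le _ _).trans (add_le_add (norm_add_le _ _) le_rfl))
    ((norm_sub_le _ _).trans (add_le_add (norm_sum_le _ _) le_rfl))).trans ?_
  have hU2 : (U : ℝ) * (2 * Real.log N * T) ≤ (U * V) * (2 * Real.log N * T) := by
    refine mul_le_mul_of_nonneg_right ?_ (by positivity)
    exact_mod_cast hUV'
  push_cast at e3
  linarith

end

lemma le_cellSeq_growth {U h : ℕ} (hh : 1 ≤ h) (hU : h ≤ U) (i : ℕ) :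
    (U : ℝ) * (1 + 1 / (2 * h)) ^ i ≤ cellSeq U h i := by
  induction i with
  | zero => simp [cellSeq]
  | succ i ih =>
    have hM : h ≤ cellSeq U h i := hU.trans (le_cellSeq U h i)
    rw [cellSeq_succ]
    obtain ⟨M, hMdef⟩ : ∃ M, M = cellSeq U h i := ⟨_, rfl⟩
    rw [← hMdef] at hM ih ⊢
    have h1 : M ≤ 2 * h * (M / h) := by
      have h2 := Nat.div_add_mod M h
      have h3 := Nat.mod_lt M hh
      have h4 : 1 ≤ M / h := (Nat.one_le_div_iff hh).mpr hM
      have h5 : h ≤ h * (M / h) := Nat.le_mul_of_pos_right h h4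
      have : 2 * h * (M / h) = h * (M / h) + h * (M / h) := by ring
      omega
    have hh' : (0 : ℝ) < h := by exact_mod_cast hh
    have h1' : (M : ℝ) ≤ 2 * h * (M / h : ℕ) := by exact_mod_cast h1
    have h2 : (M : ℝ) / (2 * h) ≤ (M / h : ℕ) := by
      rw [div_le_iff₀ (by positivity)]; linarith
    rw [pow_succ, ← mul_assoc]
    refine (mul_le_mul_of_nonneg_right ih (by positivity)).trans ?_
    push_cast
    have : (M : ℝ) * (1 + 1 / (2 * h)) = M + M / (2 * h) := by ring
    linarith

lemma le_cellSeq_of_log {U h y : ℕ} (hh : 1 ≤ h) (hU : h ≤ U) :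
    y ≤ cellSeq U h (2 * h * (Nat.log 2 y + 1)) := by
  have h1 := le_cellSeq_growth hh hU (2 * h * (Nat.log 2 y + 1))
  have hh' : (0 : ℝ) < h := by exact_mod_cast hh
  have h2 : (2 : ℝ) ≤ (1 + 1 / (2 * h)) ^ (2 * h) := by
    have := one_add_mul_le_pow (a := 1 / (2 * (h : ℝ))) (by
      have : (0 : ℝ) ≤ 1 / (2 * h) := by positivity
      linarith) (2 * h)
    refine le_trans (le_of_eq ?_) this
    push_cast; field_simp; norm_num
  have h3 : (y : ℝ) ≤ 2 ^ (Nat.log 2 y + 1) := by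
    exact_mod_cast (Nat.lt_pow_succ_log_self one_lt_two y).le
  have h4 : (2 : ℝ) ^ (Nat.log 2 y + 1) ≤ (1 + 1 / (2 * h)) ^ (2 * h * (Nat.log 2 y + 1)) := by
    rw [pow_mul]; gcongr
  have h5 : (1 : ℝ) ≤ U := by exact_mod_cast hh.trans hU
  have h6 : (0 : ℝ) ≤ (1 + 1 / (2 * h)) ^ (2 * h * (Nat.log 2 y + 1)) := by positivity
  have : (y : ℝ) ≤ cellSeq U h (2 * h * (Nat.log 2 y + 1)) := by
    have := mul_le_mul_of_nonneg_right h5 h6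
    linarith
  exact_mod_cast this

section
open DirichletCharacter

lemma card_primChars_le (r : ℕ) [NeZero r] : (primChars r).card ≤ r.totient := by
  classical
  refine (card_le_univ _).trans (le_of_eq ?_)
  rw [← Nat.card_eq_fintype_card]
  exact card_eq_totient_of_hasEnoughRootsOfUnity ℂ r

lemma large_sieve_block {P : ℕ} (hP : 1 ≤ P) (m n : ℕ) (c : ℕ → ℂ) :
    ∑ r ∈ Ioc P (2 * P), (r.totient : ℝ)⁻¹ * ∑ ψ ∈ primChars r, ‖∑ k ∈ Ioc m n, c k * ψ k‖ ^ 2 ≤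
      (P : ℝ)⁻¹ * (((n - m : ℕ) + (2 * P : ℝ) ^ 2 * (1 + 2 * Real.log (2 * P))) *
        ∑ k ∈ Ioc m n, ‖c k‖ ^ 2) := by
  have hP' : (0 : ℝ) < P := by exact_mod_cast hP
  have h := multiplicative_large_sieve (R := 2 * P) (by omega) (m + 1) (n + 1) c
  have hIoc : Ico (m + 1) (n + 1) = Ioc m n := by
    ext; simp only [mem_Ico, mem_Ioc]; omega
  rw [hIoc, Nat.add_sub_add_right] at h
  push_cast at h
  refine le_trans ?_ (mul_le_mul_of_nonneg_left h (by positivity))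
  rw [mul_sum]
  refine (sum_le_sum fun r hr => ?_).trans (sum_le_sum_of_subset_of_nonneg (s := Ioc P (2 * P))
    (fun r hr => ?_) fun _ _ _ => by positivity)
  · obtain ⟨h1, h2⟩ := mem_Ioc.mp hr
    rw [← mul_assoc]
    refine mul_le_mul_of_nonneg_right ?_ (by positivity)
    rw [div_eq_mul_inv, ← mul_assoc]
    refine le_mul_of_one_le_left (by positivity) ?_
    rw [inv_mul_eq_div, one_le_div hP']
    exact_mod_cast h1.le
  · obtain ⟨h1, h2⟩ := mem_Ioc.mp hr
    rw [mem_Icc]; omega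

lemma sum_primChars_cauchy (s : Finset ℕ) {w : ℕ → ℝ} (hw : ∀ r, 0 ≤ w r)
    (u v : ∀ r, DirichletCharacter ℂ r → ℝ) :
    (∑ r ∈ s, w r * ∑ ψ ∈ primChars r, u r ψ * v r ψ) ^ 2 ≤
      (∑ r ∈ s, w r * ∑ ψ ∈ primChars r, u r ψ ^ 2) *
        ∑ r ∈ s, w r * ∑ ψ ∈ primChars r, v r ψ ^ 2 := by
  have e : ∀ F : ∀ r, DirichletCharacter ℂ r → ℝ, ∑ r ∈ s, w r * ∑ ψ ∈ primChars r, F r ψ =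
      ∑ x ∈ s.sigma primChars, w x.1 * F x.1 x.2 := by
    intro F
    simp_rw [mul_sum]
    rw [sum_sigma']
  rw [e fun r ψ => u r ψ * v r ψ, e fun r ψ => u r ψ ^ 2, e fun r ψ => v r ψ ^ 2]
  refine sum_sq_le_sum_mul_sum_of_sq_le_mul _ (fun x _ => mul_nonneg (hw _) (sq_nonneg _))
    (fun x _ => mul_nonneg (hw _) (sq_nonneg _)) fun x _ => le_of_eq (by ring)

lemma sum_primChars_bilinear_sq_le {P : ℕ} (hP : 1 ≤ P) (m₁ m₂ k₁ k₂ : ℕ) (b a : ℕ → ℂ) :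
    (∑ r ∈ Ioc P (2 * P), (r.totient : ℝ)⁻¹ * ∑ ψ ∈ primChars r,
      ‖(∑ m ∈ Ioc m₁ m₂, b m * ψ m) * ∑ k ∈ Ioc k₁ k₂, a k * ψ k‖) ^ 2 ≤
    ((P : ℝ)⁻¹ * (((m₂ - m₁ : ℕ) + (2 * P : ℝ) ^ 2 * (1 + 2 * Real.log (2 * P))) *
        ∑ k ∈ Ioc m₁ m₂, ‖b k‖ ^ 2)) *
    ((P : ℝ)⁻¹ * (((k₂ - k₁ : ℕ) + (2 * P : ℝ) ^ 2 * (1 + 2 * Real.log (2 * P))) *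
        ∑ k ∈ Ioc k₁ k₂, ‖a k‖ ^ 2)) := by
  refine le_trans ?_ (mul_le_mul (large_sieve_block hP m₁ m₂ b) (large_sieve_block hP k₁ k₂ a)
    (by positivity) ?_)
  · simp_rw [norm_mul]
    exact sum_primChars_cauchy _ (fun r => by positivity)
      (fun r ψ => ‖∑ m ∈ Ioc m₁ m₂, b m * ψ m‖) fun r ψ => ‖∑ k ∈ Ioc k₁ k₂, a k * ψ k‖
  · exact le_trans (by positivity) (large_sieve_block hP m₁ m₂ b)

lemma sum_primChars_sq_le {P : ℕ} (hP : 1 ≤ P) (m n : ℕ) (c : ℕ → ℂ) :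
    (∑ r ∈ Ioc P (2 * P), (r.totient : ℝ)⁻¹ * ∑ ψ ∈ primChars r, ‖∑ k ∈ Ioc m n, c k * ψ k‖) ^ 2 ≤
      ((n - m : ℕ) + (2 * P : ℝ) ^ 2 * (1 + 2 * Real.log (2 * P))) *
        ∑ k ∈ Ioc m n, ‖c k‖ ^ 2 := by
  have hP' : (0 : ℝ) < P := by exact_mod_cast hP
  have h1 : ∑ r ∈ Ioc P (2 * P), (r.totient : ℝ)⁻¹ * ∑ ψ ∈ primChars r, (1 : ℝ) ≤ P := by
    calc _ ≤ ∑ r ∈ Ioc P (2 * P), (1 : ℝ) := by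
          refine sum_le_sum fun r hr => ?_
          have hr0 : 0 < r := (Nat.zero_le P).trans_lt (mem_Ioc.mp hr).1
          have : NeZero r := ⟨hr0.ne'⟩
          rw [sum_const, nsmul_eq_mul, mul_one, inv_mul_le_iff₀ (by
            exact_mod_cast Nat.totient_pos.mpr hr0), mul_one]
          exact_mod_cast card_primChars_le r
      _ = P := by
          rw [sum_const, Nat.card_Ioc, nsmul_eq_mul, mul_one]
          exact congrArg _ (by omega)
  have h2 := large_sieve_block hP m n c
  have h3 : (∑ r ∈ Ioc P (2 * P), (r.totient : ℝ)⁻¹ * ∑ ψ ∈ primChars r,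
      ‖∑ k ∈ Ioc m n, c k * ψ k‖) ^ 2 ≤
      (∑ r ∈ Ioc P (2 * P), (r.totient : ℝ)⁻¹ * ∑ ψ ∈ primChars r, (1 : ℝ)) *
      ∑ r ∈ Ioc P (2 * P), (r.totient : ℝ)⁻¹ * ∑ ψ ∈ primChars r,
        ‖∑ k ∈ Ioc m n, c k * ψ k‖ ^ 2 := by
    simpa using sum_primChars_cauchy (Ioc P (2 * P)) (fun r => by positivity)
      (w := fun r => (r.totient : ℝ)⁻¹) (fun _ _ => 1) fun r ψ => ‖∑ k ∈ Ioc m n, c k * ψ k‖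
  refine h3.trans ((mul_le_mul h1 h2 (by positivity) hP'.le).trans (le_of_eq ?_))
  rw [← mul_assoc, mul_inv_cancel₀ hP'.ne', one_mul]
end

/-- `⌈log N⌉` as a natural number. -/
def ell (N : ℕ) : ℕ := ⌈Real.log N⌉₊

lemma log_le_ell (N : ℕ) : Real.log N ≤ ell N := Nat.le_ceil _

lemma ell_le {N : ℕ} (hL : 1 ≤ Real.log N) : (ell N : ℝ) ≤ 2 * Real.log N := by
  have := Nat.ceil_lt_add_one (a := Real.log N) (by linarith)
  rw [ell]; linarith

lemma one_le_ell {N : ℕ} (hL : 1 ≤ Real.log N) : 1 ≤ ell N := by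
  have h := hL.trans (log_le_ell N)
  exact_mod_cast h

lemma log_two_mul_le {N n : ℕ} (hL : 1 ≤ Real.log N) (hn : n ≤ 2 * N) :
    Real.log n ≤ 2 * ell N := by
  have hl := log_le_ell N
  rcases Nat.eq_zero_or_pos n with rfl | h0
  · simp
  have hN : N ≠ 0 := by rintro rfl; simp at hL; linarith
  have h1 : Real.log n ≤ Real.log (2 * N : ℕ) :=
    Real.log_le_log (by exact_mod_cast h0) (by exact_mod_cast hn)
  rw [Nat.cast_mul, Real.log_mul (by norm_num) (by exact_mod_cast hN)] at h1
  have := Real.log_two_lt_d9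
  push_cast at h1
  linarith

lemma sum_card_divisors_sq_le {N n : ℕ} (hL : 1 ≤ Real.log N) (hn : n ≤ 2 * N) :
    ∑ m ∈ Icc 1 n, (m.divisors.card : ℝ) ^ 2 ≤ 81 * n * (ell N : ℝ) ^ 4 := by
  have hl : (1 : ℝ) ≤ ell N := hL.trans (log_le_ell N)
  refine (sum_card_divisors_pow_le 2 n).trans ?_
  have h1 := log_two_mul_le hL hn
  have h0 := Real.log_natCast_nonneg n
  have h2 : (1 + Real.log n) ^ 2 ^ 2 ≤ (3 * (ell N : ℝ)) ^ 4 := by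
    refine pow_le_pow_left₀ (by linarith) (by linarith) _
  calc _ ≤ (n : ℝ) * (3 * (ell N : ℝ)) ^ 4 := mul_le_mul_of_nonneg_left h2 (Nat.cast_nonneg _)
    _ = _ := by ring

lemma sum_sq_vaughanCoeff_le {N U M M' : ℕ} (hL : 1 ≤ Real.log N) (hM : M ≤ N)
    (hM' : M' ≤ 2 * M) :
    ∑ m ∈ Ioc M M', (vaughanCoeff U m) ^ 2 ≤ 162 * M * (ell N : ℝ) ^ 4 := by
  calc _ ≤ ∑ m ∈ Icc 1 M', (m.divisors.card : ℝ) ^ 2 := by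
        refine (sum_le_sum fun m _ => sq_le_sq' (neg_le_of_abs_le (abs_vaughanCoeff_le U m))
          (le_of_abs_le (abs_vaughanCoeff_le U m))).trans ?_
        refine sum_le_sum_of_subset_of_nonneg (fun m hm => ?_) fun _ _ _ => by positivity
        simp only [mem_Ioc, mem_Icc] at hm ⊢; omega
    _ ≤ 81 * M' * (ell N : ℝ) ^ 4 := sum_card_divisors_sq_le hL (by omega)
    _ ≤ 81 * (2 * M : ℕ) * (ell N : ℝ) ^ 4 := by gcongr
    _ = _ := by push_cast; ring

section
open ArithmeticFunction

lemma sum_sq_vonMangoldt_le {N V z : ℕ} (hz : z ≤ N) :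
    ∑ k ∈ Ioc V z, (vonMangoldt k : ℝ) ^ 2 ≤ z * (ell N : ℝ) ^ 2 := by
  calc _ ≤ ∑ k ∈ Ioc V z, (ell N : ℝ) ^ 2 := by
        refine sum_le_sum fun k hk => pow_le_pow_left₀ vonMangoldt_nonneg ?_ _
        obtain ⟨h1, h2⟩ := mem_Ioc.mp hk
        refine vonMangoldt_le_log.trans (le_trans ?_ (log_le_ell N))
        exact Real.log_le_log (by exact_mod_cast (Nat.zero_le V).trans_lt h1)
          (by exact_mod_cast h2.trans hz)
    _ ≤ _ := by
        rw [sum_const, Nat.card_Ioc, nsmul_eq_mul]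
        refine mul_le_mul_of_nonneg_right ?_ (by positivity)
        exact_mod_cast Nat.sub_le _ _

lemma sum_sq_cellCoeff_le {N U V h y I : ℕ} (hL : 1 ≤ Real.log N) (hy : y ≤ N) :
    ∑ n ∈ Ioc y (y + y / h), (cellCoeff U V h y I n) ^ 2 ≤ 648 * N * (ell N : ℝ) ^ 6 := by
  have hyh := Nat.div_le_self y h
  calc _ ≤ ∑ n ∈ Ioc y (y + y / h), (n.divisors.card : ℝ) ^ 2 * (2 * ell N) ^ 2 := by
        refine sum_le_sum fun n hn => ?_
        rw [← mul_pow]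
        obtain ⟨h1, h2⟩ := mem_Ioc.mp hn
        have h3 : |cellCoeff U V h y I n| ≤ n.divisors.card * (2 * ell N) :=
          (abs_cellCoeff_le U V h y I n).trans
            (mul_le_mul_of_nonneg_left (log_two_mul_le hL (by omega)) (Nat.cast_nonneg _))
        exact sq_le_sq' (neg_le_of_abs_le h3) (le_of_abs_le h3)
    _ = (∑ n ∈ Ioc y (y + y / h), (n.divisors.card : ℝ) ^ 2) * (2 * ell N) ^ 2 :=
        (sum_mul _ _ _).symm
    _ ≤ (∑ n ∈ Icc 1 (2 * N), (n.divisors.card : ℝ) ^ 2) * (2 * ell N) ^ 2 := by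
        refine mul_le_mul_of_nonneg_right ?_ (by positivity)
        refine sum_le_sum_of_subset_of_nonneg (fun m hm => ?_) fun _ _ _ => by positivity
        simp only [mem_Ioc, mem_Icc] at hm ⊢; omega
    _ ≤ (81 * (2 * N : ℕ) * (ell N : ℝ) ^ 4) * (2 * ell N) ^ 2 :=
        mul_le_mul_of_nonneg_right (sum_card_divisors_sq_le hL le_rfl) (by positivity)
    _ = _ := by push_cast; ring
end

lemma cell_numeric {x N P M : ℝ} {a : ℕ} (hx : 1 ≤ x) (hP0 : 0 < P) (hP : x ^ (a + 3) ≤ P)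
    (hPN : P ^ 2 * x ^ (2 * a + 8) ≤ N) (hM : x ^ (2 * a + 7) ≤ M)
    (hMN : M * x ^ (2 * a + 7) ≤ N) :
    (P⁻¹ * ((M + 20 * P ^ 2 * x) * (162 * M * x ^ 4))) *
      (P⁻¹ * ((N / M + 20 * P ^ 2 * x) * (N / M * x ^ 2))) ≤ (300 * (N / x ^ a)) ^ 2 := by
  have hx0 : 0 < x := by linarith
  have hM0 : 0 < M := lt_of_lt_of_le (by positivity) hM
  have hN0 : 0 < N := lt_of_lt_of_le (by positivity) hMN
  obtain ⟨t, ht⟩ : ∃ t, t = x ^ a := ⟨_, rfl⟩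
  have ht0 : 0 < t := ht ▸ by positivity
  have e1 : x ^ (2 * a + 7) = t ^ 2 * x ^ 7 := by rw [ht]; ring
  have e2 : x ^ (2 * a + 8) = t ^ 2 * x ^ 8 := by rw [ht]; ring
  have e3 : x ^ (a + 3) = t * x ^ 3 := by rw [ht]; ring
  rw [e1] at hM hMN
  rw [e2] at hPN
  rw [e3] at hP
  rw [← ht]
  have h1 : x ^ 6 * N ^ 2 / P ^ 2 ≤ N ^ 2 / t ^ 2 := by
    rw [div_le_div_iff₀ (by positivity) (by positivity)]
    have : (t * x ^ 3) ^ 2 ≤ P ^ 2 := pow_le_pow_left₀ (by positivity) hP 2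
    calc x ^ 6 * N ^ 2 * t ^ 2 = N ^ 2 * (t * x ^ 3) ^ 2 := by ring
      _ ≤ _ := mul_le_mul_of_nonneg_left this (by positivity)
  have h2 : x ^ 7 * N * M ≤ N ^ 2 / t ^ 2 := by
    rw [le_div_iff₀ (by positivity)]
    calc x ^ 7 * N * M * t ^ 2 = N * (M * (t ^ 2 * x ^ 7)) := by ring
      _ ≤ N * N := mul_le_mul_of_nonneg_left hMN hN0.le
      _ = _ := by ring
  have h3 : x ^ 7 * N * (N / M) ≤ N ^ 2 / t ^ 2 := by
    rw [le_div_iff₀ (by positivity), ← mul_div_assoc, div_mul_eq_mul_div, div_le_iff₀ hM0]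
    calc x ^ 7 * N * N * t ^ 2 = N ^ 2 * (t ^ 2 * x ^ 7) := by ring
      _ ≤ _ := mul_le_mul_of_nonneg_left hM (by positivity)
  have h4 : x ^ 8 * N * P ^ 2 ≤ N ^ 2 / t ^ 2 := by
    rw [le_div_iff₀ (by positivity)]
    calc x ^ 8 * N * P ^ 2 * t ^ 2 = N * (P ^ 2 * (t ^ 2 * x ^ 8)) := by ring
      _ ≤ N * N := mul_le_mul_of_nonneg_left hPN hN0.le
      _ = _ := by ring
  have h5 : 0 ≤ N ^ 2 / t ^ 2 := by positivity
  calc _ = 162 * (x ^ 6 * N ^ 2 / P ^ 2) + 3240 * (x ^ 7 * N * M) +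
        3240 * (x ^ 7 * N * (N / M)) + 64800 * (x ^ 8 * N * P ^ 2) := by field_simp; ring
    _ ≤ 90000 * (N ^ 2 / t ^ 2) := by linarith
    _ = _ := by ring

lemma large_sieve_const_le {N P : ℕ} (hL : 1 ≤ Real.log N) (hPN : P ≤ N) :
    (2 * P : ℝ) ^ 2 * (1 + 2 * Real.log (2 * P)) ≤ 20 * P ^ 2 * ell N := by
  have hl : (1 : ℝ) ≤ ell N := hL.trans (log_le_ell N)
  have h1 := log_two_mul_le (n := 2 * P) hL (by omega)
  push_cast at h1
  calc (2 * P : ℝ) ^ 2 * (1 + 2 * Real.log (2 * P)) ≤ (2 * P : ℝ) ^ 2 * (5 * ell N) :=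
        mul_le_mul_of_nonneg_left (by linarith) (by positivity)
    _ = _ := by ring

section
open ArithmeticFunction DirichletCharacter

lemma norm_sq_mul_char_le {q : ℕ} (ξ : DirichletCharacter ℂ q) (z : ℝ) (n : ℕ) :
    ‖(z : ℂ) * ξ n‖ ^ 2 ≤ z ^ 2 := by
  rw [norm_mul, Complex.norm_real, mul_pow, Real.norm_eq_abs, sq_abs]
  exact mul_le_of_le_one_right (sq_nonneg _) (pow_le_one₀ (norm_nonneg _) (ξ.norm_le_one _))

lemma sum_primChars_cell_le {N y U V P M M' q a : ℕ} (hL : 1 ≤ Real.log N)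
    (hP : (ell N : ℝ) ^ (a + 3) ≤ P) (hPN : (P : ℝ) ^ 2 * (ell N : ℝ) ^ (2 * a + 8) ≤ N)
    (hM : (ell N : ℝ) ^ (2 * a + 7) ≤ M) (hV : (ell N : ℝ) ^ (2 * a + 7) ≤ V) (hM' : M' ≤ 2 * M)
    (hy : y ≤ N) (ξ : DirichletCharacter ℂ q) :
    ∑ r ∈ Ioc P (2 * P), (r.totient : ℝ)⁻¹ * ∑ ψ ∈ primChars r,
      ‖∑ m ∈ Ioc M M', ∑ k ∈ Ioc V (y / M),
        (vaughanCoeff U m : ℂ) * (vonMangoldt k : ℂ) * (ψ (m * k : ℕ) * ξ (m * k : ℕ))‖ ≤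
      300 * (N / (ell N : ℝ) ^ a) := by
  have hl : (1 : ℝ) ≤ ell N := hL.trans (log_le_ell N)
  have hP1 : (1 : ℝ) ≤ P := (one_le_pow₀ hl).trans hP
  have hP1' : 1 ≤ P := by exact_mod_cast hP1
  have hM1 : (1 : ℝ) ≤ M := (one_le_pow₀ hl).trans hM
  have hM1' : 1 ≤ M := by exact_mod_cast hM1
  rcases Nat.lt_or_ge V (y / M) with hVy | hVy
  swap
  · rw [Ioc_eq_empty_of_le hVy]
    simp only [sum_empty, sum_const_zero, norm_zero, mul_zero]
    positivity
  have hMV : M * V ≤ N := by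
    have := (Nat.le_div_iff_mul_le hM1').mp hVy.le
    rw [mul_comm]; omega
  have hMN : (M : ℝ) * (ell N : ℝ) ^ (2 * a + 7) ≤ N := by
    refine (mul_le_mul_of_nonneg_left hV (by positivity)).trans ?_
    exact_mod_cast hMV
  have hMN1 : M ≤ N := by
    have : (M : ℝ) ≤ N := (le_mul_of_one_le_right (by positivity) (one_le_pow₀ hl)).trans hMN
    exact_mod_cast this
  have hPN1 : P ≤ N := by
    have : (P : ℝ) ≤ N := by
      refine le_trans ?_ hPN
      refine le_trans ?_ (le_mul_of_one_le_right (by positivity) (one_le_pow₀ hl))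
      exact le_self_pow₀ hP1 two_ne_zero
    exact_mod_cast this
  have hX := large_sieve_const_le hL hPN1
  have hyM : ((y / M : ℕ) : ℝ) ≤ N / M := Nat.cast_div_le.trans (by gcongr)
  have hyN : y / M ≤ N := (Nat.div_le_self _ _).trans hy
  refine le_of_abs_le (abs_le_of_sq_le_sq ?_ (by positivity))
  have hfac : ∀ r (ψ : DirichletCharacter ℂ r), ∑ m ∈ Ioc M M', ∑ k ∈ Ioc V (y / M),
      (vaughanCoeff U m : ℂ) * (vonMangoldt k : ℂ) * (ψ (m * k : ℕ) * ξ (m * k : ℕ)) =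
      (∑ m ∈ Ioc M M', ((vaughanCoeff U m : ℂ) * ξ m) * ψ m) *
        ∑ k ∈ Ioc V (y / M), ((vonMangoldt k : ℂ) * ξ k) * ψ k := by
    intro r ψ
    rw [sum_mul_sum]
    refine sum_congr rfl fun m _ => sum_congr rfl fun k _ => ?_
    push_cast
    rw [map_mul, map_mul]; ring
  simp_rw [hfac]
  refine (sum_primChars_bilinear_sq_le hP1' M M' V (y / M) _ _).trans ?_
  refine le_trans ?_ (cell_numeric (a := a) hl (by positivity) hP hPN hM hMN)
  have hb : ∑ k ∈ Ioc M M', ‖(vaughanCoeff U k : ℂ) * ξ k‖ ^ 2 ≤ 162 * M * (ell N : ℝ) ^ 4 :=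
    (sum_le_sum fun k _ => norm_sq_mul_char_le ξ _ k).trans (sum_sq_vaughanCoeff_le hL hMN1 hM')
  have ha : ∑ k ∈ Ioc V (y / M), ‖(vonMangoldt k : ℂ) * ξ k‖ ^ 2 ≤ N / M * (ell N : ℝ) ^ 2 :=
    ((sum_le_sum fun k _ => norm_sq_mul_char_le ξ _ k).trans (sum_sq_vonMangoldt_le hyN)).trans
      (by gcongr)
  have h1 : ((M' - M : ℕ) : ℝ) ≤ M := by exact_mod_cast (by omega : M' - M ≤ M)
  have h2 : ((y / M - V : ℕ) : ℝ) ≤ N / M := le_trans (by exact_mod_cast Nat.sub_le _ _) hyM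
  have hlog : 0 ≤ Real.log (2 * P) := Real.log_nonneg (by linarith)
  refine mul_le_mul (mul_le_mul_of_nonneg_left (mul_le_mul (add_le_add h1 hX) hb ?_ ?_) ?_)
    (mul_le_mul_of_nonneg_left (mul_le_mul (add_le_add h2 hX) ha ?_ ?_) ?_) ?_ ?_ <;> positivity

lemma sum_primChars_tail_le {N y U V P h I q a : ℕ} (hL : 1 ≤ Real.log N) (hP1 : 1 ≤ P)
    (hPN : (P : ℝ) ^ 2 * (ell N : ℝ) ^ (2 * a + 7) ≤ N) (hh : (ell N : ℝ) ^ (2 * a + 6) ≤ h)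
    (hy : y ≤ N) (ξ : DirichletCharacter ℂ q) :
    ∑ r ∈ Ioc P (2 * P), (r.totient : ℝ)⁻¹ * ∑ ψ ∈ primChars r,
      ‖∑ n ∈ Ioc y (y + y / h), (cellCoeff U V h y I n : ℂ) * (ψ n * ξ n)‖ ≤
      120 * (N / (ell N : ℝ) ^ a) := by
  have hl : (1 : ℝ) ≤ ell N := hL.trans (log_le_ell N)
  have hP1' : (1 : ℝ) ≤ P := by exact_mod_cast hP1
  have hPN1 : P ≤ N := by
    have : (P : ℝ) ≤ N := by
      refine le_trans ?_ hPN
      refine le_trans ?_ (le_mul_of_one_le_right (by positivity) (one_le_pow₀ hl))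
      exact le_self_pow₀ hP1' two_ne_zero
    exact_mod_cast this
  refine le_of_abs_le (abs_le_of_sq_le_sq ?_ (by positivity))
  have hfac : ∀ r (ψ : DirichletCharacter ℂ r), ∑ n ∈ Ioc y (y + y / h),
      (cellCoeff U V h y I n : ℂ) * (ψ n * ξ n) =
      ∑ n ∈ Ioc y (y + y / h), ((cellCoeff U V h y I n : ℂ) * ξ n) * ψ n :=
    fun r ψ => sum_congr rfl fun n _ => by ring
  simp_rw [hfac]
  refine (sum_primChars_sq_le hP1 _ _ _).trans ?_
  have hc : ∑ n ∈ Ioc y (y + y / h), ‖(cellCoeff U V h y I n : ℂ) * ξ n‖ ^ 2 ≤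
      648 * N * (ell N : ℝ) ^ 6 :=
    (sum_le_sum fun k _ => norm_sq_mul_char_le ξ _ k).trans (sum_sq_cellCoeff_le hL hy)
  have hX := large_sieve_const_le hL hPN1
  obtain ⟨t, ht⟩ : ∃ t, t = (ell N : ℝ) ^ a := ⟨_, rfl⟩
  obtain ⟨x, hx⟩ : ∃ x, x = (ell N : ℝ) := ⟨_, rfl⟩
  rw [← ht]
  rw [← hx] at hl hh hPN hc hX ht
  have hx0 : 0 < x := by linarith
  have ht0 : 0 < t := ht ▸ by positivity
  have hh0 : (0 : ℝ) < h := lt_of_lt_of_le (by positivity) hh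
  have e1 : x ^ (2 * a + 6) = t ^ 2 * x ^ 6 := by rw [ht]; ring
  have e2 : x ^ (2 * a + 7) = t ^ 2 * x ^ 7 := by rw [ht]; ring
  rw [e1] at hh
  rw [e2] at hPN
  have h1 : ((y + y / h - y : ℕ) : ℝ) ≤ N / (t ^ 2 * x ^ 6) := by
    rw [Nat.add_sub_cancel_left]
    refine Nat.cast_div_le.trans ?_
    gcongr
  have h2 : 20 * (P : ℝ) ^ 2 * x ≤ 20 * (N / (t ^ 2 * x ^ 6)) := by
    rw [mul_assoc]
    refine mul_le_mul_of_nonneg_left ?_ (by norm_num)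
    rw [le_div_iff₀ (by positivity)]
    calc (P : ℝ) ^ 2 * x * (t ^ 2 * x ^ 6) = P ^ 2 * (t ^ 2 * x ^ 7) := by ring
      _ ≤ _ := hPN
  have hlog : 0 ≤ Real.log (2 * P) := Real.log_nonneg (by linarith)
  refine (mul_le_mul (add_le_add h1 (hX.trans h2)) hc (by positivity) (by positivity)).trans ?_
  calc (N / (t ^ 2 * x ^ 6) + 20 * (N / (t ^ 2 * x ^ 6))) * (648 * N * x ^ 6) =
      13608 * (N / t) ^ 2 := by field_simp; ring
    _ ≤ _ := by have := sq_nonneg ((N : ℝ) / t); nlinarith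
end

section
open ArithmeticFunction DirichletCharacter

/-- The product of two characters as a character modulo the product of the levels. -/
def charTwist {r q : ℕ} (ψ : DirichletCharacter ℂ r) (ξ : DirichletCharacter ℂ q) :
    DirichletCharacter ℂ (r * q) :=
  changeLevel (Nat.dvd_mul_right r q) ψ * changeLevel (Nat.dvd_mul_left q r) ξ

lemma charTwist_apply {r q : ℕ} (ψ : DirichletCharacter ℂ r) (ξ : DirichletCharacter ℂ q) (n : ℕ) :
    charTwist ψ ξ n = ψ n * ξ n := changeLevel_mul_apply ψ ξ n

/-- Norm of a twisted von Mangoldt sum, set to zero for principal twists. -/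
def twistedNorm (y : ℕ) {r q : ℕ} (ψ : DirichletCharacter ℂ r) (ξ : DirichletCharacter ℂ q) : ℝ := by
  classical
  exact if charTwist ψ ξ = 1 then 0 else ‖∑ n ∈ Icc 1 y, (vonMangoldt n : ℂ) * (ψ n * ξ n)‖

lemma twistedNorm_le {y : ℕ} {r q : ℕ} {ψ : DirichletCharacter ℂ r} {ξ : DirichletCharacter ℂ q}
    {B : ℝ} (hB : 0 ≤ B) (h : charTwist ψ ξ ≠ 1 →
      ‖∑ n ∈ Icc 1 y, (vonMangoldt n : ℂ) * (ψ n * ξ n)‖ ≤ B) : twistedNorm y ψ ξ ≤ B := by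
  classical
  rw [twistedNorm]
  split_ifs with h1
  · exact hB
  · exact h h1

lemma twistedNorm_eq {y : ℕ} {r q : ℕ} {ψ : DirichletCharacter ℂ r} {ξ : DirichletCharacter ℂ q}
    (h : charTwist ψ ξ ≠ 1) :
    twistedNorm y ψ ξ = ‖∑ n ∈ Icc 1 y, (vonMangoldt n : ℂ) * (ψ n * ξ n)‖ := by
  classical
  rw [twistedNorm, if_neg h]

lemma twistedNorm_nonneg {y : ℕ} {r q : ℕ} (ψ : DirichletCharacter ℂ r)
    (ξ : DirichletCharacter ℂ q) : 0 ≤ twistedNorm y ψ ξ := by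
  classical
  rw [twistedNorm]
  split_ifs
  · exact le_rfl
  · exact norm_nonneg _

lemma norm_mul_char_le_one {r q : ℕ} (ψ : DirichletCharacter ℂ r) (ξ : DirichletCharacter ℂ q)
    (n : ℕ) : ‖ψ n * ξ n‖ ≤ 1 := by
  rw [norm_mul]
  exact mul_le_one₀ (ψ.norm_le_one _) (norm_nonneg _) (ξ.norm_le_one _)

lemma norm_sum_charTwist_le {r q : ℕ} [NeZero r] [NeZero q] {ψ : DirichletCharacter ℂ r}
    {ξ : DirichletCharacter ℂ q} (h : charTwist ψ ξ ≠ 1) (m z : ℕ) :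
    ‖∑ k ∈ Icc 1 z, (ψ (m * k : ℕ) * ξ (m * k : ℕ))‖ ≤ r * q + 1 := by
  have h1 : ∑ k ∈ Icc 1 z, (ψ (m * k : ℕ) * ξ (m * k : ℕ)) =
      (ψ m * ξ m) * (∑ k ∈ range (z + 1), charTwist ψ ξ k - charTwist ψ ξ (0 : ℕ)) := by
    rw [range_eq_Ico, sum_eq_sum_Ico_succ_bot (Nat.succ_pos z), add_sub_cancel_left, mul_sum]
    have : Icc 1 z = Ico (0 + 1) (z + 1) := by ext; simp only [mem_Icc, mem_Ico]; omega
    rw [this]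
    refine sum_congr rfl fun k _ => ?_
    rw [charTwist_apply]
    push_cast
    rw [map_mul, map_mul]; ring
  rw [h1, norm_mul]
  refine (mul_le_of_le_one_left (norm_nonneg _) (norm_mul_char_le_one _ _ _)).trans ?_
  refine (norm_sub_le _ _).trans (add_le_add ?_ ((charTwist ψ ξ).norm_le_one _))
  have : NeZero (r * q) := ⟨mul_ne_zero (NeZero.ne r) (NeZero.ne q)⟩
  refine (norm_sum_range_char_le h (z + 1)).trans (le_of_eq (by push_cast; rfl))

lemma sum_primChars_const_le (P : ℕ) {B : ℝ} (hB : 0 ≤ B) :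
    ∑ r ∈ Ioc P (2 * P), (r.totient : ℝ)⁻¹ * ∑ _ψ ∈ primChars r, B ≤ P * B := by
  calc _ ≤ ∑ r ∈ Ioc P (2 * P), B := by
        refine sum_le_sum fun r hr => ?_
        have hr0 : 0 < r := (Nat.zero_le P).trans_lt (mem_Ioc.mp hr).1
        have : NeZero r := ⟨hr0.ne'⟩
        rw [sum_const, nsmul_eq_mul, inv_mul_le_iff₀ (by
          exact_mod_cast Nat.totient_pos.mpr hr0)]
        refine mul_le_mul_of_nonneg_right ?_ hB
        exact_mod_cast card_primChars_le r
    _ = P * B := by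
        rw [sum_const, Nat.card_Ioc, nsmul_eq_mul]
        exact congrArg (fun n : ℕ => (n : ℝ) * B) (by omega)

lemma natLog_two_le_ell {N y : ℕ} (hy : y ≤ N) : (Nat.log 2 y : ℝ) ≤ 2 * ell N := by
  rcases Nat.eq_zero_or_pos y with rfl | hy0
  · simp
  have h1 : ((2 : ℝ) ^ Nat.log 2 y) ≤ N := by
    exact_mod_cast (Nat.pow_log_le_self 2 hy0.ne').trans hy
  have h2 := Real.log_le_log (by positivity) h1
  rw [Real.log_pow] at h2
  have h3 := Real.log_two_gt_d9
  have h4 : (0 : ℝ) ≤ Nat.log 2 y := Nat.cast_nonneg _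
  have h5 := log_le_ell N
  nlinarith

lemma sum_primChars_block_le {A B N P q y : ℕ} [NeZero q] (hL : 1 ≤ Real.log N)
    (hP : (ell N : ℝ) ^ (3 * A + 13) ≤ P)
    (hPN : (P : ℝ) ^ 2 * (ell N : ℝ) ^ (13 * A + 56 + B) ≤ N)
    (hq : (q : ℝ) ≤ (ell N : ℝ) ^ B) (hy : y ≤ N) (ξ : DirichletCharacter ℂ q) :
    ∑ r ∈ Ioc P (2 * P), (r.totient : ℝ)⁻¹ * ∑ ψ ∈ primChars r, twistedNorm y ψ ξ ≤
      2000 * (N / (ell N : ℝ) ^ (A + 1)) := by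
  have hl : (1 : ℝ) ≤ ell N := hL.trans (log_le_ell N)
  have hl' : 1 ≤ ell N := one_le_ell hL
  have hP1 : (1 : ℝ) ≤ P := (one_le_pow₀ hl).trans hP
  have hP1' : 1 ≤ P := by exact_mod_cast hP1
  have hq1 : (1 : ℝ) ≤ q := by exact_mod_cast Nat.pos_of_ne_zero (NeZero.ne q)
  have hL0 : 0 ≤ Real.log N := by linarith
  obtain ⟨x, hx⟩ : ∃ x, x = (ell N : ℝ) := ⟨_, rfl⟩
  obtain ⟨U, hU⟩ : ∃ U, U = ell N ^ (6 * A + 27) := ⟨_, rfl⟩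
  obtain ⟨h, hh⟩ : ∃ h, h = ell N ^ (2 * A + 8) := ⟨_, rfl⟩
  obtain ⟨I, hI⟩ : ∃ I, I = 2 * h * (Nat.log 2 y + 1) := ⟨_, rfl⟩
  have hU' : (U : ℝ) = x ^ (6 * A + 27) := by rw [hU, hx]; push_cast; rfl
  have hh' : (h : ℝ) = x ^ (2 * A + 8) := by rw [hh, hx]; push_cast; rfl
  have hU1 : 1 ≤ U := hU ▸ Nat.one_le_pow _ _ hl'
  have hh1 : 1 ≤ h := hh ▸ Nat.one_le_pow _ _ hl'
  have hhU : h ≤ U := by rw [hU, hh]; exact Nat.pow_le_pow_right hl' (by omega)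
  have hyI : y ≤ cellSeq U h I := hI ▸ le_cellSeq_of_log hh1 hhU
  have hLx : Real.log N ≤ x := hx ▸ log_le_ell N
  rw [← hx] at hl hP hPN hq
  have hx0 : 0 < x := by linarith
  obtain ⟨T, hT⟩ : ∃ T : ℝ, T = 3 * P * x ^ B := ⟨_, rfl⟩
  obtain ⟨E, hE⟩ : ∃ E : ℝ, E = U * Real.log N + 3 * (U * U * (Real.log N * T)) := ⟨_, rfl⟩
  have hE0 : 0 ≤ E := by rw [hE, hT]; positivity
  have hpt : ∀ r ∈ Ioc P (2 * P), ∀ ψ ∈ primChars r, twistedNorm y ψ ξ ≤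
      E + ∑ i ∈ range I, ‖∑ m ∈ Ioc (cellSeq U h i) (cellSeq U h (i + 1)),
        ∑ k ∈ Ioc U (y / cellSeq U h i),
          (vaughanCoeff U m : ℂ) * (vonMangoldt k : ℂ) * (ψ (m * k : ℕ) * ξ (m * k : ℕ))‖ +
        ‖∑ n ∈ Ioc y (y + y / h), (cellCoeff U U h y I n : ℂ) * (ψ n * ξ n)‖ := by
    intro r hr ψ _
    obtain ⟨hr1, hr2⟩ := mem_Ioc.mp hr
    have : NeZero r := ⟨by omega⟩
    refine twistedNorm_le (by positivity) fun hne => ?_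
    rw [hE]
    refine norm_sum_vonMangoldt_mul_le hU1 hU1 hy hyI (f := fun n : ℕ => ψ n * ξ n)
      (fun n => norm_mul_char_le_one ψ ξ n) fun m _ z => ?_
    refine (norm_sum_charTwist_le hne m z).trans ?_
    have h1 : (r : ℝ) ≤ 2 * P := by exact_mod_cast hr2
    have h2 : (r : ℝ) * q ≤ 2 * P * x ^ B := mul_le_mul h1 hq (by linarith) (by linarith)
    have h3 : (1 : ℝ) ≤ P * x ^ B := one_le_mul_of_one_le_of_one_le hP1 (one_le_pow₀ hl)
    rw [hT]; linarith
  have hsum : ∑ r ∈ Ioc P (2 * P), (r.totient : ℝ)⁻¹ * ∑ ψ ∈ primChars r, twistedNorm y ψ ξ ≤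
      ∑ r ∈ Ioc P (2 * P), (r.totient : ℝ)⁻¹ * ∑ _ψ ∈ primChars r, E +
      ∑ i ∈ range I, ∑ r ∈ Ioc P (2 * P), (r.totient : ℝ)⁻¹ * ∑ ψ ∈ primChars r,
        ‖∑ m ∈ Ioc (cellSeq U h i) (cellSeq U h (i + 1)),
        ∑ k ∈ Ioc U (y / cellSeq U h i),
          (vaughanCoeff U m : ℂ) * (vonMangoldt k : ℂ) * (ψ (m * k : ℕ) * ξ (m * k : ℕ))‖ +
      ∑ r ∈ Ioc P (2 * P), (r.totient : ℝ)⁻¹ * ∑ ψ ∈ primChars r,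
        ‖∑ n ∈ Ioc y (y + y / h), (cellCoeff U U h y I n : ℂ) * (ψ n * ξ n)‖ := by
    rw [sum_comm (s := range I), ← sum_add_distrib, ← sum_add_distrib]
    refine sum_le_sum fun r hr => ?_
    rw [← mul_sum, ← mul_add, ← mul_add, sum_comm (s := range I), ← sum_add_distrib,
      ← sum_add_distrib]
    exact mul_le_mul_of_nonneg_left (sum_le_sum (hpt r hr)) (by positivity)
  refine hsum.trans ?_
  have hN0 : (0 : ℝ) ≤ N := Nat.cast_nonneg N
  have hPN' : ∀ j, j ≤ 13 * A + 56 + B → (P : ℝ) ^ 2 * x ^ j ≤ N := fun j hj =>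
    (mul_le_mul_of_nonneg_left (pow_le_pow_right₀ hl hj) (by positivity)).trans hPN
  have b1 := sum_primChars_const_le P hE0
  have b2 : ∀ i ∈ range I, ∑ r ∈ Ioc P (2 * P), (r.totient : ℝ)⁻¹ * ∑ ψ ∈ primChars r,
        ‖∑ m ∈ Ioc (cellSeq U h i) (cellSeq U h (i + 1)),
        ∑ k ∈ Ioc U (y / cellSeq U h i),
          (vaughanCoeff U m : ℂ) * (vonMangoldt k : ℂ) * (ψ (m * k : ℕ) * ξ (m * k : ℕ))‖ ≤
      300 * (N / x ^ (3 * A + 10)) := by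
    intro i _
    have hUK : (ell N : ℝ) ^ (2 * (3 * A + 10) + 7) = U := by
      rw [← hx, hU']; exact congrArg _ (by ring)
    rw [hx]
    refine sum_primChars_cell_le hL (by rw [← hx]; exact hP)
      (by rw [← hx]; exact hPN' _ (by omega)) ?_ hUK.le ?_ hy ξ
    · rw [hUK]; exact_mod_cast le_cellSeq U h i
    · rw [cellSeq_succ]
      have := Nat.div_le_self (cellSeq U h i) h
      omega
  have b3 := sum_primChars_tail_le (U := U) (V := U) (I := I) (h := h) (a := A + 1) hL hP1'
    (by rw [← hx]; exact hPN' _ (by omega))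
    (by rw [← hx, hh']; exact (congrArg (x ^ ·) (by ring)).le) hy ξ
  rw [← hx] at b3
  have b2' := sum_le_sum b2
  rw [sum_const, card_range, nsmul_eq_mul] at b2'
  have hIle : (I : ℝ) ≤ 6 * x ^ (2 * A + 9) := by
    rw [hI]
    push_cast
    rw [hh']
    have hlog : (Nat.log 2 y : ℝ) ≤ 2 * x := hx ▸ natLog_two_le_ell hy
    calc 2 * x ^ (2 * A + 8) * ((Nat.log 2 y : ℝ) + 1) ≤ 2 * x ^ (2 * A + 8) * (3 * x) := by
          refine mul_le_mul_of_nonneg_left ?_ (by positivity); linarith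
      _ = _ := by ring
  have c2 : (I : ℝ) * (300 * (N / x ^ (3 * A + 10))) ≤ 1800 * (N / x ^ (A + 1)) := by
    refine (mul_le_mul_of_nonneg_right hIle (by positivity)).trans (le_of_eq ?_)
    have : x ^ (3 * A + 10) = x ^ (2 * A + 9) * x ^ (A + 1) := by ring
    rw [this]; field_simp; ring
  have c1 : (P : ℝ) * E ≤ 10 * (N / x ^ (A + 1)) := by
    have h1 : E ≤ 10 * (P * x ^ (12 * A + 55 + B)) := by
      have hxx : Real.log N ≤ x := hLx
      have t1 : (U : ℝ) * Real.log N ≤ P * x ^ (12 * A + 55 + B) := by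
        rw [hU']
        calc x ^ (6 * A + 27) * Real.log N ≤ x ^ (6 * A + 27) * x := by gcongr
          _ = 1 * x ^ (6 * A + 28) := by ring
          _ ≤ _ := mul_le_mul hP1 (pow_le_pow_right₀ hl (by omega)) (by positivity) (by linarith)
      have t2 : (U : ℝ) * U * (Real.log N * T) ≤ 3 * (P * x ^ (12 * A + 55 + B)) := by
        rw [hU', hT]
        calc x ^ (6 * A + 27) * x ^ (6 * A + 27) * (Real.log N * (3 * P * x ^ B)) ≤
            x ^ (6 * A + 27) * x ^ (6 * A + 27) * (x * (3 * P * x ^ B)) := by gcongr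
          _ = _ := by ring
      rw [hE]; linarith
    refine (mul_le_mul_of_nonneg_left h1 (by positivity)).trans ?_
    rw [← mul_div_assoc, le_div_iff₀ (by positivity)]
    calc (P : ℝ) * (10 * (P * x ^ (12 * A + 55 + B))) * x ^ (A + 1) =
        10 * (P ^ 2 * x ^ (13 * A + 56 + B)) := by ring
      _ ≤ _ := by linarith
  have hNx : 0 ≤ N / x ^ (A + 1) := by positivity
  rw [← hx]
  refine (add_le_add (add_le_add b1 b2') b3).trans ?_
  linarith
end

section
open ArithmeticFunction DirichletCharacter

lemma sum_union_le_of_nonneg' {F : ℕ → ℝ} (hF : ∀ r, 0 ≤ F r) {s t : Finset ℕ} :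
    ∑ r ∈ s ∪ t, F r ≤ ∑ r ∈ s, F r + ∑ r ∈ t, F r := by
  have := sum_union_inter (s₁ := s) (s₂ := t) (f := F)
  have h := sum_nonneg (s := s ∩ t) fun r _ => hF r
  linarith

lemma sum_dyadic_le {F : ℕ → ℝ} (hF : ∀ r, 0 ≤ F r) {R R₀ : ℕ} {B : ℝ} (hB : 0 ≤ B)
    (h : ∀ P, R₀ ≤ P → P ≤ R → ∑ r ∈ Ioc P (2 * P), F r ≤ B) (J : ℕ) :
    ∑ r ∈ Ioc R₀ (R₀ * 2 ^ J) with r ≤ R, F r ≤ J * B := by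
  induction J with
  | zero => simp
  | succ J ih =>
    have h1 : R₀ ≤ R₀ * 2 ^ J := Nat.le_mul_of_pos_right _ (by positivity)
    have h2 : R₀ * 2 ^ (J + 1) = 2 * (R₀ * 2 ^ J) := by ring
    rw [h2]
    obtain ⟨P, hP⟩ : ∃ P, P = R₀ * 2 ^ J := ⟨_, rfl⟩
    rw [← hP] at ih h1 ⊢
    have hsplit : {r ∈ Ioc R₀ (2 * P) | r ≤ R} =
        {r ∈ Ioc R₀ P | r ≤ R} ∪ {r ∈ Ioc P (2 * P) | r ≤ R} := by
      ext r; simp only [mem_filter, mem_union, mem_Ioc]; omega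
    rw [hsplit]
    refine (sum_union_le_of_nonneg' hF).trans ?_
    push_cast
    have : ∑ r ∈ Ioc P (2 * P) with r ≤ R, F r ≤ B := by
      rcases Nat.le_total P R with hPR | hPR
      · exact (sum_le_sum_of_subset_of_nonneg (filter_subset _ _) fun r _ _ => hF r).trans
          (h P h1 hPR)
      · rw [filter_eq_empty_iff.mpr]
        · simpa using hB
        · intro r hr
          have := mem_Ioc.mp hr
          omega
    linarith

/-- A Bombieri–Vinogradov type estimate for character sums twisted by a character of small
modulus. -/
theorem exists_sum_primChars_twistedNorm_le (A B : ℕ) : ∃ C : ℝ, 0 < C ∧ ∀ N : ℕ,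
    2 ≤ Real.log N → ∀ (q : ℕ) [NeZero q] (ξ : DirichletCharacter ℂ q),
    (q : ℝ) ≤ (ell N : ℝ) ^ B → ∀ y ≤ N, ∀ R : ℕ,
    (R : ℝ) ^ 2 * (ell N : ℝ) ^ (13 * A + 56 + B) ≤ N →
    ∑ r ∈ Icc 1 R, (r.totient : ℝ)⁻¹ * ∑ ψ ∈ primChars r, twistedNorm y ψ ξ ≤
      C * (N / (ell N : ℝ) ^ A) := by
  obtain ⟨C, hC, hSW⟩ := exists_norm_sum_char_vonMangoldt_le (4 * A + 13) (2 * (3 * A + 13 + B))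
  refine ⟨C * 2 ^ (4 * A + 13) + 6000, by positivity, ?_⟩
  intro N hL q _ ξ hq y hy R hR
  have hL1 : 1 ≤ Real.log N := by linarith
  have hl : (1 : ℝ) ≤ ell N := hL1.trans (log_le_ell N)
  have hlL := ell_le hL1
  have hN3 : 3 ≤ N := by
    by_contra h
    have h1 : (N : ℝ) ≤ 2 := by exact_mod_cast (by omega : N ≤ 2)
    have h2 := Real.log_two_lt_d9
    rcases Nat.eq_zero_or_pos N with h0 | h0
    · rw [h0] at hL; simp at hL; linarith
    have h3 := Real.log_le_log (by exact_mod_cast h0) h1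
    linarith
  have hRN : R ≤ N := by
    rcases Nat.eq_zero_or_pos R with h0 | h0
    · omega
    have hR1 : (1 : ℝ) ≤ R := by exact_mod_cast h0
    have : (R : ℝ) ≤ N := by
      refine le_trans ?_ hR
      refine le_trans ?_ (le_mul_of_one_le_right (by positivity) (one_le_pow₀ hl))
      exact le_self_pow₀ hR1 two_ne_zero
    exact_mod_cast this
  obtain ⟨R₀, hR₀⟩ : ∃ R₀, R₀ = ell N ^ (3 * A + 13) := ⟨_, rfl⟩
  have hR₀' : (R₀ : ℝ) = (ell N : ℝ) ^ (3 * A + 13) := by rw [hR₀]; push_cast; rfl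
  obtain ⟨F, hF⟩ : ∃ F : ℕ → ℝ, F = fun r => (r.totient : ℝ)⁻¹ *
    ∑ ψ ∈ primChars r, twistedNorm y ψ ξ := ⟨_, rfl⟩
  have hF0 : ∀ r, 0 ≤ F r := fun r => by
    rw [hF]
    exact mul_nonneg (by positivity) (sum_nonneg fun ψ _ => twistedNorm_nonneg ψ ξ)
  change ∑ r ∈ Icc 1 R, (fun r : ℕ => (r.totient : ℝ)⁻¹ *
    ∑ ψ ∈ primChars r, twistedNorm y ψ ξ) r ≤ _
  rw [← hF]
  have hblock : ∀ P, R₀ ≤ P → P ≤ R → ∑ r ∈ Ioc P (2 * P), F r ≤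
      2000 * (N / (ell N : ℝ) ^ (A + 1)) := by
    intro P hP1 hP2
    rw [hF]
    refine sum_primChars_block_le hL1 (by rw [← hR₀']; exact_mod_cast hP1) (le_trans ?_ hR) hq hy ξ
    have : (P : ℝ) ≤ R := by exact_mod_cast hP2
    gcongr
  have hlarge := sum_dyadic_le hF0 (by positivity) hblock (Nat.log 2 R + 1)
  have hR₀1 : 1 ≤ R₀ := hR₀ ▸ Nat.one_le_pow _ _ (one_le_ell hL1)
  have hsmall : ∀ r ∈ Icc 1 R₀, F r ≤ C * 2 ^ (4 * A + 13) * (N / (ell N : ℝ) ^ (4 * A + 13)) := by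
    intro r hr
    obtain ⟨hr1, hr2⟩ := mem_Icc.mp hr
    have : NeZero r := ⟨by omega⟩
    have hφ : (0 : ℝ) < r.totient := by exact_mod_cast Nat.totient_pos.mpr hr1
    rw [hF]
    simp only
    rw [inv_mul_le_iff₀ hφ]
    have hB0 : 0 ≤ C * 2 ^ (4 * A + 13) * (N / (ell N : ℝ) ^ (4 * A + 13)) := by positivity
    refine (sum_le_card_nsmul _ _ (C * 2 ^ (4 * A + 13) * (N / (ell N : ℝ) ^ (4 * A + 13)))
      fun ψ _ => twistedNorm_le hB0 fun hne => ?_).trans ?_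
    · have : NeZero (r * q) := ⟨mul_ne_zero (NeZero.ne r) (NeZero.ne q)⟩
      have hrq : ((r * q : ℕ) : ℝ) ≤ Real.log N ^ (2 * (3 * A + 13 + B)) := by
        push_cast
        have hr3 : (r : ℝ) ≤ (ell N : ℝ) ^ (3 * A + 13) := by rw [← hR₀']; exact_mod_cast hr2
        calc (r : ℝ) * q ≤ (ell N : ℝ) ^ (3 * A + 13) * (ell N : ℝ) ^ B :=
              mul_le_mul hr3 hq (by positivity) (by positivity)
          _ = (ell N : ℝ) ^ (3 * A + 13 + B) := by ring
          _ ≤ (Real.log N ^ 2) ^ (3 * A + 13 + B) :=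
              pow_le_pow_left₀ (by positivity) (by nlinarith) _
          _ = _ := by rw [← pow_mul]
      have h1 := hSW N hN3 (r * q) (charTwist ψ ξ) hne hrq y hy
      have h2 : ∑ n ∈ Icc 1 y, (vonMangoldt n : ℂ) * (ψ n * ξ n) =
          ∑ n ∈ range (y + 1), charTwist ψ ξ n * (vonMangoldt n : ℂ) := by
        rw [range_eq_Ico, sum_eq_sum_Ico_succ_bot (Nat.succ_pos y)]
        have : Icc 1 y = Ico (0 + 1) (y + 1) := by ext; simp only [mem_Icc, mem_Ico]; omega
        rw [this]
        simp only [ArithmeticFunction.map_zero, Complex.ofReal_zero, mul_zero, _root_.zero_add]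
        refine sum_congr rfl fun n _ => ?_
        rw [charTwist_apply]; ring
      rw [h2]
      refine h1.trans ?_
      rw [mul_div_assoc, mul_assoc]
      refine mul_le_mul_of_nonneg_left ?_ hC.le
      rw [← mul_div_assoc, div_le_div_iff₀ (by positivity) (by positivity)]
      have : (ell N : ℝ) ^ (4 * A + 13) ≤ 2 ^ (4 * A + 13) * Real.log N ^ (4 * A + 13) := by
        rw [← mul_pow]; exact pow_le_pow_left₀ (by positivity) hlL _
      calc (N : ℝ) * (ell N : ℝ) ^ (4 * A + 13) ≤
          N * (2 ^ (4 * A + 13) * Real.log N ^ (4 * A + 13)) := by gcongr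
        _ = _ := by ring
    · rw [nsmul_eq_mul]
      refine mul_le_mul_of_nonneg_right ?_ hB0
      exact_mod_cast card_primChars_le r
  have hsmall' := sum_le_sum hsmall
  rw [sum_const, Nat.card_Icc, Nat.add_sub_cancel, nsmul_eq_mul, hR₀'] at hsmall'
  have hs2 : (ell N : ℝ) ^ (3 * A + 13) *
      (C * 2 ^ (4 * A + 13) * (N / (ell N : ℝ) ^ (4 * A + 13))) =
      C * 2 ^ (4 * A + 13) * (N / (ell N : ℝ) ^ A) := by
    have : (ell N : ℝ) ^ (4 * A + 13) = (ell N : ℝ) ^ (3 * A + 13) * (ell N : ℝ) ^ A := by ring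
    rw [this]; field_simp
  rw [hs2] at hsmall'
  have hcover : Icc 1 R ⊆ Icc 1 R₀ ∪ {r ∈ Ioc R₀ (R₀ * 2 ^ (Nat.log 2 R + 1)) | r ≤ R} := by
    intro r hr
    obtain ⟨h1, h2⟩ := mem_Icc.mp hr
    have h3 := (Nat.lt_pow_succ_log_self one_lt_two R).le
    have h4 : 2 ^ (Nat.log 2 R + 1) ≤ R₀ * 2 ^ (Nat.log 2 R + 1) := Nat.le_mul_of_pos_left _ hR₀1
    simp only [mem_union, mem_filter, mem_Icc, mem_Ioc]
    rw [Nat.succ_eq_add_one] at h3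
    omega
  refine (sum_le_sum_of_subset_of_nonneg hcover fun r _ _ => hF0 r).trans ?_
  refine (sum_union_le_of_nonneg' hF0).trans ?_
  have hl2 : ((Nat.log 2 R + 1 : ℕ) : ℝ) ≤ 3 * ell N := by
    push_cast
    have := natLog_two_le_ell hRN
    linarith
  have h3 : ((Nat.log 2 R + 1 : ℕ) : ℝ) * (2000 * (N / (ell N : ℝ) ^ (A + 1))) ≤
      6000 * (N / (ell N : ℝ) ^ A) := by
    refine (mul_le_mul_of_nonneg_right hl2 (by positivity)).trans (le_of_eq ?_)
    rw [pow_succ]; field_simp; ring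
  rw [add_mul]
  linarith
end

section
open ArithmeticFunction

lemma inv_le_fract_of_rational_approx {α : ℝ} {a t : ℤ} {q : ℕ} (hq : 0 < q)
    (hco : IsCoprime a (q : ℤ)) (hα : |q * α - a| * q ≤ 1) (ht : t ≠ 0) (htq : 2 * |t| ≤ q) :
    ((2 * q : ℝ))⁻¹ ≤ Int.fract (t * α) := by
  have hq0 : (0 : ℝ) < q := by exact_mod_cast hq
  by_contra! hlt
  have hF0 := Int.fract_nonneg (t * α)
  have hfl := Int.floor_add_fract (t * α)
  obtain ⟨F, hF⟩ : ∃ F, F = Int.fract (t * α) := ⟨_, rfl⟩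
  obtain ⟨n, hn⟩ : ∃ n, n = ⌊t * α⌋ := ⟨_, rfl⟩
  rw [← hF] at hlt hF0 hfl
  rw [← hn] at hfl
  have h1 : q * F < 1 / 2 := by
    have := mul_lt_mul_of_pos_left hlt hq0
    rwa [mul_inv, ← mul_assoc, mul_comm (q : ℝ) 2⁻¹, mul_assoc, mul_inv_cancel₀ hq0.ne',
      mul_one, ← one_div] at this
  have h2 : |(t : ℝ) * (q * α - a)| ≤ 1 / 2 := by
    rw [abs_mul]
    have h3 : 2 * |(t : ℝ)| ≤ q := by exact_mod_cast htq
    have := mul_le_mul_of_nonneg_right h3 (abs_nonneg (q * α - a))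
    linarith
  have h4 : (q * n - a * t : ℝ) = t * (q * α - a) - q * F := by linear_combination (q : ℝ) * hfl
  have h5 := mul_nonneg hq0.le hF0
  have h6 := abs_le.mp h2
  have h7 : |(q * n - a * t : ℝ)| < 1 := by
    rw [h4, abs_lt]; constructor <;> linarith
  have h8 : |(q : ℤ) * n - a * t| < 1 := by exact_mod_cast h7
  have h9 : (q : ℤ) * n = a * t := by have := Int.abs_lt_one_iff.mp h8; linarith
  have h10 : (q : ℤ) ∣ t := hco.symm.dvd_of_dvd_mul_left ⟨n, h9.symm⟩
  have h11 := Int.le_of_dvd (abs_pos.mpr ht) ((dvd_abs _ _).mpr h10)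
  have := abs_pos.mpr ht
  linarith

lemma norm_sum_ex_mul_le {α : ℝ} {a : ℤ} {q m : ℕ} (hq : 0 < q)
    (hco : IsCoprime a (q : ℤ)) (hα : |q * α - a| * q ≤ 1) (hm : 1 ≤ m) (hmq : 2 * m ≤ q)
    (z : ℕ) : ‖∑ k ∈ Icc 1 z, ex ((m * k : ℕ) * α)‖ ≤ 2 * q := by
  have hq0 : (0 : ℝ) < q := by exact_mod_cast hq
  have h1 := inv_le_fract_of_rational_approx (t := (m : ℤ)) hq hco hα (by omega)
    (by rw [Nat.abs_cast]; exact_mod_cast hmq)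
  have h2 := inv_le_fract_of_rational_approx (t := -(m : ℤ)) hq hco hα (by omega)
    (by rw [abs_neg, Nat.abs_cast]; exact_mod_cast hmq)
  push_cast at h1 h2
  have hpos : 0 < Int.fract (m * α) := lt_of_lt_of_le (by positivity) h1
  rw [neg_mul, Int.fract_neg hpos.ne'] at h2
  have h3 := norm_sum_ex_le hpos 1 (z + 1)
  have : Icc 1 z = Ico 1 (z + 1) := by ext; simp only [mem_Icc, mem_Ico]; omega
  rw [this]
  have h4 : ∀ k : ℕ, ex ((m * k : ℕ) * α) = ex (k * (m * α)) := fun k => by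
    push_cast; congr 1; ring
  simp_rw [h4]
  refine h3.trans ?_
  have h5 := inv_anti₀ (by positivity) h1
  have h6 := inv_anti₀ (by positivity) h2
  rw [inv_inv] at h5 h6
  linarith

lemma sum_norm_sq_ex_le {α : ℝ} {a : ℤ} {q : ℕ} (hq : 2 ≤ q)
    (hco : IsCoprime a (q : ℤ)) (hα : |q * α - a| * q ≤ 1) (M V z : ℕ) (c : ℕ → ℂ) (J : ℕ) :
    ∑ m ∈ Ioc M (M + J * (q / 2)), ‖∑ k ∈ Ioc V z, c k * ex (k * (m * α))‖ ^ 2 ≤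
      J * (((z - V : ℕ) + 2 * q * (1 + Real.log (2 * q))) * ∑ k ∈ Ioc V z, ‖c k‖ ^ 2) := by
  induction J with
  | zero => simp
  | succ J ih =>
    have hq0 : (2 : ℝ) ≤ q := by exact_mod_cast hq
    have h := additive_large_sieve (Ioc (M + J * (q / 2)) (M + (J + 1) * (q / 2)))
      (fun m : ℕ => m * α) (δ := (2 * q : ℝ)⁻¹) (by positivity)
      (inv_le_one_of_one_le₀ (by linarith)) ?_ (V + 1) (z + 1) c
    · rw [← Ioc_eq_Ico_succ, inv_inv, Nat.add_sub_add_right] at h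
      rw [← sum_Ioc_consecutive _ (Nat.le_add_right M (J * (q / 2)))
        (by gcongr; omega : M + J * (q / 2) ≤ M + (J + 1) * (q / 2))]
      push_cast at h ih ⊢
      linarith
    · intro i hi j hj hij
      have hi' := mem_Ioc.mp hi
      have hj' := mem_Ioc.mp hj
      have h1 := inv_le_fract_of_rational_approx (t := (i : ℤ) - j) (by omega) hco hα (by omega) ?_
      · push_cast at h1
        rwa [sub_mul] at h1
      · obtain ⟨w, hw⟩ : ∃ w, w = M + J * (q / 2) := ⟨_, rfl⟩
        have : M + (J + 1) * (q / 2) = w + q / 2 := by rw [hw]; ring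
        rw [← hw, this] at hi' hj'
        rcases abs_cases ((i : ℤ) - j) with h2 | h2 <;> omega

lemma norm_bilinear_ex_sq_le {α : ℝ} {a : ℤ} {q : ℕ} (hq : 2 ≤ q)
    (hco : IsCoprime a (q : ℤ)) (hα : |q * α - a| * q ≤ 1) {M M' : ℕ} (hM' : M' ≤ 2 * M) (V z : ℕ)
    (b c : ℕ → ℝ) :
    ‖∑ m ∈ Ioc M M', ∑ k ∈ Ioc V z, (b m : ℂ) * (c k : ℂ) * ex ((m * k : ℕ) * α)‖ ^ 2 ≤
      (∑ m ∈ Ioc M M', b m ^ 2) * ((3 * M / q + 1) *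
        ((z + 2 * q * (1 + Real.log (2 * q))) * ∑ k ∈ Ioc V z, c k ^ 2)) := by
  have hq0 : (2 : ℝ) ≤ q := by exact_mod_cast hq
  have hlog : 0 ≤ Real.log (2 * q) := Real.log_nonneg (by linarith)
  have h1 : ‖∑ m ∈ Ioc M M', ∑ k ∈ Ioc V z, (b m : ℂ) * (c k : ℂ) * ex ((m * k : ℕ) * α)‖ ≤
      ∑ m ∈ Ioc M M', |b m| * ‖∑ k ∈ Ioc V z, (c k : ℂ) * ex (k * (m * α))‖ := by
    refine norm_sum_le_of_le _ fun m _ => le_of_eq ?_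
    rw [← Real.norm_eq_abs, ← Complex.norm_real, ← norm_mul, mul_sum]
    congr 1
    refine sum_congr rfl fun k _ => ?_
    rw [mul_assoc]
    congr 3
    push_cast; ring
  obtain ⟨J, hJ⟩ : ∃ J, J = (M' - M) / (q / 2) + 1 := ⟨_, rfl⟩
  have hg : 0 < q / 2 := by omega
  have hMJ : M' ≤ M + J * (q / 2) := by
    have := Nat.lt_div_mul_add (a := M' - M) hg
    rw [hJ, add_mul, one_mul]; omega
  have hJle : (J : ℝ) ≤ 3 * M / q + 1 := by
    rw [hJ]; push_cast
    have h2 : (((M' - M) / (q / 2) : ℕ) : ℝ) ≤ ((M' - M : ℕ) : ℝ) / (q / 2 : ℕ) := Nat.cast_div_le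
    have h3 : ((M' - M : ℕ) : ℝ) ≤ M := by exact_mod_cast (by omega : M' - M ≤ M)
    have h4 : (q : ℝ) ≤ 3 * (q / 2 : ℕ) := by exact_mod_cast (by omega : q ≤ 3 * (q / 2))
    have h5 : (0 : ℝ) < (q / 2 : ℕ) := by exact_mod_cast hg
    have h6 : ((M' - M : ℕ) : ℝ) / (q / 2 : ℕ) ≤ 3 * M / q := by
      rw [div_le_div_iff₀ h5 (by linarith)]
      calc ((M' - M : ℕ) : ℝ) * q ≤ M * (3 * (q / 2 : ℕ)) :=
            mul_le_mul h3 h4 (by linarith) (Nat.cast_nonneg _)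
        _ = _ := by ring
    linarith
  refine (pow_le_pow_left₀ (norm_nonneg _) h1 2).trans ((sum_mul_sq_le_sq_mul_sq _ _ _).trans ?_)
  simp_rw [sq_abs]
  refine mul_le_mul_of_nonneg_left ?_ (sum_nonneg fun _ _ => sq_nonneg _)
  refine (sum_le_sum_of_subset_of_nonneg (Ioc_subset_Ioc_right hMJ)
    fun _ _ _ => by positivity).trans ((sum_norm_sq_ex_le hq hco hα M V z _ J).trans ?_)
  have hc : ∀ k, ‖(c k : ℂ)‖ ^ 2 = c k ^ 2 := fun k => by
    rw [Complex.norm_real, Real.norm_eq_abs, sq_abs]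
  simp_rw [hc]
  have hz : ((z - V : ℕ) : ℝ) ≤ z := by exact_mod_cast Nat.sub_le _ _
  have hS : 0 ≤ ∑ k ∈ Ioc V z, c k ^ 2 := sum_nonneg fun _ _ => sq_nonneg _
  gcongr

lemma minor_cell_numeric {x N q M : ℝ} {a : ℕ} (hx : 1 ≤ x) (hq : x ^ (2 * a + 7) ≤ q)
    (hqN : q * x ^ (2 * a + 7) ≤ N) (hM : x ^ (2 * a + 7) ≤ M)
    (hMN : M * x ^ (2 * a + 7) ≤ N) :
    162 * M * x ^ 4 * ((3 * M / q + 1) * ((N / M + 6 * q * x) * (N / M * x ^ 2))) ≤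
      (70 * (N / x ^ a)) ^ 2 := by
  have hx0 : 0 < x := by linarith
  have hM0 : 0 < M := lt_of_lt_of_le (by positivity) hM
  have hq0 : 0 < q := lt_of_lt_of_le (by positivity) hq
  have hN0 : 0 < N := lt_of_lt_of_le (by positivity) hMN
  obtain ⟨t, ht⟩ : ∃ t, t = x ^ a := ⟨_, rfl⟩
  have ht0 : 0 < t := ht ▸ by positivity
  have e : x ^ (2 * a + 7) = t ^ 2 * x ^ 7 := by rw [ht]; ring
  rw [e] at hq hqN hM hMN
  rw [← ht]
  have e1 : 162 * M * x ^ 4 * ((3 * M / q + 1) * ((N / M + 6 * q * x) * (N / M * x ^ 2))) =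
      162 * N * x ^ 6 * (3 * (N / q) + 18 * M * x + N / M + 6 * q * x) := by
    field_simp; ring
  have k0 : 0 < t ^ 2 * x ^ 7 := by positivity
  have k1 : N / q ≤ N / (t ^ 2 * x ^ 7) := by gcongr
  have k2 : N / M ≤ N / (t ^ 2 * x ^ 7) := by gcongr
  have k3 : M ≤ N / (t ^ 2 * x ^ 7) := by rwa [le_div_iff₀ k0]
  have k4 : q ≤ N / (t ^ 2 * x ^ 7) := by rwa [le_div_iff₀ k0]
  obtain ⟨w, hw⟩ : ∃ w, w = N / (t ^ 2 * x ^ 7) := ⟨_, rfl⟩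
  rw [← hw] at k1 k2 k3 k4
  have hw0 : 0 ≤ w := hw ▸ by positivity
  have k5 : 3 * (N / q) + 18 * M * x + N / M + 6 * q * x ≤ 28 * (w * x) := by
    have a1 : N / q ≤ w * x := k1.trans (le_mul_of_one_le_right hw0 hx)
    have a2 : N / M ≤ w * x := k2.trans (le_mul_of_one_le_right hw0 hx)
    have a3 := mul_le_mul_of_nonneg_right k3 hx0.le
    have a4 := mul_le_mul_of_nonneg_right k4 hx0.le
    linarith
  rw [e1]
  calc _ ≤ 162 * N * x ^ 6 * (28 * (w * x)) := by gcongr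
    _ = 4536 * (N / t) ^ 2 := by rw [hw]; field_simp; ring
    _ ≤ _ := by have := sq_nonneg (N / t); linarith [mul_pow 70 (N / t) 2]

lemma norm_minor_cell_le {N M M' V q A : ℕ} {α : ℝ} {a : ℤ} (hL : 1 ≤ Real.log N)
    (hco : IsCoprime a (q : ℤ)) (hα : |q * α - a| * q ≤ 1) (hq2 : 2 ≤ q)
    (hq : (ell N : ℝ) ^ (2 * A + 7) ≤ q) (hqN : q * (ell N : ℝ) ^ (2 * A + 7) ≤ N)
    (hM : (ell N : ℝ) ^ (2 * A + 7) ≤ M) (hV : (ell N : ℝ) ^ (2 * A + 7) ≤ V)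
    (hM' : M' ≤ 2 * M) :
    ‖∑ m ∈ Ioc M M', ∑ k ∈ Ioc V (N / M),
      (vaughanCoeff V m : ℂ) * (vonMangoldt k : ℂ) * ex ((m * k : ℕ) * α)‖ ≤
      70 * (N / (ell N : ℝ) ^ A) := by
  have hl : (1 : ℝ) ≤ ell N := hL.trans (log_le_ell N)
  have hM0 : (0 : ℝ) < M := lt_of_lt_of_le (by positivity) hM
  rcases le_or_gt (N / M) V with hc | hc
  · rw [Ioc_eq_empty_of_le hc]; simp; positivity
  have hMpos : 0 < M := by exact_mod_cast hM0
  have hVM : V * M ≤ N := (Nat.mul_le_mul_right M hc.le).trans (Nat.div_mul_le_self N M)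
  have hMN : (M : ℝ) * (ell N : ℝ) ^ (2 * A + 7) ≤ N := by
    have : (V : ℝ) * M ≤ N := by exact_mod_cast hVM
    refine le_trans ?_ this
    rw [mul_comm]
    exact mul_le_mul_of_nonneg_right hV hM0.le
  have hMN1 : M ≤ N := by
    have : (M : ℝ) ≤ N := le_trans (le_mul_of_one_le_right hM0.le (one_le_pow₀ hl)) hMN
    exact_mod_cast this
  have hqN1 : q ≤ N := by
    have : (q : ℝ) ≤ N := le_trans (le_mul_of_one_le_right (Nat.cast_nonneg _) (one_le_pow₀ hl)) hqN
    exact_mod_cast this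
  have hlog := log_two_mul_le hL (show 2 * q ≤ 2 * N by omega)
  push_cast at hlog
  refine le_of_abs_le (abs_le_of_sq_le_sq ?_ (by positivity))
  refine (norm_bilinear_ex_sq_le hq2 hco hα hM' V (N / M) _ _).trans ?_
  refine le_trans ?_ (minor_cell_numeric (a := A) hl hq hqN hM hMN)
  have hb := sum_sq_vaughanCoeff_le (U := V) hL hMN1 hM'
  have hyM : ((N / M : ℕ) : ℝ) ≤ N / M := Nat.cast_div_le
  have ha : ∑ k ∈ Ioc V (N / M), (vonMangoldt k : ℝ) ^ 2 ≤ N / M * (ell N : ℝ) ^ 2 :=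
    (sum_sq_vonMangoldt_le (Nat.div_le_self N M)).trans (by gcongr)
  have ha0 : 0 ≤ ∑ k ∈ Ioc V (N / M), (vonMangoldt k : ℝ) ^ 2 := sum_nonneg fun _ _ => sq_nonneg _
  have hq0 : (2 : ℝ) ≤ q := by exact_mod_cast hq2
  have hlog0 : 0 ≤ Real.log (2 * q) := Real.log_nonneg (by linarith)
  have hc : ((N / M : ℕ) : ℝ) + 2 * q * (1 + Real.log (2 * q)) ≤ N / M + 6 * q * ell N := by
    have : 2 * q * (1 + Real.log (2 * q)) ≤ 2 * q * (3 * ell N) := by gcongr; linarith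
    linarith
  gcongr

lemma norm_sum_cellCoeff_le {N U V h I a : ℕ} (hL : 1 ≤ Real.log N)
    (hh : (ell N : ℝ) ^ (2 * a + 6) ≤ h) {f : ℕ → ℂ} (hf : ∀ n, ‖f n‖ ≤ 1) :
    ‖∑ n ∈ Ioc N (N + N / h), (cellCoeff U V h N I n : ℂ) * f n‖ ≤
      26 * (N / (ell N : ℝ) ^ a) := by
  have hl : (1 : ℝ) ≤ ell N := hL.trans (log_le_ell N)
  have h1 : ‖∑ n ∈ Ioc N (N + N / h), (cellCoeff U V h N I n : ℂ) * f n‖ ≤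
      ∑ n ∈ Ioc N (N + N / h), 1 * |cellCoeff U V h N I n| := by
    refine norm_sum_le_of_le _ fun n _ => ?_
    rw [norm_mul, Complex.norm_real, Real.norm_eq_abs, one_mul]
    exact mul_le_of_le_one_right (abs_nonneg _) (hf n)
  refine h1.trans (le_of_abs_le (abs_le_of_sq_le_sq ?_ (by positivity)))
  refine (sum_mul_sq_le_sq_mul_sq _ _ _).trans ?_
  simp_rw [sq_abs]
  rw [one_pow, sum_const, Nat.card_Ioc, Nat.add_sub_cancel_left, nsmul_eq_mul, mul_one]
  have h2 : ((N / h : ℕ) : ℝ) ≤ N / (ell N : ℝ) ^ (2 * a + 6) := by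
    refine Nat.cast_div_le.trans ?_
    gcongr
  refine (mul_le_mul h2 (sum_sq_cellCoeff_le hL le_rfl) (sum_nonneg fun _ _ => sq_nonneg _)
    (by positivity)).trans ?_
  have e : (ell N : ℝ) ^ (2 * a + 6) = ((ell N : ℝ) ^ a) ^ 2 * (ell N : ℝ) ^ 6 := by ring
  rw [e]
  calc _ = 648 * (N / (ell N : ℝ) ^ a) ^ 2 := by field_simp
    _ ≤ _ := by
      have := sq_nonneg ((N : ℝ) / (ell N : ℝ) ^ a)
      linarith [mul_pow 26 ((N : ℝ) / (ell N : ℝ) ^ a) 2]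

theorem norm_sum_vonMangoldt_mul_ex_le {A N q : ℕ} {a : ℤ} {α : ℝ} (hL : 1 ≤ Real.log N)
    (hco : IsCoprime a (q : ℤ)) (hα : |q * α - a| * q ≤ 1)
    (hq : 2 * (ell N : ℝ) ^ (13 * A + 43) ≤ q) (hqN : q * (ell N : ℝ) ^ (13 * A + 43) ≤ N) :
    ‖∑ n ∈ Icc 1 N, (vonMangoldt n : ℂ) * ex (n * α)‖ ≤ 500 * (N / (ell N : ℝ) ^ A) := by
  have hl : (1 : ℝ) ≤ ell N := hL.trans (log_le_ell N)
  have hLx := log_le_ell N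
  obtain ⟨U, hU⟩ : ∃ U, U = ell N ^ (6 * A + 21) := ⟨_, rfl⟩
  obtain ⟨h, hh⟩ : ∃ h, h = ell N ^ (2 * A + 6) := ⟨_, rfl⟩
  have hl1 : 1 ≤ ell N := by exact_mod_cast hl
  have hU1 : 1 ≤ U := hU ▸ Nat.one_le_pow _ _ hl1
  have hh1 : 1 ≤ h := hh ▸ Nat.one_le_pow _ _ hl1
  have hhU : h ≤ U := by rw [hh, hU]; exact Nat.pow_le_pow_right hl1 (by omega)
  have hU' : (U : ℝ) = (ell N : ℝ) ^ (6 * A + 21) := by rw [hU]; push_cast; rfl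
  have hh' : (h : ℝ) = (ell N : ℝ) ^ (2 * A + 6) := by rw [hh]; push_cast; rfl
  have hone : (1 : ℝ) ≤ (ell N : ℝ) ^ (13 * A + 43) := one_le_pow₀ hl
  have hq0 : (2 : ℝ) ≤ q := by linarith
  have hq2 : 2 ≤ q := by exact_mod_cast hq0
  have hUq : 2 * (U * U) ≤ q := by
    have : (2 : ℝ) * (U * U) ≤ q := by
      refine le_trans ?_ hq
      rw [hU', ← pow_add]
      exact mul_le_mul_of_nonneg_left (pow_le_pow_right₀ hl (by omega)) (by norm_num)
    exact_mod_cast this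
  have hpow : ∀ j, j ≤ 13 * A + 43 → (ell N : ℝ) ^ j ≤ (ell N : ℝ) ^ (13 * A + 43) :=
    fun j hj => pow_le_pow_right₀ hl hj
  have hmain := norm_sum_vonMangoldt_mul_le (V := U) hU1 hU1 le_rfl
    (le_cellSeq_of_log (y := N) hh1 hhU)
    (f := fun n : ℕ => ex (n * α)) (fun n => (norm_ex _).le) (T := 2 * q) fun m hm z => by
      have := mem_Icc.mp hm
      exact norm_sum_ex_mul_le (by omega) hco hα this.1 (by omega) z
  have b2 : ∀ i ∈ range (2 * h * (Nat.log 2 N + 1)),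
      ‖∑ m ∈ Ioc (cellSeq U h i) (cellSeq U h (i + 1)), ∑ k ∈ Ioc U (N / cellSeq U h i),
        (vaughanCoeff U m : ℂ) * (vonMangoldt k : ℂ) * ex ((m * k : ℕ) * α)‖ ≤
      70 * (N / (ell N : ℝ) ^ (3 * A + 7)) := by
    intro i _
    have hUK : (ell N : ℝ) ^ (2 * (3 * A + 7) + 7) = U := by
      rw [hU']; exact congrArg _ (by ring)
    refine norm_minor_cell_le hL hco hα hq2 ?_ ?_ ?_ hUK.le ?_
    · have := hpow (2 * (3 * A + 7) + 7) (by omega); linarith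
    · exact (mul_le_mul_of_nonneg_left (hpow _ (by omega)) (Nat.cast_nonneg _)).trans hqN
    · rw [hUK]; exact_mod_cast le_cellSeq U h i
    · rw [cellSeq_succ]
      have := Nat.div_le_self (cellSeq U h i) h
      omega
  have b3 := norm_sum_cellCoeff_le (U := U) (V := U) (h := h) (a := A)
    (I := 2 * h * (Nat.log 2 N + 1)) hL hh'.ge
    (f := fun n : ℕ => ex (n * α)) (fun n => (norm_ex _).le)
  have b2' := sum_le_sum b2
  rw [sum_const, card_range, nsmul_eq_mul] at b2'
  refine hmain.trans ?_
  obtain ⟨x, hx⟩ : ∃ x, x = (ell N : ℝ) := ⟨_, rfl⟩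
  rw [← hx] at hl hLx hU' hh' hone hq hqN hpow b2' b3
  rw [← hx]
  have hx0 : 0 < x := by linarith
  have hN0 : (0 : ℝ) ≤ N := Nat.cast_nonneg N
  have c2 : ((2 * h * (Nat.log 2 N + 1) : ℕ) : ℝ) * (70 * (N / x ^ (3 * A + 7))) ≤
      420 * (N / x ^ A) := by
    have hI : ((2 * h * (Nat.log 2 N + 1) : ℕ) : ℝ) ≤ 6 * x ^ (2 * A + 7) := by
      push_cast
      rw [hh']
      have hlog : (Nat.log 2 N : ℝ) ≤ 2 * x := hx ▸ natLog_two_le_ell le_rfl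
      calc 2 * x ^ (2 * A + 6) * ((Nat.log 2 N : ℝ) + 1) ≤ 2 * x ^ (2 * A + 6) * (3 * x) := by
            refine mul_le_mul_of_nonneg_left ?_ (by positivity); linarith
        _ = _ := by ring
    refine (mul_le_mul_of_nonneg_right hI (by positivity)).trans (le_of_eq ?_)
    have : x ^ (3 * A + 7) = x ^ (2 * A + 7) * x ^ A := by ring
    rw [this]; field_simp; ring
  have c0 : (U : ℝ) * Real.log N ≤ N / x ^ A := by
    rw [le_div_iff₀ (by positivity), hU']
    calc x ^ (6 * A + 21) * Real.log N * x ^ A ≤ x ^ (6 * A + 21) * x * x ^ A := by gcongr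
      _ = x ^ (7 * A + 22) := by ring
      _ ≤ 1 * x ^ (13 * A + 43) := by rw [one_mul]; exact hpow _ (by omega)
      _ ≤ q * x ^ (13 * A + 43) := by gcongr; linarith
      _ ≤ N := hqN
  have c1 : (U : ℝ) * U * (Real.log N * (2 * q)) ≤ 2 * (N / x ^ A) := by
    rw [← mul_div_assoc, le_div_iff₀ (by positivity), hU']
    calc x ^ (6 * A + 21) * x ^ (6 * A + 21) * (Real.log N * (2 * q)) * x ^ A ≤
        x ^ (6 * A + 21) * x ^ (6 * A + 21) * (x * (2 * q)) * x ^ A := by gcongr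
      _ = 2 * (q * x ^ (13 * A + 43)) := by ring
      _ ≤ 2 * N := by linarith
  have hNx : 0 ≤ N / x ^ A := by positivity
  refine (add_le_add (add_le_add (add_le_add c0 (mul_le_mul_of_nonneg_left c1
    (by norm_num : (0 : ℝ) ≤ 3))) b2') b3).trans ?_
  linarith
end

section
open ArithmeticFunction DirichletCharacter

lemma norm_sum_mul_ex_le {N : ℕ} {a : ℕ → ℂ} {E : ℝ} (hE : 0 ≤ E)
    (h : ∀ y ≤ N, ‖∑ n ∈ Icc 1 y, a n‖ ≤ E) (β : ℝ) {Y : ℕ} (hY : Y ≤ N) :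
    ‖∑ n ∈ Ioc Y N, a n * ex (n * β)‖ ≤ 2 * E * (1 + 2 * Real.pi * |β| * N) := by
  have hI : ∀ y, Icc 1 y = Ioc 0 y := fun y => by ext; simp only [mem_Icc, mem_Ioc]; omega
  have hA : ∀ Z, Y ≤ Z → Z ≤ N → ‖∑ n ∈ Ioc Y Z, a n‖ ≤ 2 * E := by
    intro Z h1 h2
    have h3 := sum_Ioc_consecutive a (Nat.zero_le Y) h1
    have h4 : ∑ n ∈ Ioc Y Z, a n = ∑ n ∈ Ioc 0 Z, a n - ∑ n ∈ Ioc 0 Y, a n := by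
      rw [← h3]; ring
    rw [h4]
    refine (norm_sub_le _ _).trans ?_
    have h5 := h Z h2
    have h6 := h Y hY
    rw [hI] at h5 h6
    linarith
  have key : ∀ j, Y + j ≤ N → ‖∑ n ∈ Ioc Y (Y + j), a n * ex (n * β) -
      (∑ n ∈ Ioc Y (Y + j), a n) * ex ((Y + j : ℕ) * β)‖ ≤ j * (2 * E * (2 * Real.pi * |β|)) := by
    intro j
    induction j with
    | zero => intro _; simp
    | succ j ih =>
      intro hj
      have ih' := ih (by omega)
      rw [← add_assoc, sum_Ioc_succ_top (by omega), sum_Ioc_succ_top (by omega)]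
      have h1 := hA (Y + j) (by omega) (by omega)
      have h2 : ‖ex ((Y + j : ℕ) * β) - ex ((Y + j + 1 : ℕ) * β)‖ ≤ 2 * Real.pi * |β| := by
        refine (norm_ex_sub_ex_le _ _).trans (le_of_eq ?_)
        congr 1
        rw [← abs_neg]; congr 1; push_cast; ring
      have h3 : ∀ S T e1 e2 b : ℂ, S + b * e2 - (T + b) * e2 = (S - T * e1) + T * (e1 - e2) :=
        fun _ _ _ _ _ => by ring
      rw [h3 _ _ (ex ((Y + j : ℕ) * β))]
      refine (norm_add_le _ _).trans ?_
      rw [norm_mul]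
      have h4 := mul_le_mul h1 h2 (norm_nonneg _) (by positivity)
      push_cast at ih' ⊢
      push_cast at h4
      linarith
  have h1 := key (N - Y) (by omega)
  rw [Nat.add_sub_cancel' hY] at h1
  have h2 := hA N hY le_rfl
  have h3 : ‖(∑ n ∈ Ioc Y N, a n) * ex (N * β)‖ ≤ 2 * E := by rwa [norm_mul, norm_ex, mul_one]
  have h4 := norm_le_norm_add_norm_sub' (∑ n ∈ Ioc Y N, a n * ex (n * β))
    ((∑ n ∈ Ioc Y N, a n) * ex (N * β))
  have h5 : ((N - Y : ℕ) : ℝ) * (2 * E * (2 * Real.pi * |β|)) ≤ N * (2 * E * (2 * Real.pi * |β|)) := by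
    refine mul_le_mul_of_nonneg_right (by exact_mod_cast Nat.sub_le N Y) ?_
    have := Real.pi_pos
    positivity
  linarith

/-- The coefficient of a function on residues with respect to a character. -/
def charCoeff {r : ℕ} [NeZero r] (h : ZMod r → ℂ) (ψ : DirichletCharacter ℂ r) : ℂ :=
  (r.totient : ℂ)⁻¹ * ∑ b : ZMod r, (starRingEnd ℂ) (ψ b) * h b

lemma sum_charCoeff_mul {r : ℕ} [NeZero r] (h : ZMod r → ℂ) {n : ZMod r} (hn : IsUnit n) :
    ∑ ψ : DirichletCharacter ℂ r, charCoeff h ψ * ψ n = h n := by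
  have hφ : (r.totient : ℂ) ≠ 0 := by
    exact_mod_cast (Nat.totient_pos.mpr (Nat.pos_of_ne_zero (NeZero.ne r))).ne'
  have h1 : ∀ ψ : DirichletCharacter ℂ r, charCoeff h ψ * ψ n =
      ∑ b : ZMod r, (r.totient : ℂ)⁻¹ * (h b * ((starRingEnd ℂ) (ψ b) * ψ n)) := by
    intro ψ
    rw [charCoeff, mul_assoc, sum_mul, mul_sum]
    exact sum_congr rfl fun b _ => by ring
  simp_rw [h1]
  rw [sum_comm, sum_eq_single n]
  · rw [← mul_sum, ← mul_sum, sum_conj_char_mul_char hn, if_pos rfl]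
    field_simp
  · intro b _ hb
    rw [← mul_sum, ← mul_sum]
    by_cases hu : IsUnit b
    · rw [sum_conj_char_mul_char hu, if_neg hb, mul_zero, mul_zero]
    · rw [sum_eq_zero fun ψ _ => by rw [ψ.map_nonunit hu, _root_.map_zero, zero_mul],
        mul_zero, mul_zero]
  · intro hh; exact absurd (mem_univ _) hh

lemma norm_charCoeff_le {r : ℕ} [NeZero r] {h : ZMod r → ℂ} (hh : ∀ b, ‖h b‖ ≤ 1)
    (ψ : DirichletCharacter ℂ r) : ‖charCoeff h ψ‖ ≤ r := by
  have hφ : (1 : ℝ) ≤ r.totient := by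
    exact_mod_cast Nat.totient_pos.mpr (Nat.pos_of_ne_zero (NeZero.ne r))
  rw [charCoeff, norm_mul, norm_inv, Complex.norm_natCast]
  have h1 : ‖∑ b : ZMod r, (starRingEnd ℂ) (ψ b) * h b‖ ≤ r := by
    refine (norm_sum_le_of_le (n := fun _ => (1 : ℝ)) _ fun b _ => ?_).trans ?_
    · rw [norm_mul, RCLike.norm_conj]
      exact mul_le_one₀ (ψ.norm_le_one b) (norm_nonneg _) (hh b)
    · simp [ZMod.card]
  calc _ ≤ 1 * (r : ℝ) := mul_le_mul (inv_le_one_of_one_le₀ hφ) h1 (norm_nonneg _) zero_le_one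
    _ = r := one_mul _

/-- An additive character of denominator `q` as a function on residues. -/
def zex (q : ℕ) (a : ℤ) (b : ZMod q) : ℂ := ex (b.val * (a / q))

lemma norm_zex (q : ℕ) (a : ℤ) (b : ZMod q) : ‖zex q a b‖ = 1 := norm_ex _

lemma zex_natCast {q : ℕ} [NeZero q] (a : ℤ) (n : ℕ) : zex q a n = ex (n * (a / q)) := by
  have hq : (q : ℝ) ≠ 0 := by exact_mod_cast NeZero.ne q
  rw [zex, ZMod.val_natCast]
  have h1 : (n : ℝ) = (n % q : ℕ) + q * (n / q : ℕ) := by exact_mod_cast (Nat.mod_add_div n q).symm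
  generalize n / q = d at h1
  have h : (n : ℝ) * (a / q) = ((n % q : ℕ) : ℝ) * (a / q) + ((a * d : ℤ) : ℝ) := by
    rw [congrArg (· * ((a : ℝ) / q)) h1]
    push_cast
    field_simp
  rw [h, ex_add_intCast]

lemma ex_int_div_two {a : ℤ} (ha : ¬ (2 : ℤ) ∣ a) : ex (a / 2) = -1 := by
  obtain ⟨m, rfl⟩ : ∃ m, a = 2 * m + 1 := ⟨a / 2, by omega⟩
  have h : ((2 * m + 1 : ℤ) : ℝ) / 2 = 1 / 2 + (m : ℤ) := by push_cast; ring
  rw [h, ex_add_intCast, ex]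
  rw [← Complex.exp_pi_mul_I]
  congr 1
  push_cast
  ring

lemma charCoeff_zex_one {q : ℕ} [NeZero q] {a : ℤ} (hq : 4 ∣ q) (hco : IsCoprime a (q : ℤ)) :
    charCoeff (zex q a) 1 = 0 := by
  obtain ⟨k, rfl⟩ := hq
  have hk : (k : ℝ) ≠ 0 := by
    have := NeZero.ne (4 * k)
    exact_mod_cast (by omega : k ≠ 0)
  have ha : ¬ (2 : ℤ) ∣ a := by
    intro h2
    have h3 := hco.isUnit_of_dvd' h2 ⟨2 * k, by push_cast; ring⟩
    rw [Int.isUnit_iff] at h3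
    omega
  rw [charCoeff, mul_eq_zero]
  right
  obtain ⟨S, hS⟩ : ∃ S, S = ∑ b : ZMod (4 * k), (starRingEnd ℂ)
    ((1 : DirichletCharacter ℂ (4 * k)) b) * zex (4 * k) a b := ⟨_, rfl⟩
  have hcop : ∀ x, Nat.Coprime x (4 * k) ↔ Nat.Coprime x (2 * k) := fun x => by
    rw [show 4 * k = 2 * (2 * k) by ring, Nat.coprime_mul_iff_right]
    exact ⟨fun h => h.2, fun h => ⟨Nat.Coprime.coprime_mul_right_right h, h⟩⟩
  have h1 : S = ∑ b : ZMod (4 * k), (starRingEnd ℂ)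
      ((1 : DirichletCharacter ℂ (4 * k)) (b + ((2 * k : ℕ) : ZMod (4 * k)))) *
        zex (4 * k) a (b + ((2 * k : ℕ) : ZMod (4 * k))) := by
    rw [hS]
    exact (Equiv.sum_comp (Equiv.addRight ((2 * k : ℕ) : ZMod (4 * k))) _).symm
  have h2 : ∀ b : ZMod (4 * k), (starRingEnd ℂ)
      ((1 : DirichletCharacter ℂ (4 * k)) (b + ((2 * k : ℕ) : ZMod (4 * k)))) *
        zex (4 * k) a (b + ((2 * k : ℕ) : ZMod (4 * k))) =
      -((starRingEnd ℂ) ((1 : DirichletCharacter ℂ (4 * k)) b) * zex (4 * k) a b) := by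
    intro b
    obtain ⟨v, rfl⟩ : ∃ v : ℕ, (v : ZMod (4 * k)) = b := ⟨b.val, ZMod.natCast_zmod_val b⟩
    rw [← Nat.cast_add, zex_natCast, zex_natCast]
    have h3 : ex ((v + 2 * k : ℕ) * (a / (4 * k : ℕ))) = -ex (v * (a / (4 * k : ℕ))) := by
      have h4 : ((v + 2 * k : ℕ) : ℝ) * (a / (4 * k : ℕ)) = v * (a / (4 * k : ℕ)) + a / 2 := by
        push_cast; field_simp; ring
      rw [h4, ex_add, ex_int_div_two ha]; ring
    have h5 : (1 : DirichletCharacter ℂ (4 * k)) ((v + 2 * k : ℕ) : ZMod (4 * k)) =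
        (1 : DirichletCharacter ℂ (4 * k)) (v : ZMod (4 * k)) := by
      have h6 : IsUnit ((v + 2 * k : ℕ) : ZMod (4 * k)) ↔ IsUnit (v : ZMod (4 * k)) := by
        rw [ZMod.isUnit_iff_coprime, ZMod.isUnit_iff_coprime, hcop, hcop, Nat.coprime_add_self_left]
      by_cases hu : IsUnit (v : ZMod (4 * k))
      · rw [MulChar.one_apply hu, MulChar.one_apply (h6.mpr hu)]
      · rw [MulChar.map_nonunit _ hu, MulChar.map_nonunit _ (mt h6.mp hu)]
    rw [h3, h5]; ring
  simp_rw [h2, sum_neg_distrib, ← hS] at h1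
  rw [← hS]
  linear_combination h1 / 2

lemma norm_sum_vonMangoldt_sub_le {m y : ℕ} (hm : m ≠ 0) {f g : ℕ → ℂ}
    (h : ∀ n, n.Coprime m → f n = g n) (h1 : ∀ n, ‖f n - g n‖ ≤ 1) :
    ‖∑ n ∈ Icc 1 y, (vonMangoldt n : ℂ) * f n - ∑ n ∈ Icc 1 y, (vonMangoldt n : ℂ) * g n‖ ≤
      (Nat.log 2 y + 1) * Real.log m := by
  refine le_trans ?_ (sum_vonMangoldt_not_coprime_le hm y)
  rw [← sum_sub_distrib, sum_filter]
  have hs : Icc 1 y ⊆ range (y + 1) := fun n hn => by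
    rw [mem_Icc] at hn; rw [mem_range]; omega
  refine (norm_sum_le_of_le _ fun n _ => ?_).trans (sum_le_sum_of_subset_of_nonneg hs fun n _ _ => ?_)
  · rw [← mul_sub, norm_mul, Complex.norm_real, Real.norm_of_nonneg vonMangoldt_nonneg]
    by_cases hn : n.Coprime m
    · rw [if_neg (not_not.mpr hn), h n hn, sub_self, norm_zero, mul_zero]
    · rw [if_pos hn]
      exact mul_le_of_le_one_right vonMangoldt_nonneg (h1 n)
  · split_ifs
    · exact le_rfl
    · exact vonMangoldt_nonneg

lemma norm_sum_vonMangoldt_mul_zex_le {q y : ℕ} [NeZero q] {a : ℤ} {F : ℕ → ℂ}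
    (hF : ∀ n, ‖F n‖ ≤ 1) :
    ‖∑ n ∈ Icc 1 y, (vonMangoldt n : ℂ) * (F n * ex (n * (a / q)))‖ ≤
      (Nat.log 2 y + 1) * Real.log q + ∑ ξ : DirichletCharacter ℂ q, ‖charCoeff (zex q a) ξ‖ *
        ‖∑ n ∈ Icc 1 y, (vonMangoldt n : ℂ) * (F n * ξ n)‖ := by
  have h1 := norm_sum_vonMangoldt_sub_le (y := y) (NeZero.ne q)
    (f := fun n => F n * ex (n * (a / q)))
    (g := fun n => F n * ∑ ξ : DirichletCharacter ℂ q, charCoeff (zex q a) ξ * ξ n)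
    (fun n hn => by
      rw [sum_charCoeff_mul _ ((ZMod.isUnit_iff_coprime n q).mpr hn), zex_natCast]) fun n => by
      by_cases hn : n.Coprime q
      · rw [sum_charCoeff_mul _ ((ZMod.isUnit_iff_coprime n q).mpr hn), zex_natCast, sub_self,
          norm_zero]
        exact zero_le_one
      · rw [sum_eq_zero fun ξ _ => by
          rw [ξ.map_nonunit (mt (ZMod.isUnit_iff_coprime n q).mp hn), mul_zero], mul_zero, sub_zero,
          norm_mul, norm_ex, mul_one]
        exact hF n
  refine (norm_le_norm_add_norm_sub' _ (∑ n ∈ Icc 1 y, (vonMangoldt n : ℂ) *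
      (F n * ∑ ξ : DirichletCharacter ℂ q, charCoeff (zex q a) ξ * ξ n))).trans ?_
  rw [add_comm]
  refine add_le_add h1 ?_
  have h2 : ∑ n ∈ Icc 1 y, (vonMangoldt n : ℂ) *
      (F n * ∑ ξ : DirichletCharacter ℂ q, charCoeff (zex q a) ξ * ξ n) =
      ∑ ξ : DirichletCharacter ℂ q, charCoeff (zex q a) ξ *
        ∑ n ∈ Icc 1 y, (vonMangoldt n : ℂ) * (F n * ξ n) := by
    simp_rw [mul_sum]
    rw [sum_comm]
    exact sum_congr rfl fun _ _ => sum_congr rfl fun _ _ => by ring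
  rw [h2]
  exact norm_sum_le_of_le _ fun ξ _ => (norm_mul _ _).le

lemma norm_sum_vonMangoldt_mul_ex_le_of_four_dvd {q y : ℕ} [NeZero q] {a : ℤ} (hq : 4 ∣ q)
    (hco : IsCoprime a (q : ℤ)) {E : ℝ} (hE : 0 ≤ E) (h : ∀ ξ : DirichletCharacter ℂ q, ξ ≠ 1 →
      ‖∑ n ∈ Icc 1 y, (vonMangoldt n : ℂ) * ξ n‖ ≤ E) :
    ‖∑ n ∈ Icc 1 y, (vonMangoldt n : ℂ) * ex (n * (a / q))‖ ≤
      (Nat.log 2 y + 1) * Real.log q + q * (q * E) := by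
  have h1 := norm_sum_vonMangoldt_mul_zex_le (q := q) (y := y) (a := a) (F := fun _ => 1)
    fun _ => by rw [norm_one]
  simp_rw [one_mul] at h1
  refine h1.trans (add_le_add le_rfl ?_)
  calc _ ≤ ∑ _ξ : DirichletCharacter ℂ q, (q * E : ℝ) := by
        refine sum_le_sum fun ξ _ => ?_
        by_cases hξ : ξ = 1
        · rw [hξ, charCoeff_zex_one hq hco, norm_zero, zero_mul]; positivity
        · exact mul_le_mul (norm_charCoeff_le (fun b => (norm_zex q a b).le) ξ) (h ξ hξ)
            (norm_nonneg _) (Nat.cast_nonneg _)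
    _ ≤ _ := by
      rw [sum_const, nsmul_eq_mul]
      refine mul_le_mul_of_nonneg_right ?_ (by positivity)
      rw [card_univ, ← Nat.card_eq_fintype_card,
        DirichletCharacter.card_eq_totient_of_hasEnoughRootsOfUnity ℂ q]
      exact_mod_cast Nat.totient_le q
end

section

/-- The difference of the indicators of `1 + e` and `1 + 3 * e` modulo `4 * e`. -/
def residueDiff (e n : ℕ) : ℝ :=
  (if n ≡ 1 + e [MOD 4 * e] then 1 else 0) - (if n ≡ 1 + 3 * e [MOD 4 * e] then 1 else 0)

lemma chi4_of_even {n : ℕ} (h : Even n) : chi4 n = 0 := by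
  obtain ⟨k, rfl⟩ := h
  rw [chi4, if_neg (by omega), if_neg (by omega)]

lemma residueDiff_of_not_dvd {e m : ℕ} (h : ¬ e ∣ m) : residueDiff e (m + 1) = 0 := by
  have key : ∀ j, ¬ m + 1 ≡ 1 + j * e [MOD 4 * e] := by
    intro j hj
    have h1 : m + 1 ≡ 1 + j * e [MOD e] := hj.of_mul_left 4
    have h2 : m + 1 ≡ 0 + 1 [MOD e] := by
      refine h1.trans ?_
      rw [add_comm, Nat.ModEq.comm]
      refine Nat.ModEq.add_right 1 ?_
      exact ((Nat.modEq_zero_iff_dvd).mpr (Nat.dvd_mul_left e j)).symm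
    exact h ((Nat.modEq_zero_iff_dvd).mp (Nat.ModEq.add_right_cancel' 1 h2))
  have k1 := key 1
  rw [one_mul] at k1
  rw [residueDiff, if_neg k1, if_neg (key 3), sub_zero]

lemma residueDiff_mul {e k : ℕ} (he : e ≠ 0) : residueDiff e (k * e + 1) = chi4 k := by
  have key : ∀ j, k * e + 1 ≡ 1 + j * e [MOD 4 * e] ↔ k ≡ j [MOD 4] := by
    intro j
    rw [← Nat.ModEq.mul_right_cancel_iff' (m := 4) he, add_comm 1]
    exact ⟨Nat.ModEq.add_right_cancel' 1, Nat.ModEq.add_right 1⟩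
  have k1 := key 1
  rw [one_mul] at k1
  rw [residueDiff, chi4, if_congr k1 rfl rfl, if_congr (key 3) rfl rfl]
  simp only [Nat.ModEq, Nat.reduceMod]
  by_cases h1 : k % 4 = 1
  · simp [h1]
  · by_cases h3 : k % 4 = 3 <;> simp [h1, h3]

lemma abs_residueDiff_le (e n : ℕ) : |residueDiff e n| ≤ 1 := by
  rw [residueDiff]
  split_ifs <;> norm_num

lemma sum_even_residueDiff_eq_r3 {D : ℝ} {N p : ℕ} (hD : 0 < D) (hDN : D < N) (hp : p.Prime)
    (hpN : p ≤ N) : r3 D N (p - 1) =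
      ∑ e ∈ Icc 1 ⌊D⌋₊ with Even e, if ⌈e * (N / D)⌉₊ < p then residueDiff e p else 0 := by
  have hN0 : (0 : ℝ) < N := hD.trans hDN
  have hND : 1 < N / D := by rwa [one_lt_div hD]
  obtain ⟨m, rfl⟩ : ∃ m, p = m + 1 := ⟨p - 1, by have := hp.two_le; omega⟩
  have hm : m ≠ 0 := by rintro rfl; exact Nat.not_prime_one hp
  rw [Nat.add_sub_cancel, r3, ← Nat.sum_div_divisors]
  have hiff : ∀ e : ℕ, ⌈e * ((N : ℝ) / D)⌉₊ < m + 1 ↔ e * ((N : ℝ) / D) ≤ m := fun e => by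
    rw [Nat.lt_succ_iff, Nat.ceil_le]
  simp only [hiff]
  have hdiv : ∀ e ∈ m.divisors, ((N : ℝ) / D ≤ ((m / e : ℕ) : ℝ)) ↔ e * ((N : ℝ) / D) ≤ m := by
    intro e he
    obtain ⟨he1, -⟩ := Nat.mem_divisors.mp he
    have he0 : (0 : ℝ) < e := by exact_mod_cast Nat.pos_of_dvd_of_pos he1 (Nat.pos_of_ne_zero hm)
    rw [Nat.cast_div he1 he0.ne', le_div_iff₀ he0, mul_comm]
  rw [sum_congr rfl fun e he => if_congr (hdiv e he) rfl rfl, ← sum_filter, ← sum_filter]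
  refine sum_congr_of_eq_on_inter ?_ ?_ ?_
  · intro e he hne
    obtain ⟨he1, he2⟩ := mem_filter.mp he
    obtain ⟨hem, -⟩ := Nat.mem_divisors.mp he1
    have he0 := Nat.pos_of_dvd_of_pos hem (Nat.pos_of_ne_zero hm)
    have heD : e ≤ ⌊D⌋₊ := by
      refine Nat.le_floor ?_
      have h1 : (e : ℝ) * (N / D) ≤ N := he2.trans (by exact_mod_cast (by omega : m ≤ N))
      rw [← mul_div_assoc, div_le_iff₀ hD, mul_comm] at h1
      exact le_of_mul_le_mul_left h1 hN0
    have hodd : ¬ Even e := fun hev => hne (by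
      simp only [mem_filter, mem_Icc]; exact ⟨⟨⟨he0, heD⟩, hev⟩, he2⟩)
    apply chi4_of_even
    rcases hp.eq_two_or_odd' with h2 | h2
    · exfalso
      have hm1 : m = 1 := by omega
      rw [hm1, Nat.dvd_one] at hem
      rw [hem, hm1, Nat.cast_one, one_mul] at he2
      linarith
    · have hme : Even m := by
        rcases Nat.even_or_odd m with h3 | h3
        · exact h3
        · exact absurd h2 (Nat.not_odd_iff_even.mpr (h3.add_odd odd_one))
      obtain ⟨k, rfl⟩ := hem
      rw [Nat.mul_div_cancel_left k he0]
      rcases Nat.even_mul.mp hme with h3 | h3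
      · exact absurd h3 hodd
      · exact h3
  · intro e he hne
    simp only [mem_filter, mem_Icc, Nat.mem_divisors] at he hne
    exact residueDiff_of_not_dvd fun hd => hne ⟨⟨hd, hm⟩, he.2⟩
  · intro e he he'
    simp only [mem_filter, mem_Icc, Nat.mem_divisors] at he he'
    obtain ⟨k, rfl⟩ := he.1.1
    rw [mul_comm e k, Nat.mul_div_cancel k he'.1.1.1, residueDiff_mul (by omega)]

lemma le_totient_mul_card_divisors (n : ℕ) : n ≤ n.totient * n.divisors.card := by
  induction n using Nat.recOnPosPrimePosCoprime with
  | zero => simp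
  | one => simp
  | prime_pow p n hp hn =>
    rw [Nat.totient_prime_pow hp hn, Nat.divisors_prime_pow hp, card_map, card_range]
    obtain ⟨k, rfl⟩ : ∃ k, n = k + 1 := ⟨n - 1, by omega⟩
    obtain ⟨s, rfl⟩ : ∃ s, p = s + 2 := ⟨p - 2, by have := hp.two_le; omega⟩
    rw [Nat.add_sub_cancel, pow_succ, mul_assoc]
    refine Nat.mul_le_mul_left _ ?_
    rw [show s + 2 - 1 = s + 1 by omega]
    nlinarith [Nat.zero_le (s * k)]
  | coprime a b ha hb hab iha ihb =>
    rw [Nat.totient_mul hab, hab.card_divisors_mul]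
    calc a * b ≤ (a.totient * a.divisors.card) * (b.totient * b.divisors.card) :=
          Nat.mul_le_mul iha ihb
      _ = _ := by ring

lemma sum_inv_totient_le (X : ℕ) :
    ∑ k ∈ Icc 1 X, (k.totient : ℝ)⁻¹ ≤ (1 + Real.log X) ^ 2 := by
  refine le_trans ?_ (sum_card_divisors_pow_div_le 1 X)
  refine sum_le_sum fun k hk => ?_
  have hk0 : 0 < k := (mem_Icc.mp hk).1
  have h1 : (0 : ℝ) < k.totient := by exact_mod_cast Nat.totient_pos.mpr hk0
  have h2 : (0 : ℝ) < k := by exact_mod_cast hk0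
  rw [pow_one, inv_eq_one_div, div_le_iff₀ h1, ← div_eq_mul_inv, div_mul_eq_mul_div, le_div_iff₀ h2,
    one_mul]
  have := le_totient_mul_card_divisors k
  rw [mul_comm]
  exact_mod_cast this

lemma sum_inv_totient_dvd_le {r X : ℕ} (hr : 0 < r) :
    ∑ m ∈ Icc 1 X with r ∣ m, (m.totient : ℝ)⁻¹ ≤ (r.totient : ℝ)⁻¹ * (1 + Real.log X) ^ 2 := by
  have hφ : (0 : ℝ) < r.totient := by exact_mod_cast Nat.totient_pos.mpr hr
  calc ∑ m ∈ Icc 1 X with r ∣ m, (m.totient : ℝ)⁻¹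
      ≤ ∑ m ∈ (Icc 1 X).image (r * ·), (m.totient : ℝ)⁻¹ := by
        refine sum_le_sum_of_subset_of_nonneg (fun m hm => ?_) fun _ _ _ => by positivity
        simp only [mem_filter, mem_Icc] at hm
        obtain ⟨⟨h1, h2⟩, k, rfl⟩ := hm
        refine mem_image.mpr ⟨k, mem_Icc.mpr ⟨?_, ?_⟩, rfl⟩
        · exact Nat.pos_of_mul_pos_left h1
        · exact (Nat.le_mul_of_pos_left k hr).trans h2
    _ = ∑ k ∈ Icc 1 X, ((r * k).totient : ℝ)⁻¹ :=
        sum_image fun a _ b _ h => Nat.eq_of_mul_eq_mul_left hr h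
    _ ≤ ∑ k ∈ Icc 1 X, (r.totient : ℝ)⁻¹ * (k.totient : ℝ)⁻¹ := by
        refine sum_le_sum fun k hk => ?_
        have h1 : (0 : ℝ) < k.totient := by
          exact_mod_cast Nat.totient_pos.mpr (mem_Icc.mp hk).1
        rw [← mul_inv]
        refine inv_anti₀ (by positivity) ?_
        exact_mod_cast Nat.totient_super_multiplicative r k
    _ ≤ _ := by
        rw [← mul_sum]
        exact mul_le_mul_of_nonneg_left (sum_inv_totient_le X) (by positivity)
end

section
open ArithmeticFunction DirichletCharacter

lemma sum_char_le_sum_primChars {m : ℕ} [NeZero m] {G : DirichletCharacter ℂ m → ℝ}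
    (hG : ∀ ψ, 0 ≤ G ψ) {T : ∀ r, DirichletCharacter ℂ r → ℝ}
    (hT : ∀ r (h : r ∣ m) (ψ : DirichletCharacter ℂ r), G (changeLevel h ψ) ≤ T r ψ) :
    ∑ ψ, G ψ ≤ ∑ r ∈ m.divisors, ∑ ψ ∈ primChars r, T r ψ := by
  classical
  rw [← sum_fiberwise_of_maps_to (t := m.divisors) (g := fun ψ : DirichletCharacter ℂ m =>
    ψ.conductor) fun ψ _ => Nat.mem_divisors.mpr ⟨ψ.conductor_dvd_level, NeZero.ne m⟩]
  refine sum_le_sum fun r hr => ?_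
  have hrm : r ∣ m := (Nat.mem_divisors.mp hr).1
  calc ∑ ψ : DirichletCharacter ℂ m with ψ.conductor = r, G ψ
      ≤ ∑ ψ ∈ (primChars r).image (changeLevel hrm), G ψ := by
        refine sum_le_sum_of_subset_of_nonneg (fun ψ hψ => ?_) fun ψ _ _ => hG ψ
        obtain ⟨-, rfl⟩ := mem_filter.mp hψ
        refine mem_image.mpr ⟨ψ.primitiveCharacter, ?_, changeLevel_primitiveCharacter ψ⟩
        exact mem_primChars.mpr (primitiveCharacter_isPrimitive ψ)
    _ ≤ ∑ ψ ∈ primChars r, G (changeLevel hrm ψ) := sum_image_le_of_nonneg fun ψ _ => hG _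
    _ ≤ _ := sum_le_sum fun ψ _ => hT r hrm ψ

lemma gcd_four_mul_dvd {e q : ℕ} (hq : ¬ 4 ∣ q) : Nat.gcd (4 * e) q ∣ 2 * e := by
  obtain ⟨g, hg⟩ : ∃ g, g = Nat.gcd (4 * e) q := ⟨_, rfl⟩
  have h1 : g ∣ 4 * e := hg ▸ Nat.gcd_dvd_left _ _
  have h2 : g ∣ q := hg ▸ Nat.gcd_dvd_right _ _
  rw [← hg]
  rcases Nat.even_or_odd g with h3 | h3
  · obtain ⟨k, hk⟩ := h3
    have hk2 : g = 2 * k := by omega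
    rcases Nat.even_or_odd k with h4 | h4
    · obtain ⟨l, hl⟩ := h4
      exact absurd (dvd_trans ⟨l, by omega⟩ h2) hq
    · rw [hk2] at h1 ⊢
      refine Nat.mul_dvd_mul_left 2 ?_
      have h5 : k ∣ 2 * e := by
        rw [show 4 * e = 2 * (2 * e) by ring] at h1
        exact Nat.dvd_of_mul_dvd_mul_left two_pos h1
      exact (Nat.Coprime.dvd_mul_left h4.coprime_two_right).mp h5
  · rw [show 4 * e = 4 * e from rfl] at h1
    have h4 : Nat.Coprime g 4 := by
      rw [show 4 = 2 ^ 2 by norm_num]; exact Nat.Coprime.pow_right 2 h3.coprime_two_right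
    exact ((Nat.Coprime.dvd_mul_left h4).mp h1).mul_left 2

lemma coprime_one_add_mul_of_even {e j : ℕ} (he : Even e) : (1 + j * e).Coprime (4 * e) := by
  refine Nat.Coprime.mul_right ?_ ?_
  · rw [show 4 = 2 ^ 2 by norm_num]
    refine Nat.Coprime.pow_right 2 (Nat.Coprime.symm ?_)
    rw [Nat.coprime_two_left]
    exact odd_one.add_even (he.mul_left j)
  · simp

lemma charTwist_ne_one {e q r : ℕ} (he : Even e) (hq : ¬ 4 ∣ q)
    (hr : r ∣ 4 * e) (ψ : DirichletCharacter ℂ r) (ξ : DirichletCharacter ℂ q)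
    (h : changeLevel hr ψ ((1 + 2 * e : ℕ) : ZMod (4 * e)) ≠ 1) : charTwist ψ ξ ≠ 1 := by
  intro h1
  obtain ⟨n, hn1, hn2⟩ := Nat.chineseRemainder' (n := 4 * e) (m := q) (a := 1 + 2 * e) (b := 1) (by
    have h2 : 0 + 1 ≡ 2 * e + 1 [MOD Nat.gcd (4 * e) q] :=
      Nat.ModEq.add_right 1 ((Nat.modEq_zero_iff_dvd.mpr (gcd_four_mul_dvd hq)).symm)
    rw [add_comm 1]
    exact h2.symm)
  have hc1 : n.Coprime (4 * e) := by
    rw [Nat.Coprime, hn1.gcd_eq]; exact coprime_one_add_mul_of_even he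
  have hc2 : n.Coprime q := by rw [Nat.Coprime, hn2.gcd_eq]; simp
  have hc3 : n.Coprime (r * q) := Nat.Coprime.mul_right (hc1.coprime_dvd_right hr) hc2
  have h3 := charTwist_apply ψ ξ n
  rw [h1, MulChar.one_apply ((ZMod.isUnit_iff_coprime n _).mpr hc3),
    (ZMod.natCast_eq_natCast_iff n 1 q).mpr hn2, Nat.cast_one, _root_.map_one, mul_one,
    ← changeLevel_natCast hr ψ hc1, (ZMod.natCast_eq_natCast_iff n (1 + 2 * e) (4 * e)).mpr hn1] at h3
  exact h h3.symm

/-- `residueDiff` as a function on residues modulo `4 * e`. -/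
def residueDiffZMod (e : ℕ) (b : ZMod (4 * e)) : ℂ :=
  (if b = ((1 + e : ℕ) : ZMod (4 * e)) then 1 else 0) -
    (if b = ((1 + 3 * e : ℕ) : ZMod (4 * e)) then 1 else 0)

lemma residueDiffZMod_natCast (e n : ℕ) : residueDiffZMod e n = residueDiff e n := by
  rw [residueDiffZMod, residueDiff, if_congr (ZMod.natCast_eq_natCast_iff n (1 + e) (4 * e)) rfl rfl,
    if_congr (ZMod.natCast_eq_natCast_iff n (1 + 3 * e) (4 * e)) rfl rfl]
  split_ifs <;> norm_num

lemma sum_charCoeff_residueDiff {e : ℕ} (he : Even e) [NeZero (4 * e)] (n : ℕ) :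
    ∑ ψ : DirichletCharacter ℂ (4 * e), charCoeff (residueDiffZMod e) ψ * ψ n = residueDiff e n := by
  by_cases hn : n.Coprime (4 * e)
  · rw [sum_charCoeff_mul _ ((ZMod.isUnit_iff_coprime n _).mpr hn), residueDiffZMod_natCast]
  · rw [sum_eq_zero fun ψ _ => by
      rw [ψ.map_nonunit (mt (ZMod.isUnit_iff_coprime n _).mp hn), mul_zero]]
    have key : ∀ j, ¬ n ≡ 1 + j * e [MOD 4 * e] := fun j hj => hn (by
      rw [Nat.Coprime, hj.gcd_eq]; exact coprime_one_add_mul_of_even he)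
    have k1 := key 1
    rw [one_mul] at k1
    rw [residueDiff, if_neg k1, if_neg (key 3)]
    simp

lemma charCoeff_residueDiffZMod (e : ℕ) [NeZero (4 * e)] (ψ : DirichletCharacter ℂ (4 * e)) :
    charCoeff (residueDiffZMod e) ψ = ((4 * e).totient : ℂ)⁻¹ *
      ((starRingEnd ℂ) (ψ ((1 + e : ℕ) : ZMod (4 * e))) -
        (starRingEnd ℂ) (ψ ((1 + 3 * e : ℕ) : ZMod (4 * e)))) := by
  rw [charCoeff]
  congr 1
  simp_rw [residueDiffZMod, mul_sub, mul_ite, mul_one, mul_zero]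
  rw [sum_sub_distrib, sum_ite_eq', sum_ite_eq', if_pos (mem_univ _), if_pos (mem_univ _)]

lemma norm_charCoeff_residueDiffZMod_le (e : ℕ) [NeZero (4 * e)]
    (ψ : DirichletCharacter ℂ (4 * e)) :
    ‖charCoeff (residueDiffZMod e) ψ‖ ≤ 2 * ((4 * e).totient : ℝ)⁻¹ := by
  rw [charCoeff_residueDiffZMod, norm_mul, norm_inv, Complex.norm_natCast, mul_comm]
  refine mul_le_mul_of_nonneg_right ((norm_sub_le _ _).trans ?_) (by positivity)
  rw [RCLike.norm_conj, RCLike.norm_conj]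
  linarith [ψ.norm_le_one ((1 + e : ℕ) : ZMod (4 * e)),
    ψ.norm_le_one ((1 + 3 * e : ℕ) : ZMod (4 * e))]

lemma charCoeff_residueDiffZMod_eq_zero {e : ℕ} (he : Even e) [NeZero (4 * e)]
    {ψ : DirichletCharacter ℂ (4 * e)} (h : ψ ((1 + 2 * e : ℕ) : ZMod (4 * e)) = 1) :
    charCoeff (residueDiffZMod e) ψ = 0 := by
  have h1 : ((1 + 3 * e : ℕ) : ZMod (4 * e)) =
      ((1 + e : ℕ) : ZMod (4 * e)) * ((1 + 2 * e : ℕ) : ZMod (4 * e)) := by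
    rw [← Nat.cast_mul, ZMod.natCast_eq_natCast_iff]
    obtain ⟨k, rfl⟩ := he
    have : (1 + (k + k)) * (1 + 2 * (k + k)) = 1 + 3 * (k + k) + k * (4 * (k + k)) := by ring
    rw [this]
    exact (Nat.add_mul_modulus_modEq_iff.mpr rfl).symm
  rw [charCoeff_residueDiffZMod, h1, map_mul, h, mul_one, sub_self, mul_zero]

lemma norm_sum_vonMangoldt_residueDiff_char_le {e q y : ℕ} (he : Even e) (he0 : e ≠ 0)
    (hq : ¬ 4 ∣ q) (ξ : DirichletCharacter ℂ q) :
    ‖∑ n ∈ Icc 1 y, (vonMangoldt n : ℂ) * ((residueDiff e n : ℂ) * ξ n)‖ ≤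
      2 * (((4 * e).totient : ℝ)⁻¹ * ∑ r ∈ (4 * e).divisors, ∑ ψ ∈ primChars r, twistedNorm y ψ ξ) +
        2 * ((Nat.log 2 y + 1) * Real.log (4 * e : ℕ)) := by
  classical
  have hne : NeZero (4 * e) := ⟨by omega⟩
  obtain ⟨err, herr⟩ : ∃ z : ℝ, z = (Nat.log 2 y + 1) * Real.log (4 * e : ℕ) := ⟨_, rfl⟩
  have herr0 : 0 ≤ err := by
    rw [herr]; exact mul_nonneg (by positivity) (Real.log_natCast_nonneg _)
  obtain ⟨G, hG⟩ : ∃ G : DirichletCharacter ℂ (4 * e) → ℝ, G = fun ψ =>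
      if ψ ((1 + 2 * e : ℕ) : ZMod (4 * e)) = 1 then 0 else
        max (‖∑ n ∈ Icc 1 y, (vonMangoldt n : ℂ) * (ψ n * ξ n)‖ - err) 0 := ⟨_, rfl⟩
  have hG0 : ∀ ψ, 0 ≤ G ψ := fun ψ => by
    rw [hG]; dsimp only; split_ifs
    · exact le_rfl
    · exact le_max_right _ _
  have hφ : (0 : ℝ) < (4 * e).totient := by
    exact_mod_cast Nat.totient_pos.mpr (by omega)
  have hexp : ∑ n ∈ Icc 1 y, (vonMangoldt n : ℂ) * ((residueDiff e n : ℂ) * ξ n) =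
      ∑ ψ : DirichletCharacter ℂ (4 * e), charCoeff (residueDiffZMod e) ψ *
        ∑ n ∈ Icc 1 y, (vonMangoldt n : ℂ) * (ψ n * ξ n) := by
    simp_rw [← sum_charCoeff_residueDiff he, sum_mul, mul_sum]
    rw [sum_comm]
    exact sum_congr rfl fun _ _ => sum_congr rfl fun _ _ => by ring
  have hterm : ∀ ψ : DirichletCharacter ℂ (4 * e), ‖charCoeff (residueDiffZMod e) ψ *
      ∑ n ∈ Icc 1 y, (vonMangoldt n : ℂ) * (ψ n * ξ n)‖ ≤
      2 * ((4 * e).totient : ℝ)⁻¹ * (G ψ + err) := by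
    intro ψ
    by_cases h : ψ ((1 + 2 * e : ℕ) : ZMod (4 * e)) = 1
    · rw [charCoeff_residueDiffZMod_eq_zero he h, zero_mul, norm_zero]
      have := hG0 ψ
      positivity
    · rw [norm_mul]
      refine mul_le_mul (norm_charCoeff_residueDiffZMod_le e ψ) ?_ (norm_nonneg _) (by positivity)
      rw [hG]; dsimp only; rw [if_neg h]
      linarith [le_max_left (‖∑ n ∈ Icc 1 y, (vonMangoldt n : ℂ) * (ψ n * ξ n)‖ - err) 0]
  have hsum : ∑ ψ, G ψ ≤ ∑ r ∈ (4 * e).divisors, ∑ ψ ∈ primChars r, twistedNorm y ψ ξ := by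
    refine sum_char_le_sum_primChars hG0 (T := fun r ψ => twistedNorm y ψ ξ) fun r hr ψ => ?_
    rw [hG]; dsimp only
    split_ifs with h
    · exact twistedNorm_nonneg ψ ξ
    · refine max_le ?_ (twistedNorm_nonneg ψ ξ)
      rw [twistedNorm_eq (charTwist_ne_one he hq hr ψ ξ h)]
      have h1 := norm_sum_vonMangoldt_sub_le (y := y) hne.ne
        (f := fun n => changeLevel hr ψ n * ξ n) (g := fun n => ψ n * ξ n)
        (fun n hn => by rw [changeLevel_natCast hr ψ hn]) fun n => by
          by_cases hn : n.Coprime (4 * e)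
          · rw [changeLevel_natCast hr ψ hn, sub_self, norm_zero]; exact zero_le_one
          · rw [(changeLevel hr ψ).map_nonunit (mt (ZMod.isUnit_iff_coprime n _).mp hn), zero_mul,
              zero_sub, norm_neg]
            exact norm_mul_char_le_one ψ ξ n
      rw [← herr] at h1
      have h2 := norm_le_norm_add_norm_sub'
        (∑ n ∈ Icc 1 y, (vonMangoldt n : ℂ) * (changeLevel hr ψ n * ξ n))
        (∑ n ∈ Icc 1 y, (vonMangoldt n : ℂ) * (ψ n * ξ n))
      linarith
  rw [hexp]
  refine (norm_sum_le_of_le _ fun ψ _ => hterm ψ).trans ?_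
  rw [← mul_sum, sum_add_distrib, sum_const, nsmul_eq_mul, card_univ, ← Nat.card_eq_fintype_card,
    DirichletCharacter.card_eq_totient_of_hasEnoughRootsOfUnity ℂ (4 * e), ← herr, mul_add,
    mul_assoc 2 _ (((4 * e).totient : ℝ) * err), ← mul_assoc _ _ err, inv_mul_cancel₀ hφ.ne', one_mul,
    mul_assoc]
  gcongr

lemma sum_even_divisors_le {E : ℕ} (T : ℕ → ℝ) (hT : ∀ r, 0 ≤ T r) :
    ∑ e ∈ Icc 1 E with _root_.Even e, ((4 * e).totient : ℝ)⁻¹ * ∑ r ∈ (4 * e).divisors, T r ≤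
      (1 + Real.log (4 * E : ℕ)) ^ 2 * ∑ r ∈ Icc 1 (4 * E), (r.totient : ℝ)⁻¹ * T r := by
  calc ∑ e ∈ Icc 1 E with _root_.Even e, ((4 * e).totient : ℝ)⁻¹ * ∑ r ∈ (4 * e).divisors, T r
      ≤ ∑ e ∈ Icc 1 E, ((4 * e).totient : ℝ)⁻¹ * ∑ r ∈ (4 * e).divisors, T r :=
        sum_le_sum_of_subset_of_nonneg (filter_subset _ _) fun e _ _ =>
          mul_nonneg (by positivity) (sum_nonneg fun r _ => hT r)
    _ = ∑ m ∈ (Icc 1 E).image (4 * ·), (m.totient : ℝ)⁻¹ * ∑ r ∈ m.divisors, T r :=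
        (sum_image (f := fun m : ℕ => (m.totient : ℝ)⁻¹ * ∑ r ∈ m.divisors, T r)
          fun a _ b _ h => Nat.eq_of_mul_eq_mul_left four_pos h).symm
    _ ≤ ∑ m ∈ Icc 1 (4 * E), (m.totient : ℝ)⁻¹ * ∑ r ∈ m.divisors, T r := by
        refine sum_le_sum_of_subset_of_nonneg (fun m hm => ?_) fun e _ _ =>
          mul_nonneg (by positivity) (sum_nonneg fun r _ => hT r)
        obtain ⟨e, he, rfl⟩ := mem_image.mp hm
        simp only [mem_Icc] at he ⊢
        omega
    _ = ∑ m ∈ Icc 1 (4 * E), ∑ r ∈ Icc 1 (4 * E), if r ∣ m then (m.totient : ℝ)⁻¹ * T r else 0 := by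
        refine sum_congr rfl fun m hm => ?_
        obtain ⟨h1, h2⟩ := mem_Icc.mp hm
        rw [mul_sum, ← sum_filter]
        refine sum_congr ?_ fun _ _ => rfl
        ext r
        simp only [mem_filter, mem_Icc, Nat.mem_divisors]
        constructor
        · rintro ⟨h3, -⟩
          exact ⟨⟨Nat.pos_of_dvd_of_pos h3 h1, (Nat.le_of_dvd h1 h3).trans h2⟩, h3⟩
        · rintro ⟨-, h3⟩
          exact ⟨h3, by omega⟩
    _ = ∑ r ∈ Icc 1 (4 * E), T r * ∑ m ∈ Icc 1 (4 * E) with r ∣ m, (m.totient : ℝ)⁻¹ := by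
        rw [sum_comm]
        refine sum_congr rfl fun r _ => ?_
        rw [← sum_filter, mul_sum]
        exact sum_congr rfl fun m _ => mul_comm _ _
    _ ≤ ∑ r ∈ Icc 1 (4 * E), T r * ((r.totient : ℝ)⁻¹ * (1 + Real.log (4 * E : ℕ)) ^ 2) :=
        sum_le_sum fun r hr => mul_le_mul_of_nonneg_left
          (sum_inv_totient_dvd_le (mem_Icc.mp hr).1) (hT r)
    _ = _ := by
        rw [mul_sum]
        exact sum_congr rfl fun r _ => by ring

theorem sum_even_norm_sum_vonMangoldt_le {E q y : ℕ} [NeZero q] {a : ℤ} (hq : ¬ 4 ∣ q) {B : ℝ}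
    (hB : ∀ ξ : DirichletCharacter ℂ q,
      ∑ r ∈ Icc 1 (4 * E), (r.totient : ℝ)⁻¹ * ∑ ψ ∈ primChars r, twistedNorm y ψ ξ ≤ B) :
    ∑ e ∈ Icc 1 E with _root_.Even e,
      ‖∑ n ∈ Icc 1 y, (vonMangoldt n : ℂ) * ((residueDiff e n : ℂ) * ex (n * (a / q)))‖ ≤
      E * ((Nat.log 2 y + 1) * Real.log q) + q * (q * (2 * ((1 + Real.log (4 * E : ℕ)) ^ 2 * B) +
        E * (2 * ((Nat.log 2 y + 1) * Real.log (4 * E : ℕ))))) := by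
  obtain ⟨S, hS⟩ : ∃ S, S = (Icc 1 E).filter _root_.Even := ⟨_, rfl⟩
  have hScard : (S.card : ℝ) ≤ E := by
    have := card_filter_le (Icc 1 E) _root_.Even
    rw [Nat.card_Icc, Nat.add_sub_cancel, ← hS] at this
    exact_mod_cast this
  rw [← hS]
  have h1 : ∀ e ∈ S,
      ‖∑ n ∈ Icc 1 y, (vonMangoldt n : ℂ) * ((residueDiff e n : ℂ) * ex (n * (a / q)))‖ ≤
      (Nat.log 2 y + 1) * Real.log q + ∑ ξ : DirichletCharacter ℂ q, q *
        ‖∑ n ∈ Icc 1 y, (vonMangoldt n : ℂ) * ((residueDiff e n : ℂ) * ξ n)‖ := by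
    intro e _
    refine (norm_sum_vonMangoldt_mul_zex_le (q := q) (y := y) (a := a)
      (F := fun n => (residueDiff e n : ℂ)) fun n => ?_).trans ?_
    · rw [Complex.norm_real]; exact abs_residueDiff_le e n
    · refine add_le_add le_rfl (sum_le_sum fun ξ _ => ?_)
      exact mul_le_mul_of_nonneg_right (norm_charCoeff_le (fun b => (norm_zex q a b).le) ξ)
        (norm_nonneg _)
  have hlogq : 0 ≤ (Nat.log 2 y + 1) * Real.log q :=
    mul_nonneg (by positivity) (Real.log_natCast_nonneg _)
  have hξ : ∀ ξ : DirichletCharacter ℂ q, ∑ e ∈ S,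
      ‖∑ n ∈ Icc 1 y, (vonMangoldt n : ℂ) * ((residueDiff e n : ℂ) * ξ n)‖ ≤
      2 * ((1 + Real.log (4 * E : ℕ)) ^ 2 * B) +
        E * (2 * ((Nat.log 2 y + 1) * Real.log (4 * E : ℕ))) := by
    intro ξ
    have h2 : ∀ e ∈ S, ‖∑ n ∈ Icc 1 y, (vonMangoldt n : ℂ) * ((residueDiff e n : ℂ) * ξ n)‖ ≤
        2 * (((4 * e).totient : ℝ)⁻¹ *
          ∑ r ∈ (4 * e).divisors, ∑ ψ ∈ primChars r, twistedNorm y ψ ξ) +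
        2 * ((Nat.log 2 y + 1) * Real.log (4 * E : ℕ)) := by
      intro e he
      rw [hS, mem_filter, mem_Icc] at he
      refine (norm_sum_vonMangoldt_residueDiff_char_le he.2 (by omega) hq ξ).trans ?_
      have h3 : Real.log (4 * e : ℕ) ≤ Real.log (4 * E : ℕ) :=
        Real.log_le_log (by exact_mod_cast (by omega : 0 < 4 * e))
          (by exact_mod_cast (by omega : 4 * e ≤ 4 * E))
      gcongr
    refine (sum_le_sum h2).trans ?_
    rw [sum_add_distrib, sum_const, nsmul_eq_mul, ← mul_sum]
    have h4 := sum_even_divisors_le (E := E) (fun r => ∑ ψ ∈ primChars r, twistedNorm y ψ ξ)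
      fun r => sum_nonneg fun ψ _ => twistedNorm_nonneg ψ ξ
    rw [← hS] at h4
    have h5 : (0 : ℝ) ≤ 2 * ((Nat.log 2 y + 1) * Real.log (4 * E : ℕ)) :=
      mul_nonneg two_pos.le (mul_nonneg (by positivity) (Real.log_natCast_nonneg _))
    refine add_le_add (mul_le_mul_of_nonneg_left (h4.trans ?_) two_pos.le)
      (mul_le_mul_of_nonneg_right hScard h5)
    exact mul_le_mul_of_nonneg_left (hB ξ) (sq_nonneg _)
  refine (sum_le_sum h1).trans ?_
  rw [sum_add_distrib, sum_const, nsmul_eq_mul]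
  refine add_le_add (mul_le_mul_of_nonneg_right hScard hlogq) ?_
  rw [sum_comm]
  simp_rw [← mul_sum]
  refine mul_le_mul_of_nonneg_left ?_ (Nat.cast_nonneg q)
  have hnn : 0 ≤ 2 * ((1 + Real.log (4 * E : ℕ)) ^ 2 * B) +
        E * (2 * ((Nat.log 2 y + 1) * Real.log (4 * E : ℕ))) :=
    (sum_nonneg fun _ _ => norm_nonneg _).trans (hξ 1)
  refine (sum_le_sum fun ξ _ => hξ ξ).trans ?_
  rw [sum_const, nsmul_eq_mul]
  refine mul_le_mul_of_nonneg_right ?_ hnn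
  rw [card_univ, ← Nat.card_eq_fintype_card,
    DirichletCharacter.card_eq_totient_of_hasEnoughRootsOfUnity ℂ q]
  exact_mod_cast Nat.totient_le q
end

section
open ArithmeticFunction DirichletCharacter

lemma card_Ioc_filter_residueDiff_ne_zero_le {e u v : ℕ} (he : e ≠ 0) (huv : u ≤ v) :
    (#{n ∈ Ioc u v | residueDiff e n ≠ 0} : ℝ) ≤ ((v - u : ℕ) : ℝ) / e + 1 := by
  have h1 : {n ∈ Ioc u v | residueDiff e n ≠ 0} ⊆ {n ∈ Ioc u v | n ≡ 1 [MOD e]} := by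
    intro n hn
    rw [mem_filter] at hn ⊢
    refine ⟨hn.1, ?_⟩
    obtain ⟨m, rfl⟩ : ∃ m, n = m + 1 := ⟨n - 1, by have := (mem_Ioc.mp hn.1).1; omega⟩
    by_contra h
    refine hn.2 (residueDiff_of_not_dvd fun hd => h ?_)
    have := Nat.ModEq.add_right 1 (Nat.modEq_zero_iff_dvd.mpr hd)
    rwa [_root_.zero_add] at this
  refine (Nat.cast_le.mpr (card_le_card h1)).trans ?_
  have h2 := Nat.Ioc_filter_modEq_card (r := e) u v (Nat.pos_of_ne_zero he) 1
  have he' : (0 : ℚ) < e := by exact_mod_cast Nat.pos_of_ne_zero he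
  have h3 : ((#{n ∈ Ioc u v | n ≡ 1 [MOD e]} : ℤ) : ℚ) ≤ ((v - u : ℕ) : ℚ) / e + 1 := by
    rw [h2]
    push_cast [Nat.cast_sub huv]
    refine max_le ?_ ?_
    · have h4 := Int.floor_le (((v : ℚ) - 1) / e)
      have h5 := Int.lt_floor_add_one (((u : ℚ) - 1) / e)
      have h6 : ((v : ℚ) - u) / e = (v - 1) / e - (u - 1) / e := by ring
      rw [h6]
      linarith
    · have : (u : ℚ) ≤ v := by exact_mod_cast huv
      have h7 : (0 : ℚ) ≤ (v - u) / e := div_nonneg (by linarith) he'.le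
      linarith
  have h4 : (((#{n ∈ Ioc u v | n ≡ 1 [MOD e]} : ℤ) : ℚ) : ℝ) ≤ ((((v - u : ℕ) : ℚ) / e + 1 : ℚ) : ℝ) :=
    Rat.cast_le.mpr h3
  push_cast at h4
  exact h4

/-- Partial sums of a function of modulus at most `Λ(n) |residueDiff e n|` are controlled by those
along multiples of `H`. -/
lemma norm_sum_residueDiff_le_grid {e H N : ℕ} (he : e ≠ 0) (hH : 0 < H) {F : ℕ → ℂ}
    (hF : ∀ n, ‖F n‖ ≤ 1) {y : ℕ} (hy : y ≤ N) :
    ‖∑ n ∈ Icc 1 y, (vonMangoldt n : ℂ) * ((residueDiff e n : ℂ) * F n)‖ ≤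
      ∑ j ∈ range (N / H + 1),
        ‖∑ n ∈ Icc 1 (j * H), (vonMangoldt n : ℂ) * ((residueDiff e n : ℂ) * F n)‖ +
      Real.log N * ((H : ℝ) / e + 1) := by
  have hI : ∀ y, Icc 1 y = Ioc 0 y := fun y => by ext; simp only [mem_Icc, mem_Ioc]; omega
  obtain ⟨f, hf⟩ : ∃ f : ℕ → ℂ, f = fun n =>
    (vonMangoldt n : ℂ) * ((residueDiff e n : ℂ) * F n) := ⟨_, rfl⟩
  have hfe : ∀ n, (vonMangoldt n : ℂ) * ((residueDiff e n : ℂ) * F n) = f n := fun n => by rw [hf]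
  simp_rw [hfe]
  have hle : y / H * H ≤ y := Nat.div_mul_le_self y H
  have h1 := sum_Ioc_consecutive f (Nat.zero_le (y / H * H)) hle
  rw [hI y, ← h1]
  refine (norm_add_le _ _).trans (add_le_add ?_ ?_)
  · rw [← hI]
    exact single_le_sum (f := fun j => ‖∑ n ∈ Icc 1 (j * H), f n‖) (fun _ _ => norm_nonneg _)
      (mem_range.mpr (Nat.lt_succ_of_le (Nat.div_le_div_right hy)))
  · have h2 : ∀ n ∈ Ioc (y / H * H) y, ‖f n‖ ≤ if residueDiff e n ≠ 0 then Real.log N else 0 := by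
      intro n hn
      obtain ⟨hn1, hn2⟩ := mem_Ioc.mp hn
      have hlog : vonMangoldt n ≤ Real.log N := vonMangoldt_le_log.trans
        (Real.log_le_log (by exact_mod_cast (by omega : 0 < n)) (by exact_mod_cast hn2.trans hy))
      rw [hf]
      dsimp only
      by_cases h : residueDiff e n = 0
      · simp [h]
      · rw [if_pos h, norm_mul, norm_mul, Complex.norm_real, Complex.norm_real, Real.norm_eq_abs,
          Real.norm_eq_abs, abs_of_nonneg vonMangoldt_nonneg]
        have h3 := mul_le_mul (abs_residueDiff_le e n) (hF n) (norm_nonneg _) zero_le_one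
        have h4 := mul_le_mul hlog h3 (mul_nonneg (abs_nonneg _) (norm_nonneg _))
          (vonMangoldt_nonneg.trans hlog)
        linarith
    refine (norm_sum_le_of_le _ h2).trans ?_
    rw [← sum_filter, sum_const, nsmul_eq_mul, mul_comm]
    refine mul_le_mul_of_nonneg_left ?_ (Real.log_natCast_nonneg N)
    refine (card_Ioc_filter_residueDiff_ne_zero_le he hle).trans ?_
    have h5 : y - y / H * H ≤ H := by
      have := Nat.lt_div_mul_add (a := y) hH
      omega
    have h6 : ((y - y / H * H : ℕ) : ℝ) ≤ H := by exact_mod_cast h5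
    gcongr

lemma sum_not_prime_vonMangoldt_le {N : ℕ} (hN : 1 ≤ N) :
    ∑ n ∈ Icc 1 N with ¬ n.Prime, vonMangoldt n ≤ 2 * √N * Real.log N := by
  have h := Chebyshev.psi_sub_theta_le (x := N) (by exact_mod_cast hN)
  rw [Chebyshev.psi_sub_theta_eq_sum_not_prime, Nat.floor_natCast] at h
  exact h

lemma norm_sum_prime_sub_le {N : ℕ} (hN : 1 ≤ N) {F : ℕ → ℂ} {W : ℝ} (hW : 0 ≤ W)
    (hF : ∀ n ∈ Icc 1 N, ‖F n‖ ≤ W) :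
    ‖∑ n ∈ Icc 1 N with n.Prime, (Real.log n : ℂ) * F n‖ ≤
      ‖∑ n ∈ Icc 1 N, (vonMangoldt n : ℂ) * F n‖ + W * (2 * √N * Real.log N) := by
  have h1 := sum_filter_add_sum_filter_not (Icc 1 N) (fun n => n.Prime)
    (fun n => (vonMangoldt n : ℂ) * F n)
  have h2 : ∑ n ∈ Icc 1 N with n.Prime, (vonMangoldt n : ℂ) * F n =
      ∑ n ∈ Icc 1 N with n.Prime, (Real.log n : ℂ) * F n :=
    sum_congr rfl fun n hn => by rw [vonMangoldt_apply_prime (mem_filter.mp hn).2]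
  rw [h2] at h1
  rw [← eq_sub_iff_add_eq] at h1
  rw [h1]
  refine (norm_sub_le _ _).trans (add_le_add le_rfl ?_)
  refine (norm_sum_le_of_le (f := fun n => (vonMangoldt n : ℂ) * F n) _
    (fun n hn => (?_ : _ ≤ W * vonMangoldt n))).trans ?_
  · rw [norm_mul, Complex.norm_real, Real.norm_eq_abs, abs_of_nonneg vonMangoldt_nonneg, mul_comm]
    exact mul_le_mul_of_nonneg_right (hF n (mem_filter.mp hn).1) vonMangoldt_nonneg
  · rw [← mul_sum]
    exact mul_le_mul_of_nonneg_left (sum_not_prime_vonMangoldt_le hN) hW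

theorem norm_sum_prime_r3_mul_ex_le {N q H : ℕ} {D : ℝ} [NeZero q] {a : ℤ}
    (hN : 1 ≤ N) (hD : 0 < D) (hDN : D < N) (hH : 0 < H) {X : ℝ}
    (hX : ∀ y ≤ N, ∑ e ∈ Icc 1 ⌊D⌋₊ with _root_.Even e,
      ‖∑ n ∈ Icc 1 y, (vonMangoldt n : ℂ) * ((residueDiff e n : ℂ) * ex (n * (a / q)))‖ ≤ X)
    (β : ℝ) :
    ‖∑ n ∈ Icc 1 N with n.Prime, (Real.log n : ℂ) * ((r3 D N (n - 1) : ℂ) * ex (n * (a / q + β)))‖ ≤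
      2 * ((N / H + 1 : ℕ) * X + Real.log N * (H * (1 + Real.log N) + D)) *
        (1 + 2 * Real.pi * |β| * N) + D * (2 * √N * Real.log N) := by
  obtain ⟨S, hS⟩ : ∃ S, S = (Icc 1 ⌊D⌋₊).filter _root_.Even := ⟨_, rfl⟩
  rw [← hS] at hX
  have hScard : (#S : ℝ) ≤ D := by
    have := card_filter_le (Icc 1 ⌊D⌋₊) _root_.Even
    rw [Nat.card_Icc, Nat.add_sub_cancel, ← hS] at this
    exact (Nat.cast_le.mpr this).trans (Nat.floor_le hD.le)
  obtain ⟨w, hw⟩ : ∃ w : ℕ → ℕ → ℝ, w = fun (e n : ℕ) =>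
    if ⌈(e : ℝ) * ((N : ℝ) / D)⌉₊ < n then residueDiff e n else 0 := ⟨_, rfl⟩
  have hw1 : ∀ e n, |w e n| ≤ 1 := fun e n => by
    rw [hw]; dsimp only; split_ifs
    · exact abs_residueDiff_le e n
    · simp
  have h1 : ∑ n ∈ Icc 1 N with n.Prime, (Real.log n : ℂ) * ((r3 D N (n - 1) : ℂ) *
      ex (n * (a / q + β))) = ∑ n ∈ Icc 1 N with n.Prime, (Real.log n : ℂ) *
        (((∑ e ∈ S, w e n : ℝ) : ℂ) * ex (n * (a / q + β))) := by
    refine sum_congr rfl fun n hn => ?_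
    obtain ⟨hn1, hn2⟩ := mem_filter.mp hn
    rw [sum_even_residueDiff_eq_r3 hD hDN hn2 (mem_Icc.mp hn1).2, ← hS, hw]
  rw [h1]
  refine (norm_sum_prime_sub_le hN hD.le fun n _ => ?_).trans (add_le_add ?_ le_rfl)
  · rw [norm_mul, norm_ex, mul_one, Complex.norm_real, Real.norm_eq_abs]
    refine (abs_sum_le_sum_abs _ _).trans ((sum_le_sum fun e _ => hw1 e n).trans ?_)
    rwa [sum_const, nsmul_eq_mul, mul_one]
  have h2 : ∑ n ∈ Icc 1 N, (vonMangoldt n : ℂ) * (((∑ e ∈ S, w e n : ℝ) : ℂ) * ex (n * (a / q + β))) =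
      ∑ e ∈ S, ∑ n ∈ Icc 1 N, (vonMangoldt n : ℂ) * ((w e n : ℂ) * ex (n * (a / q + β))) := by
    rw [sum_comm]
    refine sum_congr rfl fun n _ => ?_
    rw [← mul_sum, ← sum_mul, Complex.ofReal_sum]
  rw [h2]
  obtain ⟨f, hf⟩ : ∃ f : ℕ → ℕ → ℂ, f = fun e n =>
    (vonMangoldt n : ℂ) * ((residueDiff e n : ℂ) * ex (n * (a / q))) := ⟨_, rfl⟩
  obtain ⟨G, hG⟩ : ∃ G : ℕ → ℝ, G = fun e => ∑ j ∈ range (N / H + 1),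
    ‖∑ n ∈ Icc 1 (j * H), f e n‖ + Real.log N * ((H : ℝ) / e + 1) := ⟨_, rfl⟩
  have hG0 : ∀ e, 0 ≤ G e := fun e => by
    rw [hG]
    have := Real.log_natCast_nonneg N
    exact add_nonneg (sum_nonneg fun _ _ => norm_nonneg _) (by positivity)
  have hβ : 0 ≤ 1 + 2 * Real.pi * |β| * N := by
    have := Real.pi_pos
    positivity
  have h3 : ∀ e ∈ S, ‖∑ n ∈ Icc 1 N, (vonMangoldt n : ℂ) * ((w e n : ℂ) * ex (n * (a / q + β)))‖ ≤
      2 * G e * (1 + 2 * Real.pi * |β| * N) := by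
    intro e he
    have he0 : e ≠ 0 := by
      rw [hS] at he
      have := (mem_Icc.mp (mem_filter.mp he).1).1
      omega
    have h4 : ∑ n ∈ Icc 1 N, (vonMangoldt n : ℂ) * ((w e n : ℂ) * ex (n * (a / q + β))) =
        ∑ n ∈ Icc 1 N with ⌈e * ((N : ℝ) / D)⌉₊ < n, f e n * ex (n * β) := by
      rw [sum_filter]
      refine sum_congr rfl fun n _ => ?_
      rw [hw, hf]
      dsimp only
      split_ifs
      · rw [mul_add, ex_add]; ring
      · simp
    rw [h4]
    by_cases hY : ⌈e * ((N : ℝ) / D)⌉₊ ≤ N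
    · have h5 : (Icc 1 N).filter (⌈e * ((N : ℝ) / D)⌉₊ < ·) = Ioc ⌈e * ((N : ℝ) / D)⌉₊ N := by
        ext n; simp only [mem_filter, mem_Icc, mem_Ioc]; omega
      rw [h5]
      refine norm_sum_mul_ex_le (hG0 e) (fun y hy => ?_) β hY
      have := norm_sum_residueDiff_le_grid (e := e) (F := fun n => ex (n * (a / q))) he0 hH
        (fun n => (norm_ex _).le) hy
      rw [hG, hf]
      exact this
    · rw [filter_false_of_mem, sum_empty, norm_zero]
      · exact mul_nonneg (mul_nonneg two_pos.le (hG0 e)) hβ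
      · intro n hn
        have := (mem_Icc.mp hn).2
        omega
  refine (norm_sum_le_of_le _ h3).trans ?_
  rw [← sum_mul, ← mul_sum]
  refine mul_le_mul_of_nonneg_right (mul_le_mul_of_nonneg_left ?_ two_pos.le) hβ
  rw [hG, sum_add_distrib, ← mul_sum, sum_add_distrib]
  refine add_le_add ?_ (mul_le_mul_of_nonneg_left (add_le_add ?_ ?_) (Real.log_natCast_nonneg N))
  · rw [sum_comm]
    refine (sum_le_sum fun j hj => (?_ : _ ≤ X)).trans ?_
    · rw [hf]
      refine hX _ ((Nat.mul_le_mul_right H (Nat.lt_succ_iff.mp (mem_range.mp hj))).trans ?_)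
      exact Nat.div_mul_le_self N H
    · rw [sum_const, card_range, nsmul_eq_mul]
  · simp_rw [div_eq_mul_inv]
    rw [← mul_sum]
    refine mul_le_mul_of_nonneg_left ?_ (Nat.cast_nonneg H)
    calc ∑ e ∈ S, ((e : ℝ))⁻¹ ≤ ∑ e ∈ Icc 1 N, ((e : ℝ))⁻¹ := by
          refine sum_le_sum_of_subset_of_nonneg (fun e he => ?_) fun _ _ _ => by positivity
          rw [hS, mem_filter, mem_Icc] at he
          rw [mem_Icc]
          refine ⟨he.1.1, he.1.2.trans ?_⟩
          exact_mod_cast (Nat.floor_le hD.le).trans hDN.le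
      _ ≤ _ := sum_inv_Icc_le
  · rwa [sum_const, nsmul_eq_mul, mul_one]

end

section
open ArithmeticFunction DirichletCharacter

/-- The exponential sum over primes `p ≤ N` weighted by `r₃(p - 1) log p` is small at points close
to rationals whose small denominator is not divisible by `4`. -/
theorem exists_norm_sum_prime_r3_mul_ex_le (A b : ℕ) : ∃ C : ℝ, ∃ P : ℕ, 0 < C ∧ ∀ N : ℕ,
    2 ≤ Real.log N → ∀ D : ℝ, 1 ≤ D → 4 * D * (ell N : ℝ) ^ P ≤ √N →
    ∀ (q : ℕ) [NeZero q] (a : ℤ) (β : ℝ), ¬ 4 ∣ q → (q : ℝ) ≤ (ell N : ℝ) ^ b →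
    |β| * N ≤ (ell N : ℝ) ^ b →
    ‖∑ n ∈ Icc 1 N with n.Prime, (Real.log n : ℂ) * ((r3 D N (n - 1) : ℂ) * ex (n * (a / q + β)))‖ ≤
      C * (N / (ell N : ℝ) ^ A) := by
  obtain ⟨K, hK⟩ : ∃ K, K = A + b + 2 := ⟨_, rfl⟩
  obtain ⟨A₀, hA₀⟩ : ∃ A₀, A₀ = A + K + 3 * b + 2 := ⟨_, rfl⟩
  obtain ⟨C₀, hC₀, hBV⟩ := exists_sum_primChars_twistedNorm_le A₀ b
  obtain ⟨P, hP⟩ : ∃ P, P = 13 * A₀ + 56 + b := ⟨_, rfl⟩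
  refine ⟨16 * (36 * C₀ + 41) + 2, P, by positivity, ?_⟩
  intro N hL D hD hDP q _ a β h4 hq hβ
  have hL1 : 1 ≤ Real.log N := by linarith
  have hx2 := hL.trans (log_le_ell N)
  have hlog := log_le_ell N
  have hN1 : 1 ≤ N := by
    by_contra h
    have : N = 0 := by omega
    rw [this] at hL
    norm_num at hL
  have hNR : (1 : ℝ) ≤ N := by exact_mod_cast hN1
  have hnatlog : ∀ y ≤ N, (Nat.log 2 y : ℝ) ≤ 2 * ell N := fun y hy => natLog_two_le_ell hy
  have hBV' := hBV N hL q
  obtain ⟨x, hx⟩ : ∃ x : ℝ, x = ell N := ⟨_, rfl⟩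
  have hlog2 : ∀ n : ℕ, n ≤ 2 * N → Real.log n ≤ 2 * x := fun n hn => hx ▸ log_two_mul_le hL1 hn
  rw [← hx] at hx2 hlog hq hβ hDP hBV' ⊢
  rw [← hx] at hnatlog
  have hx1 : 1 ≤ x := by linarith
  have hx0 : 0 < x := by linarith
  have hs1 : 1 ≤ √(N : ℝ) := Real.one_le_sqrt.mpr hNR
  have hss : √(N : ℝ) * √(N : ℝ) = N := Real.mul_self_sqrt (by linarith)
  have hsN : √(N : ℝ) ≤ N := by nlinarith
  have hpow1 : ∀ k, 1 ≤ x ^ k := fun k => one_le_pow₀ hx1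
  have hDx : D * x ^ P ≤ √N := by
    have : 0 ≤ D * x ^ P := by positivity
    linarith
  have hxP : x ^ P ≤ √N := by
    have := mul_le_mul_of_nonneg_right hD (zero_le_one.trans (hpow1 P))
    linarith
  have hDle : ∀ k ≤ P, D * √N ≤ N / x ^ k := by
    intro k hk
    rw [le_div_iff₀ (by positivity)]
    have h1 : D * x ^ k ≤ √N :=
      (mul_le_mul_of_nonneg_left (pow_le_pow_right₀ hx1 hk) (by linarith)).trans hDx
    calc D * √N * x ^ k = D * x ^ k * √N := by ring
      _ ≤ √N * √N := mul_le_mul_of_nonneg_right h1 (by positivity)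
      _ = N := hss
  have hDle' : ∀ k ≤ P, D ≤ N / x ^ k := fun k hk =>
    (le_mul_of_one_le_right (by linarith) hs1).trans (hDle k hk)
  have h4D : 4 * D ≤ √N := (le_mul_of_one_le_right (by linarith) (hpow1 P)).trans hDP
  have hDN : D < N := by linarith
  have hqN : q ≤ 2 * N := by
    have h1 : (q : ℝ) ≤ N := (hq.trans (pow_le_pow_right₀ hx1 (by omega))).trans (hxP.trans hsN)
    have h2 : q ≤ N := by exact_mod_cast h1
    omega
  obtain ⟨E, hE⟩ : ∃ E, E = ⌊D⌋₊ := ⟨_, rfl⟩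
  have hED : (E : ℝ) ≤ D := hE ▸ Nat.floor_le (by linarith)
  have hEN : 4 * E ≤ 2 * N := by
    have h1 : (4 * E : ℝ) ≤ N := by linarith
    have h2 : 4 * E ≤ N := by exact_mod_cast h1
    omega
  have hER : ((4 * E : ℕ) : ℝ) ^ 2 * x ^ (13 * A₀ + 56 + b) ≤ N := by
    rw [← hP]
    push_cast
    have h1 : 4 * (E : ℝ) ≤ 4 * D := by linarith
    calc (4 * (E : ℝ)) ^ 2 * x ^ P ≤ (4 * D) ^ 2 * x ^ P := by gcongr
      _ = (4 * D) * (4 * D * x ^ P) := by ring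
      _ ≤ √N * √N := mul_le_mul h4D hDP (by positivity) (by positivity)
      _ = N := hss
  obtain ⟨T, hT⟩ : ∃ T, T = N / x ^ A₀ := ⟨_, rfl⟩
  have hT0 : 0 ≤ T := by rw [hT]; positivity
  have hET : (E : ℝ) ≤ T := hED.trans (hT ▸ hDle' A₀ (by omega))
  have hX : ∀ y ≤ N, ∑ e ∈ Icc 1 ⌊D⌋₊ with _root_.Even e,
      ‖∑ n ∈ Icc 1 y, (vonMangoldt n : ℂ) * ((residueDiff e n : ℂ) * ex (n * (a / q)))‖ ≤
      (18 * C₀ + 18) * x ^ (2 * b + 2) * T := by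
    intro y hy
    rw [← hE]
    refine (sum_even_norm_sum_vonMangoldt_le h4 (B := C₀ * T) fun ξ => ?_).trans ?_
    · rw [hT]; exact hBV' ξ hq y hy _ hER
    · have h1 : (Nat.log 2 y : ℝ) + 1 ≤ 3 * x := by linarith [hnatlog y hy]
      have h2 := hlog2 q hqN
      have h3 := hlog2 (4 * E) hEN
      have h3' : 1 + Real.log (4 * E : ℕ) ≤ 3 * x := by linarith
      have h3n := Real.log_natCast_nonneg (4 * E)
      have h2n := Real.log_natCast_nonneg q
      have hq0 : (0 : ℝ) ≤ q := Nat.cast_nonneg q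
      have hE0 : (0 : ℝ) ≤ E := Nat.cast_nonneg E
      calc _ ≤ T * (3 * x * (2 * x)) + x ^ b * (x ^ b * (2 * ((3 * x) ^ 2 * (C₀ * T)) +
            T * (2 * (3 * x * (2 * x))))) := by gcongr
        _ = 6 * T * x ^ 2 * 1 + (18 * C₀ + 12) * x ^ (2 * b + 2) * T := by ring
        _ ≤ 6 * T * x ^ 2 * x ^ (2 * b) + (18 * C₀ + 12) * x ^ (2 * b + 2) * T := by
            gcongr; exact hpow1 _
        _ = _ := by ring
  obtain ⟨H, hH⟩ : ∃ H, H = ⌈(N : ℝ) / x ^ K⌉₊ := ⟨_, rfl⟩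
  have hNK0 : 0 < (N : ℝ) / x ^ K := by positivity
  have hNK1 : 1 ≤ (N : ℝ) / x ^ K := hD.trans (hDle' K (by omega))
  have hH0 : 0 < H := hH ▸ Nat.ceil_pos.mpr hNK0
  have hHle : (H : ℝ) ≤ 2 * (N / x ^ K) := by
    have := Nat.ceil_lt_add_one hNK0.le
    rw [← hH] at this
    linarith
  have hNH : ((N / H + 1 : ℕ) : ℝ) ≤ 2 * x ^ K := by
    have h1 : ((N / H : ℕ) : ℝ) ≤ N / H := Nat.cast_div_le
    have h2 : (N : ℝ) / x ^ K ≤ H := hH ▸ Nat.le_ceil _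
    have h3 : (N : ℝ) / H ≤ x ^ K := by
      rw [div_le_iff₀ (by exact_mod_cast hH0)]
      rwa [div_le_iff₀ (by positivity), mul_comm] at h2
    push_cast
    linarith [hpow1 K]
  have hlogN0 := Real.log_natCast_nonneg N
  have hβ' : 1 + 2 * Real.pi * |β| * N ≤ 8 * x ^ b := by
    have h1 := Real.pi_lt_d2
    have h2 : 2 * Real.pi * (|β| * N) ≤ 6.3 * x ^ b :=
      mul_le_mul (by linarith) hβ (by positivity) (by norm_num)
    have := hpow1 b
    nlinarith
  refine (norm_sum_prime_r3_mul_ex_le hN1 (by linarith) hDN hH0 hX β).trans ?_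
  obtain ⟨V, hV⟩ : ∃ V, V = (N : ℝ) / x ^ K := ⟨_, rfl⟩
  obtain ⟨Z, hZ⟩ : ∃ Z, Z = (N : ℝ) / x ^ A := ⟨_, rfl⟩
  have hDV : D ≤ V := hV ▸ hDle' K (by omega)
  have hV0 : 0 ≤ V := hV ▸ hNK0.le
  rw [← hV] at hHle
  rw [← hZ]
  have hTZ : x ^ (A₀ - A) * T = Z := by
    rw [hT, hZ, mul_div_assoc', div_eq_div_iff (by positivity) (by positivity), mul_comm (x ^ _),
      mul_assoc, ← pow_add, Nat.sub_add_cancel (by omega)]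
  have hVZ : x ^ (b + 2) * V = Z := by
    rw [hV, hZ, hK, mul_div_assoc', div_eq_div_iff (by positivity) (by positivity)]
    ring
  have hlast : D * (2 * √N * Real.log N) ≤ 2 * Z := by
    have h1 : D * √N * x ≤ Z := by
      have h2 := hDle (A + 1) (by omega)
      calc D * √N * x ≤ N / x ^ (A + 1) * x := by gcongr
        _ = Z := by rw [hZ, pow_succ]; field_simp
    calc D * (2 * √N * Real.log N) = 2 * (D * √N * Real.log N) := by ring
      _ ≤ 2 * (D * √N * x) := by gcongr
      _ ≤ _ := by linarith
  have hmain : 2 * ((N / H + 1 : ℕ) * ((18 * C₀ + 18) * x ^ (2 * b + 2) * T) +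
      Real.log N * (H * (1 + Real.log N) + D)) * (1 + 2 * Real.pi * |β| * N) ≤
      16 * (36 * C₀ + 41) * Z := by
    have h1 : Real.log N * (H * (1 + Real.log N) + D) ≤ 5 * (x ^ 2 * V) := by
      have h2 : 1 + Real.log N ≤ 2 * x := by linarith
      have h3 : 0 ≤ 1 + Real.log N := by linarith
      calc Real.log N * (H * (1 + Real.log N) + D) ≤ x * (2 * V * (2 * x) + V * x) := by
            have h4 : V ≤ V * x := le_mul_of_one_le_right hV0 hx1
            have h5 : D ≤ V * x := hDV.trans h4
            gcongr
        _ = _ := by ring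
    calc _ ≤ 2 * (2 * x ^ K * ((18 * C₀ + 18) * x ^ (2 * b + 2) * T) + 5 * (x ^ 2 * V)) *
          (8 * x ^ b) := by
          have h0 : 0 ≤ 1 + 2 * Real.pi * |β| * N := by
            have := Real.pi_pos
            positivity
          gcongr
      _ = 16 * ((36 * C₀ + 36) * (x ^ (K + 3 * b + 2) * T) + 5 * (x ^ (b + 2) * V)) := by ring
      _ = 16 * ((36 * C₀ + 36) * Z + 5 * Z) := by
          rw [hVZ, ← hTZ, show A₀ - A = K + 3 * b + 2 by omega]
      _ = _ := by ring
  linarith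

end

section
open ArithmeticFunction DirichletCharacter

/-- The exponential sum over primes is small close to rationals whose small denominator is
divisible by `4`. -/
theorem exists_norm_sum_prime_mul_ex_le_of_four_dvd (A b : ℕ) : ∃ C : ℝ, 0 < C ∧ ∀ N : ℕ,
    2 ≤ Real.log N → (ell N : ℝ) ^ (A + b + 2) ≤ √N →
    ∀ (q : ℕ) [NeZero q] (a : ℤ) (β : ℝ), 4 ∣ q → IsCoprime a (q : ℤ) →
    (q : ℝ) ≤ (ell N : ℝ) ^ b → |β| * N ≤ (ell N : ℝ) ^ b →
    ‖∑ n ∈ Icc 1 N with n.Prime, (Real.log n : ℂ) * ex (n * (a / q + β))‖ ≤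
      C * (N / (ell N : ℝ) ^ A) := by
  obtain ⟨A', hA'⟩ : ∃ A', A' = A + 3 * b := ⟨_, rfl⟩
  obtain ⟨C₀, hC₀, hSW⟩ := exists_norm_sum_char_vonMangoldt_le A' (2 * b)
  refine ⟨16 * (6 + C₀ * 2 ^ A') + 2, by positivity, ?_⟩
  intro N hL hxN q _ a β h4 hco hq hβ
  have hL1 : 1 ≤ Real.log N := by linarith
  have hlog := log_le_ell N
  have hx2 := hL.trans hlog
  have hell := ell_le hL1
  have hN3 : 3 ≤ N := by
    by_contra h
    have h1 : (N : ℝ) ≤ 2 := by exact_mod_cast (by omega : N ≤ 2)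
    have h2 := Real.log_le_sub_one_of_pos (x := N) (by
      rcases Nat.eq_zero_or_pos N with h3 | h3
      · rw [h3] at hL; norm_num at hL
      · exact_mod_cast h3)
    linarith
  have hNR : (1 : ℝ) ≤ N := by exact_mod_cast (by omega : 1 ≤ N)
  have hnatlog : ∀ y ≤ N, (Nat.log 2 y : ℝ) ≤ 2 * ell N := fun y hy => natLog_two_le_ell hy
  have hlog2 : ∀ n : ℕ, n ≤ 2 * N → Real.log n ≤ 2 * ell N := fun n hn => log_two_mul_le hL1 hn
  obtain ⟨x, hx⟩ : ∃ x : ℝ, x = ell N := ⟨_, rfl⟩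
  rw [← hx] at hx2 hlog hq hβ hxN hell hnatlog hlog2 ⊢
  have hx1 : 1 ≤ x := by linarith
  have hx0 : 0 < x := by linarith
  have hs1 : 1 ≤ √(N : ℝ) := Real.one_le_sqrt.mpr hNR
  have hss : √(N : ℝ) * √(N : ℝ) = N := Real.mul_self_sqrt (by linarith)
  have hsN : √(N : ℝ) ≤ N := by nlinarith
  have hpow1 : ∀ k, 1 ≤ x ^ k := fun k => one_le_pow₀ hx1
  have hqN : q ≤ 2 * N := by
    have h1 : (q : ℝ) ≤ N := (hq.trans (pow_le_pow_right₀ hx1 (by omega))).trans (hxN.trans hsN)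
    have h2 : q ≤ N := by exact_mod_cast h1
    omega
  have hqlog : (q : ℝ) ≤ Real.log N ^ (2 * b) := by
    refine hq.trans ?_
    rw [pow_mul]
    refine pow_le_pow_left₀ hx0.le ?_ b
    nlinarith
  obtain ⟨T, hT⟩ : ∃ T, T = (N : ℝ) / x ^ A' := ⟨_, rfl⟩
  have hT0 : 0 ≤ T := by rw [hT]; positivity
  have hE : ∀ ξ : DirichletCharacter ℂ q, ξ ≠ 1 → ∀ y ≤ N,
      ‖∑ n ∈ Icc 1 y, (vonMangoldt n : ℂ) * ξ n‖ ≤ C₀ * 2 ^ A' * T := by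
    intro ξ hξ y hy
    have h1 := hSW N hN3 q ξ hξ hqlog y hy
    have h2 : ∑ n ∈ range (y + 1), ξ n * (vonMangoldt n : ℂ) =
        ∑ n ∈ Icc 1 y, (vonMangoldt n : ℂ) * ξ n := by
      rw [range_eq_Ico, sum_eq_sum_Ico_succ_bot (by omega)]
      simp only [ArithmeticFunction.map_zero, Complex.ofReal_zero, mul_zero, _root_.zero_add]
      refine sum_congr ?_ fun _ _ => mul_comm _ _
      ext n; simp only [mem_Ico, mem_Icc]; omega
    rw [h2] at h1
    refine h1.trans ?_
    rw [hT, mul_assoc, mul_div_assoc]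
    refine mul_le_mul_of_nonneg_left ?_ hC₀.le
    rw [mul_div_assoc', div_le_div_iff₀ (by positivity) (by positivity)]
    have h3 : x ^ A' ≤ (2 * Real.log N) ^ A' := pow_le_pow_left₀ hx0.le hell A'
    rw [mul_pow] at h3
    calc (N : ℝ) * x ^ A' ≤ N * (2 ^ A' * Real.log N ^ A') := by gcongr
      _ = _ := by ring
  have hS : ∀ y ≤ N, ‖∑ n ∈ Icc 1 y, (vonMangoldt n : ℂ) * ex (n * (a / q))‖ ≤
      6 * x ^ 2 + x ^ (2 * b) * (C₀ * 2 ^ A' * T) := by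
    intro y hy
    refine (norm_sum_vonMangoldt_mul_ex_le_of_four_dvd h4 hco (E := C₀ * 2 ^ A' * T)
      (by positivity) fun ξ hξ => hE ξ hξ y hy).trans ?_
    have h1 : (Nat.log 2 y : ℝ) + 1 ≤ 3 * x := by linarith [hnatlog y hy]
    have h2 := hlog2 q hqN
    have h2n := Real.log_natCast_nonneg q
    have hq0 : (0 : ℝ) ≤ q := Nat.cast_nonneg q
    calc _ ≤ 3 * x * (2 * x) + x ^ b * (x ^ b * (C₀ * 2 ^ A' * T)) := by gcongr
      _ = _ := by ring
  have hβ' : 1 + 2 * Real.pi * |β| * N ≤ 8 * x ^ b := by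
    have h1 := Real.pi_lt_d2
    have h2 : 2 * Real.pi * (|β| * N) ≤ 6.3 * x ^ b :=
      mul_le_mul (by linarith) hβ (by positivity) (by norm_num)
    have := hpow1 b
    nlinarith
  have hE0 : 0 ≤ 6 * x ^ 2 + x ^ (2 * b) * (C₀ * 2 ^ A' * T) := by positivity
  have habel := norm_sum_mul_ex_le hE0 hS β (Nat.zero_le N)
  have hΛ : ∑ n ∈ Ioc 0 N, (vonMangoldt n : ℂ) * ex (n * (a / q)) * ex (n * β) =
      ∑ n ∈ Icc 1 N, (vonMangoldt n : ℂ) * ex (n * (a / q + β)) := by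
    refine sum_congr ?_ fun n _ => by rw [mul_assoc, ← ex_add, mul_add]
    ext n; simp only [mem_Ioc, mem_Icc]; omega
  rw [hΛ] at habel
  refine (norm_sum_prime_sub_le (by omega) zero_le_one fun n _ => (norm_ex _).le).trans ?_
  obtain ⟨Z, hZ⟩ : ∃ Z, Z = (N : ℝ) / x ^ A := ⟨_, rfl⟩
  have hsZ : ∀ k ≤ b + 2, √N * x ^ k ≤ Z := by
    intro k hk
    rw [hZ, le_div_iff₀ (by positivity)]
    calc √N * x ^ k * x ^ A = √N * x ^ (k + A) := by ring
      _ ≤ √N * √N := mul_le_mul_of_nonneg_left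
          ((pow_le_pow_right₀ hx1 (by omega)).trans hxN) (by positivity)
      _ = N := hss
  have hTZ : x ^ (3 * b) * T = Z := by
    rw [hT, hZ, hA', mul_div_assoc', div_eq_div_iff (by positivity) (by positivity)]
    ring
  rw [← hZ]
  have h1 : 1 * (2 * √N * Real.log N) ≤ 2 * Z := by
    have := hsZ 1 (by omega)
    have h2 : √N * Real.log N ≤ √N * x ^ 1 := by rw [pow_one]; gcongr
    linarith
  have h2 : 2 * (6 * x ^ 2 + x ^ (2 * b) * (C₀ * 2 ^ A' * T)) * (1 + 2 * Real.pi * |β| * N) ≤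
      16 * (6 + C₀ * 2 ^ A') * Z := by
    have h3 : 1 * x ^ (b + 2) ≤ √N * x ^ (b + 2) := by gcongr
    calc _ ≤ 2 * (6 * x ^ 2 + x ^ (2 * b) * (C₀ * 2 ^ A' * T)) * (8 * x ^ b) := by gcongr
      _ = 96 * (1 * x ^ (b + 2)) + 16 * C₀ * 2 ^ A' * (x ^ (3 * b) * T) := by ring
      _ ≤ 96 * Z + 16 * C₀ * 2 ^ A' * Z := by
          rw [hTZ]
          have := h3.trans (hsZ (b + 2) le_rfl)
          linarith
      _ = _ := by ring
  linarith

theorem norm_sum_prime_mul_ex_le {A N q : ℕ} {a : ℤ} {α : ℝ} (hL : 1 ≤ Real.log N)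
    (hxN : (ell N : ℝ) ^ (A + 1) ≤ √N)
    (hco : IsCoprime a (q : ℤ)) (hα : |q * α - a| * q ≤ 1)
    (hq : 2 * (ell N : ℝ) ^ (13 * A + 43) ≤ q) (hqN : (q : ℝ) * (ell N : ℝ) ^ (13 * A + 43) ≤ N) :
    ‖∑ n ∈ Icc 1 N with n.Prime, (Real.log n : ℂ) * ex (n * α)‖ ≤
      502 * (N / (ell N : ℝ) ^ A) := by
  have hN1 : 1 ≤ N := by
    by_contra h
    have : N = 0 := by omega
    rw [this] at hL
    norm_num at hL
  have hlog := log_le_ell N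
  refine (norm_sum_prime_sub_le hN1 zero_le_one fun n _ => (norm_ex _).le).trans ?_
  have h1 := norm_sum_vonMangoldt_mul_ex_le hL hco hα hq hqN
  have hx0 : (0 : ℝ) < ell N := by linarith
  have h2 : √N * Real.log N ≤ N / (ell N : ℝ) ^ A := by
    rw [le_div_iff₀ (by positivity)]
    calc √N * Real.log N * (ell N : ℝ) ^ A ≤ √N * ell N * (ell N : ℝ) ^ A := by gcongr
      _ = √N * (ell N : ℝ) ^ (A + 1) := by ring
      _ ≤ √N * √N := by gcongr
      _ = N := Real.mul_self_sqrt (Nat.cast_nonneg N)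
  linarith

end

section

lemma sum_range_ex_mul_div {M : ℕ} (hM : 0 < M) {k : ℤ} (hk : |k| < M) :
    ∑ j ∈ range M, ex (k * (j / M)) = if k = 0 then (M : ℂ) else 0 := by
  have hM' : (M : ℝ) ≠ 0 := by exact_mod_cast hM.ne'
  split_ifs with h
  · simp [h, ex_zero]
  · have h1 : ∀ j : ℕ, ex (k * (j / M)) = ex (k / M) ^ j := fun j => by
      rw [← ex_nat_mul]; congr 1; ring
    simp_rw [h1]
    have h2 : ex (k / M) ≠ 1 := by
      rw [ex, Ne, Complex.exp_eq_one_iff]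
      rintro ⟨n, hn⟩
      have h3 : (2 * Real.pi * Complex.I : ℂ) ≠ 0 := Complex.two_pi_I_ne_zero
      have h4 : (2 * Real.pi * Complex.I : ℂ) * ((k / M : ℝ) : ℂ) = 2 * Real.pi * Complex.I * n := by
        rw [mul_comm _ (n : ℂ), ← hn]; ring
      have h5 := mul_left_cancel₀ h3 h4
      have h6 : (k : ℝ) / M = n := by exact_mod_cast h5
      rw [div_eq_iff hM'] at h6
      have h7 : k = n * M := by exact_mod_cast h6
      have h8 : n ≠ 0 := by rintro rfl; simp at h7; exact h h7
      rw [h7, abs_mul, Nat.abs_cast] at hk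
      have h9 : (1 : ℤ) ≤ |n| := Int.one_le_abs h8
      have h10 : (0 : ℤ) ≤ M := Int.natCast_nonneg M
      nlinarith
    rw [geom_sum_eq h2, ← ex_nat_mul, mul_div_cancel₀ _ hM', ex_intCast, sub_self, zero_div]

/-- The exponential sum with coefficients `f` over `s`. -/
def expSum (s : Finset ℕ) (f : ℕ → ℝ) (α : ℝ) : ℂ := ∑ n ∈ s, (f n : ℂ) * ex (n * α)

lemma sum_norm_expSum_sq {s : Finset ℕ} {N M : ℕ} (hs : ∀ n ∈ s, n ≤ N) (hM : N < M) (f : ℕ → ℝ) :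
    ∑ j ∈ range M, ‖expSum s f (j / M)‖ ^ 2 = M * ∑ n ∈ s, f n ^ 2 := by
  have h1 : ∀ α, ((‖expSum s f α‖ ^ 2 : ℝ) : ℂ) =
      ∑ m ∈ s, ∑ n ∈ s, (f m * f n : ℂ) * ex (((m - n : ℤ) : ℝ) * α) := by
    intro α
    rw [Complex.ofReal_pow, ← Complex.mul_conj', expSum, map_sum, sum_mul_sum]
    refine sum_congr rfl fun m _ => sum_congr rfl fun n _ => ?_
    rw [map_mul, Complex.conj_ofReal, mul_mul_mul_comm, ex_mul_conj]
    congr 2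
    push_cast
    ring
  have h2 : ((∑ j ∈ range M, ‖expSum s f (j / M)‖ ^ 2 : ℝ) : ℂ) = ((M * ∑ n ∈ s, f n ^ 2 : ℝ) : ℂ) := by
    rw [Complex.ofReal_sum, sum_congr rfl fun j _ => h1 _, sum_comm, Complex.ofReal_mul,
      Complex.ofReal_sum, mul_sum]
    refine sum_congr rfl fun m hm => ?_
    rw [sum_comm]
    have h3 : ∀ n ∈ s, ∑ j ∈ range M, (f m * f n : ℂ) * ex (((m - n : ℤ) : ℝ) * (j / M)) =
        if m = n then (f m * f n : ℂ) * M else 0 := by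
      intro n hn
      have hm' := hs m hm
      have hn' := hs n hn
      rw [← mul_sum, sum_range_ex_mul_div (by omega) (by rw [abs_lt]; omega), mul_ite, mul_zero]
      refine if_congr ?_ rfl rfl
      omega
    rw [sum_congr rfl h3, sum_ite_eq, if_pos hm]
    push_cast
    ring
  exact_mod_cast h2

lemma sum_expSum_mul {s : Finset ℕ} {N M : ℕ} (hs : ∀ n ∈ s, n ≤ N) (hM : 2 * N < M)
    (a b c : ℕ → ℝ) :
    ∑ j ∈ range M, expSum s a (j / M) * expSum s b (j / M) * expSum s c (j / M) *
      ex (-N * (j / M)) = M * ((∑ k ∈ s, ∑ m ∈ s, ∑ n ∈ s,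
        if k + m + n = N then a k * b m * c n else 0 : ℝ) : ℂ) := by
  have h1 : ∀ α, expSum s a α * expSum s b α * expSum s c α * ex (-N * α) =
      ∑ k ∈ s, ∑ m ∈ s, ∑ n ∈ s, (a k * b m * c n : ℂ) * ex (((k + m + n - N : ℤ) : ℝ) * α) := by
    intro α
    rw [expSum, expSum, expSum, sum_mul_sum, sum_mul, sum_mul]
    refine sum_congr rfl fun k _ => ?_
    rw [sum_mul_sum, sum_mul]
    refine sum_congr rfl fun m _ => ?_
    rw [sum_mul]
    refine sum_congr rfl fun n _ => ?_
    have h2 : (((k + m + n - N : ℤ) : ℝ)) * α = k * α + m * α + n * α + -N * α := by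
      push_cast; ring
    rw [h2, ex_add, ex_add, ex_add]
    ring
  rw [sum_congr rfl fun j _ => h1 _, sum_comm, Complex.ofReal_sum, mul_sum]
  refine sum_congr rfl fun k hk => ?_
  rw [sum_comm, Complex.ofReal_sum, mul_sum]
  refine sum_congr rfl fun m hm => ?_
  rw [sum_comm, Complex.ofReal_sum, mul_sum]
  refine sum_congr rfl fun n hn => ?_
  have hk' := hs k hk
  have hm' := hs m hm
  have hn' := hs n hn
  rw [← mul_sum, sum_range_ex_mul_div (by omega) (by rw [abs_lt]; omega)]
  by_cases h : k + m + n = N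
  · rw [if_pos h, if_pos (by omega)]
    push_cast
    ring
  · rw [if_neg h, if_neg (by omega)]
    simp

/-- The circle method when at every point one of two of the generating functions is small. -/
theorem abs_sum_triple_le {s : Finset ℕ} {N : ℕ} (hs : ∀ n ∈ s, n ≤ N) {a b c : ℕ → ℝ} {E : ℝ}
    (hE : 0 ≤ E) (h : ∀ α, ‖expSum s b α‖ ≤ E ∨ ‖expSum s c α‖ ≤ E) :
    |∑ k ∈ s, ∑ m ∈ s, ∑ n ∈ s, if k + m + n = N then a k * b m * c n else 0| ≤
      E * (∑ n ∈ s, a n ^ 2 + ∑ n ∈ s, b n ^ 2 + ∑ n ∈ s, c n ^ 2) := by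
  obtain ⟨M, hM⟩ : ∃ M, M = 2 * N + 1 := ⟨_, rfl⟩
  have hM0 : (0 : ℝ) < M := by exact_mod_cast (by omega : 0 < M)
  obtain ⟨T, hT⟩ : ∃ T : ℝ, T = ∑ k ∈ s, ∑ m ∈ s, ∑ n ∈ s,
    if k + m + n = N then a k * b m * c n else 0 := ⟨_, rfl⟩
  have h1 := sum_expSum_mul hs (by omega : 2 * N < M) a b c
  have hp := fun f => sum_norm_expSum_sq hs (by omega : N < M) f
  rw [← hT] at h1 ⊢
  have h2 : ‖(M * (T : ℂ) : ℂ)‖ = M * |T| := by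
    rw [norm_mul, Complex.norm_natCast, Complex.norm_real, Real.norm_eq_abs]
  have h3 : ∀ j ∈ range M, ‖expSum s a (j / M) * expSum s b (j / M) * expSum s c (j / M) *
      ex (-N * (j / M))‖ ≤ E * (‖expSum s a (j / M)‖ ^ 2 + ‖expSum s b (j / M)‖ ^ 2 +
        ‖expSum s c (j / M)‖ ^ 2) := by
    intro j _
    rw [norm_mul, norm_mul, norm_mul, norm_ex, mul_one]
    obtain ⟨u, hu⟩ : ∃ u, u = ‖expSum s a (j / M)‖ := ⟨_, rfl⟩
    obtain ⟨v, hv⟩ : ∃ v, v = ‖expSum s b (j / M)‖ := ⟨_, rfl⟩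
    obtain ⟨w, hw⟩ : ∃ w, w = ‖expSum s c (j / M)‖ := ⟨_, rfl⟩
    have hu0 : 0 ≤ u := hu ▸ norm_nonneg _
    have hv0 : 0 ≤ v := hv ▸ norm_nonneg _
    have hw0 : 0 ≤ w := hw ▸ norm_nonneg _
    have h' := h (j / M)
    rw [← hv, ← hw] at h'
    rw [← hu, ← hv, ← hw]
    rcases h' with h' | h'
    · calc u * v * w = v * (u * w) := by ring
        _ ≤ E * (u * w) := mul_le_mul_of_nonneg_right h' (by positivity)
        _ ≤ _ := mul_le_mul_of_nonneg_left
          (by nlinarith [sq_nonneg (u - w), sq_nonneg v, sq_nonneg u, sq_nonneg w]) hE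
    · calc u * v * w = w * (u * v) := by ring
        _ ≤ E * (u * v) := mul_le_mul_of_nonneg_right h' (by positivity)
        _ ≤ _ := mul_le_mul_of_nonneg_left
          (by nlinarith [sq_nonneg (u - v), sq_nonneg w, sq_nonneg u, sq_nonneg v]) hE
  have h4 := norm_sum_le_of_le _ h3
  rw [h1, h2, ← mul_sum, sum_add_distrib, sum_add_distrib, hp, hp, hp] at h4
  refine le_of_mul_le_mul_left (h4.trans (le_of_eq ?_)) hM0
  ring

lemma abs_chi4_le (n : ℕ) : |chi4 n| ≤ 1 := by
  rw [chi4]; split_ifs <;> norm_num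

lemma abs_sum_divisors_ite_chi4_le (P : ℕ → Prop) [DecidablePred P] (m : ℕ) :
    |∑ d ∈ m.divisors, if P d then chi4 d else 0| ≤ m.divisors.card := by
  refine (abs_sum_le_sum_abs _ _).trans ((sum_le_sum (g := fun _ => (1 : ℝ)) fun d _ => ?_).trans ?_)
  · split_ifs
    · exact abs_chi4_le d
    · rw [abs_zero]; exact zero_le_one
  · rw [sum_const, nsmul_eq_mul, mul_one]

lemma sum_prime_sq_le {N : ℕ} {w : ℕ → ℝ} (hw : ∀ p, p.Prime → |w p| ≤ (p - 1).divisors.card) :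
    ∑ p ∈ Icc 1 N with p.Prime, (w p * Real.log p) ^ 2 ≤
      Real.log N ^ 2 * (N * (1 + Real.log N) ^ 4) := by
  calc ∑ p ∈ Icc 1 N with p.Prime, (w p * Real.log p) ^ 2
      ≤ ∑ p ∈ Icc 1 N with p.Prime, Real.log N ^ 2 * ((p - 1).divisors.card : ℝ) ^ 2 := by
        refine sum_le_sum fun p hp => ?_
        obtain ⟨h1, h2⟩ := mem_filter.mp hp
        rw [mem_Icc] at h1
        have h3 : Real.log p ≤ Real.log N := Real.log_le_log (by exact_mod_cast h1.1)
          (by exact_mod_cast h1.2)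
        have h4 := Real.log_natCast_nonneg p
        rw [mul_pow, mul_comm, ← sq_abs (w p)]
        have h5 := hw p h2
        gcongr
    _ ≤ ∑ n ∈ Icc 1 N, Real.log N ^ 2 * (n.divisors.card : ℝ) ^ 2 := by
        have h1 : ∑ p ∈ Icc 1 N with p.Prime, Real.log N ^ 2 * ((p - 1).divisors.card : ℝ) ^ 2 =
            ∑ n ∈ ((Icc 1 N).filter Nat.Prime).image (· - 1),
              Real.log N ^ 2 * (n.divisors.card : ℝ) ^ 2 := by
          refine (sum_image (f := fun n : ℕ => Real.log N ^ 2 * (n.divisors.card : ℝ) ^ 2) ?_).symm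
          intro p hp q hq (h : p - 1 = q - 1)
          have h1 := (mem_filter.mp hp).2.two_le
          have h2 := (mem_filter.mp hq).2.two_le
          omega
        rw [h1]
        refine sum_le_sum_of_subset_of_nonneg (fun n hn => ?_) fun _ _ _ => by positivity
        obtain ⟨p, hp, rfl⟩ := mem_image.mp hn
        have h2 := (mem_filter.mp hp).2.two_le
        have h3 := mem_Icc.mp (mem_filter.mp hp).1
        rw [mem_Icc]
        omega
    _ ≤ _ := by
        rw [← mul_sum]
        exact mul_le_mul_of_nonneg_left (sum_card_divisors_pow_le 2 N) (sq_nonneg _)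

lemma tripleSum_eq (N : ℕ) (w1 w2 : ℕ → ℝ) : tripleSum N w1 w2 =
    ∑ k ∈ Icc 1 N with k.Prime, ∑ m ∈ Icc 1 N with m.Prime, ∑ n ∈ Icc 1 N with n.Prime,
      if k + m + n = N then (w1 k * Real.log k) * (w2 m * Real.log m) * Real.log n else 0 := by
  have hs : (range (N + 1)).filter Nat.Prime = (Icc 1 N).filter Nat.Prime := by
    ext p
    simp only [mem_filter, mem_range, mem_Icc]
    constructor
    · rintro ⟨h1, h2⟩
      exact ⟨⟨h2.one_le, by omega⟩, h2⟩
    · rintro ⟨⟨-, h1⟩, h2⟩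
      exact ⟨by omega, h2⟩
  rw [tripleSum, ← hs, sum_filter]
  refine sum_congr rfl fun k _ => ?_
  by_cases hk : k.Prime
  · rw [if_pos hk, sum_filter]
    refine sum_congr rfl fun m _ => ?_
    by_cases hm : m.Prime
    · rw [if_pos hm, sum_filter]
      refine sum_congr rfl fun n _ => ?_
      by_cases hn : n.Prime
      · rw [if_pos hn]
        refine if_congr ⟨fun h => h.2.2.2, fun h => ⟨hk, hm, hn, h⟩⟩ ?_ rfl
        ring
      · simp [hn]
    · simp [hm]
  · simp [hk]

end

lemma exists_norm_expSum_le_or : ∃ C : ℝ, ∃ P : ℕ, 0 < C ∧ ∀ N : ℕ, 2 ≤ Real.log N → ∀ D : ℝ,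
    1 ≤ D → 4 * D * (ell N : ℝ) ^ P ≤ √N → ∀ α : ℝ,
    ‖expSum ((Icc 1 N).filter Nat.Prime) (fun n => r3 D N (n - 1) * Real.log n) α‖ ≤
      C * (N / (ell N : ℝ) ^ 7) ∨
    ‖expSum ((Icc 1 N).filter Nat.Prime) (fun n => Real.log n) α‖ ≤
      C * (N / (ell N : ℝ) ^ 7) := by
  obtain ⟨C₁, P₁, hC₁, hS3⟩ := exists_norm_sum_prime_r3_mul_ex_le 7 135
  obtain ⟨C₂, hC₂, hS0⟩ := exists_norm_sum_prime_mul_ex_le_of_four_dvd 7 135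
  refine ⟨C₁ + C₂ + 502, P₁ + 144, by positivity, ?_⟩
  intro N hL D hD hDP α
  have hL1 : 1 ≤ Real.log N := by linarith
  have hx2 := hL.trans (log_le_ell N)
  have hN1 : 1 ≤ N := by
    by_contra h
    have : N = 0 := by omega
    rw [this] at hL
    norm_num at hL
  have hNR : (1 : ℝ) ≤ N := by exact_mod_cast hN1
  have hminor := fun (q : ℕ) (a : ℤ) (β : ℝ) =>
    norm_sum_prime_mul_ex_le (A := 7) (N := N) (q := q) (a := a) (α := β) hL1
  have hS3' := hS3 N hL D hD
  have hS0' := hS0 N hL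
  obtain ⟨x, hx⟩ : ∃ x : ℝ, x = ell N := ⟨_, rfl⟩
  rw [← hx] at hx2 hDP hS3' hS0' hminor ⊢
  have hx1 : 1 ≤ x := by linarith
  have hx0 : 0 < x := by linarith
  have hpow1 : ∀ k, 1 ≤ x ^ k := fun k => one_le_pow₀ hx1
  have hDle : ∀ k ≤ P₁ + 144, 4 * D * x ^ k ≤ √N := fun k hk =>
    (mul_le_mul_of_nonneg_left (pow_le_pow_right₀ hx1 hk) (by linarith)).trans hDP
  have hxle : ∀ k ≤ P₁ + 144, x ^ k ≤ √N := fun k hk =>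
    (le_mul_of_one_le_left (by positivity) (by linarith)).trans (hDle k hk)
  have hsN : √(N : ℝ) ≤ N := by
    have hs1 : 1 ≤ √(N : ℝ) := Real.one_le_sqrt.mpr hNR
    have hss : √(N : ℝ) * √(N : ℝ) = N := Real.mul_self_sqrt (by linarith)
    nlinarith
  have hxN : x ^ 134 ≤ N := (hxle 134 (by omega)).trans hsN
  obtain ⟨Q, hQ⟩ : ∃ Q, Q = ⌊(N : ℝ) / x ^ 134⌋₊ := ⟨_, rfl⟩
  have hQ0 : 0 < Q := hQ ▸ Nat.floor_pos.mpr ((one_le_div (by positivity)).mpr hxN)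
  have hQle : (Q : ℝ) * x ^ 134 ≤ N := by
    rw [← le_div_iff₀ (by positivity), hQ]
    exact Nat.floor_le (by positivity)
  have hQlt : (N : ℝ) ≤ (Q + 1) * x ^ 134 := by
    rw [← div_le_iff₀ (by positivity), hQ]
    exact (Nat.lt_floor_add_one _).le
  obtain ⟨r, hr1, hr2⟩ := Real.exists_rat_abs_sub_le_and_den_le α hQ0
  obtain ⟨q, hq⟩ : ∃ q, q = r.den := ⟨_, rfl⟩
  obtain ⟨a, ha⟩ : ∃ a, a = r.num := ⟨_, rfl⟩
  have hco : IsCoprime a (q : ℤ) := by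
    rw [ha, hq, Int.isCoprime_iff_gcd_eq_one]
    exact r.reduced
  have hrR : ((r : ℚ) : ℝ) = (a : ℝ) / q := by rw [ha, hq]; exact Rat.cast_def r
  have hq0 : q ≠ 0 := hq ▸ r.den_nz
  have hqpos : (0 : ℝ) < q := by exact_mod_cast Nat.pos_of_ne_zero hq0
  have hq1 : (1 : ℝ) ≤ q := by exact_mod_cast Nat.pos_of_ne_zero hq0
  rw [← hq] at hr1 hr2
  rw [hrR] at hr1
  have hqQ : (q : ℝ) ≤ Q := by exact_mod_cast hr2
  have hQ1 : (0 : ℝ) < Q + 1 := by positivity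
  have : NeZero q := ⟨hq0⟩
  obtain ⟨β, hβ⟩ : ∃ β, β = α - a / q := ⟨_, rfl⟩
  have hα : α = a / q + β := by rw [hβ]; ring
  rw [← hβ] at hr1
  have hZ0 : 0 ≤ (N : ℝ) / x ^ 7 := by positivity
  have e0 : expSum ((Icc 1 N).filter Nat.Prime) (fun n => Real.log n) α =
      ∑ n ∈ Icc 1 N with n.Prime, (Real.log n : ℂ) * ex (n * α) := rfl
  have e3 : expSum ((Icc 1 N).filter Nat.Prime) (fun n => r3 D N (n - 1) * Real.log n) α =
      ∑ n ∈ Icc 1 N with n.Prime, (Real.log n : ℂ) * ((r3 D N (n - 1) : ℂ) * ex (n * α)) := by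
    rw [expSum]
    refine sum_congr rfl fun n _ => ?_
    push_cast
    ring
  rw [e0, e3]
  by_cases hbig : 2 * x ^ 134 ≤ q
  · right
    refine (hminor q a α (hxle 8 (by omega)) hco ?_ hbig ?_).trans ?_
    · have h1 : (q : ℝ) * α - a = q * β := by rw [hβ]; field_simp
      rw [h1, abs_mul, abs_of_pos hqpos]
      calc (q : ℝ) * |β| * q ≤ q * (1 / ((Q + 1) * q)) * q := by gcongr
        _ = q / (Q + 1) := by field_simp
        _ ≤ 1 := by rw [div_le_one hQ1]; linarith
    · exact (mul_le_mul_of_nonneg_right hqQ (by positivity)).trans hQle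
    · exact mul_le_mul_of_nonneg_right (by linarith) hZ0
  · push Not at hbig
    have hqb : (q : ℝ) ≤ x ^ 135 := by
      refine hbig.le.trans ?_
      calc 2 * x ^ 134 ≤ x * x ^ 134 := by gcongr
        _ = x ^ 135 := by ring
    have hβN : |β| * N ≤ x ^ 135 := by
      calc |β| * N ≤ 1 / ((Q + 1) * q) * N := by gcongr
        _ ≤ 1 / ((Q + 1) * 1) * ((Q + 1) * x ^ 134) := by gcongr
        _ = x ^ 134 := by field_simp
        _ ≤ x ^ 135 := pow_le_pow_right₀ hx1 (by omega)
    rw [hα]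
    by_cases h4 : 4 ∣ q
    · right
      refine (hS0' (hxle 144 (by omega)) q a β h4 hco hqb hβN).trans ?_
      exact mul_le_mul_of_nonneg_right (by linarith) hZ0
    · left
      refine (hS3' (hDle P₁ (by omega)) q a β h4 hqb hβN).trans ?_
      exact mul_le_mul_of_nonneg_right (by linarith) hZ0

lemma exists_abs_tripleSum_le : ∃ C : ℝ, ∃ P : ℕ, 0 < C ∧ ∀ N : ℕ, 2 ≤ Real.log N → ∀ D : ℝ,
    1 ≤ D → 4 * D * (ell N : ℝ) ^ P ≤ √N →
    |tripleSum N (fun p => r1 D (p - 1)) (fun p => r3 D N (p - 1))| ≤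
      C * N ^ 2 * (Real.log N)⁻¹ := by
  obtain ⟨C, P, hC, h⟩ := exists_norm_expSum_le_or
  refine ⟨48 * C, P, by positivity, ?_⟩
  intro N hL D hD hDP
  have hlog := log_le_ell N
  have hL0 : 0 < Real.log N := by linarith
  have hx0 : (0 : ℝ) < ell N := by linarith
  rw [tripleSum_eq]
  refine (abs_sum_triple_le (N := N) (fun n hn => (mem_Icc.mp (mem_filter.mp hn).1).2)
    (a := fun n => r1 D (n - 1) * Real.log n) (b := fun n => r3 D N (n - 1) * Real.log n)
    (c := fun n => Real.log n) (by positivity) (h N hL D hD hDP)).trans ?_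
  have h1 := sum_prime_sq_le (N := N) (w := fun p => r1 D (p - 1))
    fun p _ => abs_sum_divisors_ite_chi4_le _ _
  have h2 := sum_prime_sq_le (N := N) (w := fun p => r3 D N (p - 1))
    fun p _ => abs_sum_divisors_ite_chi4_le _ _
  have h3 := sum_prime_sq_le (N := N) (w := fun _ => 1) fun p hp => by
    rw [abs_one]
    exact_mod_cast card_pos.mpr (Nat.nonempty_divisors.mpr (by have := hp.two_le; omega))
  simp only [one_mul] at h3
  obtain ⟨x, hx⟩ : ∃ x : ℝ, x = ell N := ⟨_, rfl⟩
  rw [← hx] at hlog hx0 ⊢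
  have h4 : Real.log N ^ 2 * (N * (1 + Real.log N) ^ 4) ≤ 16 * x ^ 6 * N := by
    have : 1 + Real.log N ≤ 2 * x := by linarith
    calc Real.log N ^ 2 * (N * (1 + Real.log N) ^ 4) ≤ x ^ 2 * (N * (2 * x) ^ 4) := by gcongr
      _ = _ := by ring
  calc _ ≤ C * (N / x ^ 7) * (16 * x ^ 6 * N + 16 * x ^ 6 * N + 16 * x ^ 6 * N) :=
        mul_le_mul_of_nonneg_left (add_le_add (add_le_add (h1.trans h4) (h2.trans h4))
          (h3.trans h4)) (by positivity)
    _ = 48 * C * N ^ 2 * x⁻¹ := by field_simp; ring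
    _ ≤ _ := by gcongr

/-- with D = √N (log N)^{-c} for any large enough constant c,
R₁,₃(N) ≪ N² (log N)^{-1} for large odd N. -/
theorem R_one_three_bound :
    ∃ c0 : ℝ, 0 < c0 ∧ ∀ c : ℝ, c0 ≤ c → ∃ C : ℝ, 0 < C ∧ ∃ N0 : ℕ,
      ∀ N : ℕ, N0 ≤ N → Odd N →
        |tripleSum N (fun p => r1 (Real.sqrt N * Real.log N ^ (-c)) (p - 1))
            (fun p => r3 (Real.sqrt N * Real.log N ^ (-c)) (N : ℝ) (p - 1))| ≤
          C * (N : ℝ) ^ 2 * (Real.log N)⁻¹ := by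
  obtain ⟨C, P, hC, h⟩ := exists_abs_tripleSum_le
  refine ⟨P + 1, by positivity, fun c hc => ⟨C, hC, ?_⟩⟩
  obtain ⟨k, hk⟩ : ∃ k, k = ⌈c⌉₊ := ⟨_, rfl⟩
  have hck : c ≤ k := hk ▸ Nat.le_ceil c
  obtain ⟨C₁, hC₁, hlog⟩ := exists_log_pow_le (k + 1) (one_half_pos (α := ℝ))
  refine ⟨⌈Real.exp (2 + C₁ + 2 ^ (P + 2))⌉₊, fun N hN _ => ?_⟩
  have hexp : Real.exp (2 + C₁ + 2 ^ (P + 2)) ≤ N := Nat.ceil_le.mp hN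
  have hN0 : (0 : ℝ) < N := (Real.exp_pos _).trans_le hexp
  have hN1 : (1 : ℝ) ≤ N := (Real.one_le_exp (by positivity)).trans hexp
  have hL := (Real.le_log_iff_exp_le hN0).mpr hexp
  have hP : (0 : ℝ) < 2 ^ (P + 2) := by positivity
  have hell := ell_le (N := N) (by linarith)
  have hlogN := hlog N hN1
  rw [← Real.sqrt_eq_rpow] at hlogN
  obtain ⟨L, hLdef⟩ : ∃ L, L = Real.log N := ⟨_, rfl⟩
  have hb := h N (by linarith) (Real.sqrt N * Real.log N ^ (-c))
  rw [← hLdef] at hL hell hlogN hb ⊢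
  have hL1 : 1 ≤ L := by linarith
  have hL0 : 0 < L := by linarith
  refine hb ?_ ?_
  · rw [Real.rpow_neg hL0.le, ← div_eq_mul_inv, one_le_div (Real.rpow_pos_of_pos hL0 c)]
    have h1 : L ^ c ≤ L ^ k := by
      rw [← Real.rpow_natCast]
      exact Real.rpow_le_rpow_of_exponent_le hL1 hck
    have h2 : C₁ * L ^ k ≤ C₁ * √N := by
      refine le_trans ?_ hlogN
      rw [pow_succ, mul_comm]
      exact mul_le_mul_of_nonneg_left (by linarith) (by positivity)
    exact h1.trans (le_of_mul_le_mul_left h2 (by linarith))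
  · have h1 : L ^ (-c) ≤ (L ^ (P + 1))⁻¹ := by
      rw [← Real.rpow_natCast, ← Real.rpow_neg hL0.le]
      refine Real.rpow_le_rpow_of_exponent_le hL1 ?_
      push_cast
      linarith
    calc 4 * (√N * L ^ (-c)) * (ell N : ℝ) ^ P
        ≤ 4 * (√N * (L ^ (P + 1))⁻¹) * (2 * L) ^ P := by gcongr
      _ = √N * (2 ^ (P + 2) / L) := by
          rw [mul_pow]; field_simp; ring
      _ ≤ √N * 1 := by
          refine mul_le_mul_of_nonneg_left ?_ (Real.sqrt_nonneg _)
          rw [div_le_one hL0]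
          linarith
      _ = √N := mul_one _
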